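/- Fix μ > 0 and let a : ℝ → ℝ be Bohr almost periodic with inf a > 0. Then there exists an almost periodic semi-wave solution (ũ, h̃) of (FBP_a) connecting u*_a and 0; in particular its profile v(ξ, τ) := ũ(ξ + h̃⁻¹(τ), h̃⁻¹(τ)) is Bohr almost periodic in τ uniformly in ξ ≤ 0, and sup_{τ ∈ ℝ} |v(ξ, τ) − u*_a(ξ + τ)| → 0 as ξ → −∞. -/

import Mathlib

/-- A function `f : ℝ → ℝ` is Bohr almost periodic if for every `ε > 0` there is `L > 0`
such that every interval of length `L` contains an `ε`-almost period `s`. -/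
def BohrAlmostPeriodic (f : ℝ → ℝ) : Prop :=
  ∀ ε > (0 : ℝ), ∃ L > (0 : ℝ), ∀ t : ℝ, ∃ s ∈ Set.Icc t (t + L),
    ∀ x : ℝ, |f (x + s) - f x| < ε

/-- `u` is a bounded positive C² solution of `u'' + u (g x - u) = 0` on `ℝ`. -/
def IsBddPosSteadyState (g u : ℝ → ℝ) : Prop :=
  ContDiff ℝ 2 u ∧ (∃ C : ℝ, ∀ x : ℝ, |u x| ≤ C) ∧ (∀ x : ℝ, 0 < u x) ∧
    ∀ x : ℝ, deriv (deriv u) x + u x * (g x - u x) = 0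

/-- `(u, h)` is a classical solution of the free boundary problem
`u_t = u_xx + u (g x - u)` for `x < h t`, `u (h t) t = 0`, `h' t = -μ u_x (h t) t`,
for times `t` in the set `J`. -/
structure IsFBPSol (μ : ℝ) (g : ℝ → ℝ) (J : Set ℝ) (u : ℝ → ℝ → ℝ) (h : ℝ → ℝ) : Prop where
  h_diff : ∀ t ∈ J, DifferentiableAt ℝ h t
  h_deriv_cont : ContinuousOn (deriv h) J
  u_cont : ContinuousOn (fun p : ℝ × ℝ => u p.1 p.2) {p : ℝ × ℝ | p.2 ∈ J ∧ p.1 ≤ h p.2}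
  u_reg_x : ∀ t ∈ J, ∀ x < h t, DifferentiableAt ℝ (fun y => u y t) x ∧
      DifferentiableAt ℝ (deriv fun y => u y t) x
  u_reg_t : ∀ t ∈ J, ∀ x < h t, DifferentiableAt ℝ (fun s => u x s) t
  pde : ∀ t ∈ J, ∀ x < h t,
      deriv (fun s => u x s) t = deriv (deriv fun y => u y t) x + u x t * (g x - u x t)
  bdry : ∀ t ∈ J, u (h t) t = 0
  stefan : ∀ t ∈ J, deriv h t = -μ * deriv (fun y => u y t) (h t)

/-- The profile `v (ξ, τ) = u (ξ + τ, h⁻¹ τ)` of a solution with strictly monotone front `h`. -/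
noncomputable def profile (u : ℝ → ℝ → ℝ) (h : ℝ → ℝ) (ξ τ : ℝ) : ℝ :=
  u (ξ + τ) (Function.invFun h τ)

/-- `(u, h)` is an almost periodic semi-wave solution of the free boundary problem
connecting the steady state `ustar` and `0`. -/
structure IsAPSemiWave (μ : ℝ) (g ustar : ℝ → ℝ) (u : ℝ → ℝ → ℝ) (h : ℝ → ℝ) : Prop where
  sol : IsFBPSol μ g Set.univ u h
  bdd : ∃ C : ℝ, ∀ x t : ℝ, |u x t| ≤ C
  pos : ∀ t : ℝ, ∀ x < h t, 0 < u x t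
  mono : StrictMono h
  tendsto_top : Filter.Tendsto h Filter.atTop Filter.atTop
  tendsto_bot : Filter.Tendsto h Filter.atBot Filter.atBot
  almost_periodic : ∀ ε > (0 : ℝ), ∃ L > (0 : ℝ), ∀ r : ℝ, ∃ s ∈ Set.Icc r (r + L),
      ∀ ξ ≤ (0 : ℝ), ∀ τ : ℝ, |profile u h ξ (τ + s) - profile u h ξ τ| < ε
  connects : ∀ ε > (0 : ℝ), ∃ X : ℝ, ∀ ξ ≤ X, ∀ τ : ℝ,
      |profile u h ξ τ - ustar (ξ + τ)| < ε

namespace SemiWave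

open Filter Topology Set

/-- Second order expansion data of `f` at `x`: first derivative `fx`, second derivative `fxx`. -/
def Jet2 (f : ℝ → ℝ) (x fx fxx : ℝ) : Prop :=
  ∃ f' : ℝ → ℝ, f' x = fx ∧ (∀ᶠ y in 𝓝 x, HasDerivAt f (f' y) y) ∧ HasDerivAt f' fxx x

/-- Pointwise parabolic derivatives of `z` at `(x, t)`. -/
def Jet (z : ℝ → ℝ → ℝ) (x t zt zx zxx : ℝ) : Prop :=
  HasDerivAt (fun s => z x s) zt t ∧ Jet2 (fun y => z y t) x zx zxx

namespace Jet2

variable {f g : ℝ → ℝ} {x fx fxx gx gxx : ℝ}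

theorem hasDerivAt (h : Jet2 f x fx fxx) : HasDerivAt f fx x := by
  obtain ⟨f', rfl, h1, _⟩ := h
  exact h1.self_of_nhds

theorem congr (h : Jet2 f x fx fxx) (hg : ∀ᶠ y in 𝓝 x, g y = f y) : Jet2 g x fx fxx := by
  obtain ⟨f', rfl, h1, h2⟩ := h
  refine ⟨f', rfl, ?_, h2⟩
  filter_upwards [h1, hg.eventually_nhds] with y hy1 hy2
  exact hy1.congr_of_eventuallyEq hy2

theorem cast (h : Jet2 f x fx fxx) {c d : ℝ} (h1 : c = fx) (h2 : d = fxx) : Jet2 f x c d := by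
  subst h1 h2; exact h

theorem const (c x : ℝ) : Jet2 (fun _ => c) x 0 0 :=
  ⟨fun _ => 0, rfl, Eventually.of_forall fun y => hasDerivAt_const y c, hasDerivAt_const x 0⟩

theorem id (x : ℝ) : Jet2 (fun y => y) x 1 0 :=
  ⟨fun _ => 1, rfl, Eventually.of_forall fun y => hasDerivAt_id y, hasDerivAt_const x 1⟩

theorem add (h : Jet2 f x fx fxx) (k : Jet2 g x gx gxx) :
    Jet2 (fun y => f y + g y) x (fx + gx) (fxx + gxx) := by
  obtain ⟨f', rfl, h1, h2⟩ := h
  obtain ⟨g', rfl, k1, k2⟩ := k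
  refine ⟨fun y => f' y + g' y, rfl, ?_, h2.add k2⟩
  filter_upwards [h1, k1] with y a b using a.add b

theorem mul (h : Jet2 f x fx fxx) (k : Jet2 g x gx gxx) :
    Jet2 (fun y => f y * g y) x (fx * g x + f x * gx) (fxx * g x + 2 * fx * gx + f x * gxx) := by
  have hf := h.hasDerivAt
  have hg := k.hasDerivAt
  obtain ⟨f', rfl, h1, h2⟩ := h
  obtain ⟨g', rfl, k1, k2⟩ := k
  refine ⟨fun y => f' y * g y + f y * g' y, rfl, ?_, ?_⟩
  · filter_upwards [h1, k1] with y a b using a.mul b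
  · exact ((h2.mul hg).add (hf.mul k2)).congr_deriv (by ring)

theorem const_mul (c : ℝ) (h : Jet2 f x fx fxx) :
    Jet2 (fun y => c * f y) x (c * fx) (c * fxx) :=
  ((const c x).mul h).cast (by ring) (by ring)

theorem neg (h : Jet2 f x fx fxx) : Jet2 (fun y => - f y) x (-fx) (-fxx) := by
  have := h.const_mul (-1)
  simpa using this

theorem sub (h : Jet2 f x fx fxx) (k : Jet2 g x gx gxx) :
    Jet2 (fun y => f y - g y) x (fx - gx) (fxx - gxx) := by
  have := h.add k.neg
  simpa only [sub_eq_add_neg] using this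

/-- Composition with a twice differentiable function. -/
theorem comp {G : ℝ → ℝ} {Gx Gxx : ℝ} (h : Jet2 f x fx fxx) (k : Jet2 G (f x) Gx Gxx) :
    Jet2 (fun y => G (f y)) x (Gx * fx) (Gxx * fx ^ 2 + Gx * fxx) := by
  have hf := h.hasDerivAt
  obtain ⟨f', rfl, h1, h2⟩ := h
  obtain ⟨G', rfl, k1, k2⟩ := k
  refine ⟨fun y => G' (f y) * f' y, rfl, ?_, ?_⟩
  · filter_upwards [h1, hf.continuousAt.eventually k1] with y a b using b.comp y a
  · exact ((k2.comp x hf).mul h2).congr_deriv (by simp only [Function.comp]; ring)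

theorem exp (x : ℝ) : Jet2 Real.exp x (Real.exp x) (Real.exp x) :=
  ⟨Real.exp, rfl, Eventually.of_forall Real.hasDerivAt_exp, Real.hasDerivAt_exp x⟩

/-- Affine change of the argument. -/
theorem comp_add {d : ℝ} (k : Jet2 f (x + d) fx fxx) :
    Jet2 (fun y => f (y + d)) x fx fxx :=
  (comp ((id x).add (const d x)) k).cast (by ring) (by ring)

theorem sq (h : Jet2 f x fx fxx) :
    Jet2 (fun y => f y ^ 2) x (2 * f x * fx) (2 * fx ^ 2 + 2 * f x * fxx) := by
  have := h.mul h
  simp only [← pow_two] at this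
  exact this.cast (by ring) (by ring)

theorem fxx_nonneg_of_isLocalMin (h : Jet2 f x fx fxx) (hm : IsLocalMin f x) : 0 ≤ fxx := by
  have h0 : fx = 0 := hm.hasDerivAt_eq_zero h.hasDerivAt
  by_contra hneg
  push Not at hneg
  obtain ⟨f', hx, h1, h2⟩ := h
  have hs := hasDerivAt_iff_tendsto_slope.1 h2
  have hev : ∀ᶠ y in 𝓝[≠] x, slope f' x y < 0 := hs.eventually (gt_mem_nhds hneg)
  rw [eventually_nhdsWithin_iff] at hev
  obtain ⟨δ, hδ, hb⟩ := Metric.eventually_nhds_iff.1 (hev.and (h1.and hm))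
  have hd : ∀ y ∈ Set.Icc x (x + δ / 2), dist y x < δ := fun y hy => by
    rw [Real.dist_eq, abs_of_nonneg (by linarith [hy.1])]; linarith [hy.2]
  obtain ⟨c, hc, hc2⟩ := exists_hasDerivAt_eq_slope f f' (show x < x + δ / 2 by linarith)
    (fun y hy => (hb (hd y hy)).2.1.continuousAt.continuousWithinAt)
    (fun y hy => (hb (hd y ⟨hy.1.le, hy.2.le⟩)).2.1)
  have h3 := (hb (hd c ⟨hc.1.le, hc.2.le⟩)).1 (by simpa using hc.1.ne')
  have h4 := (hb (hd (x + δ / 2) ⟨by linarith, le_rfl⟩)).2.2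
  rw [slope_def_field, hx, h0, sub_zero, div_lt_iff₀ (by linarith [hc.1]), zero_mul] at h3
  rw [hc2, div_lt_iff₀ (by linarith)] at h3
  linarith

end Jet2

namespace Jet

variable {z w : ℝ → ℝ → ℝ} {x t zt zx zxx wt wx wxx : ℝ}

theorem cast (h : Jet z x t zt zx zxx) {b c d : ℝ} (h0 : b = zt) (h1 : c = zx) (h2 : d = zxx) :
    Jet z x t b c d := by
  subst h0 h1 h2; exact h

theorem congr (h : Jet z x t zt zx zxx) (hx : ∀ᶠ y in 𝓝 x, w y t = z y t)
    (ht : ∀ᶠ s in 𝓝 t, w x s = z x s) : Jet w x t zt zx zxx :=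
  ⟨h.1.congr_of_eventuallyEq ht, h.2.congr hx⟩

theorem const (c : ℝ) : Jet (fun _ _ => c) x t 0 0 0 := ⟨hasDerivAt_const t c, Jet2.const c x⟩

theorem of_space {f : ℝ → ℝ} (h : Jet2 f x zx zxx) : Jet (fun y _ => f y) x t 0 zx zxx :=
  ⟨hasDerivAt_const t _, h⟩

theorem of_time {f : ℝ → ℝ} (h : HasDerivAt f zt t) : Jet (fun _ s => f s) x t zt 0 0 :=
  ⟨h, Jet2.const _ x⟩

theorem add (h : Jet z x t zt zx zxx) (k : Jet w x t wt wx wxx) :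
    Jet (fun y s => z y s + w y s) x t (zt + wt) (zx + wx) (zxx + wxx) :=
  ⟨h.1.add k.1, h.2.add k.2⟩

theorem sub (h : Jet z x t zt zx zxx) (k : Jet w x t wt wx wxx) :
    Jet (fun y s => z y s - w y s) x t (zt - wt) (zx - wx) (zxx - wxx) :=
  ⟨h.1.sub k.1, h.2.sub k.2⟩

theorem mul (h : Jet z x t zt zx zxx) (k : Jet w x t wt wx wxx) :
    Jet (fun y s => z y s * w y s) x t (zt * w x t + z x t * wt) (zx * w x t + z x t * wx)
      (zxx * w x t + 2 * zx * wx + z x t * wxx) :=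
  ⟨h.1.mul k.1, h.2.mul k.2⟩

theorem const_mul (c : ℝ) (h : Jet z x t zt zx zxx) :
    Jet (fun y s => c * z y s) x t (c * zt) (c * zx) (c * zxx) :=
  ⟨h.1.const_mul c, h.2.const_mul c⟩

theorem comp {G : ℝ → ℝ} {Gx Gxx : ℝ} (h : Jet z x t zt zx zxx) (k : Jet2 G (z x t) Gx Gxx) :
    Jet (fun y s => G (z y s)) x t (Gx * zt) (Gx * zx) (Gxx * zx ^ 2 + Gx * zxx) :=
  ⟨k.hasDerivAt.comp t h.1, h.2.comp k⟩

theorem exp (h : Jet z x t zt zx zxx) :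
    Jet (fun y s => Real.exp (z y s)) x t (Real.exp (z x t) * zt) (Real.exp (z x t) * zx)
      (Real.exp (z x t) * (zx ^ 2 + zxx)) :=
  (h.comp (Jet2.exp _)).cast rfl rfl (by ring)

/-- Translation in space and reparametrization of time. -/
theorem comp_time {τ : ℝ → ℝ} {τ' d : ℝ} (h : Jet z (x + d) (τ t) zt zx zxx)
    (k : HasDerivAt τ τ' t) : Jet (fun y s => z (y + d) (τ s)) x t (zt * τ') zx zxx :=
  ⟨h.1.comp t k, h.2.comp_add⟩

end Jet

theorem HasDerivAt.nonpos_of_eventually_le_left {f : ℝ → ℝ} {t f' : ℝ} (h : HasDerivAt f f' t)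
    (hm : ∀ᶠ s in 𝓝[<] t, f t ≤ f s) : f' ≤ 0 := by
  have hs := (hasDerivAt_iff_tendsto_slope.1 h).mono_left
    (nhdsWithin_mono t (fun y (hy : y < t) => hy.ne) : 𝓝[<] t ≤ 𝓝[≠] t)
  refine le_of_tendsto hs ?_
  filter_upwards [hm, self_mem_nhdsWithin] with s h1 h2
  rw [slope_def_field]
  exact div_nonpos_of_nonneg_of_nonpos (by linarith) (by linarith [Set.mem_Iio.1 h2])

/-- Weak maximum principle for the operator `∂ₜ - ∂ₓₓ - K` on arbitrary closed domains of bounded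
height. -/
theorem max_principle {D : Set (ℝ × ℝ)} (hD : IsClosed D) {t0 t1 K B : ℝ} {z : ℝ → ℝ → ℝ}
    (hDt : ∀ p ∈ D, t0 ≤ p.2 ∧ p.2 ≤ t1)
    (hz : ContinuousOn (fun p : ℝ × ℝ => z p.1 p.2) D) (hB : ∀ p ∈ D, -B ≤ z p.1 p.2)
    (h : ∀ x t, (x, t) ∈ D → z x t < 0 → (∀ᶠ y in 𝓝 x, (y, t) ∈ D) ∧
      (∀ᶠ s in 𝓝[<] t, (x, s) ∈ D) ∧ ∃ zt zx zxx, Jet z x t zt zx zxx ∧ zxx + K * z x t ≤ zt)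
    (x t : ℝ) (hxt : (x, t) ∈ D) : 0 ≤ z x t := by
  by_contra hneg
  push Not at hneg
  set c : ℝ := Real.exp (-K * t) with hc
  have hc0 : 0 < c := Real.exp_pos _
  have hlen : 0 ≤ t - t0 := by linarith [(hDt _ hxt).1]
  set P : ℝ := 1 + x ^ 2 + 3 * (t - t0) with hP
  have hP0 : 0 < P := by positivity
  obtain ⟨ε, hε, hε2⟩ : ∃ ε : ℝ, 0 < ε ∧ c * z x t + ε * P < 0 := by
    refine ⟨-(c * z x t) / (2 * P), by apply div_pos <;> nlinarith, ?_⟩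
    have : -(c * z x t) / (2 * P) * P = -(c * z x t) / 2 := by field_simp
    rw [this]; nlinarith
  set W : ℝ → ℝ → ℝ := fun y s => Real.exp (-K * s) * z y s + ε * (1 + y ^ 2 + 3 * (s - t0))
    with hW
  have hWneg : W x t < 0 := hε2
  -- exponential bound
  set A : ℝ := Real.exp (|K| * (|t0| + |t1|)) with hA
  have hexpA : ∀ p ∈ D, Real.exp (-K * p.2) ≤ A := by
    intro p hp
    apply Real.exp_le_exp.2
    have h1 : |p.2| ≤ |t0| + |t1| := by
      rcases hDt p hp with ⟨h1, h2⟩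
      apply abs_le.2; constructor
      · linarith [neg_abs_le t0, abs_nonneg t1]
      · linarith [le_abs_self t1, abs_nonneg t0]
    calc -K * p.2 ≤ |(-K) * p.2| := le_abs_self _
      _ = |K| * |p.2| := by rw [abs_mul, abs_neg]
      _ ≤ _ := by gcongr
  have hA0 : 0 < A := Real.exp_pos _
  set R : ℝ := Real.sqrt (A * |B| / ε) + |x| with hR
  set S : Set (ℝ × ℝ) := D ∩ (Set.Icc (-R) R ×ˢ Set.Icc t0 t1) with hS
  have hScpt : IsCompact S := (isCompact_Icc.prod isCompact_Icc).inter_left hD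
  have hxS : (x, t) ∈ S := by
    refine ⟨hxt, ⟨?_, ?_⟩, (hDt _ hxt).1, (hDt _ hxt).2⟩
    · have := Real.sqrt_nonneg (A * |B| / ε); simp only; linarith [neg_abs_le x]
    · have := Real.sqrt_nonneg (A * |B| / ε); simp only; linarith [le_abs_self x]
  have hWc : ContinuousOn (fun p : ℝ × ℝ => W p.1 p.2) S := by
    simp only [hW]
    exact ((Continuous.continuousOn (by fun_prop)).mul (hz.mono Set.inter_subset_left)).add
      (Continuous.continuousOn (by fun_prop))
  obtain ⟨⟨a, b⟩, haS, hmin⟩ := hScpt.exists_isMinOn ⟨_, hxS⟩ hWc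
  have hab : W a b < 0 := lt_of_le_of_lt (hmin hxS) hWneg
  have hminD : ∀ y s, (y, s) ∈ D → W a b ≤ W y s := by
    intro y s hys
    by_cases hyR : (y, s) ∈ S
    · exact hmin hyR
    · have hyR' : R < |y| := by
        by_contra hcon
        push Not at hcon
        exact hyR ⟨hys, abs_le.1 hcon, (hDt _ hys).1, (hDt _ hys).2⟩
      have h1 : A * |B| / ε ≤ y ^ 2 := by
        rw [← sq_abs y]
        calc A * |B| / ε = (Real.sqrt (A * |B| / ε)) ^ 2 := (Real.sq_sqrt (by positivity)).symm
          _ ≤ |y| ^ 2 := by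
            apply pow_le_pow_left₀ (Real.sqrt_nonneg _); linarith [abs_nonneg x]
      have h2 : A * |B| ≤ ε * y ^ 2 := by rw [div_le_iff₀ hε] at h1; linarith
      have h3 : -(A * |B|) ≤ Real.exp (-K * s) * z y s := by
        have hb := hB _ hys
        have he := hexpA _ hys
        simp only at hb he
        have : -|B| ≤ z y s := by linarith [le_abs_self B]
        nlinarith [Real.exp_pos (-K * s), abs_nonneg B, mul_le_mul_of_nonneg_left this (Real.exp_pos (-K * s)).le, mul_le_mul_of_nonneg_right he (abs_nonneg B)]
      have h4 : 0 ≤ s - t0 := by linarith [(hDt _ hys).1]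
      have : 0 ≤ W y s := by simp only [hW]; nlinarith
      linarith
  have habD : (a, b) ∈ D := haS.1
  have hb0 : 0 ≤ b - t0 := by linarith [(hDt _ habD).1]
  have hzab : z a b < 0 := by
    by_contra hcon
    push Not at hcon
    have : 0 ≤ W a b := by simp only [hW]; positivity
    linarith
  obtain ⟨hx1, ht1, zt, zx, zxx, hJ, hle⟩ := h a b habD hzab
  set E : ℝ := Real.exp (-K * b) with hE
  have hE0 : 0 < E := Real.exp_pos _
  have hxx : 0 ≤ E * zxx + ε * 2 := by
    have h1 : Jet2 (fun y => W y b) a (E * zx + ε * (2 * a)) (E * zxx + ε * 2) := by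
      have := (hJ.2.const_mul E).add ((((Jet2.const 1 a).add (Jet2.id a).sq).add
        (Jet2.const (3 * (b - t0)) a)).const_mul ε)
      exact this.cast (by ring) (by ring)
    refine h1.fxx_nonneg_of_isLocalMin ?_
    filter_upwards [hx1] with y hy using hminD y b hy
  have htt : E * (zt - K * z a b) + 3 * ε ≤ 0 := by
    have h1 : HasDerivAt (fun s => W a s) (E * (zt - K * z a b) + 3 * ε) b := by
      have e1 : HasDerivAt (fun s : ℝ => Real.exp (-K * s)) (E * (-K)) b := by
        have := ((hasDerivAt_id b).const_mul (-K)).exp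
        simpa [hE] using this
      have e2 : HasDerivAt (fun s : ℝ => ε * (1 + a ^ 2 + 3 * (s - t0))) (ε * 3) b := by
        have := (((((hasDerivAt_id b).sub_const t0).const_mul 3).const_add (1 + a ^ 2)).const_mul ε)
        simpa using this
      exact ((e1.mul hJ.1).add e2).congr_deriv (by ring)
    refine HasDerivAt.nonpos_of_eventually_le_left h1 ?_
    filter_upwards [ht1] with s hs using hminD a s hs
  nlinarith

/-- A continuous function on `[a, b]` with vanishing ends and nonnegative symmetric second
derivative is nonpositive. -/
theorem nonpos_of_symm_deriv {a b : ℝ} {v G : ℝ → ℝ} (hv : ContinuousOn v (Icc a b))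
    (ha : v a ≤ 0) (hb : v b ≤ 0)
    (hG : ∀ x ∈ Ioo a b, 0 ≤ G x)
    (h : ∀ x ∈ Ioo a b, Tendsto (fun y => (v (x + y) + v (x - y) - 2 * v x) / y ^ 2) (𝓝[>] 0)
      (𝓝 (G x))) : ∀ x ∈ Icc a b, v x ≤ 0 := by
  intro c hc
  by_contra hneg
  push Not at hneg
  have hab : a < b := by
    rcases lt_or_eq_of_le (hc.1.trans hc.2) with h | h
    · exact h
    · have : c = a := by linarith [hc.1, hc.2]
      rw [this] at hneg; linarith
  set ε := v c / (2 * (b - a) ^ 2) with hε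
  have hε0 : 0 < ε := by have : 0 < b - a := by linarith
                         positivity
  set ψ : ℝ → ℝ := fun x => v x + ε * ((x - a) * (x - b)) with hψ
  have hψc : ContinuousOn ψ (Icc a b) := hv.add (Continuous.continuousOn (by fun_prop))
  obtain ⟨d, hd, hmax⟩ := isCompact_Icc.exists_isMaxOn ⟨c, hc⟩ hψc
  have hψcpos : 0 < ψ c := by
    have h1 : ε * (b - a) ^ 2 = v c / 2 := by
      have : b - a ≠ 0 := by linarith
      rw [hε]; field_simp
    have h2 : -((b - a) ^ 2) ≤ (c - a) * (c - b) := by nlinarith [hc.1, hc.2]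
    simp only [hψ]
    nlinarith
  have hψd : 0 < ψ d := lt_of_lt_of_le hψcpos (hmax hc)
  have hdI : d ∈ Ioo a b := by
    refine ⟨lt_of_le_of_ne hd.1 ?_, lt_of_le_of_ne hd.2 ?_⟩
    · rintro rfl; simp [hψ] at hψd; linarith
    · rintro rfl; simp [hψ] at hψd; linarith
  have h1 : ∀ᶠ y in 𝓝[>] (0:ℝ), (v (d + y) + v (d - y) - 2 * v d) / y ^ 2 ≤ -2 * ε := by
    have e1 : ∀ᶠ y in 𝓝[>] (0:ℝ), d + y ∈ Icc a b ∧ d - y ∈ Icc a b := by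
      have : Ioo (0:ℝ) (min (d - a) (b - d)) ∈ 𝓝[>] (0:ℝ) :=
        Ioo_mem_nhdsGT (lt_min (by linarith [hdI.1]) (by linarith [hdI.2]))
      filter_upwards [this] with y hy
      have := lt_min_iff.1 hy.2
      exact ⟨⟨by linarith [hy.1], by linarith [hy.1]⟩, by linarith [hy.1], by linarith [hy.1]⟩
    filter_upwards [e1, self_mem_nhdsWithin] with y hy hy0
    have hy0 : (0:ℝ) < y := hy0
    have m1 : ψ (d + y) ≤ ψ d := hmax hy.1
    have m2 : ψ (d - y) ≤ ψ d := hmax hy.2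
    rw [div_le_iff₀ (by positivity)]
    simp only [hψ] at m1 m2
    nlinarith
  have := le_of_tendsto (h d hdI) h1
  linarith [hG d hdI]

theorem eq_affine_of_symm_deriv_zero {a b : ℝ} (hab : a < b) {v : ℝ → ℝ}
    (hv : ContinuousOn v (Icc a b))
    (h : ∀ x ∈ Ioo a b, Tendsto (fun y => (v (x + y) + v (x - y) - 2 * v x) / y ^ 2) (𝓝[>] 0)
      (𝓝 0)) : ∃ c d : ℝ, ∀ x ∈ Icc a b, v x = c * x + d := by
  set c := (v b - v a) / (b - a) with hc
  have hc' : c * (b - a) = v b - v a := by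
    have : b - a ≠ 0 := by linarith
    rw [hc]; field_simp
  set d := v a - c * a with hd
  have key : ∀ x y : ℝ, (v (x + y) - (c * (x + y) + d) + (v (x - y) - (c * (x - y) + d))
      - 2 * (v x - (c * x + d))) = (v (x + y) + v (x - y) - 2 * v x) := by
    intro x y; ring
  have key2 : ∀ x y : ℝ, (-(v (x + y) - (c * (x + y) + d)) + -(v (x - y) - (c * (x - y) + d))
      - 2 * -(v x - (c * x + d))) = -(v (x + y) + v (x - y) - 2 * v x) := by
    intro x y; ring
  have c1 : ContinuousOn (fun x => v x - (c * x + d)) (Icc a b) :=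
    hv.sub (Continuous.continuousOn (by fun_prop))
  have h1 := nonpos_of_symm_deriv (v := fun x => v x - (c * x + d)) (G := fun _ => 0)
    c1 (by simp [hd]) (by simp only [hd]; linarith) (fun _ _ => le_rfl)
    (fun x hx => by simpa only [key] using h x hx)
  have h2 := nonpos_of_symm_deriv (v := fun x => -(v x - (c * x + d))) (G := fun _ => 0)
    c1.neg (by simp [hd]) (by simp only [hd]; linarith) (fun _ _ => le_rfl)
    (fun x hx => by
      have := (h x hx).neg
      simpa only [key2, neg_div, neg_zero] using this)
  exact ⟨c, d, fun x hx => by linarith [h1 x hx, h2 x hx]⟩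

/-- The symmetric second difference quotient converges to the second derivative. -/
theorem tendsto_symm_deriv {W W' : ℝ → ℝ} {g : ℝ} {x : ℝ}
    (h1 : ∀ y, HasDerivAt W (W' y) y) (h2 : HasDerivAt W' g x) :
    Tendsto (fun y => (W (x + y) + W (x - y) - 2 * W x) / y ^ 2) (𝓝[>] 0) (𝓝 g) := by
  rw [Metric.tendsto_nhds]
  intro ε hε
  have hs := hasDerivAt_iff_isLittleO.1 h2
  have hb := hs.bound (show (0:ℝ) < ε / 2 by linarith)
  obtain ⟨δ, hδ, hd⟩ := Metric.eventually_nhds_iff.1 hb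
  filter_upwards [Ioo_mem_nhdsGT hδ] with y hy
  obtain ⟨s, hs, hs2⟩ := exists_hasDerivAt_eq_slope
    (fun s => W (x + s) + W (x - s) - 2 * W x - g * s ^ 2)
    (fun s => W' (x + s) - W' (x - s) - 2 * g * s) hy.1
    (fun s _ => by
      have : Continuous W := continuous_iff_continuousAt.2 fun y => (h1 y).continuousAt
      fun_prop)
    (fun s _ => by
      have e1 : HasDerivAt (fun s => W (x + s)) (W' (x + s)) s :=
        ((h1 (x + s)).comp s ((hasDerivAt_id s).const_add x)).congr_deriv (by ring)
      have e2 : HasDerivAt (fun s => W (x - s)) (-W' (x - s)) s :=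
        ((h1 (x - s)).comp s ((hasDerivAt_id s).const_sub x)).congr_deriv (by ring)
      have e3 : HasDerivAt (fun s : ℝ => g * s ^ 2) (g * (2 * s)) s := by
        simpa using (hasDerivAt_pow 2 s).const_mul g
      exact (((e1.add e2).sub_const _).sub e3).congr_deriv (by ring))
  have b1 := hd (y := x + s) (by rw [Real.dist_eq, add_sub_cancel_left, abs_of_pos hs.1]; linarith [hs.2, hy.2])
  have b2 := hd (y := x - s) (by
    rw [Real.dist_eq, show x - s - x = -s by ring, abs_neg, abs_of_pos hs.1]; linarith [hs.2, hy.2])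
  simp only [smul_eq_mul, Real.norm_eq_abs] at b1 b2
  rw [show x + s - x = s by ring, abs_of_pos hs.1] at b1
  rw [show x - s - x = -s by ring, abs_neg, abs_of_pos hs.1] at b2
  have hy0 := hy.1
  have b1' := abs_le.1 b1
  have b2' := abs_le.1 b2
  simp only [sub_zero, add_zero] at hs2
  have hq : W (x + y) + W (x - y) - 2 * W x - g * y ^ 2
      = y * (W' (x + s) - W' (x - s) - 2 * g * s) := by
    rw [hs2]; field_simp; ring
  have hsb : |W (x + y) + W (x - y) - 2 * W x - g * y ^ 2| < ε * y ^ 2 := by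
    have : |W' (x + s) - W' (x - s) - 2 * g * s| ≤ ε * s := abs_le.2 ⟨by linarith, by linarith⟩
    rw [hq, abs_mul, abs_of_pos hy0]
    calc _ ≤ y * (ε * s) := by gcongr
      _ < ε * y ^ 2 := by
        have := mul_lt_mul_of_pos_left hs.2 (mul_pos hy0 hε); nlinarith
  rw [Real.dist_eq]
  have : (W (x + y) + W (x - y) - 2 * W x) / y ^ 2 - g
      = (W (x + y) + W (x - y) - 2 * W x - g * y ^ 2) / y ^ 2 := by field_simp
  rw [this, abs_div, abs_of_pos (show 0 < y ^ 2 by positivity), div_lt_iff₀ (by positivity)]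
  exact hsb

/-- Schwarz: a continuous function with continuous symmetric second derivative is `C²`. -/
theorem schwarz_regularity {a b : ℝ} (hab : a < b) {v G : ℝ → ℝ} (hv : ContinuousOn v (Icc a b))
    (hG : ContinuousOn G (Icc a b))
    (h : ∀ x ∈ Ioo a b, Tendsto (fun y => (v (x + y) + v (x - y) - 2 * v x) / y ^ 2) (𝓝[>] 0)
      (𝓝 (G x))) :
    ∃ v' : ℝ → ℝ, ∀ x ∈ Ioo a b, HasDerivAt v (v' x) x ∧ HasDerivAt v' (G x) x := by
  set H : ℝ → ℝ := fun x => G (max a (min b x)) with hH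
  have hproj : ∀ x, max a (min b x) ∈ Icc a b := fun x =>
    ⟨le_max_left _ _, max_le hab.le (min_le_left _ _)⟩
  have hHc : Continuous H := hG.comp_continuous (by fun_prop) hproj
  have hHe : ∀ x ∈ Icc a b, H x = G x := fun x hx => by
    simp only [hH]; rw [min_eq_right hx.2, max_eq_right hx.1]
  set W' : ℝ → ℝ := fun x => ∫ s in a..x, H s with hW'
  have hW'd : ∀ x, HasDerivAt W' (H x) x := fun x =>
    intervalIntegral.integral_hasDerivAt_right (hHc.intervalIntegrable _ _)
      hHc.stronglyMeasurable.stronglyMeasurableAtFilter hHc.continuousAt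
  have hW'c : Continuous W' := continuous_iff_continuousAt.2 fun x => (hW'd x).continuousAt
  set W : ℝ → ℝ := fun x => ∫ s in a..x, W' s with hW
  have hWd : ∀ x, HasDerivAt W (W' x) x := fun x =>
    intervalIntegral.integral_hasDerivAt_right (hW'c.intervalIntegrable _ _)
      hW'c.stronglyMeasurable.stronglyMeasurableAtFilter hW'c.continuousAt
  have hWc : Continuous W := continuous_iff_continuousAt.2 fun x => (hWd x).continuousAt
  obtain ⟨c, d, hcd⟩ := eq_affine_of_symm_deriv_zero hab (v := fun x => v x - W x)
    (hv.sub hWc.continuousOn) (by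
      intro x hx
      have h1 := (h x hx).sub (tendsto_symm_deriv hWd (hW'd x))
      rw [hHe x (Ioo_subset_Icc_self hx), sub_self] at h1
      refine h1.congr fun y => ?_
      ring)
  refine ⟨fun x => c + W' x, fun x hx => ⟨?_, ?_⟩⟩
  · have e : HasDerivAt (fun x => c * x + d + W x) (c + W' x) x := by
      have := (((hasDerivAt_id x).const_mul c).add_const d).add (hWd x)
      exact this.congr_deriv (by simp)
    refine e.congr_of_eventuallyEq ?_
    filter_upwards [Ioo_mem_nhds hx.1 hx.2] with y hy
    linarith [hcd y (Ioo_subset_Icc_self hy)]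
  · rw [← hHe x (Ioo_subset_Icc_self hx)]
    exact (hW'd x).const_add c

/-- Arzelà–Ascoli for pointwise bounded, asymptotically equicontinuous sequences. -/
theorem exists_subseq_tendstoLocallyUniformly {X : Type*} [PseudoMetricSpace X]
    [TopologicalSpace.SeparableSpace X] [Nonempty X] (F : ℕ → X → ℝ)
    (hb : ∀ x, ∃ B, ∀ n, |F n x| ≤ B)
    (he : ∀ x, ∀ ε > (0:ℝ), ∃ δ > (0:ℝ), ∃ N, ∀ n ≥ N, ∀ y, dist y x < δ → |F n y - F n x| ≤ ε) :
    ∃ φ : ℕ → ℕ, StrictMono φ ∧ ∃ f : X → ℝ, Continuous f ∧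
      TendstoLocallyUniformly (fun n => F (φ n)) f atTop := by
  obtain ⟨d, hd⟩ := TopologicalSpace.exists_dense_seq X
  choose B hB using hb
  have hK : IsCompact (Set.pi univ fun i : ℕ => Icc (-B (d i)) (B (d i))) :=
    isCompact_univ_pi fun i => isCompact_Icc
  obtain ⟨L, _, φ, hφ, hL⟩ := hK.tendsto_subseq (x := fun n i => F n (d i))
    (fun n i _ => abs_le.1 (hB _ n))
  have hLi : ∀ i, Tendsto (fun n => F (φ n) (d i)) atTop (𝓝 (L i)) := fun i =>
    (tendsto_pi_nhds.1 hL) i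
  have hcauchy : ∀ x, CauchySeq fun n => F (φ n) x := by
    intro x
    rw [Metric.cauchySeq_iff']
    intro ε hε
    obtain ⟨δ, hδ, N, hN⟩ := he x (ε / 5) (by linarith)
    obtain ⟨i, hi⟩ := hd.exists_dist_lt x hδ
    rw [dist_comm] at hi
    obtain ⟨N2, hN2⟩ := Metric.cauchySeq_iff'.1 (hLi i).cauchySeq (ε / 5) (by linarith)
    refine ⟨max N N2, fun n hn => ?_⟩
    set k := max N N2
    have a1 := abs_le.1 (hN (φ n) (le_trans (le_trans (le_max_left _ _) hn) (hφ.id_le n)) _ hi)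
    have a2 := abs_le.1 (hN (φ k) (le_trans (le_max_left _ _) (hφ.id_le k)) _ hi)
    have a3 := hN2 n (le_trans (le_max_right _ _) hn)
    have a4 := hN2 k (le_max_right _ _)
    rw [Real.dist_eq, abs_lt] at a3 a4 ⊢
    constructor <;> linarith
  choose f hf using fun x => cauchySeq_tendsto_of_complete (hcauchy x)
  have hfe : ∀ x, ∀ ε > (0:ℝ), ∃ δ > (0:ℝ), ∀ y, dist y x < δ → |f y - f x| ≤ ε := by
    intro x ε hε
    obtain ⟨δ, hδ, N, hN⟩ := he x ε hε
    refine ⟨δ, hδ, fun y hy => ?_⟩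
    refine le_of_tendsto ((hf y).sub (hf x)).abs ?_
    filter_upwards [eventually_ge_atTop N] with n hn
    exact hN _ (hn.trans (hφ.id_le n)) y hy
  refine ⟨φ, hφ, f, ?_, ?_⟩
  · rw [Metric.continuous_iff]
    intro x ε hε
    obtain ⟨δ, hδ, h⟩ := hfe x (ε / 2) (by linarith)
    exact ⟨δ, hδ, fun y hy => by rw [Real.dist_eq]; linarith [h y hy]⟩
  · rw [Metric.tendstoLocallyUniformly_iff]
    intro ε hε x
    obtain ⟨δ1, hδ1, h1⟩ := hfe x (ε / 4) (by linarith)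
    obtain ⟨δ2, hδ2, N, h2⟩ := he x (ε / 4) (by linarith)
    obtain ⟨N3, h3⟩ := Metric.tendsto_atTop.1 (hf x) (ε / 4) (by linarith)
    refine ⟨Metric.ball x (min δ1 δ2), Metric.ball_mem_nhds _ (lt_min hδ1 hδ2), ?_⟩
    filter_upwards [eventually_ge_atTop N, eventually_ge_atTop N3] with n hn hn3 y hy
    have hy := lt_min_iff.1 (Metric.mem_ball.1 hy)
    have a1 := abs_le.1 (h1 y hy.1)
    have a2 := abs_le.1 (h2 (φ n) (hn.trans (hφ.id_le n)) y hy.2)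
    have a3 := h3 n hn3
    rw [Real.dist_eq, abs_lt] at a3 ⊢
    constructor <;> linarith

theorem TendstoLocallyUniformly.uniform_on_compact {X : Type*} [PseudoMetricSpace X]
    {F : ℕ → X → ℝ} {f : X → ℝ} (h : TendstoLocallyUniformly F f atTop) {K : Set X}
    (hK : IsCompact K) {ε : ℝ} (hε : 0 < ε) : ∃ N, ∀ n ≥ N, ∀ x ∈ K, |F n x - f x| < ε := by
  have h1 := (tendstoLocallyUniformlyOn_iff_tendstoUniformlyOn_of_compact hK).1
    (h.tendstoLocallyUniformlyOn (s := K))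
  obtain ⟨N, hN⟩ := eventually_atTop.1 (Metric.tendstoUniformlyOn_iff.1 h1 ε hε)
  exact ⟨N, fun n hn x hx => by have := hN n hn x hx; rwa [dist_comm, Real.dist_eq] at this⟩

theorem hasDerivAt_of_bound {f : ℝ → ℝ} {t L : ℝ}
    (h : ∀ ε > (0:ℝ), ∃ δ > (0:ℝ), ∀ s, |s| < δ → |f (t + s) - f t - L * s| ≤ ε * |s|) :
    HasDerivAt f L t := by
  rw [hasDerivAt_iff_isLittleO_nhds_zero, Asymptotics.isLittleO_iff]
  intro c hc
  obtain ⟨δ, hδ, hd⟩ := h c hc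
  rw [Metric.eventually_nhds_iff]
  refine ⟨δ, hδ, fun s hs => ?_⟩
  rw [Real.dist_eq, sub_zero] at hs
  have := hd s hs
  simpa [mul_comm] using this

theorem HasDerivAt.bound {f : ℝ → ℝ} {t L : ℝ} (h : HasDerivAt f L t) {ε : ℝ} (hε : 0 < ε) :
    ∃ δ > (0:ℝ), ∀ s, |s| < δ → |f (t + s) - f t - L * s| ≤ ε * |s| := by
  rw [hasDerivAt_iff_isLittleO_nhds_zero, Asymptotics.isLittleO_iff] at h
  obtain ⟨δ, hδ, hd⟩ := Metric.eventually_nhds_iff.1 (h hε)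
  refine ⟨δ, hδ, fun s hs => ?_⟩
  have := hd (y := s) (by rwa [Real.dist_eq, sub_zero])
  simpa [mul_comm] using this

/-- A continuous function whose increments `f (t + s) - f t` vary with `t` by `o(s)`, uniformly,
is differentiable. -/
theorem exists_hasDerivAt_of_sliding {f : ℝ → ℝ} {a b : ℝ} (hf : ContinuousOn f (Ioo a b))
    (h : ∀ ε > (0:ℝ), ∃ δ > (0:ℝ), ∀ s, 0 < s → s < δ → ∀ t ∈ Ioo a b, ∀ t' ∈ Ioo a b,
      |t - t'| < δ → |(f (t + s) - f t) - (f (t' + s) - f t')| ≤ ε * s) {t : ℝ} (ht : t ∈ Ioo a b) :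
    ∃ L, HasDerivAt f L t := by
  have hct : ∀ y ∈ Ioo a b, ContinuousAt f y := fun y hy => hf.continuousAt (Ioo_mem_nhds hy.1 hy.2)
  -- comparison of quotients
  have key : ∀ ε > (0:ℝ), ∃ δ > (0:ℝ), ∀ s, 0 < s → s < δ → ∀ᶠ r in 𝓝[>] (0:ℝ),
      |(f (t + s) - f t) / s - (f (t + r) - f t) / r| ≤ 3 * ε := by
    intro ε hε
    obtain ⟨δ, hδ, hd⟩ := h ε hε
    refine ⟨min δ (b - t), lt_min hδ (by linarith [ht.2]), fun s hs hs' => ?_⟩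
    have hs' := lt_min_iff.1 hs'
    have c1 := (hct (t + s) ⟨by linarith [ht.1], by linarith⟩)
    have c2 := hct t ht
    obtain ⟨d1, hd1, e1⟩ := Metric.continuousAt_iff.1 c1 (ε * s) (by positivity)
    obtain ⟨d2, hd2, e2⟩ := Metric.continuousAt_iff.1 c2 (ε * s) (by positivity)
    have : Ioo (0:ℝ) (min (min d1 d2) (min δ s)) ∈ 𝓝[>] (0:ℝ) :=
      Ioo_mem_nhdsGT (lt_min (lt_min hd1 hd2) (lt_min hδ hs))
    filter_upwards [this] with r hr
    obtain ⟨hr0, hr⟩ := hr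
    obtain ⟨hra, hrb⟩ := lt_min_iff.1 hr
    obtain ⟨hr1, hr2⟩ := lt_min_iff.1 hra
    obtain ⟨hr3, hr4⟩ := lt_min_iff.1 hrb
    set n := ⌊s / r⌋₊ with hn
    have n1 : (n:ℝ) * r ≤ s := by
      have := Nat.floor_le (show 0 ≤ s / r by positivity)
      rwa [le_div_iff₀ hr0] at this
    have n2 : s < n * r + r := by
      have := Nat.lt_floor_add_one (s / r)
      rw [div_lt_iff₀ hr0] at this; linarith
    have a1 : |f (t + n * r) - f (t + s)| < ε * s := by
      have := e1 (x := t + n * r) (by rw [Real.dist_eq, abs_lt]; constructor <;> linarith)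
      rwa [Real.dist_eq] at this
    have a2 : |f (t + r) - f t| < ε * s := by
      have := e2 (x := t + r) (by rw [Real.dist_eq, abs_lt]; constructor <;> linarith)
      rwa [Real.dist_eq] at this
    have ind : ∀ k : ℕ, k ≤ n → |f (t + k * r) - f t - k * (f (t + r) - f t)| ≤ k * (ε * r) := by
      intro k
      induction k with
      | zero => intro _; simp
      | succ k ih =>
        intro hk
        have i1 := ih (by omega)
        have hk' : ((k:ℝ) + 1) * r ≤ n * r := by
          gcongr; exact_mod_cast hk
        have hkr : 0 ≤ (k:ℝ) * r := by positivity
        have i2 := hd r hr0 hr3 (t + k * r) ⟨by linarith [ht.1], by linarith⟩ t ht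
          (by rw [abs_lt]; constructor <;> linarith)
        rw [abs_le] at i1 i2 ⊢
        push_cast
        rw [show t + ((k:ℝ) + 1) * r = t + k * r + r by ring]
        constructor <;> linarith
    have i3 := ind n le_rfl
    set z := (f (t + r) - f t) / r with hz
    have hzr : f (t + r) - f t = z * r := by rw [hz]; field_simp
    rw [hzr] at i3 a2
    have a3 : |(s - n * r) * z| ≤ ε * s := by
      rw [abs_mul, abs_of_nonneg (by linarith)]
      rw [abs_mul, abs_of_pos hr0] at a2
      have : (s - n * r) * |z| ≤ r * |z| := by gcongr; linarith
      linarith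
    have e : (f (t + s) - f t) / s - z = (f (t + s) - f t - s * z) / s := by field_simp
    rw [e, abs_div, abs_of_pos hs, div_le_iff₀ hs]
    have i4 : (n:ℝ) * (ε * r) ≤ ε * s := by nlinarith
    rw [abs_le] at i3 a3 ⊢
    rw [abs_lt] at a1
    constructor <;> nlinarith
  obtain ⟨L, hL⟩ : ∃ L, Tendsto (fun r => (f (t + r) - f t) / r) (𝓝[>] 0) (𝓝 L) := by
    apply cauchy_map_iff_exists_tendsto.1
    rw [Metric.cauchy_iff]
    refine ⟨inferInstance, fun ε hε => ?_⟩
    obtain ⟨δ, hδ, hd⟩ := key (ε / 12) (by linarith)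
    have := hd (δ / 2) (by linarith) (by linarith)
    refine ⟨_, image_mem_map this, ?_⟩
    rintro _ ⟨r1, h1, rfl⟩ _ ⟨r2, h2, rfl⟩
    have h1 := abs_le.1 (mem_ofPred.1 h1)
    have h2 := abs_le.1 (mem_ofPred.1 h2)
    rw [Real.dist_eq, abs_lt]
    constructor <;> linarith
  refine ⟨L, hasDerivAt_of_bound fun ε hε => ?_⟩
  obtain ⟨δ, hδ, hd⟩ := h (ε / 2) (by linarith)
  obtain ⟨η, hη, hd2⟩ := key (ε / 6) (by linarith)
  have hpos : ∀ s, 0 < s → s < η → |f (t + s) - f t - L * s| ≤ ε / 2 * s := by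
    intro s h1 h2
    have := le_of_tendsto ((tendsto_const_nhds.sub hL).abs) (hd2 s h1 h2)
    have e : f (t + s) - f t - L * s = ((f (t + s) - f t) / s - L) * s := by field_simp
    rw [e, abs_mul, abs_of_pos h1]
    gcongr; linarith
  refine ⟨min (min δ η) (t - a), lt_min (lt_min hδ hη) (by linarith [ht.1]), fun s hs => ?_⟩
  obtain ⟨hs, hs3⟩ := lt_min_iff.1 hs
  obtain ⟨hs1, hs2⟩ := lt_min_iff.1 hs
  rcases lt_trichotomy s 0 with hneg | rfl | hp
  · rw [abs_of_neg hneg] at *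
    have b1 := hpos (-s) (by linarith) hs2
    have b2 := hd (-s) (by linarith) hs1 (t + s) ⟨by linarith, by linarith [ht.2]⟩ t ht
      (by rw [add_sub_cancel_left, abs_of_neg hneg]; exact hs1)
    rw [show t + s + -s = t by ring] at b2
    rw [abs_le] at b1 b2 ⊢
    constructor <;> linarith
  · simp
  · rw [abs_of_pos hp] at *
    have := hpos s hp hs2
    nlinarith

/-- The compactly supported profile `(1 - (x/ρ)²)²`. -/
noncomputable def bump (ρ x : ℝ) : ℝ := (1 - (x / ρ) ^ 2) ^ 2

theorem bump_nonneg (ρ x : ℝ) : 0 ≤ bump ρ x := sq_nonneg _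

theorem bump_le_one {ρ x : ℝ} (hρ : 0 < ρ) (h : |x| ≤ ρ) : bump ρ x ≤ 1 := by
  have h1 : (x / ρ) ^ 2 ≤ 1 := by
    rw [div_pow, div_le_one (by positivity), ← sq_abs]
    exact pow_le_pow_left₀ (abs_nonneg x) h 2
  have h2 : 0 ≤ (x / ρ) ^ 2 := sq_nonneg _
  unfold bump; nlinarith

theorem bump_zero (ρ : ℝ) : bump ρ 0 = 1 := by simp [bump]

theorem bump_edge {ρ x : ℝ} (hρ : 0 < ρ) (h : |x| = ρ) : bump ρ x = 0 := by
  have : (x / ρ) ^ 2 = 1 := by rw [div_pow, ← sq_abs, h, div_self (by positivity)]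
  simp [bump, this]

theorem continuous_bump (ρ : ℝ) : Continuous (bump ρ) := by unfold bump; fun_prop

theorem jet2_bump (ρ x : ℝ) :
    ∃ fx fxx, Jet2 (bump ρ) x fx fxx ∧ -(9 / ρ ^ 2) * bump ρ x ≤ fxx := by
  have h := (((Jet2.const 1 x).sub ((Jet2.id x).const_mul (1 / ρ)).sq).sq)
  refine ⟨_, _, h.congr (Eventually.of_forall fun y => ?_), ?_⟩
  · simp only [bump]; ring
  · have e : bump ρ x = (1 - (1 / ρ * x) ^ 2) ^ 2 := by simp only [bump]; ring
    rw [e]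
    have hq : 0 ≤ (1 / ρ * x) ^ 2 := sq_nonneg _
    have hr : 0 ≤ (1 / ρ) ^ 2 := sq_nonneg _
    have e2 : 9 / ρ ^ 2 = 9 * (1 / ρ) ^ 2 := by ring
    rw [e2]
    have : 0 ≤ (1 / ρ) ^ 2 * (9 * ((1 / ρ * x) ^ 2) ^ 2 - 6 * (1 / ρ * x) ^ 2 + 5) := by
      apply mul_nonneg hr; nlinarith [sq_nonneg (3 * (1 / ρ * x) ^ 2 - 1)]
    nlinarith

theorem isClosed_box (a b c d : ℝ) : IsClosed (Icc a b ×ˢ Icc c d : Set (ℝ × ℝ)) :=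
  isClosed_Icc.prod isClosed_Icc

/-- Growth from below for nonnegative solutions of `u_t = u_xx + u (g - u)`. -/
theorem bump_growth {u : ℝ → ℝ → ℝ} {g : ℝ → ℝ} {x ρ t0 t1 m η κ ε : ℝ} (hρ : 0 < ρ)
    (hκ : 0 < κ) (hε : 0 < ε)
    (hm : κ + 9 / ρ ^ 2 + η ≤ m) (hε1 : ε * Real.exp (κ * (t1 - t0)) ≤ η)
    (hc : ContinuousOn (fun p : ℝ × ℝ => u p.1 p.2) (Icc (x - ρ) (x + ρ) ×ˢ Icc t0 t1))
    (hg : ∀ y, m ≤ g y)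
    (hu : ∀ y ∈ Icc (x - ρ) (x + ρ), ∀ t ∈ Icc t0 t1, 0 ≤ u y t)
    (h0 : ∀ y ∈ Icc (x - ρ) (x + ρ), ε ≤ u y t0)
    (hJ : ∀ y ∈ Ioo (x - ρ) (x + ρ), ∀ t ∈ Ioc t0 t1, ∃ ut ux uxx, Jet u y t ut ux uxx ∧
      ut = uxx + u y t * (g y - u y t)) (t : ℝ) (ht : t ∈ Icc t0 t1) :
    ε * Real.exp (κ * (t - t0)) ≤ u x t := by
  have hbd : ∀ s ≤ t1, ε * Real.exp (κ * (s - t0)) ≤ η := fun s hs => by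
    refine le_trans ?_ hε1
    gcongr
  have := max_principle (isClosed_box (x - ρ) (x + ρ) t0 t1) (t0 := t0) (t1 := t1) (K := m - η)
    (B := η) (z := fun y s => u y s - ε * Real.exp (κ * (s - t0)) * bump ρ (y - x))
    (fun p hp => hp.2) ?_ ?_ ?_ x t ⟨⟨by linarith, by linarith⟩, ht⟩
  · simp only [sub_self, bump_zero, mul_one] at this; linarith
  · refine hc.sub (Continuous.continuousOn ?_)
    have := continuous_bump ρ
    fun_prop
  · rintro ⟨y, s⟩ ⟨hy, hs⟩
    have h1 := hu y hy s hs
    have h2 := bump_le_one (x := y - x) hρ (abs_le.2 ⟨by linarith [hy.1], by linarith [hy.2]⟩)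
    have h3 := bump_nonneg ρ (y - x)
    have h4 := hbd s hs.2
    have h5 : 0 < ε * Real.exp (κ * (s - t0)) := by positivity
    simp only
    nlinarith
  · rintro y s ⟨hy, hs⟩ hz
    simp only at hy hs hz
    have hu0 := hu y hy s hs
    have hyI : y ∈ Ioo (x - ρ) (x + ρ) := by
      refine ⟨lt_of_le_of_ne hy.1 ?_, lt_of_le_of_ne hy.2 ?_⟩
      · intro he
        rw [bump_edge hρ (by rw [← he, show x - ρ - x = -ρ by ring, abs_neg, abs_of_pos hρ])] at hz
        linarith
      · intro he
        rw [bump_edge hρ (by rw [he, add_sub_cancel_left, abs_of_pos hρ])] at hz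
        linarith
    have hsI : s ∈ Ioc t0 t1 := by
      refine ⟨lt_of_le_of_ne hs.1 ?_, hs.2⟩
      rintro rfl
      have h1 := h0 y hy
      have h2 := bump_le_one (x := y - x) hρ (abs_le.2 ⟨by linarith [hy.1], by linarith [hy.2]⟩)
      simp only [sub_self, mul_zero, Real.exp_zero, mul_one] at hz
      nlinarith
    refine ⟨?_, ?_, ?_⟩
    · filter_upwards [Ioo_mem_nhds hyI.1 hyI.2] with w hw using ⟨Ioo_subset_Icc_self hw, hs⟩
    · filter_upwards [Ioo_mem_nhdsLT hsI.1] with w hw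
      exact ⟨hy, hw.1.le, by simp only; linarith [hw.2, hs.2]⟩
    · obtain ⟨ut, ux, uxx, hJu, he⟩ := hJ y hyI s hsI
      obtain ⟨fx, fxx, hf, hfx⟩ := jet2_bump ρ (y - x)
      have hE : HasDerivAt (fun s => ε * Real.exp (κ * (s - t0)))
          (κ * (ε * Real.exp (κ * (s - t0)))) s := by
        have := ((((hasDerivAt_id s).sub_const t0).const_mul κ).exp).const_mul ε
        exact this.congr_deriv (by simp only [id]; ring)
      have hb : Jet2 (fun y => bump ρ (y - x)) y fx fxx := by
        have := Jet2.comp_add (x := y) (d := -x) (f := bump ρ) (fx := fx) (fxx := fxx)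
          (by simpa only [sub_eq_add_neg] using hf)
        simpa only [sub_eq_add_neg] using this
      refine ⟨_, _, _, hJu.sub ((Jet.of_time hE).mul (Jet.of_space hb)), ?_⟩
      set e := ε * Real.exp (κ * (s - t0)) with hedef
      have he0 : 0 < e := by positivity
      set φ := bump ρ (y - x)
      have hφ := bump_nonneg ρ (y - x)
      have h2 : φ ≤ 1 := bump_le_one (x := y - x) hρ (abs_le.2 ⟨by linarith [hy.1], by linarith [hy.2]⟩)
      have hlt : u y s ≤ η := by
        have := hbd s hs.2
        nlinarith
      have hgy := hg y
      have e1 : u y s * (m - η) ≤ u y s * (g y - u y s) := by gcongr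
      have e2 : e * (-(9 / ρ ^ 2) * φ) ≤ e * fxx := by gcongr
      have e3 : e * φ * (κ + 9 / ρ ^ 2) ≤ e * φ * (m - η) := by
        have : 0 ≤ e * φ := by positivity
        gcongr; linarith
      nlinarith

theorem IsBddPosSteadyState.jet2 {g p : ℝ → ℝ} (h : IsBddPosSteadyState g p) (x : ℝ) :
    Jet2 p x (deriv p x) (p x * (p x - g x)) := by
  obtain ⟨h1, _, _, h2⟩ := h
  have hd : Differentiable ℝ p := h1.differentiable (by norm_num)
  have hd2 : Differentiable ℝ (deriv p) := by
    have : ContDiff ℝ 1 (deriv p) := by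
      have := (contDiff_succ_iff_deriv (n := 1) (f := p) (𝕜 := ℝ)).1 (by rw [one_add_one_eq_two]; exact h1)
      exact this.2.2
    exact this.differentiable (by norm_num)
  refine ⟨deriv p, rfl, Eventually.of_forall fun y => (hd y).hasDerivAt, ?_⟩
  exact (hd2 x).hasDerivAt.congr_deriv (by linarith [h2 x])

theorem IsBddPosSteadyState.continuous_coeff {g p : ℝ → ℝ} (h : IsBddPosSteadyState g p) :
    Continuous g := by
  obtain ⟨h1, _, h3, h2⟩ := h
  have e : g = fun x => p x - deriv (deriv p) x / p x := by
    funext x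
    have := h2 x
    have hp := (h3 x).ne'
    field_simp
    linarith
  rw [e]
  have c1 : Continuous (deriv (deriv p)) := by
    have := h1.continuous_iteratedDeriv 2 (by norm_num)
    rwa [iteratedDeriv_succ, iteratedDeriv_one] at this
  exact h1.continuous.sub (c1.div h1.continuous fun x => (h3 x).ne')

theorem BohrAlmostPeriodic.bounded {f : ℝ → ℝ} (h : BohrAlmostPeriodic f) (hc : Continuous f) :
    ∃ M, ∀ x, |f x| ≤ M := by
  obtain ⟨L, hL, h1⟩ := h 1 one_pos
  obtain ⟨B, hB⟩ := (isCompact_Icc (a := (0:ℝ)) (b := L)).exists_bound_of_continuousOn hc.continuousOn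
  refine ⟨B + 1, fun x => ?_⟩
  obtain ⟨s, hs, h2⟩ := h1 (-x)
  have h3 := abs_lt.1 (h2 x)
  have h4 := abs_le.1 (hB (x + s) ⟨by linarith [hs.1], by linarith [hs.2]⟩)
  exact abs_le.2 ⟨by linarith, by linarith⟩

theorem BohrAlmostPeriodic.uniformContinuous {f : ℝ → ℝ} (h : BohrAlmostPeriodic f)
    (hc : Continuous f) : ∀ ε > (0:ℝ), ∃ δ > (0:ℝ), ∀ x y, |x - y| < δ → |f x - f y| < ε := by
  intro ε hε
  obtain ⟨L, hL, h1⟩ := h (ε / 3) (by linarith)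
  have hu := (isCompact_Icc (a := (-1:ℝ)) (b := L + 1)).uniformContinuousOn_of_continuous
    hc.continuousOn
  obtain ⟨δ, hδ, h2⟩ := Metric.uniformContinuousOn_iff.1 hu (ε / 3) (by linarith)
  refine ⟨min δ 1, lt_min hδ one_pos, fun x y hxy => ?_⟩
  obtain ⟨hxy, hxy1⟩ := lt_min_iff.1 hxy
  rw [abs_lt] at hxy1
  obtain ⟨s, hs, h3⟩ := h1 (-x)
  have a1 := abs_lt.1 (h3 x)
  have a2 := abs_lt.1 (h3 y)
  have a3 := h2 (x + s) ⟨by linarith [hs.1], by linarith [hs.2]⟩ (y + s)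
    ⟨by linarith [hs.1], by linarith [hs.2]⟩ (by rw [Real.dist_eq]; simpa using hxy)
  rw [Real.dist_eq] at a3
  have a3 := abs_lt.1 a3
  exact abs_lt.2 ⟨by linarith, by linarith⟩

/-- A bounded steady state is bounded below by the lower bound of the coefficient. -/
theorem steady_lower {g p : ℝ → ℝ} {m : ℝ} (hg : ∀ x, m ≤ g x)
    (hp : ∀ x, 0 < p x) (hc : Continuous p)
    (hJ : ∀ x, ∃ px, Jet2 p x px (p x * (p x - g x))) (x : ℝ) : m ≤ p x := by
  refine le_of_forall_pos_sub_le fun θ hθ => ?_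
  wlog hθm : θ < m generalizing θ
  · linarith [hp x]
  obtain ⟨ρ, hρ, hρ2⟩ : ∃ ρ > (0:ℝ), 9 / ρ ^ 2 ≤ θ / 2 := by
    refine ⟨Real.sqrt (18 / θ), by positivity, ?_⟩
    rw [Real.sq_sqrt (by positivity)]
    apply le_of_eq; field_simp; norm_num
  obtain ⟨y, hy, hmin⟩ := (isCompact_Icc (a := x - ρ) (b := x + ρ)).exists_isMinOn
    ⟨x, by linarith, by linarith⟩ hc.continuousOn
  set ε := min (p y) (m - θ) with hε
  have hε0 : 0 < ε := lt_min (hp y) (by linarith)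
  set κ := θ / 2 with hκ
  set T := Real.log ((m - θ) / ε) / κ with hT
  have hT0 : 0 ≤ T := by
    apply div_nonneg _ (by linarith)
    apply Real.log_nonneg
    rw [le_div_iff₀ hε0]; linarith [min_le_right (p y) (m - θ)]
  have hexp : ε * Real.exp (κ * (T - 0)) = m - θ := by
    have : κ * (T - 0) = Real.log ((m - θ) / ε) := by
      rw [hT]; have : κ ≠ 0 := by rw [hκ]; linarith
      field_simp; ring
    rw [this, Real.exp_log (by apply div_pos <;> linarith)]
    field_simp
  have := bump_growth (u := fun y _ => p y) (g := g) (x := x) (ρ := ρ) (t0 := 0) (t1 := T) (m := m)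
    (η := m - θ) (κ := κ) (ε := ε) hρ (by linarith) hε0 (by linarith) hexp.le
    (Continuous.continuousOn (by fun_prop)) hg (fun y _ _ _ => (hp y).le)
    (fun z hz => (min_le_left _ _).trans (hmin hz))
    (fun z _ t _ => by
      obtain ⟨px, hpx⟩ := hJ z
      exact ⟨_, _, _, Jet.of_space hpx, by ring⟩) T ⟨hT0, le_rfl⟩
  rw [hexp] at this
  exact this

theorem isClosed_strip (t0 t1 : ℝ) : IsClosed {p : ℝ × ℝ | p.2 ∈ Icc t0 t1} :=
  isClosed_Icc.preimage continuous_snd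

theorem eventually_left_Icc {t0 t1 s : ℝ} (h : t0 < s) (h1 : s ≤ t1) :
    ∀ᶠ r in 𝓝[<] s, r ∈ Icc t0 t1 := by
  filter_upwards [Ioo_mem_nhdsLT h] with w hw
  exact ⟨hw.1.le, by linarith [hw.2]⟩

theorem hasDerivAt_exp_decay (A c s : ℝ) :
    HasDerivAt (fun s => A * Real.exp (-c * s)) (-c * (A * Real.exp (-c * s))) s := by
  have := ((hasDerivAt_id s).const_mul (-c)).exp.const_mul A
  exact this.congr_deriv (by simp only [id]; ring)

theorem le_of_forall_exp_decay {x y A c : ℝ} (hc : 0 < c)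
    (h : ∀ t, 0 ≤ t → x ≤ y + A * Real.exp (-c * t)) : x ≤ y := by
  have h1 : Tendsto (fun t : ℝ => y + A * Real.exp (-c * t)) atTop (𝓝 (y + A * 0)) := by
    refine tendsto_const_nhds.add (Tendsto.const_mul A ?_)
    refine Real.tendsto_exp_atBot.comp ?_
    exact tendsto_id.const_mul_atTop_of_neg (by linarith)
  rw [mul_zero, add_zero] at h1
  refine ge_of_tendsto h1 ?_
  filter_upwards [eventually_ge_atTop 0] with t ht using h t ht

theorem steady_upper {g p : ℝ → ℝ} {m M B : ℝ} (hm : 0 < m) (hg : ∀ x, m ≤ g x)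
    (hgM : ∀ x, g x ≤ M)
    (hp : ∀ x, 0 < p x) (hpB : ∀ x, p x ≤ B) (hc : Continuous p)
    (hJ : ∀ x, ∃ px, Jet2 p x px (p x * (p x - g x))) (x : ℝ) : p x ≤ M := by
  have hM : 0 < M := hm.trans_le ((hg 0).trans (hgM 0))
  have hB : 0 < B := (hp 0).trans_le (hpB 0)
  refine le_of_forall_exp_decay (A := B) hM fun T hT => ?_
  have := max_principle (isClosed_strip 0 T) (t0 := 0) (t1 := T) (K := M) (B := B)
    (z := fun y s => M + B * Real.exp (-M * s) - p y) (fun q hq => hq)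
    (Continuous.continuousOn (by fun_prop))
    (fun q _ => by have := hpB q.1; have := Real.exp_pos (-M * q.2); nlinarith)
    (fun y s hs hz => by
      have hs : s ∈ Icc 0 T := hs
      have hs0 : 0 < s := by
        refine lt_of_le_of_ne hs.1 ?_
        rintro rfl
        have := hpB y
        simp at hz; linarith
      refine ⟨Eventually.of_forall fun _ => hs, eventually_left_Icc hs0 hs.2, ?_⟩
      obtain ⟨px, hpx⟩ := hJ y
      refine ⟨_, _, _, ((Jet.const M).add (Jet.of_time (hasDerivAt_exp_decay B M s))).sub
        (Jet.of_space hpx), ?_⟩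
      have e0 : 0 < B * Real.exp (-M * s) := by positivity
      have h1 := hgM y
      have h2 := hp y
      set e := B * Real.exp (-M * s)
      have h3 : p y * (p y - M) ≤ p y * (p y - g y) := by gcongr
      have h4 : M * e ≤ p y * e := by gcongr; linarith
      have h5 : p y * e ≤ p y * (p y - M) := by gcongr; linarith
      have h6 : M * (M + e - p y) ≤ 0 := by nlinarith
      linarith) x T (show T ∈ Icc 0 T from ⟨hT, le_rfl⟩)
  linarith

/-- Quantitative dependence of the steady state on the coefficient. -/
theorem steady_le_of_coeff_le {g₁ g₂ p q : ℝ → ℝ} {m M δ : ℝ} (hm : 0 < m) (hδ : 0 ≤ δ)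
    (hgM : ∀ x, g₁ x ≤ M) (hgg : ∀ x, g₂ x ≤ g₁ x + δ)
    (hp : ∀ x, m ≤ p x) (hq : ∀ x, m ≤ q x) (hqM : ∀ x, q x ≤ M) (hc : Continuous p)
    (hqc : Continuous q)
    (hJ : ∀ x, ∃ px, Jet2 p x px (p x * (p x - g₁ x)))
    (hJq : ∀ x, ∃ px, Jet2 q x px (q x * (q x - g₂ x))) (x : ℝ) : q x ≤ (1 + δ / m) * p x := by
  have hM : 0 < M := hm.trans_le ((hq 0).trans (hqM 0))
  set A := M / m with hA
  have hA0 : 0 < A := by positivity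
  have hδm : 0 ≤ δ / m := by positivity
  refine le_of_forall_exp_decay (A := A * p x) hm fun T hT => ?_
  have := max_principle (isClosed_strip 0 T) (t0 := 0) (t1 := T) (K := M + δ) (B := M)
    (z := fun y s => (1 + δ / m + A * Real.exp (-m * s)) * p y - q y) (fun q hq => hq)
    (Continuous.continuousOn (by fun_prop))
    (fun r _ => by
      have := hqM r.1; have := Real.exp_pos (-m * r.2); have := hp r.1
      have : 0 ≤ (1 + δ / m + A * Real.exp (-m * r.2)) * p r.1 := by
        apply mul_nonneg <;> first | positivity | linarith
      linarith)
    (fun y s hs hz => by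
      have hs : s ∈ Icc 0 T := hs
      have hpy := hp y
      have hs0 : 0 < s := by
        refine lt_of_le_of_ne hs.1 ?_
        rintro rfl
        have := hqM y
        have h1 : M = A * m := by rw [hA]; field_simp
        simp only [mul_zero, Real.exp_zero, mul_one] at hz
        nlinarith
      refine ⟨Eventually.of_forall fun _ => hs, eventually_left_Icc hs0 hs.2, ?_⟩
      obtain ⟨px, hpx⟩ := hJ y
      obtain ⟨qx, hqx⟩ := hJq y
      refine ⟨_, _, _, (((Jet.const (1 + δ / m)).add (Jet.of_time
        (hasDerivAt_exp_decay A m s))).mul (Jet.of_space hpx)).sub (Jet.of_space hqx), ?_⟩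
      have e0 : 0 < A * Real.exp (-m * s) := by positivity
      set e := A * Real.exp (-m * s)
      have h1 := hgM y
      have h2 := hgg y
      have h3 := hq y
      set k := 1 + δ / m + e with hk
      have hδe : δ / m * m = δ := by field_simp
      have hk1 : 1 ≤ k := by linarith
      set P := p y
      set Q := q y
      have hP0 : 0 < P := by linarith
      have a1 : Q * (Q - g₁ y) - δ * Q ≤ Q * (Q - g₂ y) := by nlinarith
      have a2 : (M + δ) * (k * P - Q) ≤ -(k * P - Q) * (Q + k * P - g₁ y - δ) := by
        have : 0 ≤ (Q - k * P) * (M + Q + k * P - g₁ y) := by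
          apply mul_nonneg (by linarith); nlinarith
        nlinarith
      have a3 : (δ + m * e) * (k * P) ≤ k * (k - 1) * P ^ 2 := by
        have : (δ + m * e) = m * (k - 1) := by rw [hk]; linarith
        rw [this]
        have : 0 ≤ (k - 1) * k * P * (P - m) := by
          apply mul_nonneg _ (by linarith)
          apply mul_nonneg _ hP0.le
          apply mul_nonneg <;> linarith
        nlinarith
      have a4 : m * e * P ≤ m * e * (k * P) := by
        have : P ≤ k * P := by nlinarith
        gcongr
      nlinarith) x T (show T ∈ Icc 0 T from ⟨hT, le_rfl⟩)
  nlinarith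

/-- Temperature as a function of the enthalpy, with latent heat `ℓ`. -/
noncomputable def temp (ℓ e : ℝ) : ℝ := max (e - ℓ) 0

/-- One step of the explicit enthalpy scheme. -/
noncomputable def latStep (ℓ dx dt : ℝ) (α E : ℤ → ℝ) (i : ℤ) : ℝ :=
  E i + dt / dx ^ 2 * (temp ℓ (E (i + 1)) - 2 * temp ℓ (E i) + temp ℓ (E (i - 1)))
    + dt * (temp ℓ (E i) * (α i - temp ℓ (E i)))

/-- A monotone solution of the explicit enthalpy scheme. -/
structure LatSol (ℓ M : ℝ) where
  dx : ℝ
  dt : ℝ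
  x0 : ℝ
  t0 : ℝ
  coef : ℤ → ℝ
  E : ℕ → ℤ → ℝ
  dx_pos : 0 < dx
  dt_pos : 0 < dt
  cfl : 8 * dt ≤ dx ^ 2
  cflM : 4 * M * dt ≤ 1
  coef_nonneg : ∀ i, 0 ≤ coef i
  coef_le : ∀ i, coef i ≤ M
  E_nonneg : ∀ k i, 0 ≤ E k i
  E_le : ∀ k i, E k i ≤ ℓ + M
  mono : ∀ k i, E k i ≤ E (k + 1) i
  front : ∀ k i, E k i < ℓ → E k (i + 1) = 0
  step : ∀ k i, E (k + 1) i = latStep ℓ dx dt coef (E k) i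

theorem temp_nonneg (ℓ e : ℝ) : 0 ≤ temp ℓ e := le_max_right _ _

theorem temp_mono {ℓ e e' : ℝ} (h : e ≤ e') : temp ℓ e ≤ temp ℓ e' :=
  max_le_max (by linarith) le_rfl

theorem temp_of_ge {ℓ e : ℝ} (h : ℓ ≤ e) : temp ℓ e = e - ℓ := max_eq_left (by linarith)

theorem temp_of_le {ℓ e : ℝ} (h : e ≤ ℓ) : temp ℓ e = 0 := max_eq_right (by linarith)

theorem temp_le {ℓ M e : ℝ} (hM : 0 ≤ M) (h : e ≤ ℓ + M) : temp ℓ e ≤ M :=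
  max_le (by linarith) hM

theorem temp_sub_le {ℓ e e' : ℝ} (h : e ≤ e') : temp ℓ e' - temp ℓ e ≤ e' - e := by
  unfold temp
  rcases le_total (e' - ℓ) 0 with h1 | h1
  · rw [max_eq_right h1, max_eq_right (by linarith)]; linarith
  · rw [max_eq_left h1]; linarith [le_max_left (e - ℓ) 0]

theorem latStep_mono {ℓ M dx dt : ℝ} {α E E' : ℤ → ℝ} (hM : 0 ≤ M) (hdx : 0 < dx) (hdt : 0 < dt)
    (cfl : 8 * dt ≤ dx ^ 2) (cflM : 4 * M * dt ≤ 1) (hα : ∀ i, 0 ≤ α i)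
    (h : ∀ i, E i ≤ E' i) (hE' : ∀ i, E' i ≤ ℓ + M) (i : ℤ) :
    latStep ℓ dx dt α E i ≤ latStep ℓ dx dt α E' i := by
  unfold latStep
  set lam := dt / dx ^ 2 with hl
  have hlam : 0 ≤ lam := by positivity
  have hlam2 : lam ≤ 1 / 8 := by rw [hl, div_le_iff₀ (by positivity)]; linarith
  have h1 := temp_mono (ℓ := ℓ) (h (i + 1))
  have h2 := temp_mono (ℓ := ℓ) (h (i - 1))
  have h3 := temp_mono (ℓ := ℓ) (h i)
  have h4 := temp_sub_le (ℓ := ℓ) (h i)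
  have h5 := temp_le hM (hE' i)
  have h6 := temp_nonneg ℓ (E i)
  set a := temp ℓ (E i)
  set b := temp ℓ (E' i)
  have e1 : lam * (temp ℓ (E (i + 1)) + temp ℓ (E (i - 1)))
      ≤ lam * (temp ℓ (E' (i + 1)) + temp ℓ (E' (i - 1))) := by gcongr
  have e2 : 0 ≤ (b - a) * (1 - 2 * lam + dt * (α i - a - b)) := by
    apply mul_nonneg (by linarith)
    have : dt * (-(2 * M)) ≤ dt * (α i - a - b) := by
      gcongr; linarith [hα i]
    nlinarith
  nlinarith

namespace LatSol

variable {ℓ M : ℝ} (L : LatSol ℓ M)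

noncomputable def u (k : ℕ) (i : ℤ) : ℝ := temp ℓ (L.E k i)
noncomputable def x (i : ℤ) : ℝ := L.x0 + i * L.dx
noncomputable def t (k : ℕ) : ℝ := L.t0 + k * L.dt
noncomputable def lam : ℝ := L.dt / L.dx ^ 2

theorem lam_pos : 0 < L.lam := div_pos L.dt_pos (pow_pos L.dx_pos 2)

theorem lam_le : L.lam ≤ 1 / 8 := by
  rw [lam, div_le_iff₀ (pow_pos L.dx_pos 2)]; linarith [L.cfl]

theorem lam_mul : L.lam * L.dx ^ 2 = L.dt := by
  have := L.dx_pos.ne'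
  rw [lam]; field_simp

theorem x_succ (i : ℤ) : L.x (i + 1) = L.x i + L.dx := by simp only [x]; push_cast; ring
theorem t_add (k r : ℕ) : L.t (k + r) = L.t k + r * L.dt := by simp only [t]; push_cast; ring
theorem x_add (i j : ℤ) : L.x (i + j) = L.x i + j * L.dx := by simp only [x]; push_cast; ring

theorem step' (k : ℕ) (i : ℤ) : L.E (k + 1) i = L.E k i
    + L.lam * (L.u k (i + 1) - 2 * L.u k i + L.u k (i - 1))
    + L.dt * (L.u k i * (L.coef i - L.u k i)) := L.step k i

theorem u_nonneg (k : ℕ) (i : ℤ) : 0 ≤ L.u k i := temp_nonneg _ _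

theorem M_nonneg {ℓ M : ℝ} (L : LatSol ℓ M) : 0 ≤ M := (L.coef_nonneg 0).trans (L.coef_le 0)

theorem u_le (k : ℕ) (i : ℤ) : L.u k i ≤ M := temp_le L.M_nonneg (L.E_le k i)

theorem E_mono (i : ℤ) : Monotone fun k => L.E k i := monotone_nat_of_le_succ fun k => L.mono k i

theorem u_mono (i : ℤ) : Monotone fun k => L.u k i := fun _ _ h => temp_mono (L.E_mono i h)

theorem E_eq {k : ℕ} {i : ℤ} (h : ℓ ≤ L.E k i) : L.E k i = ℓ + L.u k i := by
  rw [u, temp_of_ge h]; ring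

theorem u_eq_zero {k : ℕ} {i : ℤ} (h : L.E k i < ℓ) : L.u k i = 0 := temp_of_le h.le

theorem inactive_right (hℓ : 0 < ℓ) {k : ℕ} {i j : ℤ} (h : L.E k i < ℓ) (hij : i < j) :
    L.E k j = 0 := by
  obtain ⟨n, rfl⟩ : ∃ n : ℕ, j = i + 1 + n := ⟨(j - i - 1).toNat, by omega⟩
  induction n with
  | zero => simpa using L.front k i h
  | succ n ih =>
    have := L.front k _ (by rw [ih (by omega)]; exact hℓ)
    push_cast
    rw [← this]; congr 1; ring

theorem active_step {k : ℕ} {i : ℤ} (h : ℓ ≤ L.E k i) : L.u (k + 1) i = L.u k i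
    + L.lam * (L.u k (i + 1) - 2 * L.u k i + L.u k (i - 1))
    + L.dt * (L.u k i * (L.coef i - L.u k i)) := by
  have h1 := L.step' k i
  rw [L.E_eq h, L.E_eq (h.trans (L.mono k i))] at h1
  linarith

theorem react_le (k : ℕ) (i : ℤ) : L.u k i * (L.coef i - L.u k i) ≤ M ^ 2 := by
  have h1 := L.u_nonneg k i
  have h2 := L.u_le k i
  have h3 := L.coef_le i
  have h4 := L.coef_nonneg i
  nlinarith

theorem second_diff_ge (k : ℕ) (i : ℤ) :
    -(M ^ 2 * L.dx ^ 2) ≤ L.u k (i + 1) - 2 * L.u k i + L.u k (i - 1) := by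
  rcases le_or_gt ℓ (L.E k i) with h | h
  · have h1 := L.active_step h
    have h2 := L.u_mono i (Nat.le_succ k)
    have h3 := L.react_le k i
    simp only [Nat.succ_eq_add_one] at h2
    have h4 : L.lam * -(M ^ 2 * L.dx ^ 2) ≤
        L.lam * (L.u k (i + 1) - 2 * L.u k i + L.u k (i - 1)) := by
      have : L.lam * -(M ^ 2 * L.dx ^ 2) = - (L.dt * M ^ 2) := by rw [← L.lam_mul]; ring
      have : L.dt * (L.u k i * (L.coef i - L.u k i)) ≤ L.dt * M ^ 2 := by
        have := L.dt_pos; gcongr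
      linarith
    exact le_of_mul_le_mul_left h4 L.lam_pos
  · rw [L.u_eq_zero h]
    have := L.u_nonneg k (i + 1)
    have := L.u_nonneg k (i - 1)
    have : 0 ≤ M ^ 2 * L.dx ^ 2 := by positivity
    linarith

end LatSol

/-- A bounded sequence with second differences bounded below is Lipschitz. -/
theorem discrete_lip {v : ℤ → ℝ} {M K d : ℝ} (hd : 0 < d) (hd1 : d ≤ 1) (hK : 0 ≤ K)
    (h0 : ∀ i, 0 ≤ v i) (hM : ∀ i, v i ≤ M)
    (h2 : ∀ i, -(K * d ^ 2) ≤ v (i + 1) - 2 * v i + v (i - 1)) (i : ℤ) :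
    v (i + 1) - v i ≤ (M + 2 * K) * d := by
  by_contra hc
  push Not at hc
  have a1 : ∀ n : ℕ, v (i + 1) - v i - n * (K * d ^ 2) ≤ v (i + n + 1) - v (i + n) := by
    intro n
    induction n with
    | zero => simp
    | succ n ih =>
      have := h2 (i + n + 1)
      rw [show i + n + 1 - 1 = i + n by ring] at this
      push_cast
      rw [show i + ((n:ℤ) + 1) = i + n + 1 by ring]
      linarith
  set N := ⌈1 / d⌉₊ with hN
  have n1 : 1 ≤ N * d := by
    have := Nat.le_ceil (1 / d)
    rwa [div_le_iff₀ hd] at this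
  have n2 : N * d ≤ 2 := by
    have := Nat.ceil_lt_add_one (show 0 ≤ 1 / d by positivity)
    have : (N:ℝ) * d < (1 / d + 1) * d := by gcongr
    have e : (1 / d + 1) * d = 1 + d := by field_simp
    linarith
  have a2 : ∀ n : ℕ, n ≤ N → n * (M * d) ≤ v (i + n) - v i := by
    intro n
    induction n with
    | zero => intro _; simp
    | succ n ih =>
      intro hn
      have b1 := ih (by omega)
      have b2 := a1 n
      have b3 : (n:ℝ) * d ≤ 2 := by
        have : (n:ℝ) * d ≤ N * d := by gcongr; exact_mod_cast (by omega : n ≤ N)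
        linarith
      have b4 : (n:ℝ) * (K * d ^ 2) ≤ 2 * K * d := by
        have := mul_le_mul_of_nonneg_right b3 (show 0 ≤ K * d by positivity)
        nlinarith
      push_cast
      rw [show i + ((n:ℤ) + 1) = i + n + 1 by ring]
      nlinarith
  have hM0 : 0 ≤ M := (h0 i).trans (hM i)
  have strict : M < v (i + N) - v i := by
    obtain ⟨n, hn⟩ : ∃ n : ℕ, N = n + 1 := by
      refine ⟨N - 1, ?_⟩
      have : 0 < N := Nat.ceil_pos.2 (by positivity)
      omega
    have b1 := a2 n (by omega)
    have b2 := a1 n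
    have b3 : (n:ℝ) * d ≤ 2 := by
      have : (n:ℝ) * d ≤ N * d := by gcongr; exact_mod_cast (by omega : n ≤ N)
      linarith
    have b4 : (n:ℝ) * (K * d ^ 2) ≤ 2 * K * d := by
      have := mul_le_mul_of_nonneg_right b3 (show 0 ≤ K * d by positivity)
      nlinarith
    have b5 : M * 1 ≤ M * (N * d) := by gcongr
    rw [hn] at b5 ⊢
    push_cast at b5 ⊢
    rw [show i + ((n:ℤ) + 1) = i + n + 1 by ring]
    nlinarith
  linarith [h0 i, hM (i + N)]

namespace LatSol

variable {ℓ M : ℝ} (L : LatSol ℓ M)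

theorem lip_right (h1 : L.dx ≤ 1) (k : ℕ) (i : ℤ) :
    L.u k (i + 1) - L.u k i ≤ (M + 2 * M ^ 2) * L.dx :=
  discrete_lip L.dx_pos h1 (sq_nonneg M) (L.u_nonneg k) (L.u_le k)
    (fun i => L.second_diff_ge k i) i

theorem lip_left (h1 : L.dx ≤ 1) (k : ℕ) (i : ℤ) :
    L.u k i - L.u k (i + 1) ≤ (M + 2 * M ^ 2) * L.dx := by
  have := discrete_lip (v := fun i => L.u k (-i)) L.dx_pos h1 (sq_nonneg M)
    (fun i => L.u_nonneg k _) (fun i => L.u_le k _)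
    (fun i => by
      have := L.second_diff_ge k (-i)
      rw [show -(i + 1) = -i - 1 by ring, show -(i - 1) = -i + 1 by ring]
      linarith) (-(i + 1))
  simpa using this

theorem lip (h1 : L.dx ≤ 1) (k : ℕ) (i j : ℤ) :
    |L.u k i - L.u k j| ≤ (M + 2 * M ^ 2) * |L.x i - L.x j| := by
  have C0 : 0 ≤ M + 2 * M ^ 2 := by have := L.M_nonneg; positivity
  wlog hij : i ≤ j generalizing i j
  · rw [abs_sub_comm, abs_sub_comm (L.x i)]; exact this j i (by omega)
  obtain ⟨n, rfl⟩ : ∃ n : ℕ, j = i + n := ⟨(j - i).toNat, by omega⟩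
  have e : |L.x i - L.x (i + n)| = n * L.dx := by
    rw [L.x_add, sub_add_cancel_left, abs_neg, abs_of_nonneg]
    · simp
    · have := L.dx_pos; positivity
  rw [e]
  clear hij e
  induction n with
  | zero => simp
  | succ n ih =>
    have a1 := L.lip_left h1 k (i + n)
    have a2 := L.lip_right h1 k (i + n)
    rw [abs_le] at ih ⊢
    push_cast
    rw [show i + ((n:ℤ) + 1) = i + n + 1 by ring]
    constructor <;> nlinarith

/-- Beyond an inactive site the temperature vanishes and to its left it is controlled by distance. -/
theorem u_le_dist (h1 : L.dx ≤ 1) {k : ℕ} {j : ℤ} (h : L.E k j < ℓ) (i : ℤ) :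
    L.u k i ≤ (M + 2 * M ^ 2) * |L.x i - L.x j| := by
  have := (abs_le.1 (L.lip h1 k i j)).2
  rw [L.u_eq_zero h] at this
  linarith

/-- The front moves at most one site in `r` steps. -/
theorem front_step (hℓ : 0 < ℓ) (h1 : L.dx ≤ 1) {r : ℕ}
    (hr : r * L.dt * (M + 2 * M ^ 2) < ℓ * L.dx) {k : ℕ} {i : ℤ} (h : L.E k i < ℓ) :
    L.E (k + r) (i + 1) < ℓ := by
  have C0 : 0 ≤ M + 2 * M ^ 2 := by have := L.M_nonneg; positivity
  have hdt := L.dt_pos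
  have hdx := L.dx_pos
  have key : ∀ n : ℕ, n ≤ r → L.E (k + n) (i + 1) * L.dx ≤ n * L.dt * (M + 2 * M ^ 2) := by
    intro n
    induction n with
    | zero => intro _; simp [L.front k i h]
    | succ n ih =>
      intro hn
      have b := ih (by omega)
      have b2 : (n:ℝ) * L.dt * (M + 2 * M ^ 2) ≤ r * L.dt * (M + 2 * M ^ 2) := by
        gcongr; omega
      have b3 : L.E (k + n) (i + 1) < ℓ := lt_of_mul_lt_mul_right (b.trans_lt (b2.trans_lt hr)) hdx.le
      have b4 := L.step' (k + n) (i + 1)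
      have b5 : L.u (k + n) (i + 1 + 1) = 0 := L.u_eq_zero (by
        rw [L.front _ _ b3]; exact hℓ)
      rw [L.u_eq_zero b3, b5] at b4
      have b6 := L.lip_left h1 (k + n) i
      rw [L.u_eq_zero b3] at b6
      rw [show i + 1 - 1 = i by ring] at b4
      rw [show k + (n + 1) = k + n + 1 by ring, b4]
      have b7 : L.lam * L.u (k + n) i * L.dx ≤ L.dt * (M + 2 * M ^ 2) := by
        have : L.lam * L.u (k + n) i * L.dx ≤ L.lam * ((M + 2 * M ^ 2) * L.dx) * L.dx := by
          have := L.lam_pos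
          gcongr; linarith
        have e : L.lam * ((M + 2 * M ^ 2) * L.dx) * L.dx = (L.lam * L.dx ^ 2) * (M + 2 * M ^ 2) := by ring
        rw [e, L.lam_mul] at this
        exact this
      push_cast
      nlinarith
  exact lt_of_mul_lt_mul_right ((key r le_rfl).trans_lt hr) hdx.le

/-- Finite speed: inactive sites stay inactive ahead of a line of slope `4 (M + 2 M²) / ℓ`. -/
theorem front_speed (hℓ : 0 < ℓ) (h1 : L.dx ≤ 1)
    (hsmall : L.dx * (M + 2 * M ^ 2) ≤ ℓ) {k n : ℕ} {i j : ℤ} (h : L.E k i < ℓ)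
    (hj : 4 * (M + 2 * M ^ 2) / ℓ * (n * L.dt) + L.dx ≤ L.x j - L.x i) :
    L.E (k + n) j < ℓ := by
  have hdt := L.dt_pos
  have hdx := L.dx_pos
  set C := M + 2 * M ^ 2 with hC
  have C0 : 0 ≤ C := by have := L.M_nonneg; positivity
  have hji : ∃ q : ℕ, j = i + q := by
    refine ⟨(j - i).toNat, ?_⟩
    have : 0 < L.x j - L.x i := by
      have : 0 ≤ 4 * C / ℓ * (n * L.dt) := by positivity
      linarith
    have : 0 < ((j:ℝ) - i) * L.dx := by simp only [x] at this; linarith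
    have : 0 < (j:ℝ) - i := pos_of_mul_pos_left this hdx.le
    have : (i:ℝ) < j := by linarith
    have : i < j := by exact_mod_cast this
    omega
  obtain ⟨q, rfl⟩ := hji
  rw [L.x_add, add_sub_cancel_left] at hj
  rcases C0.eq_or_lt with hC0 | hC0
  · -- no motion at all
    have : ∀ q : ℕ, 0 < q → L.E (k + n) (i + q) < ℓ := by
      intro q hq
      have h2 := L.front_step hℓ h1 (r := n) (by rw [← hC, ← hC0]; simp; positivity) h
      rcases Nat.lt_or_ge 1 q with hq1 | hq1
      · rw [L.inactive_right hℓ h2 (j := i + q) (by omega)]; exact hℓ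
      · have : q = 1 := by omega
        subst this; simpa using h2
    apply this
    rcases Nat.eq_zero_or_pos q with rfl | h0
    · simp [← hC0] at hj; linarith
    · exact h0
  set r := ⌊ℓ * L.dx / (2 * C * L.dt)⌋₊ with hr
  have r1 : (r:ℝ) * L.dt * C < ℓ * L.dx := by
    have := Nat.floor_le (show 0 ≤ ℓ * L.dx / (2 * C * L.dt) by positivity)
    rw [le_div_iff₀ (by positivity)] at this
    have : 0 < ℓ * L.dx := by positivity
    nlinarith
  have r2 : ℓ * L.dx ≤ 4 * C * (r * L.dt) := by
    have := Nat.lt_floor_add_one (ℓ * L.dx / (2 * C * L.dt))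
    rw [div_lt_iff₀ (by positivity), ← hr] at this
    have h3 : C * (8 * L.dt) ≤ C * L.dx ^ 2 := by gcongr; exact L.cfl
    have h4 : L.dx * C * L.dx ≤ ℓ * L.dx := by gcongr
    nlinarith
  have iter : ∀ q : ℕ, L.E (k + q * r) (i + q) < ℓ := by
    intro q
    induction q with
    | zero => simpa using h
    | succ q ih =>
      have := L.front_step hℓ h1 (r := r) r1 ih
      push_cast
      rwa [show k + (q + 1) * r = k + q * r + r by ring, show i + ((q:ℤ) + 1) = i + q + 1 by ring]
  refine lt_of_le_of_lt (L.E_mono _ ?_) (iter q)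
  have e1 : 4 * C / ℓ * (n * L.dt) * ℓ = 4 * C * (n * L.dt) := by field_simp
  have e2 : 4 * C * (n * L.dt) ≤ q * L.dx * ℓ := by
    rw [← e1]
    have : 4 * C / ℓ * (n * L.dt) ≤ q * L.dx := by push_cast at hj; linarith
    gcongr
  have e3 : 4 * C * (n * L.dt) ≤ 4 * C * ((q * r) * L.dt) := by
    calc _ ≤ q * (ℓ * L.dx) := by linarith
      _ ≤ q * (4 * C * (r * L.dt)) := by gcongr
      _ = _ := by ring
  have e4 : (n:ℝ) * L.dt ≤ (q * r) * L.dt := le_of_mul_le_mul_left e3 (by positivity)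
  have e5 : (n:ℝ) ≤ q * r := le_of_mul_le_mul_right e4 hdt
  have : n ≤ q * r := by exact_mod_cast e5
  omega

end LatSol

/-- Initial datum on the half line `x ≤ 0`. -/
noncomputable def ini (m x : ℝ) : ℝ :=
  m / 2 * Real.sin (min (max (-x * Real.sqrt (m / 2)) 0) (Real.pi / 2))

theorem ini_arg_mem (y : ℝ) : min (max y 0) (Real.pi / 2) ∈ Icc 0 (Real.pi / 2) :=
  ⟨le_min (le_max_right _ _) (by positivity), min_le_right _ _⟩

theorem ini_nonneg {m : ℝ} (hm : 0 < m) (x : ℝ) : 0 ≤ ini m x := by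
  have h := ini_arg_mem (-x * Real.sqrt (m / 2))
  have := Real.sin_nonneg_of_nonneg_of_le_pi h.1 (by linarith [h.2, Real.pi_pos])
  unfold ini; positivity

theorem ini_le {m : ℝ} (hm : 0 < m) (x : ℝ) : ini m x ≤ m / 2 := by
  have := Real.sin_le_one (min (max (-x * Real.sqrt (m / 2)) 0) (Real.pi / 2))
  unfold ini; nlinarith

theorem ini_of_nonneg {m x : ℝ} (hx : 0 ≤ x) : ini m x = 0 := by
  have : -x * Real.sqrt (m / 2) ≤ 0 := by
    have := Real.sqrt_nonneg (m / 2); nlinarith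
  rw [ini, max_eq_right this, min_eq_left (by positivity)]; simp

theorem sin_ext_second_diff {r d : ℝ} (hd : 0 ≤ d) (hr : d ≤ r) :
    -(d ^ 2) * Real.sin (min (max r 0) (Real.pi / 2)) ≤
      Real.sin (min (max (r - d) 0) (Real.pi / 2)) - 2 * Real.sin (min (max r 0) (Real.pi / 2))
      + Real.sin (min (max (r + d) 0) (Real.pi / 2)) ∧
    Real.sin (min (max (r - d) 0) (Real.pi / 2)) - 2 * Real.sin (min (max r 0) (Real.pi / 2))
      + Real.sin (min (max (r + d) 0) (Real.pi / 2)) ≤ d ^ 2 / 2 := by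
  rw [max_eq_left (by linarith : 0 ≤ r), max_eq_left (by linarith : 0 ≤ r - d),
    max_eq_left (by linarith : 0 ≤ r + d)]
  have hge : ∀ y, Real.sin y ≤ Real.sin (min y (Real.pi / 2)) := by
    intro y
    rcases le_total y (Real.pi / 2) with h | h
    · rw [min_eq_left h]
    · rw [min_eq_right h, Real.sin_pi_div_two]; exact Real.sin_le_one y
  have hup : Real.sin (min (r + d) (Real.pi / 2)) ≤ Real.sin (r + d) + d ^ 2 / 2 ∨
      Real.pi / 2 < r := by
    rcases le_or_gt r (Real.pi / 2) with h | h
    · left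
      rcases le_total (r + d) (Real.pi / 2) with h2 | h2
      · rw [min_eq_left h2]; nlinarith
      · rw [min_eq_right h2, Real.sin_pi_div_two]
        have e : Real.sin (r + d) = Real.cos (r + d - Real.pi / 2) := by
          rw [Real.cos_sub_pi_div_two]
        rw [e]
        have := Real.one_sub_sq_div_two_le_cos (x := r + d - Real.pi / 2)
        have : (r + d - Real.pi / 2) ^ 2 ≤ d ^ 2 := by
          apply pow_le_pow_left₀ <;> linarith
        linarith
    · exact Or.inr h
  have hcos := Real.one_sub_sq_div_two_le_cos (x := d)
  have hcos1 := Real.cos_le_one d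
  have hid : Real.sin (r - d) + Real.sin (r + d) = 2 * Real.cos d * Real.sin r := by
    rw [Real.sin_sub, Real.sin_add]; ring
  rcases le_or_gt r (Real.pi / 2) with h | h
  · have hs : 0 ≤ Real.sin r := Real.sin_nonneg_of_nonneg_of_le_pi (by linarith) (by linarith [Real.pi_pos])
    rw [min_eq_left h, min_eq_left (by linarith : r - d ≤ Real.pi / 2)]
    constructor
    · have := hge (r + d); nlinarith
    · rcases hup with h1 | h1
      · nlinarith
      · linarith
  · rw [min_eq_right h.le, min_eq_right (by linarith : Real.pi / 2 ≤ r + d), Real.sin_pi_div_two]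
    constructor
    · rcases le_total (r - d) (Real.pi / 2) with h2 | h2
      · rw [min_eq_left h2]
        have e : Real.sin (r - d) = Real.cos (Real.pi / 2 - (r - d)) := by
          rw [Real.cos_pi_div_two_sub]
        have := Real.one_sub_sq_div_two_le_cos (x := Real.pi / 2 - (r - d))
        have h3 : (Real.pi / 2 - (r - d)) ^ 2 ≤ d ^ 2 := by
          apply pow_le_pow_left₀ <;> linarith
        rw [e]; nlinarith
      · rw [min_eq_right h2, Real.sin_pi_div_two]; nlinarith
    · have := Real.sin_le_one (min (r - d) (Real.pi / 2)); nlinarith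

theorem ini_second_diff {m x d : ℝ} (hm : 0 < m) (hd : 0 ≤ d) (hx : x ≤ -d) :
    -(m / 2) * d ^ 2 * ini m x ≤ ini m (x + d) - 2 * ini m x + ini m (x - d) ∧
    ini m (x + d) - 2 * ini m x + ini m (x - d) ≤ m ^ 2 * d ^ 2 := by
  set q := Real.sqrt (m / 2) with hq
  have hq2 : q ^ 2 = m / 2 := Real.sq_sqrt (by positivity)
  have hq0 : 0 ≤ q := Real.sqrt_nonneg _
  have h := sin_ext_second_diff (r := -x * q) (d := d * q) (by positivity)
    (by gcongr; linarith)
  have e1 : -x * q - d * q = -(x + d) * q := by ring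
  have e2 : -x * q + d * q = -(x - d) * q := by ring
  rw [e1, e2, mul_pow, hq2] at h
  have hm2 : 0 ≤ m / 2 := by positivity
  have h1 := mul_le_mul_of_nonneg_left h.1 hm2
  have h2 := mul_le_mul_of_nonneg_left h.2 hm2
  unfold ini
  constructor
  · linarith
  · have : 0 ≤ m ^ 2 * d ^ 2 := by positivity
    nlinarith

theorem exists_latSol {ℓ m M dx dt : ℝ} {g : ℝ → ℝ} (hℓ : 0 < ℓ) (hm : 0 < m)
    (hg : ∀ x, m ≤ g x) (hgM : ∀ x, g x ≤ M) (hdx : 0 < dx) (hdt : 0 < dt)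
    (cfl : 8 * dt ≤ dx ^ 2) (cflM : 4 * M * dt ≤ 1) :
    ∃ L : LatSol ℓ M, L.dx = dx ∧ L.dt = dt ∧ L.x0 = 0 ∧ L.t0 = 0 ∧
      (∀ i, L.coef i = g (L.x i)) ∧ (∀ i ≤ 0, L.E 0 i = ℓ + ini m (L.x i)) ∧
      ∀ i > 0, L.E 0 i = 0 := by
  have hM : 0 < M := hm.trans_le ((hg 0).trans (hgM 0))
  have hmM : m ≤ M := (hg 0).trans (hgM 0)
  set α : ℤ → ℝ := fun i => g (i * dx) with hα
  have hα0 : ∀ i, 0 ≤ α i := fun i => hm.le.trans (hg _)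
  set E0 : ℤ → ℝ := fun i => if i ≤ 0 then ℓ + ini m (i * dx) else 0 with hE0
  set E : ℕ → ℤ → ℝ := fun k => (latStep ℓ dx dt α)^[k] E0 with hE
  have hstep : ∀ k i, E (k + 1) i = latStep ℓ dx dt α (E k) i := fun k i => by
    simp only [hE, Function.iterate_succ_apply']
  have hE00 : E 0 = E0 := rfl
  have hini0 : ∀ i, temp ℓ (E0 i) = ini m (i * dx) := by
    intro i
    by_cases hi : i ≤ 0
    · simp only [hE0, if_pos hi]
      rw [temp_of_ge (by linarith [ini_nonneg hm (i * dx)])]; ring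
    · simp only [hE0, if_neg hi]
      have : (0:ℝ) ≤ i := by exact_mod_cast (by omega : 0 ≤ i)
      rw [temp_of_le hℓ.le, ini_of_nonneg (by positivity)]
  have hle : ∀ k i, E k i ≤ ℓ + M := by
    intro k
    induction k with
    | zero =>
      intro i
      rw [hE00]
      by_cases hi : i ≤ 0
      · simp only [hE0, if_pos hi]; linarith [ini_le hm (i * dx)]
      · simp only [hE0, if_neg hi]; linarith
    | succ k ih =>
      intro i
      rw [hstep]
      refine (latStep_mono hM.le hdx hdt cfl cflM hα0 ih (fun _ => le_rfl) i).trans ?_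
      have : temp ℓ (ℓ + M) = M := by rw [temp_of_ge (by linarith)]; ring
      simp only [latStep, this]
      have : dt * (M * (α i - M)) ≤ 0 := by
        have : α i - M ≤ 0 := by linarith [hgM (i * dx)]
        apply mul_nonpos_of_nonneg_of_nonpos hdt.le
        exact mul_nonpos_of_nonneg_of_nonpos hM.le this
      linarith
  have hnn : ∀ k i, 0 ≤ E k i := by
    intro k
    induction k with
    | zero =>
      intro i
      rw [hE00]
      by_cases hi : i ≤ 0
      · simp only [hE0, if_pos hi]; linarith [ini_nonneg hm (i * dx)]
      · simp only [hE0, if_neg hi]; exact le_rfl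
    | succ k ih =>
      intro i
      rw [hstep]
      refine le_trans ?_ (latStep_mono (E := fun _ => 0) hM.le hdx hdt cfl cflM hα0 ih (hle k) i)
      simp [latStep, temp_of_le hℓ.le]
  have hmono : ∀ k i, E k i ≤ E (k + 1) i := by
    intro k
    induction k with
    | zero =>
      intro i
      rw [hstep, hE00]
      unfold latStep
      rw [hini0, hini0, hini0]
      have hlam : 0 ≤ dt / dx ^ 2 := by positivity
      have i0 := ini_nonneg hm (i * dx)
      rcases lt_or_ge i 0 with hi | hi
      · have hx : (i:ℝ) * dx ≤ -dx := by
          have : (i:ℝ) ≤ -1 := by exact_mod_cast (by omega : i ≤ -1)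
          nlinarith
        have h1 := (ini_second_diff hm hdx.le hx).1
        push_cast
        rw [show ((i:ℝ) + 1) * dx = i * dx + dx by ring, show ((i:ℝ) - 1) * dx = i * dx - dx by ring]
        have h2 : dt / dx ^ 2 * (-(m / 2) * dx ^ 2 * ini m (i * dx)) ≤ dt / dx ^ 2 *
          (ini m (i * dx + dx) - 2 * ini m (i * dx) + ini m (i * dx - dx)) := by gcongr
        have h3 : dt / dx ^ 2 * (-(m / 2) * dx ^ 2 * ini m (i * dx)) = - (dt * (ini m (i * dx) * (m / 2))) := by
          field_simp
        have h4 : dt * (ini m (i * dx) * (m / 2)) ≤ dt * (ini m (i * dx) * (α i - ini m (i * dx))) := by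
          gcongr
          linarith [hg (i * dx), ini_le hm (i * dx)]
        linarith
      · have : (0:ℝ) ≤ i := by exact_mod_cast hi
        rw [ini_of_nonneg (show 0 ≤ (i:ℝ) * dx by positivity)]
        have h1 := ini_nonneg hm (((i + 1 : ℤ):ℝ) * dx)
        have h2 := ini_nonneg hm (((i - 1 : ℤ):ℝ) * dx)
        have : 0 ≤ dt / dx ^ 2 * (ini m (((i + 1 : ℤ):ℝ) * dx) - 2 * 0 + ini m (((i - 1 : ℤ):ℝ) * dx)) := by
          apply mul_nonneg hlam; linarith
        linarith
    | succ k ih =>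
      intro i
      rw [hstep k, hstep (k + 1)]
      exact latStep_mono hM.le hdx hdt cfl cflM hα0 ih (hle (k + 1)) i
  have hfront : ∀ k i, E k i < ℓ → E k (i + 1) = 0 := by
    intro k
    induction k with
    | zero =>
      intro i hi
      rw [hE00] at hi ⊢
      by_cases h0 : i ≤ 0
      · simp only [hE0, if_pos h0] at hi; linarith [ini_nonneg hm (i * dx)]
      · simp only [hE0]; rw [if_neg (by omega)]
    | succ k ih =>
      intro i hi
      have h0 : E k i < ℓ := (hmono k i).trans_lt hi
      have h1 := ih i h0
      have h2 := ih (i + 1) (by rw [h1]; exact hℓ)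
      rw [hstep, latStep, h1, h2, add_sub_cancel_right, temp_of_le h0.le, temp_of_le hℓ.le]
      simp
  refine ⟨⟨dx, dt, 0, 0, α, E, hdx, hdt, cfl, cflM, hα0, fun i => hgM _, hnn, hle, hmono, hfront,
    hstep⟩, rfl, rfl, rfl, rfl, fun i => by simp [LatSol.x, hα], fun i hi => ?_, fun i hi => ?_⟩
  · simp [LatSol.x, hE00, hE0, if_pos hi]
  · simp [hE00, hE0, if_neg (not_le.2 hi)]

namespace LatSol

variable {ℓ M : ℝ} (L : LatSol ℓ M)

theorem exists_front_le (hℓ : 0 < ℓ) (h1 : L.dx ≤ 1)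
    (hsmall : L.dx * (M + 2 * M ^ 2) ≤ ℓ) {k : ℕ} {i : ℤ} (h : L.E k i < ℓ) (n : ℕ) :
    ∃ j, i ≤ j ∧ L.E (k + n) j < ℓ ∧
      L.x j ≤ L.x i + 4 * (M + 2 * M ^ 2) / ℓ * (n * L.dt) + 2 * L.dx := by
  have hdx := L.dx_pos
  have hdt := L.dt_pos
  set s := 4 * (M + 2 * M ^ 2) / ℓ * (n * L.dt) with hs
  have hs0 : 0 ≤ s := by have := L.M_nonneg; positivity
  refine ⟨i + ⌈s / L.dx + 1⌉₊, by omega, L.front_speed hℓ h1 hsmall h ?_, ?_⟩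
  · rw [L.x_add, add_sub_cancel_left]
    have := Nat.le_ceil (s / L.dx + 1)
    have h2 : (s / L.dx + 1) * L.dx ≤ ⌈s / L.dx + 1⌉₊ * L.dx := by gcongr
    have e : (s / L.dx + 1) * L.dx = s + L.dx := by field_simp
    push_cast; linarith
  · rw [L.x_add]
    have := Nat.ceil_lt_add_one (show 0 ≤ s / L.dx + 1 by positivity)
    have h2 : (⌈s / L.dx + 1⌉₊ : ℝ) * L.dx ≤ (s / L.dx + 1 + 1) * L.dx := by gcongr
    have e : (s / L.dx + 1 + 1) * L.dx = s + 2 * L.dx := by field_simp; ring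
    push_cast; linarith

theorem u_ahead (hℓ : 0 < ℓ) (h1 : L.dx ≤ 1)
    (hsmall : L.dx * (M + 2 * M ^ 2) ≤ ℓ) {k : ℕ} {i : ℤ} (h : L.E k i < ℓ) (n : ℕ) {j : ℤ}
    (hj : i ≤ j + 1) : L.u (k + n) j ≤
      (M + 2 * M ^ 2) * (4 * (M + 2 * M ^ 2) / ℓ * (n * L.dt) + 3 * L.dx) := by
  obtain ⟨q, _, h2, h3⟩ := L.exists_front_le hℓ h1 hsmall h n
  have hdx := L.dx_pos
  have hdt := L.dt_pos
  have hM := L.M_nonneg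
  rcases lt_or_ge q j with hq | hq
  · rw [L.u_eq_zero (by rw [L.inactive_right hℓ h2 hq]; exact hℓ)]; positivity
  · refine (L.u_le_dist h1 h2 j).trans ?_
    have hx1 : L.x j ≤ L.x q := by
      have : (j:ℝ) ≤ q := by exact_mod_cast hq
      simp only [x]; gcongr
    have hx2 : L.x i ≤ L.x j + L.dx := by
      rw [← L.x_succ]
      have : (i:ℝ) ≤ (j + 1 : ℤ) := by exact_mod_cast hj
      simp only [x]; gcongr
    rw [abs_sub_comm, abs_of_nonneg (by linarith)]
    gcongr; linarith

theorem time_lip {m : ℝ} (hm : 0 < m) (hℓ : 0 < ℓ) (h1 : L.dx ≤ 1)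
    (hsmall : L.dx * (M + 2 * M ^ 2) ≤ ℓ) (hx0 : L.x0 = 0)
    (hE : ∀ i ≤ 0, L.E 0 i = ℓ + ini m (L.x i)) (hE' : ∀ i > 0, L.E 0 i = 0) {A : ℝ}
    (hA1 : m ^ 2 + M ^ 2 ≤ A)
    (hA2 : (M + 2 * M ^ 2) * (4 * (M + 2 * M ^ 2) / ℓ + 3) ≤ A) (k r : ℕ) (i : ℤ) :
    L.u (k + r) i - L.u k i ≤ A * (r * L.dt + L.dx) * (1 + M * L.dt) ^ k := by
  have hdx := L.dx_pos
  have hdt := L.dt_pos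
  have hM := L.M_nonneg
  have hlam := L.lam_pos
  have hlam8 := L.lam_le
  have hdtx : L.dt ≤ L.dx := by nlinarith [L.cfl]
  have hA0 : 0 ≤ A := le_trans (by positivity) hA1
  set C := M + 2 * M ^ 2 with hC
  have hC0 : 0 ≤ C := by positivity
  have hu0 : ∀ i, L.u 0 i = ini m (L.x i) := by
    intro i
    rcases le_or_gt i 0 with hi | hi
    · rw [u, hE i hi, temp_of_ge (by linarith [ini_nonneg hm (L.x i)])]; ring
    · rw [u, hE' i hi, temp_of_le hℓ.le, ini_of_nonneg]
      have : (0:ℝ) ≤ i := by exact_mod_cast hi.le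
      simp only [x, hx0]; positivity
  induction k generalizing i with
  | zero =>
    rw [pow_zero, mul_one, zero_add]
    have key : ∀ r : ℕ, ∀ i, L.u r i ≤ L.u 0 i + A * (r * L.dt + L.dx) := by
      intro r
      induction r with
      | zero => intro i; simp; positivity
      | succ r ih =>
        intro i
        rcases lt_or_ge i 0 with hi | hi
        · have hact : ℓ ≤ L.E r i := by
            refine le_trans ?_ (L.E_mono i (Nat.zero_le r))
            simp only
            rw [hE i hi.le]; linarith [ini_nonneg hm (L.x i)]
          rw [L.active_step hact]
          have f1 := L.react_le r i
          have f2 : L.dt * (L.u r i * (L.coef i - L.u r i)) ≤ L.dt * M ^ 2 := by gcongr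
          have hx : L.x i ≤ -L.dx := by
            have : (i:ℝ) ≤ -1 := by exact_mod_cast (by omega : i ≤ -1)
            simp only [x, hx0]; nlinarith
          have f3 := (ini_second_diff hm hdx.le hx).2
          have f4 : L.lam * (L.u 0 (i + 1) - 2 * L.u 0 i + L.u 0 (i - 1)) ≤ L.dt * m ^ 2 := by
            rw [hu0, hu0, hu0, ← L.lam_mul, L.x_succ,
              show L.x (i - 1) = L.x i - L.dx by simp only [x]; push_cast; ring]
            have := mul_le_mul_of_nonneg_left f3 hlam.le
            linarith
          have g1 := mul_le_mul_of_nonneg_left (ih (i + 1)) hlam.le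
          have g2 := mul_le_mul_of_nonneg_left (ih (i - 1)) hlam.le
          have g3 := mul_le_mul_of_nonneg_left (ih i) (show 0 ≤ 1 - 2 * L.lam by linarith)
          have g4 : L.dt * (m ^ 2 + M ^ 2) ≤ L.dt * A := by gcongr
          push_cast
          linarith
        · have h2 := L.u_ahead hℓ h1 hsmall (k := 0) (i := 1) (by rw [hE' 1 one_pos]; exact hℓ)
            (r + 1) (j := i) (by omega)
          rw [zero_add] at h2
          have h3 := L.u_nonneg 0 i
          refine h2.trans ?_
          have : C * (4 * C / ℓ * (((r + 1 : ℕ):ℝ) * L.dt) + 3 * L.dx) ≤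
            (C * (4 * C / ℓ + 3)) * (((r + 1 : ℕ):ℝ) * L.dt + L.dx) := by
            have a1 : 0 ≤ C * (4 * C / ℓ) * L.dx := by positivity
            have a2 : 0 ≤ C * 3 * (((r + 1 : ℕ):ℝ) * L.dt) := by positivity
            linarith
          have h4 := mul_le_mul_of_nonneg_right hA2 (show 0 ≤ ((r + 1 : ℕ):ℝ) * L.dt + L.dx by positivity)
          linarith
    linarith [key r i]
  | succ k ih =>
    set B := A * (r * L.dt + L.dx) * (1 + M * L.dt) ^ k with hB
    have hB0 : 0 ≤ B := by positivity
    have hB1 : A * (r * L.dt + L.dx) ≤ B := by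
      have : (1:ℝ) ≤ (1 + M * L.dt) ^ k := one_le_pow₀ (by nlinarith)
      have h0 : 0 ≤ A * (r * L.dt + L.dx) := by positivity
      rw [hB]; nlinarith
    rw [pow_succ, ← mul_assoc, ← hB]
    rcases le_or_gt ℓ (L.E k i) with h | h
    · have e1 := L.active_step h
      have e2 := L.active_step (h.trans (L.E_mono i (Nat.le_add_right k r)))
      rw [show k + 1 + r = k + r + 1 by ring, e1, e2]
      have g1 := mul_le_mul_of_nonneg_left (ih (i + 1)) hlam.le
      have g2 := mul_le_mul_of_nonneg_left (ih (i - 1)) hlam.le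
      have u1 := L.u_le k i
      have u2 := L.u_le (k + r) i
      have u3 := L.u_nonneg k i
      have u4 := L.u_nonneg (k + r) i
      have c1 := L.coef_nonneg i
      have c2 := L.coef_le i
      have w0 : 0 ≤ 1 - 2 * L.lam + L.dt * (L.coef i - L.u k i - L.u (k + r) i) := by
        have : L.dt * (-(2 * M)) ≤ L.dt * (L.coef i - L.u k i - L.u (k + r) i) := by
          gcongr; linarith
        nlinarith [L.cflM]
      have g3 := mul_le_mul_of_nonneg_left (ih i) w0
      have g4 : L.dt * (L.coef i - L.u k i - L.u (k + r) i) * B ≤ L.dt * M * B := by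
        gcongr; linarith
      nlinarith
    · have h2 := L.u_ahead hℓ h1 hsmall h (1 + r) (j := i) (by omega)
      rw [show k + (1 + r) = k + 1 + r by ring] at h2
      have h3 := L.u_nonneg (k + 1) i
      have h4 : C * (4 * C / ℓ * (((1 + r : ℕ):ℝ) * L.dt) + 3 * L.dx) ≤
          (C * (4 * C / ℓ + 3)) * (r * L.dt + L.dx) := by
        push_cast
        have a1 : C * (4 * C / ℓ) * L.dt ≤ C * (4 * C / ℓ) * L.dx := by gcongr
        have a2 : 0 ≤ C * 3 * ((r:ℝ) * L.dt) := by positivity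
        linarith
      have h5 := mul_le_mul_of_nonneg_right hA2 (show 0 ≤ (r:ℝ) * L.dt + L.dx by positivity)
      have h6 : 0 ≤ B * (M * L.dt) := by positivity
      linarith

end LatSol

theorem TendstoLocallyUniformly.pointwise {X : Type*} [PseudoMetricSpace X]
    {F : ℕ → X → ℝ} {f : X → ℝ} (h : TendstoLocallyUniformly F f atTop) (x : X) :
    Tendsto (fun n => F n x) atTop (𝓝 (f x)) := by
  rw [Metric.tendsto_atTop]
  intro ε hε
  obtain ⟨N, hN⟩ := TendstoLocallyUniformly.uniform_on_compact h (isCompact_singleton (x := x)) hε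
  exact ⟨N, fun n hn => by rw [Real.dist_eq]; exact hN n hn x rfl⟩

theorem floor_nat_bounds {t τ : ℝ} (ht : 0 ≤ t) (hτ : 0 < τ) :
    (⌊t / τ⌋₊ : ℝ) * τ ≤ t ∧ t < ⌊t / τ⌋₊ * τ + τ := by
  have h1 := Nat.floor_le (show 0 ≤ t / τ by positivity)
  have h2 := Nat.lt_floor_add_one (t / τ)
  rw [le_div_iff₀ hτ] at h1
  rw [div_lt_iff₀ hτ] at h2
  exact ⟨h1, by linarith⟩

theorem floor_int_bounds {x d : ℝ} (hd : 0 < d) :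
    (⌊x / d⌋ : ℝ) * d ≤ x ∧ x < ⌊x / d⌋ * d + d := by
  have h1 := Int.floor_le (x / d)
  have h2 := Int.lt_floor_add_one (x / d)
  rw [le_div_iff₀ hd] at h1
  rw [div_lt_iff₀ hd] at h2
  exact ⟨h1, by linarith⟩

/-- `(u, h)` is approximated on times `≥ b` by lattice solutions of arbitrarily fine mesh. -/
def Approx (ℓ M b : ℝ) (g : ℝ → ℝ) (u : ℝ → ℝ → ℝ) (h : ℝ → ℝ) : Prop :=
  ∀ R > (0 : ℝ), ∀ ε > (0 : ℝ), ∃ L : LatSol ℓ M, L.dx < ε ∧ L.t0 ≤ b ∧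
    ∀ k i, b ≤ L.t k → |L.t k| ≤ R → |L.x i| ≤ R →
      |L.u k i - u (L.x i) (L.t k)| ≤ ε ∧ |L.coef i - g (L.x i)| ≤ ε ∧
      (ℓ ≤ L.E k i → L.x i ≤ h (L.t k) + ε) ∧ (L.E k i < ℓ → h (L.t k) - ε ≤ L.x i)

/-- Solution of the initial value problem started from the profile `ini m`. -/
structure IVP (ℓ m M C : ℝ) (g : ℝ → ℝ) (u : ℝ → ℝ → ℝ) (h : ℝ → ℝ) : Prop where
  lipx : ∀ x y t, 0 ≤ t → |u x t - u y t| ≤ C * |x - y|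
  monot : ∀ x t s, 0 ≤ t → 0 ≤ s → u x t ≤ u x (t + s)
  lipt : ∀ x t s, 0 ≤ t → 0 ≤ s → u x (t + s) - u x t ≤ C * Real.exp (M * t) * s
  nonneg : ∀ x t, 0 ≤ t → 0 ≤ u x t
  le : ∀ x t, 0 ≤ t → u x t ≤ M
  zero : ∀ x t, 0 ≤ t → h t ≤ x → u x t = 0
  h0 : h 0 = 0
  h_mono : ∀ t s, 0 ≤ t → 0 ≤ s → h t ≤ h (t + s)
  h_lip : ∀ t s, 0 ≤ t → 0 ≤ s → h (t + s) - h t ≤ C * s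
  init : ∀ x, u x 0 = ini m x
  approx : Approx ℓ M 0 g u h

namespace LatSol

variable {ℓ M : ℝ} (L : LatSol ℓ M)

/-- Step-function interpolation of the lattice temperature. -/
noncomputable def samp (x t : ℝ) : ℝ := L.u ⌊t / L.dt⌋₊ ⌊x / L.dx⌋

theorem samp_lip (h1 : L.dx ≤ 1) (hx0 : L.x0 = 0) (x y t : ℝ) :
    |L.samp x t - L.samp y t| ≤ (M + 2 * M ^ 2) * (|x - y| + L.dx) := by
  have hM := L.M_nonneg
  refine (L.lip h1 _ _ _).trans ?_
  gcongr
  obtain ⟨a1, a2⟩ := floor_int_bounds (x := x) L.dx_pos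
  obtain ⟨b1, b2⟩ := floor_int_bounds (x := y) L.dx_pos
  simp only [LatSol.x, hx0]
  rw [abs_le]
  constructor <;> linarith [le_abs_self (x - y), neg_abs_le (x - y)]

theorem samp_mono (x : ℝ) {t s : ℝ} (hs : 0 ≤ s) : L.samp x t ≤ L.samp x (t + s) := by
  apply L.u_mono
  apply Nat.floor_mono
  have := L.dt_pos
  gcongr; linarith

theorem samp_time {m : ℝ} (hm : 0 < m) (hℓ : 0 < ℓ) (h1 : L.dx ≤ 1)
    (hsmall : L.dx * (M + 2 * M ^ 2) ≤ ℓ) (hx0 : L.x0 = 0)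
    (hE : ∀ i ≤ 0, L.E 0 i = ℓ + ini m (L.x i)) (hE' : ∀ i > 0, L.E 0 i = 0) {A : ℝ}
    (hA1 : m ^ 2 + M ^ 2 ≤ A)
    (hA2 : (M + 2 * M ^ 2) * (4 * (M + 2 * M ^ 2) / ℓ + 3) ≤ A) (x : ℝ) {t s : ℝ}
    (ht : 0 ≤ t) (hs : 0 ≤ s) :
    L.samp x (t + s) - L.samp x t ≤ A * (s + L.dt + L.dx) * Real.exp (M * t) := by
  have hdx := L.dx_pos
  have hdt := L.dt_pos
  have hM := L.M_nonneg
  have hA0 : 0 ≤ A := le_trans (by positivity) hA1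
  obtain ⟨a1, a2⟩ := floor_nat_bounds ht hdt
  obtain ⟨b1, b2⟩ := floor_nat_bounds (add_nonneg ht hs) hdt
  have hk : ⌊t / L.dt⌋₊ ≤ ⌊(t + s) / L.dt⌋₊ := by apply Nat.floor_mono; gcongr; linarith
  unfold samp
  set k := ⌊t / L.dt⌋₊
  obtain ⟨r, hr⟩ := Nat.exists_eq_add_of_le hk
  rw [hr] at b1 b2 ⊢
  push_cast at b1 b2
  refine (L.time_lip hm hℓ h1 hsmall hx0 hE hE' hA1 hA2 k r _).trans ?_
  have e1 : (1 + M * L.dt) ^ k ≤ Real.exp (M * t) := by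
    have : 1 + M * L.dt ≤ Real.exp (M * L.dt) := by linarith [Real.add_one_le_exp (M * L.dt)]
    calc (1 + M * L.dt) ^ k ≤ Real.exp (M * L.dt) ^ k := by gcongr
      _ = Real.exp (k * (M * L.dt)) := (Real.exp_nat_mul _ _).symm
      _ ≤ _ := by apply Real.exp_le_exp.2; nlinarith
  gcongr
  linarith

theorem exists_front (hℓ : 0 < ℓ) (hE : ∀ i ≤ 0, ℓ ≤ L.E 0 i) (hE' : ∀ i > 0, L.E 0 i = 0)
    (h1 : L.dx ≤ 1) (hsmall : L.dx * (M + 2 * M ^ 2) ≤ ℓ) (k : ℕ) :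
    ∃ j, ∀ i, L.E k i < ℓ ↔ j ≤ i := by
  obtain ⟨j0, _, hj0, _⟩ := L.exists_front_le hℓ h1 hsmall
    (k := 0) (i := 1) (by rw [hE' 1 (by norm_num)]; exact hℓ) k
  rw [zero_add] at hj0
  obtain ⟨j, hj, hj2⟩ := Int.exists_least_of_bdd (P := fun i => L.E k i < ℓ)
    ⟨0, fun z hz => by
      by_contra hc
      have := hE z (by omega)
      have := L.E_mono z (Nat.zero_le k)
      simp only at this
      linarith⟩ ⟨j0, hj0⟩
  refine ⟨j, fun i => ⟨hj2 i, fun hi => ?_⟩⟩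
  rcases hi.eq_or_lt with rfl | hi
  · exact hj
  · rw [L.inactive_right hℓ hj hi]; exact hℓ

end LatSol

set_option maxHeartbeats 1000000 in
theorem ivp_exists {ℓ m M : ℝ} (hℓ : 0 < ℓ) (hm : 0 < m) (hM : 0 < M) :
    ∃ C > 0, ∀ g : ℝ → ℝ, (∀ x, m ≤ g x) → (∀ x, g x ≤ M) →
      ∃ u h, IVP ℓ m M C g u h ∧ Continuous (fun p : ℝ × ℝ => u p.1 p.2) ∧ Continuous h := by
  set C0 := M + 2 * M ^ 2 with hC0
  have hC0p : 0 < C0 := by positivity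
  set C1 := 4 * C0 / ℓ with hC1
  have hC1p : 0 < C1 := by positivity
  set A := m ^ 2 + M ^ 2 + C0 * (C1 + 3) with hA
  have hAp : 0 < A := by positivity
  have hCA1 : C0 ≤ A + C0 + C1 := by linarith
  refine ⟨A + C0 + C1, by positivity, fun g hgm hgM => ?_⟩
  set c := min 1 (ℓ / C0) with hc
  have hcp : 0 < c := by positivity
  have hc1 : c ≤ 1 := min_le_left _ _
  have hc2 : c * C0 ≤ ℓ := by
    have := min_le_right 1 (ℓ / C0)
    rw [le_div_iff₀ hC0p] at this; exact this
  set D : ℕ → ℝ := fun n => c / (n + 1) with hD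
  have hDp : ∀ n, 0 < D n := fun n => by positivity
  have hDc : ∀ n, D n ≤ c := fun n => by
    simp only [hD]; apply div_le_self hcp.le; have : (0:ℝ) ≤ n := n.cast_nonneg; linarith
  have hD0 : Tendsto D atTop (𝓝 0) := by
    have := (tendsto_one_div_add_atTop_nhds_zero_nat (𝕜 := ℝ)).const_mul c
    simpa [hD, div_eq_mul_inv] using this
  set T : ℕ → ℝ := fun n => (D n) ^ 2 / (8 * (1 + M)) with hT
  have hTp : ∀ n, 0 < T n := fun n => by have := hDp n; positivity
  have hTD : ∀ n, 8 * T n ≤ D n ^ 2 := fun n => by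
    simp only [hT]
    have e : 8 * (D n ^ 2 / (8 * (1 + M))) = D n ^ 2 / (1 + M) := by field_simp
    rw [e]; exact div_le_self (by positivity) (by linarith)
  have hTM : ∀ n, 4 * M * T n ≤ 1 := fun n => by
    have h1 : D n ≤ 1 := (hDc n).trans hc1
    have := hDp n
    simp only [hT]
    rw [← mul_div_assoc, div_le_one (by positivity)]
    have : D n ^ 2 ≤ 1 := by nlinarith
    nlinarith
  choose L hLdx hLdt hLx0 hLt0 hLc hLE hLE' using fun n =>
    exists_latSol hℓ hm hgm hgM (hDp n) (hTp n) (hTD n) (hTM n)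
  have hT0 : Tendsto T atTop (𝓝 0) := by
    have h1 := (hD0.pow 2).div_const (8 * (1 + M))
    simpa using h1
  have hL1 : ∀ n, (L n).dx ≤ 1 := fun n => by rw [hLdx]; exact (hDc n).trans hc1
  have hLs : ∀ n, (L n).dx * C0 ≤ ℓ := fun n => by
    rw [hLdx]; exact (mul_le_mul_of_nonneg_right (hDc n) hC0p.le).trans hc2
  have hLE0 : ∀ n, ∀ i ≤ 0, ℓ ≤ (L n).E 0 i := fun n i hi => by
    rw [hLE n i hi]; linarith [ini_nonneg hm ((L n).x i)]
  choose J hJ using fun n k => (L n).exists_front hℓ (hLE0 n) (hLE' n) (hL1 n) (hLs n) k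
  have hslip : ∀ n x y t, |(L n).samp x t - (L n).samp y t| ≤ C0 * (|x - y| + D n) := fun n x y t => by
    rw [← hLdx]; exact (L n).samp_lip (hL1 n) (hLx0 n) x y t
  have hstime : ∀ n x t s, 0 ≤ t → 0 ≤ s → (L n).samp x (t + s) - (L n).samp x t
      ≤ A * (s + T n + D n) * Real.exp (M * t) := fun n x t s ht hs => by
    rw [← hLdx, ← hLdt]
    exact (L n).samp_time hm hℓ (hL1 n) (hLs n) (hLx0 n) (hLE n) (hLE' n)
      (by rw [hA]; linarith [show 0 < C0 * (C1 + 3) by positivity])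
      (by show C0 * (C1 + 3) ≤ A; rw [hA]; nlinarith [sq_nonneg m, sq_nonneg M]) x ht hs
  set F : ℕ → ℝ × ℝ → ℝ := fun n p => (L n).samp p.1 (max p.2 0) with hF
  have htime2 : ∀ n x t t', |(L n).samp x (max t 0) - (L n).samp x (max t' 0)|
      ≤ A * (|t - t'| + T n + D n) * Real.exp (M * (|t| + |t'|)) := by
    intro n x t t'
    wlog htt : t' ≤ t generalizing t t'
    · rw [abs_sub_comm, abs_sub_comm t, add_comm |t|]; exact this t' t (by linarith)
    have h1 : max t' 0 ≤ max t 0 := max_le_max htt le_rfl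
    have h2 := hstime n x (max t' 0) (max t 0 - max t' 0) (le_max_right _ _) (by linarith)
    have h3 := (L n).samp_mono x (t := max t' 0) (s := max t 0 - max t' 0) (by linarith)
    rw [add_sub_cancel] at h2 h3
    rw [abs_of_nonneg (by linarith)]
    refine h2.trans ?_
    have := hTp n
    have := hDp n
    have h4 : max t 0 - max t' 0 ≤ |t - t'| := (le_abs_self _).trans (abs_max_sub_max_le_abs _ _ _)
    have h5 : max t' 0 ≤ |t| + |t'| := max_le (by linarith [le_abs_self t', abs_nonneg t]) (by positivity)
    gcongr
  obtain ⟨φ, hφ, f, hf, hlim⟩ := exists_subseq_tendstoLocallyUniformly F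
    (fun p => ⟨M, fun n => by
      simp only [hF, LatSol.samp]
      rw [abs_of_nonneg ((L n).u_nonneg _ _)]; exact (L n).u_le _ _⟩)
    (by
      rintro ⟨x, t⟩ ε hε
      set X := Real.exp (M * (|t| + (|t| + 1))) with hX
      have hXp : 0 < X := Real.exp_pos _
      set q := ε / (C0 + A * X) / 4 with hq
      have hqp : 0 < q := by positivity
      have hqe : 4 * (q * (C0 + A * X)) = ε := by rw [hq]; field_simp
      obtain ⟨N1, hN1⟩ := eventually_atTop.1 (hD0.eventually_lt_const hqp)
      obtain ⟨N2, hN2⟩ := eventually_atTop.1 (hT0.eventually_lt_const hqp)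
      refine ⟨min q 1, by positivity, max N1 N2, fun n hn y hy => ?_⟩
      have hn1 := hN1 n (le_trans (le_max_left _ _) hn)
      have hn2 := hN2 n (le_trans (le_max_right _ _) hn)
      obtain ⟨y, s⟩ := y
      rw [Prod.dist_eq, max_lt_iff, Real.dist_eq, Real.dist_eq] at hy
      obtain ⟨hy1, hy2⟩ := hy
      simp only at hy1 hy2
      have hy1' := hy1.trans_le (min_le_left _ _)
      have hy2' := hy2.trans_le (min_le_left _ _)
      have hs1 : |s| ≤ |t| + 1 := by
        have := abs_sub_abs_le_abs_sub s t
        linarith [hy2.trans_le (min_le_right _ _)]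
      have e1 := hslip n y x (max s 0)
      have e2 := htime2 n x s t
      have hTn := hTp n
      have hDn := hDp n
      have e3 : A * (|s - t| + T n + D n) * Real.exp (M * (|s| + |t|)) ≤ A * (q + q + q) * X := by
        rw [hX]; gcongr A * (?_ + ?_ + ?_) * Real.exp (M * ?_); linarith
      have e4 : C0 * (|y - x| + D n) ≤ C0 * (q + q) := by gcongr
      have e5 : F n (y, s) - F n (x, t) = ((L n).samp y (max s 0) - (L n).samp x (max s 0))
        + ((L n).samp x (max s 0) - (L n).samp x (max t 0)) := by simp only [hF]; ring
      rw [e5]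
      refine (abs_add_le _ _).trans ?_
      have : 0 < q * C0 := by positivity
      have : 0 < q * (A * X) := by positivity
      nlinarith)
  set H : ℕ → ℝ → ℝ := fun n t => J n ⌊t / (L n).dt⌋₊ * D n with hH
  have hHmono : ∀ n, Monotone (H n) := by
    intro n a b hab
    have := hDp n
    have h1 : ⌊a / (L n).dt⌋₊ ≤ ⌊b / (L n).dt⌋₊ := by
      have := (L n).dt_pos
      apply Nat.floor_mono; gcongr
    have h2 : J n ⌊a / (L n).dt⌋₊ ≤ J n ⌊b / (L n).dt⌋₊ := by
      rw [← hJ n]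
      refine lt_of_le_of_lt ((L n).E_mono _ h1) ((hJ n _ _).2 le_rfl)
    simp only [hH]
    have h3 : (J n ⌊a / (L n).dt⌋₊ : ℝ) ≤ J n ⌊b / (L n).dt⌋₊ := by exact_mod_cast h2
    gcongr
  have hH00 : ∀ n, J n 0 = 1 := by
    intro n
    have h1 := hJ n 0
    apply le_antisymm
    · rw [← h1, hLE' n 1 (by norm_num)]; exact hℓ
    · by_contra hc
      have := (h1 0).2 (by omega)
      linarith [hLE0 n 0 le_rfl]
  have hHlip : ∀ n t s, 0 ≤ t → 0 ≤ s → H n (t + s) - H n t ≤ C1 * (s + T n) + 2 * D n := by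
    intro n t s ht hs
    have hdt := (L n).dt_pos
    obtain ⟨a1, a2⟩ := floor_nat_bounds ht hdt
    obtain ⟨b1, b2⟩ := floor_nat_bounds (add_nonneg ht hs) hdt
    have hk : ⌊t / (L n).dt⌋₊ ≤ ⌊(t + s) / (L n).dt⌋₊ := by apply Nat.floor_mono; gcongr; linarith
    simp only [hH]
    set k := ⌊t / (L n).dt⌋₊
    obtain ⟨r, hr⟩ := Nat.exists_eq_add_of_le hk
    rw [hr] at b1 b2 ⊢
    push_cast at b1 b2
    obtain ⟨j, _, hj2, hj3⟩ := (L n).exists_front_le hℓ (hL1 n) (hLs n) ((hJ n k _).2 le_rfl) r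
    rw [hJ] at hj2
    have h3 : (J n (k + r) : ℝ) ≤ j := by exact_mod_cast hj2
    simp only [LatSol.x, hLx0, hLdx] at hj3
    have h4 : (J n (k + r) : ℝ) * D n ≤ j * D n := by have := hDp n; gcongr
    have h5 : C1 * (r * (L n).dt) ≤ C1 * (s + T n) := by
      gcongr; rw [← hLdt]; linarith
    linarith
  obtain ⟨ψ, hψ, h, hh, hlimh⟩ := exists_subseq_tendstoLocallyUniformly (fun n => fun t => H (φ n) (max t 0))
    (fun t => ⟨2 + C1 * (|t| + 1) + 2, fun n => by
      have h1 := hHlip (φ n) 0 (max t 0) le_rfl (le_max_right _ _)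
      have h2 := hHmono (φ n) (le_max_right t 0)
      have h3 : H (φ n) 0 = D (φ n) := by simp [hH, hH00]
      rw [zero_add] at h1
      have h4 := (hDc (φ n)).trans hc1
      have h5 := hDp (φ n)
      have h6 := hTp (φ n)
      have h7 : T (φ n) ≤ 1 := by nlinarith [hTD (φ n)]
      have h8 : C1 * (max t 0 + T (φ n)) ≤ C1 * (|t| + 1) := by
        gcongr; exact max_le (le_abs_self _) (abs_nonneg _)
      rw [abs_of_nonneg (by linarith)]
      linarith⟩)
    (by
      intro t ε hε
      obtain ⟨q, hqp, hqe⟩ : ∃ q > 0, 4 * (q * (C1 + 1)) = ε :=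
        ⟨ε / (C1 + 1) / 4, by positivity, by field_simp⟩
      obtain ⟨N1, hN1⟩ := eventually_atTop.1 ((hD0.comp hφ.tendsto_atTop).eventually_lt_const hqp)
      obtain ⟨N2, hN2⟩ := eventually_atTop.1 ((hT0.comp hφ.tendsto_atTop).eventually_lt_const hqp)
      refine ⟨q, hqp, max N1 N2, fun n hn s hs => ?_⟩
      have hn1 := hN1 n (le_trans (le_max_left _ _) hn)
      have hn2 := hN2 n (le_trans (le_max_right _ _) hn)
      simp only [Function.comp] at hn1 hn2
      rw [Real.dist_eq] at hs
      have key : ∀ s t, t ≤ s → |s - t| < q → |H (φ n) (max s 0) - H (φ n) (max t 0)| ≤ C1 * (q + q) + 2 * q := by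
        intro s t hst hs
        have h1 : max t 0 ≤ max s 0 := max_le_max hst le_rfl
        have h2 := hHlip (φ n) (max t 0) (max s 0 - max t 0) (le_max_right _ _) (by linarith)
        rw [add_sub_cancel] at h2
        have h4 : max s 0 - max t 0 ≤ |s - t| := (le_abs_self _).trans (abs_max_sub_max_le_abs _ _ _)
        rw [abs_of_nonneg (by linarith [hHmono (φ n) h1])]
        refine h2.trans ?_
        gcongr; linarith
      have hfin : C1 * (q + q) + 2 * q ≤ ε := by
        nlinarith [mul_pos hqp hC1p]
      rcases le_total t s with hts | hts
      · exact (key s t hts hs).trans hfin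
      · rw [abs_sub_comm] at hs ⊢; exact (key t s hts hs).trans hfin)
  set θ : ℕ → ℕ := φ ∘ ψ with hθ
  have hθm : StrictMono θ := hφ.comp hψ
  have hDθ : Tendsto (fun n => D (θ n)) atTop (𝓝 0) := hD0.comp hθm.tendsto_atTop
  have hTθ : Tendsto (fun n => T (θ n)) atTop (𝓝 0) := hT0.comp hθm.tendsto_atTop
  have hlim2 : TendstoLocallyUniformly (fun n => F (θ n)) f atTop := by
    intro U hU x
    obtain ⟨t, ht, h1⟩ := hlim U hU x
    exact ⟨t, ht, hψ.tendsto_atTop.eventually h1⟩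
  have hpt : ∀ x t, 0 ≤ t → Tendsto (fun n => (L (θ n)).samp x t) atTop (𝓝 (f (x, t))) := by
    intro x t ht
    have := TendstoLocallyUniformly.pointwise hlim2 (x, t)
    simpa only [hF, max_eq_left ht] using this
  have hpth : ∀ t, 0 ≤ t → Tendsto (fun n => H (θ n) t) atTop (𝓝 (h t)) := by
    intro t ht
    have := TendstoLocallyUniformly.pointwise hlimh t
    simp only [max_eq_left ht] at this
    exact this
  have hh0 : h 0 = 0 := by
    refine tendsto_nhds_unique (hpth 0 le_rfl) ?_
    have : (fun n => H (θ n) 0) = fun n => D (θ n) := by funext n; simp [hH, hH00]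
    rw [this]; exact hDθ
  have hhl : ∀ t s, 0 ≤ t → 0 ≤ s → h (t + s) - h t ≤ C1 * s := by
    intro t s ht hs
    have l1 := (hpth (t + s) (by linarith)).sub (hpth t ht)
    have l2 : Tendsto (fun n => C1 * (s + T (θ n)) + 2 * D (θ n)) atTop (𝓝 (C1 * (s + 0) + 2 * 0)) :=
      ((hTθ.const_add s).const_mul C1).add (hDθ.const_mul 2)
    have := le_of_tendsto_of_tendsto' l1 l2 fun n => hHlip (θ n) t s ht hs
    linarith
  refine ⟨fun x t => f (x, t), h, ?_, by simpa using hf, hh⟩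
  constructor
  · intro x y t ht
    have l1 := ((hpt x t ht).sub (hpt y t ht)).abs
    have l2 : Tendsto (fun n => C0 * (|x - y| + D (θ n))) atTop (𝓝 (C0 * (|x - y| + 0))) :=
      (hDθ.const_add _).const_mul C0
    have := le_of_tendsto_of_tendsto' l1 l2 fun n => hslip (θ n) x y t
    rw [add_zero] at this
    exact this.trans (by gcongr)
  · intro x t s ht hs
    exact le_of_tendsto_of_tendsto' (hpt x t ht) (hpt x (t + s) (by linarith))
      fun n => (L (θ n)).samp_mono x hs
  · intro x t s ht hs
    have l1 := (hpt x (t + s) (by linarith)).sub (hpt x t ht)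
    have l2 : Tendsto (fun n => A * (s + T (θ n) + D (θ n)) * Real.exp (M * t)) atTop
        (𝓝 (A * (s + 0 + 0) * Real.exp (M * t))) :=
      (((hTθ.const_add s).add hDθ).const_mul A).mul_const _
    have := le_of_tendsto_of_tendsto' l1 l2 fun n => hstime (θ n) x t s ht hs
    have h2 : A * Real.exp (M * t) * s ≤ (A + C0 + C1) * Real.exp (M * t) * s := by
      gcongr; linarith
    linarith
  · intro x t ht
    exact ge_of_tendsto' (hpt x t ht) fun n => (L (θ n)).u_nonneg _ _
  · intro x t ht
    exact le_of_tendsto' (hpt x t ht) fun n => (L (θ n)).u_le _ _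
  · intro x t ht hx
    have l2 : Tendsto (fun n => C0 * (max (H (θ n) t - x) 0 + 2 * D (θ n))) atTop
        (𝓝 (C0 * (max (h t - x) 0 + 2 * 0))) :=
      ((((hpth t ht).sub_const x).max tendsto_const_nhds).add (hDθ.const_mul 2)).const_mul C0
    have := le_of_tendsto_of_tendsto' (hpt x t ht) l2 fun n => by
      set n := θ n
      have e1 := hslip n x (max x (H n t)) t
      have hz : (L n).samp (max x (H n t)) t = 0 := by
        apply (L n).u_eq_zero
        rw [hJ]
        apply Int.le_floor.2
        rw [le_div_iff₀ (L n).dx_pos, hLdx]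
        exact le_max_right _ _
      rw [hz, sub_zero] at e1
      have e2 : |x - max x (H n t)| = max (H n t - x) 0 := by
        rw [abs_sub_comm]
        rcases le_total x (H n t) with h1 | h1
        · rw [max_eq_right h1, max_eq_left (by linarith), abs_of_nonneg (by linarith)]
        · rw [max_eq_left h1, max_eq_right (by linarith)]; simp
      rw [e2] at e1
      refine (le_abs_self _).trans (e1.trans ?_)
      have := hDp n
      gcongr; linarith
    rw [max_eq_right (by linarith)] at this
    have h3 : 0 ≤ f (x, t) := ge_of_tendsto' (hpt x t ht) fun n => (L (θ n)).u_nonneg _ _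
    simp only [mul_zero, add_zero] at this
    exact le_antisymm this h3
  · exact hh0
  · intro t s ht hs
    exact le_of_tendsto_of_tendsto' (hpth t ht) (hpth (t + s) (by linarith))
      fun n => hHmono (θ n) (by linarith)
  · intro t s ht hs
    refine (hhl t s ht hs).trans ?_
    gcongr; linarith
  · intro x
    refine tendsto_nhds_unique (hpt x 0 le_rfl) ?_
    have hic : ∀ i n, (L n).u 0 i = ini m ((L n).x i) := by
      intro i n
      rcases le_or_gt i 0 with hi | hi
      · rw [LatSol.u, hLE n i hi, temp_of_ge (by linarith [ini_nonneg hm ((L n).x i)])]; ring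
      · rw [LatSol.u, hLE' n i hi, temp_of_le hℓ.le, ini_of_nonneg]
        have : (0:ℝ) ≤ i := by exact_mod_cast hi.le
        have := (L n).dx_pos
        simp only [LatSol.x, hLx0]; positivity
    have e : (fun n => (L (θ n)).samp x 0) = fun n => ini m ((L (θ n)).x ⌊x / (L (θ n)).dx⌋) := by
      funext n; simp only [LatSol.samp, zero_div, Nat.floor_zero, hic]
    rw [e]
    have hcont : Continuous (ini m) := by unfold ini; fun_prop
    apply (hcont.tendsto x).comp
    have l1 : Tendsto (fun n => x - D (θ n)) atTop (𝓝 x) := by simpa using hDθ.const_sub x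
    refine tendsto_of_tendsto_of_tendsto_of_le_of_le l1 tendsto_const_nhds ?_ ?_
    · intro n
      have := (floor_int_bounds (x := x) (L (θ n)).dx_pos).2
      simp only [LatSol.x, hLx0]
      rw [hLdx] at this ⊢; linarith
    · intro n
      have := (floor_int_bounds (x := x) (L (θ n)).dx_pos).1
      simp only [LatSol.x, hLx0]
      linarith
  · intro R hR ε hε
    obtain ⟨N1, hN1⟩ := eventually_atTop.1 (hDθ.eventually_lt_const hε)
    obtain ⟨N2, hN2⟩ := TendstoLocallyUniformly.uniform_on_compact hlim2
      (isCompact_Icc.prod isCompact_Icc : IsCompact (Icc (-R) R ×ˢ Icc (-R) R)) hε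
    obtain ⟨N3, hN3⟩ := TendstoLocallyUniformly.uniform_on_compact hlimh
      (isCompact_Icc : IsCompact (Icc (-R) R)) hε
    set n := max N1 (max N2 N3) with hn
    have hn1 := hN1 n (le_max_left _ _)
    have hn2 := hN2 n ((le_max_left _ _).trans (le_max_right _ _))
    have hn3 := hN3 n ((le_max_right _ _).trans (le_max_right _ _))
    refine ⟨L (θ n), by rw [hLdx]; exact hn1, (hLt0 _).le, fun k i hk hkR hiR => ?_⟩
    have hdt := (L (θ n)).dt_pos
    have hdx := (L (θ n)).dx_pos
    have hfl : ⌊(L (θ n)).t k / (L (θ n)).dt⌋₊ = k := by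
      simp only [LatSol.t, hLt0, zero_add]
      rw [mul_div_cancel_right₀ _ hdt.ne', Nat.floor_natCast]
    have hfi : ⌊(L (θ n)).x i / (L (θ n)).dx⌋ = i := by
      simp only [LatSol.x, hLx0, zero_add]
      rw [mul_div_cancel_right₀ _ hdx.ne', Int.floor_intCast]
    have e2 := hn2 ((L (θ n)).x i, (L (θ n)).t k) ⟨abs_le.1 hiR, abs_le.1 hkR⟩
    have e3 := hn3 ((L (θ n)).t k) (abs_le.1 hkR)
    simp only [hF, LatSol.samp, max_eq_left hk, hfl, hfi] at e2
    have e4 : H (φ (ψ n)) (max ((L (θ n)).t k) 0) = J (θ n) k * D (θ n) := by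
      rw [max_eq_left hk]; simp only [hH]
      rw [show φ (ψ n) = θ n from rfl, hfl]
    simp only [e4] at e3
    rw [abs_lt] at e3
    refine ⟨e2.le, by rw [hLc]; simp [hε.le], fun hact => ?_, fun hact => ?_⟩
    · have h1 : i ≤ J (θ n) k := by
        by_contra hc
        have := (hJ (θ n) k i).2 (by omega)
        linarith
      have h2 : (i:ℝ) * D (θ n) ≤ J (θ n) k * D (θ n) := by
        have : (i:ℝ) ≤ J (θ n) k := by exact_mod_cast h1
        have := hDp (θ n)
        gcongr
      simp only [LatSol.x, hLx0, hLdx]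
      linarith
    · have h1 := (hJ (θ n) k i).1 hact
      have h2 : J (θ n) k * D (θ n) ≤ (i:ℝ) * D (θ n) := by
        have : (J (θ n) k:ℝ) ≤ i := by exact_mod_cast h1
        have := hDp (θ n)
        gcongr
      simp only [LatSol.x, hLx0, hLdx]
      linarith

theorem le_of_forall_small {a B c ε0 : ℝ} (hε0 : 0 < ε0)
    (h : ∀ ε, 0 < ε → ε < ε0 → a ≤ B + c * ε) : a ≤ B := by
  have h1 : Tendsto (fun ε : ℝ => B + c * ε) (𝓝[>] 0) (𝓝 (B + c * 0)) :=
    Tendsto.mono_left (Continuous.tendsto (by fun_prop) 0) nhdsWithin_le_nhds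
  rw [mul_zero, add_zero] at h1
  refine ge_of_tendsto h1 ?_
  filter_upwards [Ioo_mem_nhdsGT hε0] with ε hε using h ε hε.1 hε.2

/-- Doubling of variables for the lattice heat equation. -/
theorem lattice_doubling {lam τ d Z F0 A1 A2 κ : ℝ} (hτ : 0 < τ) (hd : 0 < d) (hlam : 0 < lam)
    (hlam8 : lam ≤ 1 / 8) (hld : lam * d ^ 2 = τ) {z F : ℕ → ℤ → ℝ} {i0 : ℤ} {n N : ℕ}
    (hz : ∀ k ≤ N, ∀ i, |i - i0| ≤ n → |z k i| ≤ Z)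
    (hF : ∀ k < N, ∀ i, |i - i0| < n → |F k i| ≤ F0)
    (hstep : ∀ k < N, ∀ i, |i - i0| < n → z (k + 1) i = z k i
      + lam * (z k (i + 1) - 2 * z k i + z k (i - 1)) + τ * F k i)
    (hA1 : 2 * Z ≤ A1 * (n * d) ^ 2) (hA2 : 2 * Z ≤ A2 * (N * τ)) (hA10 : 0 ≤ A1) (hA20 : 0 ≤ A2)
    (hκ0 : 0 ≤ κ) (hκ : A2 + 4 * A1 + 2 * F0 ≤ 2 * κ) {i : ℤ} (hi : i0 ≤ i) (hin : i ≤ i0 + n) :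
    z N i - z N i0 ≤ (A1 + κ) * (n * d) * (d * (i - i0)) := by
  have key : ∀ k ≤ N, ∀ i j : ℤ, j ≤ i → |i - i0| ≤ n → |j - i0| ≤ n →
      z k i - z k j ≤ A1 * d ^ 2 * ((i - i0) ^ 2 + (j - i0) ^ 2) + A2 * ((N - k) * τ)
        + (κ * (n * d) * (d * (i - j)) - κ / 2 * (d * (i - j)) ^ 2) := by
    intro k
    have hpos : ∀ k ≤ N, ∀ i j : ℤ, j ≤ i → |i - i0| ≤ n → |j - i0| ≤ n →
        0 ≤ A2 * ((N - k : ℝ) * τ) ∧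
        0 ≤ κ * (n * d) * (d * ((i:ℝ) - j)) - κ / 2 * (d * (i - j)) ^ 2 := by
      intro k hk i j hij hi hj
      have hk' : (k:ℝ) ≤ N := by exact_mod_cast hk
      have hij' : (j:ℝ) ≤ i := by exact_mod_cast hij
      have h2 : i - j ≤ 2 * n := by rw [abs_le] at hi hj; omega
      have h2' : (i:ℝ) - j ≤ 2 * n := by exact_mod_cast h2
      refine ⟨mul_nonneg hA20 (mul_nonneg (by linarith) hτ.le), ?_⟩
      have e : κ * (n * d) * (d * ((i:ℝ) - j)) - κ / 2 * (d * (i - j)) ^ 2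
        = κ / 2 * d ^ 2 * (i - j) * (2 * n - (i - j)) := by ring
      rw [e]
      have : 0 ≤ (i:ℝ) - j := by linarith
      have : 0 ≤ 2 * n - ((i:ℝ) - j) := by linarith
      positivity
    have hedge : ∀ k ≤ N, ∀ i j : ℤ, j ≤ i → |i - i0| ≤ n → |j - i0| ≤ n →
        (|i - i0| = n ∨ |j - i0| = n) →
        z k i - z k j ≤ A1 * d ^ 2 * ((i - i0) ^ 2 + (j - i0) ^ 2) + A2 * ((N - k) * τ)
        + (κ * (n * d) * (d * (i - j)) - κ / 2 * (d * (i - j)) ^ 2) := by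
      intro k hk i j hij hi hj he
      obtain ⟨p1, p2⟩ := hpos k hk i j hij hi hj
      have b1 := (abs_le.1 (hz k hk i hi)).2
      have b2 := (abs_le.1 (hz k hk j hj)).1
      have hsq : (n:ℝ) ^ 2 ≤ ((i:ℝ) - i0) ^ 2 + ((j:ℝ) - i0) ^ 2 := by
        rcases he with he | he
        · have : ((i:ℝ) - i0) ^ 2 = (n:ℝ) ^ 2 := by
            rw [← sq_abs]; congr 1; exact_mod_cast he
          nlinarith [sq_nonneg ((j:ℝ) - i0)]
        · have : ((j:ℝ) - i0) ^ 2 = (n:ℝ) ^ 2 := by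
            rw [← sq_abs]; congr 1; exact_mod_cast he
          nlinarith [sq_nonneg ((i:ℝ) - i0)]
      have : A1 * (n * d) ^ 2 ≤ A1 * d ^ 2 * (((i:ℝ) - i0) ^ 2 + ((j:ℝ) - i0) ^ 2) := by
        have : A1 * (n * d) ^ 2 = A1 * d ^ 2 * n ^ 2 := by ring
        rw [this]; gcongr
      linarith
    induction k with
    | zero =>
      intro hk i j hij hi hj
      obtain ⟨p1, p2⟩ := hpos 0 hk i j hij hi hj
      have b1 := (abs_le.1 (hz 0 hk i hi)).2
      have b2 := (abs_le.1 (hz 0 hk j hj)).1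
      have : 0 ≤ A1 * d ^ 2 * (((i:ℝ) - i0) ^ 2 + ((j:ℝ) - i0) ^ 2) := by positivity
      push_cast at p1 ⊢
      rw [sub_zero] at p1 ⊢
      linarith
    | succ k ih =>
      intro hk i j hij hi hj
      have ih := ih (by omega)
      by_cases he : |i - i0| = n ∨ |j - i0| = n
      · exact hedge (k + 1) hk i j hij hi hj he
      push Not at he
      have hi' : |i - i0| < n := lt_of_le_of_ne hi he.1
      have hj' : |j - i0| < n := lt_of_le_of_ne hj he.2
      rcases hij.eq_or_lt with rfl | hlt
      · obtain ⟨p1, p2⟩ := hpos (k + 1) hk j j le_rfl hi hj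
        have : 0 ≤ A1 * d ^ 2 * (((j:ℝ) - i0) ^ 2 + ((j:ℝ) - i0) ^ 2) := by positivity
        linarith
      rw [abs_lt] at hi' hj'
      have q1 := ih i j hij hi hj
      have q2 := ih (i + 1) j (by omega) (by rw [abs_le]; omega) hj
      have q3 := ih (i - 1) j (by omega) (by rw [abs_le]; omega) hj
      have q4 := ih i (j + 1) (by omega) hi (by rw [abs_le]; omega)
      have q5 := ih i (j - 1) (by omega) hi (by rw [abs_le]; omega)
      have s1 := hstep k (by omega) i (by rw [abs_lt]; exact hi')
      have s2 := hstep k (by omega) j (by rw [abs_lt]; exact hj')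
      have f1 := (abs_le.1 (hF k (by omega) i (by rw [abs_lt]; exact hi'))).2
      have f2 := (abs_le.1 (hF k (by omega) j (by rw [abs_lt]; exact hj'))).1
      rw [s1, s2]
      push_cast at q2 q3 q4 q5 ⊢
      have m1 := mul_le_mul_of_nonneg_left q1 (show 0 ≤ 1 - 4 * lam by linarith)
      have m2 := mul_le_mul_of_nonneg_left q2 hlam.le
      have m3 := mul_le_mul_of_nonneg_left q3 hlam.le
      have m4 := mul_le_mul_of_nonneg_left q4 hlam.le
      have m5 := mul_le_mul_of_nonneg_left q5 hlam.le
      have m6 := mul_le_mul_of_nonneg_left (show F k i - F k j ≤ 2 * F0 by linarith) hτ.le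
      have m7 := mul_le_mul_of_nonneg_left hκ hτ.le
      have e : lam * d ^ 2 * (4 * A1 - 2 * κ) = τ * (4 * A1 - 2 * κ) := by rw [hld]
      linarith
  have := key N le_rfl i i0 hi (by rw [abs_le]; omega) (by simp)
  refine this.trans ?_
  have h1 : (0:ℝ) ≤ i - i0 := by have : (i0:ℝ) ≤ i := by exact_mod_cast hi
                                 linarith
  have h2 : (i:ℝ) - i0 ≤ n := by have : (i:ℝ) ≤ i0 + n := by exact_mod_cast hin
                                 linarith
  have e1 : A1 * d ^ 2 * ((i:ℝ) - i0) ^ 2 ≤ A1 * d ^ 2 * (n * (i - i0)) := by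
    rw [sq ((i:ℝ) - i0)]; gcongr
  have e2 : 0 ≤ κ / 2 * (d * ((i:ℝ) - i0)) ^ 2 := by positivity
  simp only [sub_self, zero_mul, mul_zero, add_zero]
  nlinarith

/-- Growth in time of a lattice solution near a point. -/
theorem lattice_time {lam τ d Z F0 A ε : ℝ} (hτ : 0 < τ) (hlam : 0 < lam)
    (hlam8 : lam ≤ 1 / 8) (hld : lam * d ^ 2 = τ) {z F : ℕ → ℤ → ℝ} {i0 : ℤ} {n N : ℕ}
    (hz : ∀ k ≤ N, ∀ i, |i - i0| ≤ n → |z k i| ≤ Z)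
    (hF : ∀ k < N, ∀ i, |i - i0| < n → F k i ≤ F0)
    (hstep : ∀ k < N, ∀ i, |i - i0| < n → z (k + 1) i = z k i
      + lam * (z k (i + 1) - 2 * z k i + z k (i - 1)) + τ * F k i)
    (hA : 2 * Z ≤ A * (n * d) ^ 2) (hA0 : 0 ≤ A) (hε : 0 ≤ ε) (hF0 : 0 ≤ F0)
    (h0 : ∀ i, |i - i0| ≤ n → z 0 i ≤ z 0 i0 + ε + A * (d * (i - i0)) ^ 2) :
    z N i0 ≤ z 0 i0 + ε + (2 * A + F0) * (N * τ) := by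
  have key : ∀ k ≤ N, ∀ i, |i - i0| ≤ n →
      z k i ≤ z 0 i0 + ε + A * (d * (i - i0)) ^ 2 + (2 * A + F0) * (k * τ) := by
    intro k
    induction k with
    | zero => intro _ i hi; simpa using h0 i hi
    | succ k ih =>
      intro hk i hi
      have ih := ih (by omega)
      rcases hi.eq_or_lt with he | hi'
      · have b1 := (abs_le.1 (hz (k + 1) hk i hi)).2
        have b2 := (abs_le.1 (hz 0 (by omega) i0 (by simp))).1
        have : ((i:ℝ) - i0) ^ 2 = (n:ℝ) ^ 2 := by
          rw [← sq_abs]; congr 1; exact_mod_cast he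
        have e : A * (d * ((i:ℝ) - i0)) ^ 2 = A * (n * d) ^ 2 := by
          rw [mul_pow, this]; ring
        rw [e]
        have : 0 ≤ (2 * A + F0) * ((k + 1 : ℕ) * τ) := by positivity
        linarith
      · have s1 := hstep k (by omega) i hi'
        have f1 := hF k (by omega) i hi'
        rw [abs_lt] at hi'
        have q1 := ih i hi
        have q2 := ih (i + 1) (by rw [abs_le]; omega)
        have q3 := ih (i - 1) (by rw [abs_le]; omega)
        rw [s1]
        push_cast at q2 q3 ⊢
        have m1 := mul_le_mul_of_nonneg_left q1 (show 0 ≤ 1 - 2 * lam by linarith)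
        have m2 := mul_le_mul_of_nonneg_left q2 hlam.le
        have m3 := mul_le_mul_of_nonneg_left q3 hlam.le
        have m6 := mul_le_mul_of_nonneg_left f1 hτ.le
        have e : lam * d ^ 2 * A = τ * A := by rw [hld]
        linarith
  have := key N le_rfl i0 (by simp)
  simpa using this

/-- Second differences at distance `n` from unit second differences. -/
theorem second_diff_sum {v : ℤ → ℝ} {c : ℝ} {i : ℤ} {n : ℕ}
    (h : ∀ j, |j - i| < n → c ≤ v (j + 1) - 2 * v j + v (j - 1)) :
    c * n ^ 2 ≤ v (i + n) + v (i - n) - 2 * v i := by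
  have key : ∀ k : ℕ, k ≤ n → c * k ^ 2 ≤ v (i + k) + v (i - k) - 2 * v i ∧
      (k < n → v (i + k) + v (i - k) - c * k ^ 2 ≤
        v (i + (k + 1 : ℕ)) + v (i - (k + 1 : ℕ)) - c * ((k + 1 : ℕ) : ℝ) ^ 2) := by
    intro k
    induction k with
    | zero =>
      intro _
      refine ⟨by simp only [Nat.cast_zero, add_zero, sub_zero]; linarith, fun h0 => ?_⟩
      have := h i (by simpa using h0)
      simp only [Nat.cast_zero, add_zero, sub_zero, zero_add, Nat.cast_one]
      linarith
    | succ k ih =>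
      intro hk
      obtain ⟨i1, i2⟩ := ih (by omega)
      have i2 := i2 (by omega)
      refine ⟨by linarith, fun hlt => ?_⟩
      have a1 := h (i + (k + 1 : ℕ)) (by rw [abs_lt]; omega)
      have a2 := h (i - (k + 1 : ℕ)) (by rw [abs_lt]; omega)
      rw [show i + ((k + 1 : ℕ) : ℤ) + 1 = i + (k + 1 + 1 : ℕ) by push_cast; ring,
        show i + ((k + 1 : ℕ) : ℤ) - 1 = i + k by push_cast; ring] at a1
      rw [show i - ((k + 1 : ℕ) : ℤ) + 1 = i - k by push_cast; ring,
        show i - ((k + 1 : ℕ) : ℤ) - 1 = i - (k + 1 + 1 : ℕ) by push_cast; ring] at a2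
      push_cast at i2 a1 a2 ⊢
      linarith
  exact (key n le_rfl).1

namespace LatSol
variable {ℓ M : ℝ} (L : LatSol ℓ M)

/-- Index of the space cell containing `y`. -/
noncomputable def ix (y : ℝ) : ℤ := ⌊(y - L.x0) / L.dx⌋
/-- Index of the time cell containing `t`. -/
noncomputable def kt (t : ℝ) : ℕ := ⌊(t - L.t0) / L.dt⌋₊

theorem ix_bounds (y : ℝ) : L.x (L.ix y) ≤ y ∧ y < L.x (L.ix y) + L.dx := by
  obtain ⟨h1, h2⟩ := floor_int_bounds (x := y - L.x0) L.dx_pos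
  simp only [x, ix]; constructor <;> linarith

theorem kt_bounds {t : ℝ} (ht : L.t0 ≤ t) : L.t (L.kt t) ≤ t ∧ t < L.t (L.kt t) + L.dt := by
  obtain ⟨h1, h2⟩ := floor_nat_bounds (t := t - L.t0) (by linarith) L.dt_pos
  simp only [LatSol.t, kt]; constructor <;> linarith

theorem ix_mono {y y' : ℝ} (h : y ≤ y') : L.ix y ≤ L.ix y' := by
  have := L.dx_pos
  apply Int.floor_mono; gcongr

theorem x_sub (i j : ℤ) : L.x i - L.x j = L.dx * (i - j) := by simp only [x]; ring
theorem dt_le (h1 : L.dx ≤ 1) : L.dt ≤ L.dx := by nlinarith [L.cfl, L.dx_pos]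

theorem diff_step {k r : ℕ} {i : ℤ} (h : ℓ ≤ L.E k i) :
    L.u (k + 1 + r) i - L.u (k + 1) i = (L.u (k + r) i - L.u k i)
      + L.lam * ((L.u (k + r) (i + 1) - L.u k (i + 1)) - 2 * (L.u (k + r) i - L.u k i)
        + (L.u (k + r) (i - 1) - L.u k (i - 1)))
      + L.dt * ((L.u (k + r) i - L.u k i) * (L.coef i - L.u (k + r) i - L.u k i)) := by
  have h1 := L.active_step h
  have h2 := L.active_step (h.trans (L.E_mono i (Nat.le_add_right k r)))
  rw [Nat.add_right_comm, h2, h1]; ring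

theorem diff_react_le (k r : ℕ) (i : ℤ) {Z : ℝ} (h : |L.u (k + r) i - L.u k i| ≤ Z) :
    |(L.u (k + r) i - L.u k i) * (L.coef i - L.u (k + r) i - L.u k i)| ≤ Z * (2 * M) := by
  rw [abs_mul]
  have h1 : |L.coef i - L.u (k + r) i - L.u k i| ≤ 2 * M := by
    have := L.u_nonneg k i
    have := L.u_nonneg (k + r) i
    have := L.u_le k i
    have := L.u_le (k + r) i
    have := L.coef_le i
    have := L.coef_nonneg i
    rw [abs_le]; constructor <;> linarith
  have := L.M_nonneg
  gcongr
  exact (abs_nonneg _).trans h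

end LatSol

/-- Lipschitz limits of lattice solutions on the time interval `[b, T]`. -/
structure Reg (ℓ M K b T : ℝ) (g : ℝ → ℝ) (u : ℝ → ℝ → ℝ) (h : ℝ → ℝ) : Prop where
  approx : Approx ℓ M b g u h
  lipx : ∀ x y t, b ≤ t → t ≤ T → |u x t - u y t| ≤ K * |x - y|
  lipt : ∀ x t s, b ≤ t → t ≤ T → b ≤ s → s ≤ T → |u x t - u x s| ≤ K * |t - s|
  liph : ∀ t s, b ≤ t → t ≤ T → b ≤ s → s ≤ T → |h t - h s| ≤ K * |t - s|
  h_mono : ∀ t s, b ≤ t → t ≤ s → s ≤ T → h t ≤ h s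
  gcont : Continuous g
  nonneg : ∀ x t, b ≤ t → t ≤ T → 0 ≤ u x t
  le : ∀ x t, b ≤ t → t ≤ T → u x t ≤ M
  zero : ∀ x t, b ≤ t → t ≤ T → h t ≤ x → u x t = 0
  K_pos : 0 < K
  M_pos : 0 < M
  ℓ_pos : 0 < ℓ

namespace Reg

variable {ℓ M K b T : ℝ} {g : ℝ → ℝ} {u : ℝ → ℝ → ℝ} {h : ℝ → ℝ}

theorem lip (R : Reg ℓ M K b T g u h) (x y t s : ℝ) (ht : b ≤ t) (htT : t ≤ T) (hs : b ≤ s)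
    (hsT : s ≤ T) : |u x t - u y s| ≤ K * (|x - y| + |t - s|) := by
  have h1 := R.lipx x y t ht htT
  have h2 := R.lipt y t s ht htT hs hsT
  calc |u x t - u y s| = |(u x t - u y t) + (u y t - u y s)| := by ring_nf
    _ ≤ _ := (abs_add_le _ _).trans (by linarith)

theorem window (R : Reg ℓ M K b T g u h) {x1 x2 t1 t2 : ℝ} (hb : b ≤ t1) (hT : t2 ≤ T)
    (hh : x2 < h t1) {ε : ℝ} (hε : 0 < ε) : ∃ L : LatSol ℓ M, L.dx < ε ∧ L.t0 ≤ b ∧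
      ∀ k i, t1 ≤ L.t k → L.t k ≤ t2 → x1 ≤ L.x i → L.x i ≤ x2 →
        |L.u k i - u (L.x i) (L.t k)| ≤ ε ∧ |L.coef i - g (L.x i)| ≤ ε ∧ ℓ ≤ L.E k i := by
  set δ := min ε ((h t1 - x2) / 2) with hδ
  have hδp : 0 < δ := lt_min hε (by linarith)
  have hδ1 : δ ≤ ε := min_le_left _ _
  have hδ2 : δ ≤ (h t1 - x2) / 2 := min_le_right _ _
  obtain ⟨L, hL1, hL2, hL3⟩ := R.approx (|x1| + |x2| + |t1| + |t2| + 1) (by positivity) δ hδp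
  refine ⟨L, hL1.trans_le hδ1, hL2, fun k i hk1 hk2 hi1 hi2 => ?_⟩
  obtain ⟨a1, a2, _, a4⟩ := hL3 k i (hb.trans hk1)
    (by rw [abs_le]; constructor <;> linarith [neg_abs_le t1, le_abs_self t2, abs_nonneg x1, abs_nonneg x2, abs_nonneg t1, abs_nonneg t2])
    (by rw [abs_le]; constructor <;> linarith [neg_abs_le x1, le_abs_self x2, abs_nonneg x1, abs_nonneg x2, abs_nonneg t1, abs_nonneg t2])
  refine ⟨a1.trans hδ1, a2.trans hδ1, ?_⟩
  by_contra hc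
  have := a4 (by linarith)
  have := R.h_mono t1 (L.t k) hb hk1 (hk2.trans hT)
  linarith

/-- Difference of the time increment and its lattice approximation. -/
theorem incr_close (R : Reg ℓ M K b T g u h) (L : LatSol ℓ M) {ε x t s : ℝ} {k r : ℕ} {i : ℤ}
    (h1 : |L.u k i - u (L.x i) (L.t k)| ≤ ε)
    (h2 : |L.u (k + r) i - u (L.x i) (L.t (k + r))| ≤ ε)
    (hx : |L.x i - x| ≤ ε) (ht : |L.t k - t| ≤ ε) (hs : |L.t (k + r) - (t + s)| ≤ 2 * ε)
    (hb1 : b ≤ t) (hs0 : 0 ≤ s) (hT1 : t + s ≤ T) (hb2 : b ≤ L.t k) (hT2 : L.t (k + r) ≤ T) :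
    |(L.u (k + r) i - L.u k i) - (u x (t + s) - u x t)| ≤ (2 + 5 * K) * ε := by
  have hr := L.t_add k r
  have hdt : 0 ≤ r * L.dt := mul_nonneg r.cast_nonneg L.dt_pos.le
  have e1 := R.lip (L.x i) x (L.t k) t hb2 (by linarith) hb1 (by linarith)
  have e2 := R.lip (L.x i) x (L.t (k + r)) (t + s) (by linarith) hT2 (by linarith) hT1
  have hK := R.K_pos
  have e3 : K * (|L.x i - x| + |L.t k - t|) ≤ K * (ε + ε) := by gcongr
  have e4 : K * (|L.x i - x| + |L.t (k + r) - (t + s)|) ≤ K * (ε + 2 * ε) := by gcongr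
  rw [abs_le] at *
  constructor <;> linarith

theorem diff_lip (R : Reg ℓ M K b T g u h) {x1 x2 t1 t2 : ℝ} (hb : b ≤ t1) (hT : t2 ≤ T)
    (hh : x2 < h t1) {ρ θ : ℝ} (hρ : 0 < ρ) (hθ : 0 < θ) : ∃ C > 0, ∀ s > 0, ∀ y y' t,
      x1 + ρ ≤ y → y ≤ x2 - ρ → x1 + ρ ≤ y' → y' ≤ x2 - ρ → |y - y'| ≤ ρ / 4 →
      t1 + θ ≤ t → t + s ≤ t2 →
      |(u y (t + s) - u y t) - (u y' (t + s) - u y' t)| ≤ C * s * |y - y'| := by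
  have hK := R.K_pos
  have hM := R.M_pos
  set a1 := 32 * (K + 1) / ρ ^ 2 with ha1
  set a2 := 8 * (K + 1) / θ with ha2
  set c := (a2 + 4 * a1 + 2 * ((K + 1) * (2 * M))) / 2 with hc
  have ha1p : 0 < a1 := by positivity
  have ha2p : 0 < a2 := by positivity
  have hcp : 0 < c := by positivity
  refine ⟨(a1 + c) * ρ, by positivity, ?_⟩
  intro s hs y y' t hy1 hy2 hy1' hy2' hyy ht hts
  wlog hle : y ≤ y' generalizing y y'
  · rw [abs_sub_comm, abs_sub_comm y]
    exact this y' y hy1' hy2' hy1 hy2 (by rwa [abs_sub_comm]) (by linarith)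
  refine le_of_forall_small (c := (a1 + c) * ρ * s + 2 * (2 + 5 * K))
    (show 0 < min (min 1 (ρ / 8)) (min (θ / 8) (s / 2)) by positivity) fun ε hε hε0 => ?_
  obtain ⟨hε1, hε2⟩ := lt_min_iff.1 hε0
  obtain ⟨hε3, hε4⟩ := lt_min_iff.1 hε1
  obtain ⟨hε5, hε6⟩ := lt_min_iff.1 hε2
  obtain ⟨L, hLd, hL0, hL⟩ := R.window (x1 := x1) hb hT hh hε
  have hd := L.dx_pos
  have hτ := L.dt_pos
  have hτd := L.dt_le (by linarith)
  obtain ⟨i1, i2⟩ := L.ix_bounds y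
  obtain ⟨j1, j2⟩ := L.ix_bounds y'
  have hij := L.ix_mono hle
  set i0 := L.ix y
  set i := L.ix y'
  obtain ⟨k1, k2⟩ := L.kt_bounds (t := t) (by linarith)
  set kk := L.kt t
  obtain ⟨r1, r2⟩ := floor_nat_bounds hs.le hτ
  set r := ⌊s / L.dt⌋₊
  obtain ⟨N1, N2⟩ := floor_nat_bounds (t := θ / 2) (by linarith) hτ
  set N := ⌊θ / 2 / L.dt⌋₊
  obtain ⟨n1, n2⟩ := floor_nat_bounds (t := ρ / 2) (by linarith) hd
  set n := ⌊ρ / 2 / L.dx⌋₊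
  have hNk : N ≤ kk := by
    have : (N:ℝ) * L.dt ≤ kk * L.dt := by
      have : L.t kk = L.t0 + kk * L.dt := rfl
      linarith
    exact_mod_cast le_of_mul_le_mul_right this hτ
  obtain ⟨k0, hk0⟩ := Nat.exists_eq_add_of_le' hNk
  have hxs : ∀ j : ℤ, |j - i0| ≤ n → x1 ≤ L.x j ∧ L.x j ≤ x2 := by
    intro j hj
    have hj' : |(j:ℝ) - i0| ≤ n := by exact_mod_cast hj
    have e := L.x_sub j i0
    have : |L.dx * ((j:ℝ) - i0)| ≤ n * L.dx := by
      rw [abs_mul, abs_of_pos hd, mul_comm]; gcongr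
    rw [← e, abs_le] at this
    constructor <;> linarith
  have htk : ∀ k : ℕ, k ≤ N → t1 ≤ L.t (k0 + k) ∧ L.t (k0 + k) ≤ t2 ∧ L.t (k0 + k + r) ≤ t2 ∧
      t1 ≤ L.t (k0 + k + r) := by
    intro k hk
    have e0 : L.t (k0 + k) = L.t kk - (N - k) * L.dt := by
      rw [hk0, L.t_add, L.t_add]; ring
    have e2 : (0:ℝ) ≤ (N - k) * L.dt := by
      have : (k:ℝ) ≤ N := by exact_mod_cast hk
      exact mul_nonneg (by linarith) hτ.le
    have e3 : (N - k : ℝ) * L.dt ≤ N * L.dt := by gcongr; simp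
    have e1 := L.t_add (k0 + k) r
    have e4 : 0 ≤ r * L.dt := by positivity
    refine ⟨?_, ?_, ?_, ?_⟩ <;> linarith
  have hnode : ∀ k ≤ N, ∀ j, |j - i0| ≤ n → |L.u (k0 + k + r) j - L.u (k0 + k) j| ≤ (K + 1) * s := by
    intro k hk j hj
    obtain ⟨q1, q2⟩ := hxs j hj
    obtain ⟨p1, p2, p3, p4⟩ := htk k hk
    have e1 := (hL _ j p1 p2 q1 q2).1
    have e2 := (hL _ j p4 p3 q1 q2).1
    have e3 := R.lipt (L.x j) (L.t (k0 + k + r)) (L.t (k0 + k)) (by linarith) (by linarith) (by linarith) (by linarith)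
    rw [L.t_add (k0 + k) r, add_sub_cancel_left, abs_of_nonneg (show 0 ≤ r * L.dt by positivity),
      ← L.t_add (k0 + k) r] at e3
    have e4 : K * (r * L.dt) ≤ K * s := by gcongr
    rw [abs_le] at *
    constructor <;> linarith
  have hin : i ≤ i0 + n := by
    have e := L.x_sub i i0
    have h1 : L.dx * ((i:ℝ) - i0) < L.dx * (n + 1) := by
      rw [← e]
      have := (abs_le.1 hyy).1
      linarith
    have h2 := lt_of_mul_lt_mul_left h1 hd.le
    have h3 : i - i0 < n + 1 := by exact_mod_cast h2
    omega
  have key : ∀ σ : ℝ, (σ = 1 ∨ σ = -1) → σ * ((L.u (kk + r) i - L.u kk i) - (L.u (kk + r) i0 - L.u kk i0))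
      ≤ (a1 + c) * ρ * s * (|y - y'| + L.dx) := by
    intro σ hσ
    have hσ1 : |σ| = 1 := by rcases hσ with rfl | rfl <;> simp
    have := lattice_doubling (lam := L.lam) (τ := L.dt) (d := L.dx) (Z := (K + 1) * s)
      (F0 := (K + 1) * s * (2 * M))
      (A1 := a1 * s) (A2 := a2 * s) (κ := c * s) (i0 := i0) (n := n) (N := N) (i := i)
      (z := fun k j => σ * (L.u (k0 + k + r) j - L.u (k0 + k) j))
      (F := fun k j => σ * ((L.u (k0 + k + r) j - L.u (k0 + k) j) * (L.coef j - L.u (k0 + k + r) j - L.u (k0 + k) j)))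
      hτ hd L.lam_pos L.lam_le L.lam_mul
      (fun k hk j hj => by rw [abs_mul, hσ1, one_mul]; exact hnode k hk j hj)
      (fun k hk j hj => by
        rw [abs_mul, hσ1, one_mul]
        exact L.diff_react_le _ _ _ (hnode k hk.le j hj.le))
      (fun k hk j hj => by
        obtain ⟨p1, p2, p3, p4⟩ := htk k hk.le
        obtain ⟨q1, q2⟩ := hxs j hj.le
        have := L.diff_step (r := r) (hL _ j p1 p2 q1 q2).2.2
        rw [← add_assoc k0 k 1, this]; ring)
      (by
        have e : (ρ / 4) ^ 2 ≤ (n * L.dx) ^ 2 := by gcongr; linarith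
        have : 2 * ((K + 1) * s) = a1 * s * (ρ / 4) ^ 2 := by rw [ha1]; field_simp; norm_num
        rw [this]; gcongr)
      (by
        have e : θ / 4 ≤ N * L.dt := by linarith
        have : 2 * ((K + 1) * s) = a2 * s * (θ / 4) := by rw [ha2]; field_simp; norm_num
        rw [this]; gcongr)
      (by positivity) (by positivity) (by positivity) (le_of_eq (by rw [hc]; ring)) hij hin
    rw [hk0]
    have e3 : L.dx * ((i:ℝ) - i0) ≤ |y - y'| + L.dx := by
      rw [← L.x_sub]; linarith [neg_abs_le (y - y')]
    have e4 : 0 ≤ L.dx * ((i:ℝ) - i0) := by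
      have : (i0:ℝ) ≤ i := by exact_mod_cast hij
      exact mul_nonneg hd.le (by linarith)
    calc _ = _ := by ring
      _ ≤ _ := this
      _ ≤ (a1 * s + c * s) * ρ * (|y - y'| + L.dx) := by gcongr; linarith
      _ = _ := by ring
  have key1 := key 1 (Or.inl rfl)
  have key2 := key (-1) (Or.inr rfl)
  have hclose : ∀ j x, x1 ≤ L.x j → L.x j ≤ x2 → |L.x j - x| ≤ ε →
      |(L.u (kk + r) j - L.u kk j) - (u x (t + s) - u x t)| ≤ (2 + 5 * K) * ε := by
    intro j x q1 q2 hx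
    obtain ⟨p1, p2, p3, p4⟩ := htk N le_rfl
    rw [← hk0] at p1 p2 p3 p4
    have := L.t_add kk r
    exact R.incr_close L (hL _ j p1 p2 q1 q2).1 (hL _ j p4 p3 q1 q2).1 hx
      (by rw [abs_le]; constructor <;> linarith) (by rw [abs_le]; constructor <;> linarith)
      (by linarith) hs.le (by linarith) (by linarith) (by linarith)
  have c1 := hclose i0 y (by linarith) (by linarith) (by rw [abs_le]; constructor <;> linarith)
  have c2 := hclose i y' (by linarith) (by linarith) (by rw [abs_le]; constructor <;> linarith)
  have e5 : (a1 + c) * ρ * s * (|y - y'| + L.dx) ≤ (a1 + c) * ρ * s * (|y - y'| + ε) := by gcongr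
  rw [abs_le] at c1 c2
  rw [abs_le]
  constructor <;> linarith

end Reg

namespace Reg

variable {ℓ M K b T : ℝ} {g : ℝ → ℝ} {u : ℝ → ℝ → ℝ} {h : ℝ → ℝ}

set_option maxHeartbeats 1000000 in
theorem diff_time (R : Reg ℓ M K b T g u h) {x1 x2 t1 t2 : ℝ} (hb : b ≤ t1) (hT : t2 ≤ T)
    (hh : x2 < h t1) {ρ θ ε1 : ℝ} (hρ : 0 < ρ) (hθ : 0 < θ) (hε1 : 0 < ε1) : ∃ δ > 0, ∀ s > 0,
      ∀ y t t', x1 + ρ ≤ y → y ≤ x2 - ρ → t1 + θ ≤ t → t ≤ t' → t' + s ≤ t2 → t' - t ≤ δ →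
      |(u y (t' + s) - u y t') - (u y (t + s) - u y t)| ≤ ε1 * s := by
  have hK := R.K_pos
  have hM := R.M_pos
  obtain ⟨C, hC, hCl⟩ := R.diff_lip (x1 := x1) hb hT hh (half_pos hρ) hθ
  obtain ⟨a, ha, ha1, ha2⟩ : ∃ a > 0, C ^ 2 / ε1 ≤ a ∧ 2 * (K + 1) ≤ a * (ρ / 32) ^ 2 := by
    refine ⟨C ^ 2 / ε1 + 2 * (K + 1) / (ρ / 32) ^ 2, by positivity, ?_, ?_⟩
    · have : 0 < 2 * (K + 1) / (ρ / 32) ^ 2 := by positivity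
      linarith
    · rw [add_mul, div_mul_cancel₀ _ (by positivity)]
      have : 0 < C ^ 2 / ε1 * (ρ / 32) ^ 2 := by positivity
      linarith
  obtain ⟨B, hB, hBe⟩ : ∃ B > 0, B = 2 * a + (K + 1) * (2 * M) := ⟨_, by positivity, rfl⟩
  refine ⟨ε1 / (4 * B), by positivity, ?_⟩
  intro s hs y t t' hy1 hy2 ht htt hts hδ
  refine le_of_forall_small (c := 4 * (2 + 5 * K) + B * s)
    (show 0 < min (min 1 (ρ / 32)) (min (θ / 8) (s / 2)) by positivity) fun ε hε hε0 => ?_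
  obtain ⟨q1, q2⟩ := lt_min_iff.1 hε0
  obtain ⟨hε3, hε4⟩ := lt_min_iff.1 q1
  obtain ⟨hε5, hε6⟩ := lt_min_iff.1 q2
  obtain ⟨L, hLd, hL0, hL⟩ := R.window (x1 := x1) hb hT hh hε
  have hd := L.dx_pos
  have hτ := L.dt_pos
  have hτd := L.dt_le (by linarith)
  obtain ⟨i1, i2⟩ := L.ix_bounds y
  generalize L.ix y = i0 at *
  obtain ⟨k1, k2⟩ := L.kt_bounds (t := t) (by linarith)
  obtain ⟨l1, l2⟩ := L.kt_bounds (t := t') (by linarith)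
  have hkl : L.kt t ≤ L.kt t' := by
    apply Nat.floor_mono; gcongr
  generalize L.kt t = kk at *
  generalize L.kt t' = kl at *
  obtain ⟨N, rfl⟩ := Nat.exists_eq_add_of_le hkl
  obtain ⟨r1, r2⟩ := floor_nat_bounds hs.le hτ
  generalize ⌊s / L.dt⌋₊ = r at *
  obtain ⟨n1, n2⟩ := floor_nat_bounds (t := ρ / 16) (by linarith) hd
  generalize ⌊ρ / 16 / L.dx⌋₊ = n at *
  have hxd : ∀ j : ℤ, |j - i0| ≤ n → |L.x j - L.x i0| ≤ ρ / 16 := by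
    intro j hj
    have hj' : |(j:ℝ) - i0| ≤ n := by exact_mod_cast hj
    rw [L.x_sub j i0, abs_mul, abs_of_pos hd, mul_comm]
    refine le_trans ?_ n1
    gcongr
  have hxs : ∀ j : ℤ, |j - i0| ≤ n → x1 + ρ / 2 ≤ L.x j ∧ L.x j ≤ x2 - ρ / 2 := by
    intro j hj
    have := abs_le.1 (hxd j hj)
    constructor <;> linarith
  have hNτ : N * L.dt ≤ t' - t + ε := by
    have := L.t_add kk N
    linarith
  have htk : ∀ k : ℕ, k ≤ N → t1 ≤ L.t (kk + k) ∧ L.t (kk + k) ≤ t2 ∧ L.t (kk + k + r) ≤ t2 ∧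
      t1 ≤ L.t (kk + k + r) := by
    intro k hk
    have e0 := L.t_add kk k
    have e1 := L.t_add kk N
    have e2 : k * L.dt ≤ N * L.dt := by
      have : (k:ℝ) ≤ N := by exact_mod_cast hk
      gcongr
    have e3 := L.t_add (kk + k) r
    have e4 : 0 ≤ r * L.dt := by positivity
    have e5 : 0 ≤ k * L.dt := by positivity
    refine ⟨?_, ?_, ?_, ?_⟩ <;> linarith
  have hnode : ∀ k ≤ N, ∀ j, |j - i0| ≤ n → |L.u (kk + k + r) j - L.u (kk + k) j| ≤ (K + 1) * s := by
    intro k hk j hj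
    obtain ⟨q1, q2⟩ := hxs j hj
    obtain ⟨p1, p2, p3, p4⟩ := htk k hk
    have e1 := (hL _ j p1 p2 (by linarith) (by linarith)).1
    have e2 := (hL _ j p4 p3 (by linarith) (by linarith)).1
    have e3 := R.lipt (L.x j) (L.t (kk + k + r)) (L.t (kk + k)) (by linarith) (by linarith) (by linarith) (by linarith)
    rw [L.t_add (kk + k) r, add_sub_cancel_left, abs_of_nonneg (show 0 ≤ r * L.dt by positivity),
      ← L.t_add (kk + k) r] at e3
    have e4 : K * (r * L.dt) ≤ K * s := by gcongr
    rw [abs_le] at *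
    constructor <;> linarith
  have hclose : ∀ k ≤ N, ∀ j x tt, |j - i0| ≤ n → |L.x j - x| ≤ ε → |L.t (kk + k) - tt| ≤ ε →
      t1 ≤ tt → tt + s ≤ t2 →
      |(L.u (kk + k + r) j - L.u (kk + k) j) - (u x (tt + s) - u x tt)| ≤ (2 + 5 * K) * ε := by
    intro k hk j x tt hj hx htt h1 h2
    obtain ⟨p1, p2, p3, p4⟩ := htk k hk
    obtain ⟨q1, q2⟩ := hxs j hj
    have := L.t_add (kk + k) r
    have htt' := abs_le.1 htt
    exact R.incr_close L (hL _ j p1 p2 (by linarith) (by linarith)).1 (hL _ j p4 p3 (by linarith) (by linarith)).1 hx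
      htt (by rw [abs_le]; constructor <;> linarith)
      (by linarith) hs.le (by linarith) (by linarith) (by linarith)
  have hk0 : |L.t (kk + 0) - t| ≤ ε := by rw [abs_le, add_zero]; constructor <;> linarith
  have hkN : |L.t (kk + N) - t'| ≤ ε := by rw [abs_le]; constructor <;> linarith
  have hi0 : |L.x i0 - y| ≤ ε := by rw [abs_le]; constructor <;> linarith
  have key : ∀ σ : ℝ, (σ = 1 ∨ σ = -1) →
      σ * (L.u (kk + N + r) i0 - L.u (kk + N) i0) ≤ σ * (L.u (kk + 0 + r) i0 - L.u (kk + 0) i0)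
      + (ε1 / 4 * s + 2 * (2 + 5 * K) * ε) + (2 * (a * s) + (K + 1) * s * (2 * M)) * (N * L.dt) := by
    intro σ hσ
    have hσ1 : |σ| = 1 := by rcases hσ with rfl | rfl <;> simp
    refine lattice_time (lam := L.lam) (τ := L.dt) (d := L.dx) (Z := (K + 1) * s)
      (F0 := (K + 1) * s * (2 * M)) (A := a * s) (i0 := i0) (n := n) (N := N)
      (z := fun k j => σ * (L.u (kk + k + r) j - L.u (kk + k) j))
      (F := fun k j => σ * ((L.u (kk + k + r) j - L.u (kk + k) j) * (L.coef j - L.u (kk + k + r) j - L.u (kk + k) j)))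
      hτ L.lam_pos L.lam_le L.lam_mul
      (fun k hk j hj => by rw [abs_mul, hσ1, one_mul]; exact hnode k hk j hj)
      (fun k hk j hj => by
        refine (le_abs_self _).trans ?_
        rw [abs_mul, hσ1, one_mul]
        exact L.diff_react_le _ _ _ (hnode k hk.le j hj.le))
      (fun k hk j hj => by
        obtain ⟨p1, p2, p3, p4⟩ := htk k hk.le
        obtain ⟨q1, q2⟩ := hxs j hj.le
        have := L.diff_step (r := r) (hL _ j p1 p2 (by linarith) (by linarith)).2.2
        rw [← add_assoc kk k 1, this]; ring)
      ?_ (by positivity) (by positivity) (by positivity) ?_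
    · have e : (ρ / 32) ^ 2 ≤ (n * L.dx) ^ 2 := by gcongr; linarith
      calc 2 * ((K + 1) * s) = (2 * (K + 1)) * s := by ring
        _ ≤ (a * (ρ / 32) ^ 2) * s := by gcongr
        _ = a * s * (ρ / 32) ^ 2 := by ring
        _ ≤ _ := by gcongr
    · intro j hj
      have c1 := hclose 0 (Nat.zero_le _) j (L.x j) t hj (by simpa using hε.le) hk0 (by linarith) (by linarith)
      have c2 := hclose 0 (Nat.zero_le _) i0 (L.x i0) t (by simp) (by simpa using hε.le) hk0 (by linarith) (by linarith)
      have hr := hxd j hj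
      obtain ⟨u1, u2⟩ := hxs j hj
      obtain ⟨v1, v2⟩ := hxs i0 (by simp)
      have c3 := hCl s hs (L.x j) (L.x i0) t u1 u2 v1 v2 (by linarith) ht (by linarith)
      rw [L.x_sub] at c3
      have e1 : C * |L.dx * ((j:ℝ) - i0)| ≤ ε1 / 4 + C ^ 2 / ε1 * (L.dx * ((j:ℝ) - i0)) ^ 2 := by
        rw [← sq_abs (L.dx * ((j:ℝ) - i0))]
        generalize |L.dx * ((j:ℝ) - i0)| = r
        have : ε1 / 4 + C ^ 2 / ε1 * r ^ 2 - C * r = (ε1 / 2 - C * r) ^ 2 / ε1 := by field_simp; ring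
        have : 0 ≤ (ε1 / 2 - C * r) ^ 2 / ε1 := by positivity
        linarith
      have e2 : C * s * |L.dx * ((j:ℝ) - i0)| ≤ ε1 / 4 * s + a * s * (L.dx * ((j:ℝ) - i0)) ^ 2 := by
        have e3 : C ^ 2 / ε1 * (L.dx * ((j:ℝ) - i0)) ^ 2 ≤ a * (L.dx * ((j:ℝ) - i0)) ^ 2 := by gcongr
        have := mul_le_mul_of_nonneg_right (e1.trans (by linarith : _ ≤ ε1 / 4 + a * (L.dx * ((j:ℝ) - i0)) ^ 2)) hs.le
        linarith
      rcases hσ with rfl | rfl <;> rw [abs_le] at c1 c2 c3 <;> linarith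
  have key1 := key 1 (Or.inl rfl)
  have key2 := key (-1) (Or.inr rfl)
  have c1 := hclose 0 (Nat.zero_le _) i0 y t (by simp) hi0 hk0 (by linarith) (by linarith)
  have c2 := hclose N le_rfl i0 y t' (by simp) hi0 hkN (by linarith) (by linarith)
  have e6 : (2 * (a * s) + (K + 1) * s * (2 * M)) * (N * L.dt) ≤ ε1 / 4 * s + B * s * ε := by
    have e7 : 2 * (a * s) + (K + 1) * s * (2 * M) = B * s := by rw [hBe]; ring
    rw [e7]
    have e8 : B * s * (N * L.dt) ≤ B * s * (ε1 / (4 * B) + ε) := by gcongr; linarith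
    have e9 : B * s * (ε1 / (4 * B)) = ε1 / 4 * s := by field_simp
    linarith
  have e10 : 0 < ε1 * s := by positivity
  have e11 : 0 < (2 + 5 * K) * ε := by positivity
  rw [abs_le] at c1 c2
  rw [abs_le]
  constructor <;> linarith

end Reg

theorem LatSol.sum_step {ℓ M : ℝ} (L : LatSol ℓ M) {k r : ℕ} {i : ℤ} (h : ∀ j < r, ℓ ≤ L.E (k + j) i) :
    L.u (k + r) i - L.u k i = L.lam * (∑ j ∈ Finset.range r, L.u (k + j) (i + 1)
      - 2 * ∑ j ∈ Finset.range r, L.u (k + j) i + ∑ j ∈ Finset.range r, L.u (k + j) (i - 1))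
      + L.dt * ∑ j ∈ Finset.range r, L.u (k + j) i * (L.coef i - L.u (k + j) i) := by
  induction r with
  | zero => simp
  | succ r ih =>
    have h1 := ih fun j hj => h j (by omega)
    have h2 := L.active_step (h r (by omega))
    simp only [Finset.sum_range_succ, ← add_assoc]
    linarith

namespace Reg

variable {ℓ M K b T : ℝ} {g : ℝ → ℝ} {u : ℝ → ℝ → ℝ} {h : ℝ → ℝ}

theorem react_close (R : Reg ℓ M K b T g u h) (L : LatSol ℓ M) {ε x t : ℝ} {k : ℕ} {i : ℤ}
    (h1 : |L.u k i - u x t| ≤ ε) (h2 : |L.coef i - g x| ≤ ε) (hb : b ≤ t) (hT : t ≤ T) :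
    |L.u k i * (L.coef i - L.u k i) - u x t * (g x - u x t)| ≤ 3 * M * ε := by
  have e : L.u k i * (L.coef i - L.u k i) - u x t * (g x - u x t)
      = (L.u k i - u x t) * (L.coef i - L.u k i - u x t) + u x t * (L.coef i - g x) := by ring
  have a1 := L.u_nonneg k i
  have a2 := L.u_le k i
  have a3 := L.coef_le i
  have a4 := L.coef_nonneg i
  have a5 := R.nonneg x t hb hT
  have a6 := R.le x t hb hT
  rw [e]
  refine (abs_add_le _ _).trans ?_
  rw [abs_mul, abs_mul, abs_of_nonneg a5]
  have e1 : |L.coef i - L.u k i - u x t| ≤ 2 * M := by rw [abs_le]; constructor <;> linarith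
  have e2 : 0 ≤ ε := (abs_nonneg _).trans h1
  have hM := R.M_pos
  calc _ ≤ ε * (2 * M) + M * ε := by gcongr
    _ = _ := by ring

set_option maxHeartbeats 1000000 in
theorem second_diff (R : Reg ℓ M K b T g u h) {y t ρ θ σ A1 A2 : ℝ} (hb : b < t) (hT : t + θ ≤ T)
    (hθ : 0 < θ) (hρ : 0 < ρ) (hh : y + 2 * ρ < h (t - θ)) (hbθ : b ≤ t - θ) (hσ : σ = 1 ∨ σ = -1)
    (h1 : ∀ z, |z - y| ≤ 2 * ρ → θ * A1 ≤ σ * (u z (t + θ) - u z t))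
    (h2 : ∀ z s, |z - y| ≤ 2 * ρ → |s - t| ≤ θ → σ * (u z s * (g z - u z s)) ≤ A2) :
    ρ ^ 2 * (A1 - A2) ≤ σ * (u (y + ρ) t + u (y - ρ) t - 2 * u y t) + 4 * K * θ := by
  have hK := R.K_pos
  have hM := R.M_pos
  have hσ1 : |σ| = 1 := by rcases hσ with rfl | rfl <;> simp
  suffices H : θ * (ρ ^ 2 * (A1 - A2)) ≤ θ * (σ * (u (y + ρ) t + u (y - ρ) t - 2 * u y t) + 4 * K * θ) from
    le_of_mul_le_mul_left H hθ
  obtain ⟨C1, hC1, hC1e⟩ : ∃ C1 > 0, C1 = 2 + 5 * K + |A2| + θ * (3 * M) := ⟨_, by positivity, rfl⟩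
  refine le_of_forall_small (c := 4 * (θ * (1 + 3 * K) + M) + (θ * |A1 - A2| + C1) * (2 * ρ) + ρ ^ 2 * C1)
    (show 0 < min 1 (min (ρ / 4) (θ / 4)) by positivity) fun ε hε hε0 => ?_
  obtain ⟨hε1, q2⟩ := lt_min_iff.1 hε0
  obtain ⟨hε2, hε3⟩ := lt_min_iff.1 q2
  obtain ⟨L, hLd, hL0, hL⟩ := R.window (x1 := y - 2 * ρ) hbθ hT hh hε
  have hd := L.dx_pos
  have hτ := L.dt_pos
  have hτd := L.dt_le (by linarith)
  obtain ⟨i1, i2⟩ := L.ix_bounds y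
  generalize L.ix y = i at *
  obtain ⟨k1, k2⟩ := L.kt_bounds (t := t) (by linarith)
  generalize L.kt t = k at *
  obtain ⟨r1, r2⟩ := floor_nat_bounds hθ.le hτ
  generalize ⌊θ / L.dt⌋₊ = r at *
  obtain ⟨n1, n2⟩ := floor_nat_bounds hρ.le hd
  generalize ⌊ρ / L.dx⌋₊ = n at *
  have hxs : ∀ j : ℤ, |j - i| ≤ n → |L.x j - y| ≤ 2 * ρ := by
    intro j hj
    have hj' : |(j:ℝ) - i| ≤ n := by exact_mod_cast hj
    have : |L.x j - L.x i| ≤ ρ := by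
      rw [L.x_sub j i, abs_mul, abs_of_pos hd, mul_comm]
      refine le_trans ?_ n1
      gcongr
    rw [abs_le] at *
    constructor <;> linarith
  have hts : ∀ j ≤ r, |L.t (k + j) - t| ≤ θ ∧ t - ε ≤ L.t (k + j) ∧ L.t (k + j) ≤ t + θ ∧ |L.t (k + j) - t| ≤ θ + ε := by
    intro j hj
    have e0 := L.t_add k j
    have e1 : j * L.dt ≤ r * L.dt := by
      have : (j:ℝ) ≤ r := by exact_mod_cast hj
      gcongr
    have e2 : 0 ≤ j * L.dt := by positivity
    refine ⟨by rw [abs_le]; constructor <;> linarith, by linarith, by linarith, by rw [abs_le]; constructor <;> linarith⟩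
  have hbox : ∀ j ≤ r, ∀ q : ℤ, |q - i| ≤ n → |L.u (k + j) q - u (L.x q) (L.t (k + j))| ≤ ε ∧
      |L.coef q - g (L.x q)| ≤ ε ∧ ℓ ≤ L.E (k + j) q := by
    intro j hj q hq
    obtain ⟨p1, p2, p3, p4⟩ := hts j hj
    have := abs_le.1 (hxs q hq)
    exact hL _ _ (by linarith) (by linarith) (by linarith) (by linarith)
  set U : ℤ → ℝ := fun q => ∑ j ∈ Finset.range r, L.u (k + j) q with hU
  obtain ⟨c0, hc0⟩ : ∃ c0, c0 = θ * (A1 - A2) - C1 * ε := ⟨_, rfl⟩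
  have hw : ∀ q : ℤ, |q - i| < n → c0 ≤ L.lam * σ * U (q + 1) - 2 * (L.lam * σ * U q) + L.lam * σ * U (q - 1) := by
    intro q hq
    have e1 := L.sum_step (k := k) (r := r) (i := q) fun j hj => (hbox j hj.le q hq.le).2.2
    obtain ⟨p1, p2, p3, p4⟩ := hts r le_rfl
    have p0 := hts 0 (Nat.zero_le _)
    have htr := L.t_add k r
    have e2 := R.incr_close L (s := θ) (t := t) (x := L.x q) (hbox 0 (Nat.zero_le _) q hq.le).1 (hbox r le_rfl q hq.le).1
      (by simpa using hε.le) (by rw [abs_le, add_zero]; constructor <;> linarith)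
      (by rw [add_zero, abs_le]; constructor <;> linarith) hb.le hθ.le hT (by linarith [p0.2.1])
      (by rw [add_zero]; linarith)
    rw [add_zero] at e2
    have e3 := h1 _ (hxs q hq.le)
    have e4 : σ * (∑ j ∈ Finset.range r, L.u (k + j) q * (L.coef q - L.u (k + j) q)) ≤ r * (A2 + 3 * M * ε) := by
      rw [Finset.mul_sum]
      refine (Finset.sum_le_card_nsmul _ _ (A2 + 3 * M * ε) fun j hj => ?_).trans_eq (by simp; ring)
      have hj := (Finset.mem_range.1 hj).le
      obtain ⟨p1, p2, p3, p4⟩ := hts j hj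
      obtain ⟨b1, b2, b3⟩ := hbox j hj q hq.le
      have f1 := R.react_close L b1 b2 (by linarith) (by linarith)
      have f2 := h2 _ _ (hxs q hq.le) p1
      rw [abs_le] at f1
      rcases hσ with rfl | rfl <;> linarith
    have e5 : L.dt * (r * (A2 + 3 * M * ε)) ≤ θ * A2 + |A2| * ε + θ * (3 * M) * ε := by
      have f1 : (r * L.dt) * (3 * M * ε) ≤ θ * (3 * M * ε) := by gcongr
      have f2 : (r * L.dt - θ) * A2 ≤ |A2| * ε := by
        calc _ ≤ |(r * L.dt - θ) * A2| := le_abs_self _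
          _ = |r * L.dt - θ| * |A2| := abs_mul _ _
          _ ≤ ε * |A2| := by
            gcongr; rw [abs_le]; constructor <;> linarith
          _ = _ := mul_comm _ _
      linarith
    have e6 := mul_le_mul_of_nonneg_left e4 hτ.le
    have e7 : L.lam * σ * U (q + 1) - 2 * (L.lam * σ * U q) + L.lam * σ * U (q - 1)
        = σ * (L.u (k + r) q - L.u k q) - L.dt * (σ * (∑ j ∈ Finset.range r, L.u (k + j) q * (L.coef q - L.u (k + j) q))) := by
      rw [e1]; ring
    rw [e7, hc0, hC1e]
    rw [abs_le] at e2
    rcases hσ with rfl | rfl <;> linarith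
  have hsum := second_diff_sum (v := fun q => L.lam * σ * U q) hw
  have hUc : ∀ q : ℤ, ∀ z, |q - i| ≤ n → |L.x q - z| ≤ 2 * ε → |L.dt * U q - θ * u z t| ≤ θ * (K * θ + (1 + 3 * K) * ε) + M * ε := by
    intro q z hq hz
    have e1 : |U q - r * u z t| ≤ r * (K * θ + (1 + 3 * K) * ε) := by
      have : U q - r * u z t = ∑ j ∈ Finset.range r, (L.u (k + j) q - u z t) := by
        rw [Finset.sum_sub_distrib]; simp [hU]
      rw [this]
      refine (Finset.abs_sum_le_sum_abs _ _).trans ?_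
      refine (Finset.sum_le_card_nsmul _ _ (K * θ + (1 + 3 * K) * ε) fun j hj => ?_).trans_eq (by simp; ring)
      have hj := (Finset.mem_range.1 hj).le
      obtain ⟨p1, p2, p3, p4⟩ := hts j hj
      obtain ⟨b1, b2, b3⟩ := hbox j hj q hq
      have f1 := R.lip (L.x q) z (L.t (k + j)) t (by linarith) (by linarith) hb.le (by linarith)
      have f2 : K * (|L.x q - z| + |L.t (k + j) - t|) ≤ K * (2 * ε + (θ + ε)) := by gcongr
      rw [abs_le] at *
      constructor <;> linarith
    have e2 : L.dt * U q - θ * u z t = L.dt * (U q - r * u z t) + (r * L.dt - θ) * u z t := by ring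
    have hb' := R.nonneg z t hb.le (by linarith)
    rw [e2]
    refine (abs_add_le _ _).trans ?_
    rw [abs_mul, abs_mul, abs_of_pos hτ, abs_of_nonneg hb']
    have hu := R.le z t hb.le (by linarith)
    have g1 : |r * L.dt - θ| ≤ ε := by rw [abs_le]; constructor <;> linarith
    have g2 : |r * L.dt - θ| * u z t ≤ ε * M := by gcongr
    have g3 : L.dt * |U q - r * u z t| ≤ θ * (K * θ + (1 + 3 * K) * ε) :=
      calc _ ≤ L.dt * (r * (K * θ + (1 + 3 * K) * ε)) := by gcongr
        _ = (r * L.dt) * (K * θ + (1 + 3 * K) * ε) := by ring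
        _ ≤ _ := by gcongr
    linarith
  have xn1 : L.x (i + n) - L.x i = n * L.dx := by rw [L.x_sub]; push_cast; ring
  have xn2 : L.x (i - n) - L.x i = -(n * L.dx) := by rw [L.x_sub]; push_cast; ring
  have d0 := hUc i y (by simp) (by rw [abs_le]; constructor <;> linarith)
  have d1 := hUc (i + n) (y + ρ) (by simp) (by rw [abs_le]; constructor <;> linarith)
  have d2 := hUc (i - n) (y - ρ) (by simp) (by rw [abs_le]; constructor <;> linarith)
  have e8 : c0 * (n * L.dx) ^ 2 ≤ σ * (L.dt * U (i + n) + L.dt * U (i - n) - 2 * (L.dt * U i)) := by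
    have := mul_le_mul_of_nonneg_right hsum (sq_nonneg L.dx)
    have e9 : (L.lam * σ * U (i + n) + L.lam * σ * U (i - n) - 2 * (L.lam * σ * U i)) * L.dx ^ 2
        = σ * (L.dt * U (i + n) + L.dt * U (i - n) - 2 * (L.dt * U i)) := by rw [← L.lam_mul]; ring
    calc _ = c0 * n ^ 2 * L.dx ^ 2 := by ring
      _ ≤ _ := this
      _ = _ := e9
  have e10 : c0 * ρ ^ 2 - c0 * (n * L.dx) ^ 2 ≤ (θ * |A1 - A2| + C1) * (2 * ρ) * ε := by
    have f1 : |c0| ≤ θ * |A1 - A2| + C1 := by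
      rw [hc0]
      refine (abs_sub _ _).trans ?_
      rw [abs_mul, abs_of_pos hθ, abs_mul, abs_of_pos hC1, abs_of_pos hε]
      have : C1 * ε ≤ C1 * 1 := by gcongr
      linarith
    have f2 : |ρ ^ 2 - (n * L.dx) ^ 2| ≤ 2 * ρ * ε := by
      have : 0 ≤ n * L.dx := by positivity
      rw [show ρ ^ 2 - (n * L.dx) ^ 2 = (ρ + n * L.dx) * (ρ - n * L.dx) by ring,
        abs_of_nonneg (mul_nonneg (by positivity) (by linarith))]
      exact mul_le_mul (by linarith) (by linarith) (by linarith) (by positivity)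
    calc _ = c0 * (ρ ^ 2 - (n * L.dx) ^ 2) := by ring
      _ ≤ |c0 * (ρ ^ 2 - (n * L.dx) ^ 2)| := le_abs_self _
      _ = |c0| * |ρ ^ 2 - (n * L.dx) ^ 2| := abs_mul _ _
      _ ≤ (θ * |A1 - A2| + C1) * (2 * ρ * ε) := by gcongr
      _ = _ := by ring
  have e11 : c0 * ρ ^ 2 = θ * (ρ ^ 2 * (A1 - A2)) - ρ ^ 2 * C1 * ε := by rw [hc0]; ring
  rw [abs_le] at d0 d1 d2
  rcases hσ with rfl | rfl <;> linarith

end Reg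

namespace Reg

variable {ℓ M K b T : ℝ} {g : ℝ → ℝ} {u : ℝ → ℝ → ℝ} {h : ℝ → ℝ}

theorem react_cont (R : Reg ℓ M K b T g u h) (z : ℝ) {t ε : ℝ} (hb : b ≤ t) (hT : t ≤ T) (hε : 0 < ε) :
    ∃ δ > 0, ∀ z' s, |z' - z| ≤ δ → |s - t| ≤ δ → b ≤ s → s ≤ T →
      |u z' s * (g z' - u z' s) - u z t * (g z - u z t)| ≤ ε := by
  have hK := R.K_pos
  have hM := R.M_pos
  obtain ⟨δ1, hδ1, hg⟩ := Metric.continuous_iff.1 R.gcont z (ε / (2 * M)) (by positivity)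
  refine ⟨min (δ1 / 2) (ε / (4 * K * (|g z| + 2 * M))), by positivity, fun z' s hz hs hbs hsT => ?_⟩
  have hz1 := hz.trans (min_le_left _ _)
  have hz2 := hz.trans (min_le_right _ _)
  have hs2 := hs.trans (min_le_right _ _)
  have e1 := R.lip z' z s t hbs hsT hb hT
  have e2 : |g z' - g z| ≤ ε / (2 * M) := by
    have := hg z' (by rw [Real.dist_eq]; linarith)
    rw [Real.dist_eq] at this; exact this.le
  have a1 := R.nonneg z' s hbs hsT
  have a2 := R.le z' s hbs hsT
  have a3 := R.nonneg z t hb hT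
  have a4 := R.le z t hb hT
  have e3 : |u z' s - u z t| ≤ K * (2 * (ε / (4 * K * (|g z| + 2 * M)))) := by
    refine e1.trans ?_
    gcongr; linarith
  have e4 : K * (2 * (ε / (4 * K * (|g z| + 2 * M)))) * (|g z| + 2 * M) = ε / 2 := by
    have : |g z| + 2 * M ≠ 0 := by positivity
    field_simp; norm_num
  have e5 : |g z - u z' s - u z t| ≤ |g z| + 2 * M := by
    have := abs_le.1 (le_refl |g z|)
    rw [abs_le]; constructor <;> linarith
  have e6 : u z' s * (g z' - u z' s) - u z t * (g z - u z t)
    = (u z' s - u z t) * (g z - u z' s - u z t) + u z' s * (g z' - g z) := by ring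
  rw [e6]
  refine (abs_add_le _ _).trans ?_
  rw [abs_mul, abs_mul, abs_of_nonneg a1]
  calc _ ≤ K * (2 * (ε / (4 * K * (|g z| + 2 * M)))) * (|g z| + 2 * M) + M * (ε / (2 * M)) := by gcongr
    _ = ε := by rw [e4]; field_simp; norm_num

set_option maxHeartbeats 1000000 in
theorem jet (R : Reg ℓ M K b T g u h) {x t : ℝ} (hb : b < t) (hT : t < T) (hx : x < h t) :
    ∃ zx zxx, Jet u x t (zxx + u x t * (g x - u x t)) zx zxx := by
  have hK := R.K_pos
  have hM := R.M_pos
  obtain ⟨r, hr, hre⟩ : ∃ r > 0, r = (h t - x) / 4 := ⟨_, by linarith, rfl⟩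
  obtain ⟨η, hη, hη1, hη2, hη3⟩ : ∃ η > 0, η ≤ (t - b) / 2 ∧ η ≤ (T - t) / 2 ∧ K * η ≤ r := by
    refine ⟨min ((t - b) / 2) (min ((T - t) / 2) (r / K)), ?_, min_le_left _ _,
      (min_le_right _ _).trans (min_le_left _ _), ?_⟩
    · have : 0 < r / K := by positivity
      exact lt_min (by linarith) (lt_min (by linarith) this)
    · have : min ((t - b) / 2) (min ((T - t) / 2) (r / K)) ≤ r / K :=
        (min_le_right _ _).trans (min_le_right _ _)
      calc _ ≤ K * (r / K) := by gcongr
        _ = r := by field_simp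
  have hback : ∀ s, t - η ≤ s → s ≤ t → x + 2 * r < h s := by
    intro s h1 h2
    have e := R.liph t s (by linarith) (by linarith) (by linarith) (by linarith)
    have : K * |t - s| ≤ K * η := by
      gcongr; rw [abs_le]; constructor <;> linarith
    have := le_abs_self (h t - h s)
    linarith
  obtain ⟨C, hC, hCl⟩ := R.diff_lip (x1 := x - r) (x2 := x + r) (t1 := t - η) (t2 := T) (by linarith) le_rfl
    (by linarith [hback (t - η) le_rfl (by linarith)]) (half_pos hr) (half_pos hη)
  have hdt : ∀ y, |y - x| ≤ r / 2 → ∃ v, HasDerivAt (fun s => u y s) v t := by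
    intro y hy
    rw [abs_le] at hy
    refine exists_hasDerivAt_of_sliding (a := t - η / 2) (b := T - η / 2) ?_ ?_ ⟨by linarith, by linarith⟩
    · intro s hs
      rw [Metric.continuousWithinAt_iff]
      intro ε hε
      refine ⟨ε / K, by positivity, fun s' hs' hd => ?_⟩
      rw [Real.dist_eq] at hd ⊢
      have := R.lipt y s' s (by linarith [hs'.1]) (by linarith [hs'.2]) (by linarith [hs.1]) (by linarith [hs.2])
      rw [lt_div_iff₀ hK] at hd
      linarith
    · intro ε hε
      obtain ⟨δ, hδ, H⟩ := R.diff_time (x1 := x - r) (x2 := x + r) (t1 := t - η) (t2 := T) (by linarith) le_rfl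
        (by linarith [hback (t - η) le_rfl (by linarith)]) (half_pos hr) (half_pos hη) hε
      refine ⟨min δ (η / 2), by positivity, fun s hs hsd a ha a' ha' hd => ?_⟩
      have hd1 := hd.le.trans (min_le_left _ _)
      have hs2 := hsd.le.trans (min_le_right _ _)
      rw [abs_le] at hd1
      rcases le_total a a' with h1 | h1
      · rw [abs_sub_comm]
        exact H s hs y a a' (by linarith) (by linarith) (by linarith [ha.1]) h1 (by linarith [ha'.2]) (by linarith)
      · exact H s hs y a' a (by linarith) (by linarith) (by linarith [ha'.1]) h1 (by linarith [ha.2]) (by linarith)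
  choose! v hv using hdt
  have hvl : ∀ y y', |y - x| ≤ r / 2 → |y' - x| ≤ r / 2 → |y - y'| ≤ r / 8 → |v y - v y'| ≤ C * |y - y'| := by
    intro y y' hy hy' hyy
    refine le_of_forall_small (c := 2) one_pos fun ε hε _ => ?_
    obtain ⟨d1, hd1, b1⟩ := HasDerivAt.bound (hv y hy) hε
    obtain ⟨d2, hd2, b2⟩ := HasDerivAt.bound (hv y' hy') hε
    obtain ⟨s, hs, hs1, hs2, hs3⟩ : ∃ s > 0, s < d1 ∧ s < d2 ∧ s < η :=
      ⟨min d1 (min d2 η) / 2, by positivity, by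
        have := min_le_left d1 (min d2 η); linarith [show 0 < min d1 (min d2 η) by positivity],
        by have := (min_le_right d1 (min d2 η)).trans (min_le_left _ _); linarith [show 0 < min d1 (min d2 η) by positivity],
        by have := (min_le_right d1 (min d2 η)).trans (min_le_right _ _); linarith [show 0 < min d1 (min d2 η) by positivity]⟩
    have e1 := b1 s (by rwa [abs_of_pos hs])
    have e2 := b2 s (by rwa [abs_of_pos hs])
    rw [abs_le] at hy hy'
    have e3 := hCl s hs y y' t (by linarith) (by linarith) (by linarith) (by linarith) (by linarith) (by linarith) (by linarith)
    rw [abs_of_pos hs] at e1 e2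
    have : |v y - v y'| * s ≤ (C * |y - y'| + 2 * ε) * s := by
      rw [← abs_of_pos hs, ← abs_mul, abs_of_pos hs]
      rw [abs_le] at *
      constructor <;> linarith
    exact le_of_mul_le_mul_right this hs
  obtain ⟨G, hG⟩ : ∃ G : ℝ → ℝ, ∀ y, G y = v y - u y t * (g y - u y t) := ⟨_, fun _ => rfl⟩
  have hu_cont : Continuous fun y => u y t := by
    refine Metric.continuous_iff.2 fun y ε hε => ⟨ε / K, by positivity, fun y' hd => ?_⟩
    rw [Real.dist_eq] at hd ⊢
    have := R.lipx y' y t hb.le hT.le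
    rw [lt_div_iff₀ hK] at hd
    linarith
  have hvc : ContinuousOn v (Icc (x - r / 4) (x + r / 4)) := by
    intro y hy
    rw [Metric.continuousWithinAt_iff]
    intro ε hε
    refine ⟨min (ε / C) (r / 8), by positivity, fun y' hy' hd => ?_⟩
    rw [Real.dist_eq] at hd ⊢
    have hd1 := hd.trans_le (min_le_left _ _)
    have hd2 := hd.le.trans (min_le_right _ _)
    have := hvl y' y (by rw [abs_le]; constructor <;> linarith [hy'.1, hy'.2]) (by rw [abs_le]; constructor <;> linarith [hy.1, hy.2]) hd2
    rw [lt_div_iff₀ hC] at hd1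
    linarith
  have hgc := R.gcont
  obtain ⟨v', hv'⟩ := schwarz_regularity (a := x - r / 4) (b := x + r / 4) (by linarith) (v := fun y => u y t) (G := G)
    hu_cont.continuousOn
    (ContinuousOn.congr (f := fun y => v y - u y t * (g y - u y t)) (by fun_prop) fun y _ => hG y) (by
      intro z hz
      have hzx : |z - x| ≤ r / 4 := by rw [abs_le]; constructor <;> linarith [hz.1, hz.2]
      rw [Metric.tendsto_nhdsWithin_nhds]
      intro ε hε
      obtain ⟨d1, hd1, b1⟩ := HasDerivAt.bound (hv z (by linarith)) (show 0 < ε / 6 by positivity)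
      obtain ⟨d2, hd2, b2⟩ := R.react_cont z hb.le hT.le (show 0 < ε / 6 by positivity)
      obtain ⟨δ, hδ, c1, c2, c3, c4, c5⟩ : ∃ δ > 0, δ < d1 ∧ δ ≤ d2 ∧ C * δ ≤ ε / 6 ∧ δ ≤ r / 8 ∧ δ ≤ η := by
        refine ⟨min (d1 / 2) (min d2 (min (ε / 6 / C) (min (r / 8) η))), by positivity, ?_, ?_, ?_, ?_, ?_⟩
        · exact (min_le_left _ _).trans_lt (by linarith)
        · exact (min_le_right _ _).trans (min_le_left _ _)
        · rw [mul_comm, ← le_div_iff₀ hC]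
          exact (min_le_right _ _).trans ((min_le_right _ _).trans (min_le_left _ _))
        · exact (min_le_right _ _).trans ((min_le_right _ _).trans ((min_le_right _ _).trans (min_le_left _ _)))
        · exact (min_le_right _ _).trans ((min_le_right _ _).trans ((min_le_right _ _).trans (min_le_right _ _)))
      refine ⟨δ / 2, by positivity, fun y hy hyd => ?_⟩
      rw [mem_Ioi] at hy
      rw [Real.dist_eq, sub_zero, abs_of_pos hy] at hyd
      have key : ∀ σ : ℝ, (σ = 1 ∨ σ = -1) → y ^ 2 * (σ * G z - ε / 2) ≤ σ * (u (z + y) t + u (z - y) t - 2 * u z t) := by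
        intro σ hσ
        refine le_of_forall_small (c := 4 * K) hδ fun θ hθ hθδ => ?_
        rw [abs_le] at hzx
        have := R.second_diff (y := z) (t := t) (ρ := y) (θ := θ) (σ := σ) (A1 := σ * v z - ε / 3)
          (A2 := σ * (u z t * (g z - u z t)) + ε / 6) hb (by linarith) hθ hy
          (by linarith [hback (t - θ) (by linarith) (by linarith)]) (by linarith) hσ
          (by
            intro z' hz'
            have e1 := b1 θ (by rw [abs_of_pos hθ]; linarith)
            rw [abs_of_pos hθ] at e1
            have hz2 := abs_le.1 hz'
            have e3 := hCl θ hθ z' z t (by linarith) (by linarith) (by linarith) (by linarith) (by linarith) (by linarith) (by linarith)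
            have e4 : C * θ * |z' - z| ≤ ε / 6 * θ := by
              calc _ ≤ C * θ * δ := by gcongr; linarith
                _ = (C * δ) * θ := by ring
                _ ≤ _ := by gcongr
            rw [abs_le] at e1 e3
            rcases hσ with rfl | rfl <;> linarith)
          (by
            intro z' s hz' hs'
            have hs2 := abs_le.1 hs'
            have := abs_le.1 (b2 z' s (by linarith) (by linarith) (by linarith) (by linarith))
            rcases hσ with rfl | rfl <;> linarith)
        refine le_trans (le_of_eq ?_) this
        rw [hG]; ring
      have k1 := key 1 (Or.inl rfl)
      have k2 := key (-1) (Or.inr rfl)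
      have hy2 : 0 < y ^ 2 := by positivity
      rw [Real.dist_eq]
      have : |(u (z + y) t + u (z - y) t - 2 * u z t) / y ^ 2 - G z| ≤ ε / 2 := by
        rw [abs_le]
        constructor
        · rw [neg_le_sub_iff_le_add, ← sub_le_iff_le_add, le_div_iff₀ hy2]; linarith
        · rw [sub_le_iff_le_add, div_le_iff₀ hy2]; linarith
      linarith)
  refine ⟨v' x, G x, ?_, v', rfl, ?_, (hv' x ⟨by linarith, by linarith⟩).2⟩
  · rw [hG]
    have := hv x (by simpa using by positivity)
    exact this.congr_deriv (by ring)
  · filter_upwards [Ioo_mem_nhds (show x - r / 4 < x by linarith) (show x < x + r / 4 by linarith)] with y hy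
    exact (hv' y hy).1

end Reg

theorem abel_second_diff (v : ℤ → ℝ) (J : ℤ) (n : ℕ) :
    ∑ i ∈ Finset.range n, ((i:ℝ) + 1) * (v (J + 1 + i + 1) - 2 * v (J + 1 + i) + v (J + 1 + i - 1))
      = v J - (n + 1) * v (J + n) + n * v (J + n + 1) := by
  induction n with
  | zero => simp
  | succ n ih =>
    rw [Finset.sum_range_succ, ih]
    have e1 : J + 1 + (n:ℤ) - 1 = J + n := by ring
    have e2 : J + 1 + (n:ℤ) + 1 = J + (n + 1 : ℕ) + 1 := by push_cast; ring
    have e3 : J + 1 + (n:ℤ) = J + (n + 1 : ℕ) := by push_cast; ring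
    have e4 : J + (n:ℤ) + 1 = J + (n + 1 : ℕ) := by push_cast; ring
    rw [e1, e2, e3, e4]
    push_cast; ring

namespace LatSol
variable {ℓ M : ℝ} (L : LatSol ℓ M)

theorem moment_step (k : ℕ) (J : ℤ) (n : ℕ) (h1 : L.u k (J + n) = 0) (h2 : L.u k (J + n + 1) = 0) :
    ∑ i ∈ Finset.range n, ((i:ℝ) + 1) * L.E (k + 1) (J + 1 + i)
      = ∑ i ∈ Finset.range n, ((i:ℝ) + 1) * L.E k (J + 1 + i) + L.lam * L.u k J
        + L.dt * ∑ i ∈ Finset.range n, ((i:ℝ) + 1) * (L.u k (J + 1 + i) * (L.coef (J + 1 + i) - L.u k (J + 1 + i))) := by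
  have e := abel_second_diff (L.u k) J n
  rw [h1, h2] at e
  have e2 : L.lam * L.u k J = ∑ i ∈ Finset.range n, ((i:ℝ) + 1) *
      (L.lam * (L.u k (J + 1 + i + 1) - 2 * L.u k (J + 1 + i) + L.u k (J + 1 + i - 1))) := by
    have : L.u k J = L.u k J - (n + 1) * 0 + n * 0 := by ring
    rw [this, ← e, Finset.mul_sum]
    exact Finset.sum_congr rfl fun i _ => by ring
  rw [e2, Finset.mul_sum, ← Finset.sum_add_distrib, ← Finset.sum_add_distrib]
  refine Finset.sum_congr rfl fun i _ => ?_
  rw [L.step']; ring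

theorem moment_sum (k r : ℕ) (J : ℤ) (n : ℕ) (h : ∀ j < r, L.u (k + j) (J + n) = 0 ∧ L.u (k + j) (J + n + 1) = 0) :
    ∑ i ∈ Finset.range n, ((i:ℝ) + 1) * L.E (k + r) (J + 1 + i)
      = ∑ i ∈ Finset.range n, ((i:ℝ) + 1) * L.E k (J + 1 + i) + L.lam * ∑ j ∈ Finset.range r, L.u (k + j) J
        + L.dt * ∑ j ∈ Finset.range r, ∑ i ∈ Finset.range n,
          ((i:ℝ) + 1) * (L.u (k + j) (J + 1 + i) * (L.coef (J + 1 + i) - L.u (k + j) (J + 1 + i))) := by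
  induction r with
  | zero => simp
  | succ r ih =>
    have h1 := L.moment_step (k + r) J n (h r (by omega)).1 (h r (by omega)).2
    have h2 := ih fun j hj => h j (by omega)
    rw [Finset.sum_range_succ, Finset.sum_range_succ, ← add_assoc, h1, h2]
    ring

theorem moment_eq (hℓ : 0 < ℓ) {k : ℕ} {J : ℤ} {n : ℕ} (h : L.E k (J + 1 + n) < ℓ) :
    ∃ p : ℕ, p ≤ n ∧ (∀ i < p, ℓ ≤ L.E k (J + 1 + i)) ∧ L.E k (J + 1 + p) < ℓ ∧
      |∑ i ∈ Finset.range n, ((i:ℝ) + 1) * L.E k (J + 1 + i)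
        - ∑ i ∈ Finset.range n, ((i:ℝ) + 1) * L.u k (J + 1 + i) - ℓ * (p * (p + 1) / 2)| ≤ ℓ * (p + 1) := by
  classical
  have hex : ∃ i : ℕ, L.E k (J + 1 + i) < ℓ := ⟨n, h⟩
  obtain ⟨p, hp⟩ : ∃ p, p = Nat.find hex := ⟨_, rfl⟩
  have hp1 : L.E k (J + 1 + p) < ℓ := hp ▸ Nat.find_spec hex
  have hp2 : p ≤ n := hp ▸ Nat.find_min' hex h
  have hp3 : ∀ i < p, ℓ ≤ L.E k (J + 1 + i) := fun i hi => not_lt.1 (Nat.find_min hex (hp ▸ hi))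
  refine ⟨p, hp2, hp3, hp1, ?_⟩
  have key : ∀ n, p ≤ n → ∑ i ∈ Finset.range n, ((i:ℝ) + 1) * L.E k (J + 1 + i)
        - ∑ i ∈ Finset.range n, ((i:ℝ) + 1) * L.u k (J + 1 + i)
      = ℓ * (p * (p + 1) / 2) + if p < n then ((p:ℝ) + 1) * L.E k (J + 1 + p) else 0 := by
    intro n hn
    induction n, hn using Nat.le_induction with
    | base =>
      rw [if_neg (lt_irrefl _), add_zero, ← Finset.sum_sub_distrib]
      have : ∀ q ≤ p, ∑ i ∈ Finset.range q, (((i:ℝ) + 1) * L.E k (J + 1 + i) - ((i:ℝ) + 1) * L.u k (J + 1 + i))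
        = ℓ * (q * (q + 1) / 2) := by
        intro q
        induction q with
        | zero => simp
        | succ q ih =>
          intro hq
          rw [Finset.sum_range_succ, ih (by omega), L.E_eq (hp3 q (by omega))]
          push_cast; ring
      exact this p le_rfl
    | succ n hn ih =>
      rw [Finset.sum_range_succ, Finset.sum_range_succ, if_pos (by omega)]
      rcases hn.eq_or_lt with rfl | hlt
      · rw [if_neg (lt_irrefl _)] at ih
        rw [L.u_eq_zero hp1]; linarith
      · rw [if_pos hlt] at ih
        have e0 := L.inactive_right hℓ (j := J + 1 + n) hp1 (by omega)
        rw [e0, L.u_eq_zero (by rw [e0]; exact hℓ)]; linarith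
  rw [key n hp2, add_sub_cancel_left]
  have hE := L.E_nonneg k (J + 1 + p)
  split_ifs
  · rw [abs_of_nonneg (by positivity), mul_comm]; gcongr
  · rw [abs_zero]; positivity

end LatSol
namespace Reg

variable {ℓ M K b T : ℝ} {g : ℝ → ℝ} {u : ℝ → ℝ → ℝ} {h : ℝ → ℝ}

set_option maxHeartbeats 2000000 in
theorem weak (R : Reg ℓ M K b T g u h) {y t1 t2 : ℝ} (hb : b < t1) (ht : t1 < t2) (hT : t2 ≤ T)
    (hy : y < h t1) :
    |ℓ * ((h t2 - y) ^ 2 / 2 - (h t1 - y) ^ 2 / 2) - u y t1 * (t2 - t1)|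
      ≤ (K + M ^ 2) * (h t2 - y) ^ 2 * (t2 - t1) + K * (t2 - t1) ^ 2 := by
  have hK := R.K_pos
  have hM := R.M_pos
  have hℓ := R.ℓ_pos
  obtain ⟨D, hD, hDe⟩ : ∃ D > 0, D = t2 - t1 := ⟨_, by linarith, rfl⟩
  have hmono := R.h_mono t1 t2 hb.le ht.le hT
  obtain ⟨X, hX, hXe⟩ : ∃ X > 0, X = h t2 - y := ⟨_, by linarith, rfl⟩
  -- a bound for the discretisation error of the quadratic term
  have hquad : ∀ (P Y d ε : ℝ), 0 ≤ P → 0 ≤ Y → Y ≤ X → 0 ≤ d → d ≤ ε → ε ≤ 1 → |P - Y| ≤ (3 + 2 * K) * ε →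
      |(P ^ 2 + P * d) / 2 - Y ^ 2 / 2| ≤ (3 + 2 * K) * (2 * X + 4 + 2 * K) * ε := by
    intro P Y d ε hP hY hYX hd hdε hε1 hPY
    have hε : 0 ≤ ε := hd.trans hdε
    have h1 : P ≤ X + (3 + 2 * K) := by
      have : (3 + 2 * K) * ε ≤ (3 + 2 * K) * 1 := by gcongr
      linarith [(abs_le.1 hPY).2]
    have e : (P ^ 2 + P * d) / 2 - Y ^ 2 / 2 = (P - Y) * ((P + Y) / 2) + P * d / 2 := by ring
    rw [e]
    refine (abs_add_le _ _).trans ?_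
    rw [abs_mul, abs_of_nonneg (show 0 ≤ (P + Y) / 2 by positivity), abs_of_nonneg (show 0 ≤ P * d / 2 by positivity)]
    have f1 : |P - Y| * ((P + Y) / 2) ≤ (3 + 2 * K) * ε * ((X + (3 + 2 * K) + X) / 2) := by gcongr
    have f2 : P * d / 2 ≤ (X + (3 + 2 * K)) * ε / 2 := by gcongr
    refine (add_le_add f1 f2).trans ?_
    have : 0 ≤ ε * X := by positivity
    nlinarith [mul_nonneg hε hK.le, mul_nonneg (mul_nonneg hε hK.le) hX.le, mul_nonneg (mul_nonneg hε hK.le) hK.le]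
  rw [← hDe, ← hXe]
  obtain ⟨B, hB, hBe⟩ : ∃ B > 0, B = (3 + 2 * K) * (2 * X + 4 + 2 * K) := ⟨_, by positivity, rfl⟩
  refine le_of_forall_small (c := 2 * ℓ * B + 2 * ℓ * (X + 5 + 2 * K) + (X + 4) ^ 2 * (2 + K) +
      8 * (X + 2) * (K + M ^ 2) * D + D * (1 + 2 * K) + M)
    (show 0 < min 1 (min (t1 - b) (D / 2)) from
    lt_min one_pos (lt_min (by linarith) (by linarith))) fun ε hε hε0 => ?_
  obtain ⟨hε1, q2⟩ := lt_min_iff.1 hε0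
  obtain ⟨hε2, hε3⟩ := lt_min_iff.1 q2
  obtain ⟨L, hLd, hL0, hL⟩ := R.approx (|y| + |h t2| + |t1| + |t2| + 10) (by positivity) ε hε
  have hd := L.dx_pos
  have hτ := L.dt_pos
  have hτd := L.dt_le (by linarith)
  obtain ⟨i1, i2⟩ := L.ix_bounds y
  generalize L.ix y = J at *
  obtain ⟨k1, k2⟩ := L.kt_bounds (t := t1) (by linarith)
  generalize L.kt t1 = k at *
  obtain ⟨r1, r2⟩ := floor_nat_bounds hD.le hτ
  generalize ⌊D / L.dt⌋₊ = r at *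
  obtain ⟨n1, n2⟩ := floor_nat_bounds (show 0 ≤ X + 4 * ε by positivity) hd
  generalize ⌊(X + 4 * ε) / L.dx⌋₊ = n at *
  have hts : ∀ j ≤ r, b ≤ L.t (k + j) ∧ L.t (k + j) ≤ t2 ∧ |L.t (k + j)| ≤ |y| + |h t2| + |t1| + |t2| + 10
      ∧ |L.t (k + j) - t1| ≤ D + ε ∧ h (L.t (k + j)) ≤ h t2 := by
    intro j hj
    have e0 := L.t_add k j
    have e1 : j * L.dt ≤ r * L.dt := by
      have : (j:ℝ) ≤ r := by exact_mod_cast hj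
      gcongr
    have e2 : 0 ≤ j * L.dt := by positivity
    refine ⟨by linarith, by linarith, ?_, by rw [abs_le]; constructor <;> linarith, R.h_mono _ _ (by linarith) (by linarith) hT⟩
    rw [abs_le]
    constructor <;> linarith [neg_abs_le t1, le_abs_self t2, abs_nonneg y, abs_nonneg (h t2), abs_nonneg t2, abs_nonneg t1]
  have hxs : ∀ i : ℕ, i ≤ n + 2 → |L.x (J + i)| ≤ |y| + |h t2| + |t1| + |t2| + 10 := by
    intro i hi
    have e := L.x_add J i
    have e2 : (i:ℝ) * L.dx ≤ (n + 2) * L.dx := by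
      have : (i:ℝ) ≤ n + 2 := by exact_mod_cast hi
      gcongr
    have e3 : 0 ≤ (i:ℝ) * L.dx := by positivity
    push_cast at e
    rw [abs_le]
    constructor <;> linarith [neg_abs_le y, le_abs_self (h t2), abs_nonneg y, abs_nonneg (h t2), abs_nonneg t2, abs_nonneg t1]
  have hfar : ∀ j ≤ r, ∀ i : ℕ, n ≤ i → i ≤ n + 2 → L.E (k + j) (J + i) < ℓ := by
    intro j hj i hi hi2
    by_contra hc
    obtain ⟨p1, p2, p3, p4, p5⟩ := hts j hj
    have := (hL (k + j) (J + i) p1 p3 (hxs i hi2)).2.2.1 (not_lt.1 hc)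
    have e := L.x_add J i
    push_cast at e
    have e2 : (n:ℝ) * L.dx ≤ i * L.dx := by
      have : (n:ℝ) ≤ i := by exact_mod_cast hi
      gcongr
    linarith
  have hmom := L.moment_sum k r J n fun j hj => by
    refine ⟨L.u_eq_zero (hfar j hj.le n le_rfl (by omega)), L.u_eq_zero ?_⟩
    have := hfar j hj.le (n + 1) (by omega) (by omega)
    push_cast at this; rwa [← add_assoc] at this
  -- the enthalpy moment in terms of the front
  have hfront : ∀ j ≤ r, ∀ t, |L.t (k + j) - t| ≤ 2 * ε → b ≤ t → t ≤ T → 0 ≤ h t - y → h t - y ≤ X →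
      |L.dx ^ 2 * (∑ i ∈ Finset.range n, ((i:ℝ) + 1) * L.E (k + j) (J + 1 + i)
        - ∑ i ∈ Finset.range n, ((i:ℝ) + 1) * L.u (k + j) (J + 1 + i)) - ℓ * ((h t - y) ^ 2 / 2)|
        ≤ (ℓ * B + ℓ * (X + 5 + 2 * K)) * ε := by
    intro j hj t htt hbt htT hy0 hyX
    obtain ⟨p1, p2, p3, p4, p5⟩ := hts j hj
    obtain ⟨p, hpn, hp1, hp2, hp3⟩ := L.moment_eq hℓ (k := k + j) (J := J) (n := n) (by
      have := hfar j hj (n + 1) (by omega) (by omega)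
      push_cast at this; rwa [show J + 1 + (n:ℤ) = J + (n + 1) by ring])
    have hh := R.liph (L.t (k + j)) t p1 (by linarith) hbt htT
    have hh' : |h (L.t (k + j)) - h t| ≤ K * (2 * ε) := hh.trans (by gcongr)
    have hx1 := (hL (k + j) (J + (p + 1 : ℕ)) p1 p3 (hxs _ (by omega))).2.2.2 (by
      push_cast; rwa [show J + ((p:ℤ) + 1) = J + 1 + p by ring])
    have ex1 := L.x_add J (p + 1 : ℕ)
    push_cast at ex1 hx1
    have hx2 : p * L.dx ≤ h t - y + (3 + 2 * K) * ε := by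
      rcases p with _ | p
      · simp; positivity
      · have hx2 := (hL (k + j) (J + (p + 1 : ℕ)) p1 p3 (hxs _ (by omega))).2.2.1 (by
          have := hp1 p (by omega)
          push_cast; rwa [show J + ((p:ℤ) + 1) = J + 1 + p by ring])
        have ex2 := L.x_add J (p + 1 : ℕ)
        push_cast at ex2 hx2 ⊢
        rw [abs_le] at hh'
        linarith
    have hP : |p * L.dx - (h t - y)| ≤ (3 + 2 * K) * ε := by
      rw [abs_le] at hh' ⊢
      constructor <;> linarith
    have hq := hquad (p * L.dx) (h t - y) L.dx ε (by positivity) hy0 hyX hd.le hLd.le hε1.le hP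
    rw [← hBe] at hq
    have e1 : L.dx ^ 2 * (∑ i ∈ Finset.range n, ((i:ℝ) + 1) * L.E (k + j) (J + 1 + i)
        - ∑ i ∈ Finset.range n, ((i:ℝ) + 1) * L.u (k + j) (J + 1 + i)) - ℓ * ((h t - y) ^ 2 / 2)
        = L.dx ^ 2 * (∑ i ∈ Finset.range n, ((i:ℝ) + 1) * L.E (k + j) (J + 1 + i)
        - ∑ i ∈ Finset.range n, ((i:ℝ) + 1) * L.u (k + j) (J + 1 + i) - ℓ * (p * (p + 1) / 2)) +
        ℓ * (((p * L.dx) ^ 2 + p * L.dx * L.dx) / 2 - (h t - y) ^ 2 / 2) := by ring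
    rw [e1]
    refine (abs_add_le _ _).trans ?_
    rw [abs_mul, abs_mul, abs_of_pos hℓ, abs_of_nonneg (show 0 ≤ L.dx ^ 2 by positivity)]
    have e2 : L.dx ^ 2 * (ℓ * (p + 1)) ≤ ℓ * (X + 5 + 2 * K) * ε := by
      have f1 : p * L.dx + L.dx ≤ X + 5 + 2 * K := by
        have : (3 + 2 * K) * ε ≤ (3 + 2 * K) * 1 := by gcongr
        linarith
      calc L.dx ^ 2 * (ℓ * (p + 1)) = ℓ * (p * L.dx + L.dx) * L.dx := by ring
        _ ≤ ℓ * (X + 5 + 2 * K) * ε := by gcongr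
    calc _ ≤ L.dx ^ 2 * (ℓ * (p + 1)) + ℓ * (B * ε) := by gcongr
      _ ≤ _ := by linarith
  have m1 := hfront 0 (Nat.zero_le _) t1 (by rw [add_zero, abs_le]; constructor <;> linarith) hb.le (by linarith)
    (by linarith) (by linarith)
  have htr := L.t_add k r
  have m2 := hfront r le_rfl t2 (by rw [abs_le]; constructor <;> linarith) (by linarith) hT
    (by linarith) (by linarith)
  rw [add_zero] at m1
  rw [← hXe] at m2
  have hnd : (n * L.dx) ^ 2 ≤ (X + 4 * ε) ^ 2 := by gcongr
  have hwt : ∀ i ∈ Finset.range n, L.dx ^ 2 * ((i:ℝ) + 1) ≤ n * L.dx ^ 2 := by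
    intro i hi
    have : (i:ℝ) + 1 ≤ n := by exact_mod_cast Finset.mem_range.1 hi
    rw [mul_comm (n:ℝ)]; gcongr
  -- the change of the temperature moment
  have m3 : |L.dx ^ 2 * (∑ i ∈ Finset.range n, ((i:ℝ) + 1) * L.u (k + r) (J + 1 + i)
      - ∑ i ∈ Finset.range n, ((i:ℝ) + 1) * L.u k (J + 1 + i))| ≤ (X + 4 * ε) ^ 2 * (K * D + (2 + K) * ε) := by
    rw [← Finset.sum_sub_distrib, Finset.mul_sum]
    refine (Finset.abs_sum_le_sum_abs _ _).trans ?_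
    refine (Finset.sum_le_card_nsmul _ _ (n * L.dx ^ 2 * (K * D + (2 + K) * ε)) fun i hi => ?_).trans ?_
    · rw [← mul_sub, ← mul_assoc, abs_mul, abs_of_nonneg (by positivity)]
      have hin := Finset.mem_range.1 hi
      obtain ⟨p1, p2, p3, p4, p5⟩ := hts 0 (Nat.zero_le _)
      obtain ⟨q1, q2, q3, q4, q5⟩ := hts r le_rfl
      rw [add_zero] at p1 p2 p3 p4 p5
      have hx := hxs (i + 1) (by omega)
      have ei : J + ((i + 1 : ℕ) : ℤ) = J + 1 + i := by push_cast; ring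
      rw [ei] at hx
      have f1 := (hL k (J + 1 + i) p1 p3 hx).1
      have f2 := (hL (k + r) (J + 1 + i) q1 q3 hx).1
      have f3 := R.lipt (L.x (J + 1 + i)) (L.t (k + r)) (L.t k) q1 (by linarith) p1 (by linarith)
      have f4 : K * |L.t (k + r) - L.t k| ≤ K * D := by
        rw [htr, add_sub_cancel_left, abs_of_nonneg (by positivity)]; gcongr
      have f5 : |L.u (k + r) (J + 1 + i) - L.u k (J + 1 + i)| ≤ K * D + (2 + K) * ε := by
        have : 0 ≤ K * ε := by positivity
        rw [abs_le] at *
        constructor <;> linarith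
      have := hwt i hi
      gcongr
    · simp only [Finset.card_range, nsmul_eq_mul]
      calc _ = (n * L.dx) ^ 2 * (K * D + (2 + K) * ε) := by ring
        _ ≤ _ := by gcongr
  -- the source term
  have m4 : |L.dx ^ 2 * (L.dt * ∑ j ∈ Finset.range r, ∑ i ∈ Finset.range n,
          ((i:ℝ) + 1) * (L.u (k + j) (J + 1 + i) * (L.coef (J + 1 + i) - L.u (k + j) (J + 1 + i))))|
      ≤ (X + 4 * ε) ^ 2 * (M ^ 2) * D := by
    have f1 : ∀ j ∈ Finset.range r, |L.dx ^ 2 * ∑ i ∈ Finset.range n,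
          ((i:ℝ) + 1) * (L.u (k + j) (J + 1 + i) * (L.coef (J + 1 + i) - L.u (k + j) (J + 1 + i)))|
        ≤ (n * L.dx) ^ 2 * M ^ 2 := by
      intro j _
      rw [Finset.mul_sum]
      refine (Finset.abs_sum_le_sum_abs _ _).trans ?_
      refine (Finset.sum_le_card_nsmul _ _ (n * L.dx ^ 2 * M ^ 2) fun i hi => ?_).trans ?_
      · rw [← mul_assoc, abs_mul, abs_of_nonneg (show 0 ≤ L.dx ^ 2 * ((i:ℝ) + 1) by positivity)]
        have := hwt i hi
        have a1 := L.u_nonneg (k + j) (J + 1 + i)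
        have a2 := L.u_le (k + j) (J + 1 + i)
        have a3 := L.coef_le (J + 1 + i)
        have a4 := L.coef_nonneg (J + 1 + i)
        have : |L.u (k + j) (J + 1 + i) * (L.coef (J + 1 + i) - L.u (k + j) (J + 1 + i))| ≤ M ^ 2 := by
          rw [abs_mul, abs_of_nonneg a1, sq]
          have : |L.coef (J + 1 + i) - L.u (k + j) (J + 1 + i)| ≤ M := by
            rw [abs_le]; constructor <;> linarith
          gcongr
        gcongr
      · simp only [Finset.card_range, nsmul_eq_mul]
        exact le_of_eq (by ring)
    rw [mul_left_comm, abs_mul, abs_of_pos hτ, Finset.mul_sum]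
    calc _ ≤ L.dt * (r * ((n * L.dx) ^ 2 * M ^ 2)) := by
          gcongr
          refine (Finset.abs_sum_le_sum_abs _ _).trans ((Finset.sum_le_card_nsmul _ _ _ f1).trans ?_)
          simp
      _ = (r * L.dt) * ((n * L.dx) ^ 2 * M ^ 2) := by ring
      _ ≤ D * ((X + 4 * ε) ^ 2 * M ^ 2) := by gcongr
      _ = _ := by ring
  -- the flux term
  have m5 : |L.dx ^ 2 * (L.lam * ∑ j ∈ Finset.range r, L.u (k + j) J) - u y t1 * D|
      ≤ D * (K * D + (1 + 2 * K) * ε) + M * ε := by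
    have e0 : L.dx ^ 2 * (L.lam * ∑ j ∈ Finset.range r, L.u (k + j) J) = L.dt * ∑ j ∈ Finset.range r, L.u (k + j) J := by
      rw [← L.lam_mul]; ring
    have e1 : |∑ j ∈ Finset.range r, L.u (k + j) J - r * u y t1| ≤ r * (K * D + (1 + 2 * K) * ε) := by
      have : ∑ j ∈ Finset.range r, L.u (k + j) J - r * u y t1 = ∑ j ∈ Finset.range r, (L.u (k + j) J - u y t1) := by
        rw [Finset.sum_sub_distrib]; simp
      rw [this]
      refine (Finset.abs_sum_le_sum_abs _ _).trans ?_
      refine (Finset.sum_le_card_nsmul _ _ (K * D + (1 + 2 * K) * ε) fun j hj => ?_).trans_eq (by simp; ring)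
      obtain ⟨p1, p2, p3, p4, p5⟩ := hts j (Finset.mem_range.1 hj).le
      have f0 := (hL (k + j) J p1 p3 (by simpa using hxs 0 (by omega))).1
      have f1 := R.lip (L.x J) y (L.t (k + j)) t1 p1 (by linarith) hb.le (by linarith)
      have f2 : K * (|L.x J - y| + |L.t (k + j) - t1|) ≤ K * (ε + (D + ε)) := by
        have : |L.x J - y| ≤ ε := by rw [abs_le]; constructor <;> linarith
        gcongr
      rw [abs_le] at *
      constructor <;> linarith
    have e2 : L.dt * ∑ j ∈ Finset.range r, L.u (k + j) J - u y t1 * D =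
      L.dt * (∑ j ∈ Finset.range r, L.u (k + j) J - r * u y t1) + (r * L.dt - D) * u y t1 := by ring
    have hu0 := R.nonneg y t1 hb.le (by linarith)
    have hu := R.le y t1 hb.le (by linarith)
    rw [e0, e2]
    refine (abs_add_le _ _).trans ?_
    rw [abs_mul, abs_mul, abs_of_pos hτ, abs_of_nonneg hu0]
    have g1 : |r * L.dt - D| ≤ ε := by rw [abs_le]; constructor <;> linarith
    have g2 : |r * L.dt - D| * u y t1 ≤ ε * M := by gcongr
    have g3 : L.dt * |∑ j ∈ Finset.range r, L.u (k + j) J - r * u y t1| ≤ D * (K * D + (1 + 2 * K) * ε) :=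
      calc _ ≤ L.dt * (r * (K * D + (1 + 2 * K) * ε)) := by gcongr
        _ = (r * L.dt) * (K * D + (1 + 2 * K) * ε) := by ring
        _ ≤ _ := by gcongr
    linarith
  have hX2 : (X + 4 * ε) ^ 2 ≤ X ^ 2 + 8 * (X + 2) * ε := by nlinarith [mul_le_mul_of_nonneg_left hε1.le hε.le]
  have hX3 : (X + 4 * ε) ^ 2 * ((2 + K) * ε) ≤ (X + 4) ^ 2 * ((2 + K) * ε) := by gcongr; linarith
  have hX4 : (X + 4 * ε) ^ 2 * ((K + M ^ 2) * D) ≤ (X ^ 2 + 8 * (X + 2) * ε) * ((K + M ^ 2) * D) := by gcongr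
  rw [hmom] at m2
  rw [abs_le] at m1 m2 m3 m4 m5
  rw [abs_le]
  constructor <;> linarith

end Reg

theorem Jet2.family {f f1 f2 : ℝ → ℝ} {U : Set ℝ} (hU : IsOpen U) (h : ∀ y ∈ U, Jet2 f y (f1 y) (f2 y)) :
    ∀ y ∈ U, HasDerivAt f (f1 y) y ∧ HasDerivAt f1 (f2 y) y := by
  have h1 : ∀ y ∈ U, HasDerivAt f (f1 y) y := fun y hy => (h y hy).hasDerivAt
  refine fun y hy => ⟨h1 y hy, ?_⟩
  obtain ⟨f', -, e1, e2⟩ := h y hy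
  refine e2.congr_of_eventuallyEq ?_
  filter_upwards [e1, hU.mem_nhds hy] with z a b using (h1 z b).unique a

theorem exists_slope {φ φ1 φ2 : ℝ → ℝ} {H B : ℝ} (hB : 0 ≤ B)
    (h1 : ∀ y < H, HasDerivAt φ (φ1 y) y ∧ HasDerivAt φ1 (φ2 y) y) (h2 : ∀ y < H, |φ2 y| ≤ B)
    (hc : Continuous φ) (h0 : φ H = 0) : ∃ σ, ∀ ξ ≥ 0, |φ (H - ξ) - σ * ξ| ≤ B * ξ ^ 2 := by
  have hl : LipschitzOnWith B.toNNReal φ1 (Iio H) := by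
    refine Convex.lipschitzOnWith_of_nnnorm_hasDerivWithin_le (f' := φ2) (convex_Iio H)
      (fun y hy => (h1 y hy).2.hasDerivWithinAt) fun y hy => ?_
    rw [← NNReal.coe_le_coe, coe_nnnorm, Real.norm_eq_abs, Real.coe_toNNReal _ hB]
    exact h2 y hy
  obtain ⟨ψ, hψ, heq⟩ := hl.extend_real
  refine ⟨-ψ H, fun ξ hξ => ?_⟩
  rcases hξ.eq_or_lt with rfl | hξ
  · simp [h0]
  have hd : ∀ y ∈ Ioo (H - ξ) H, HasDerivAt (fun y => φ y - ψ H * y) (φ1 y - ψ H) y := fun y hy =>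
    ((h1 y hy.2).1.sub ((hasDerivAt_id y).const_mul (ψ H))).congr_deriv (by simp)
  obtain ⟨c, hc1, hc2⟩ := exists_hasDerivAt_eq_slope _ _ (show H - ξ < H by linarith)
    (by fun_prop) hd
  have e1 : |φ1 c - ψ H| ≤ B * ξ := by
    rw [heq hc1.2]
    have := hψ.dist_le_mul c H
    rw [Real.dist_eq, Real.dist_eq, Real.coe_toNNReal _ hB] at this
    refine this.trans ?_
    gcongr
    rw [abs_le]; constructor <;> linarith [hc1.1, hc1.2]
  rw [sub_sub_cancel, eq_div_iff hξ.ne', h0] at hc2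
  have e2 : φ (H - ξ) - -ψ H * ξ = -((φ1 c - ψ H) * ξ) := by linarith
  rw [e2, abs_neg, abs_mul, abs_of_pos hξ]
  calc _ ≤ B * ξ * ξ := by gcongr
    _ = _ := by ring

namespace Reg

variable {ℓ M K b T : ℝ} {g : ℝ → ℝ} {u : ℝ → ℝ → ℝ} {h : ℝ → ℝ}

theorem continuous_slice (R : Reg ℓ M K b T g u h) {t : ℝ} (hb : b ≤ t) (hT : t ≤ T) :
    Continuous fun y => u y t := by
  have hK := R.K_pos
  refine Metric.continuous_iff.2 fun y ε hε => ⟨ε / K, by positivity, fun y' hd => ?_⟩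
  rw [Real.dist_eq] at hd ⊢
  have := R.lipx y' y t hb hT
  rw [lt_div_iff₀ hK] at hd
  linarith

theorem abs_time_deriv_le (R : Reg ℓ M K b T g u h) {x t v : ℝ} (hb : b < t) (hT : t < T)
    (hv : HasDerivAt (fun s => u x s) v t) : |v| ≤ K := by
  have h1 := hv.le_of_lip' (C := K) R.K_pos.le (by
    filter_upwards [Ioo_mem_nhds hb hT] with s hs
    simpa using R.lipt x s t hs.1.le hs.2.le hb.le hT.le)
  simpa using h1

theorem exists_slope_at (R : Reg ℓ M K b T g u h) (hg : ∀ x, 0 ≤ g x ∧ g x ≤ M) {t : ℝ} (hb : b < t)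
    (hT : t < T) : ∃ σ, ∀ ξ ≥ 0, |u (h t - ξ) t - σ * ξ| ≤ (K + M ^ 2) * ξ ^ 2 := by
  have hj : ∀ y, ∃ p : ℝ × ℝ, y < h t → Jet u y t (p.2 + u y t * (g y - u y t)) p.1 p.2 := by
    intro y
    by_cases hy : y < h t
    · obtain ⟨a, c, H⟩ := R.jet hb hT hy
      exact ⟨(a, c), fun _ => H⟩
    · exact ⟨0, fun h => absurd h hy⟩
  choose p hp using hj
  have hK := R.K_pos
  refine exists_slope (φ := fun y => u y t) (φ1 := fun y => (p y).1) (φ2 := fun y => (p y).2) (by positivity)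
    (Jet2.family isOpen_Iio fun y hy => (hp y hy).2) (fun y hy => ?_) (R.continuous_slice hb.le hT.le)
    (R.zero _ _ hb.le hT.le le_rfl)
  have h1 := R.abs_time_deriv_le hb hT (hp y hy).1
  have h2 := R.nonneg y t hb.le hT.le
  have h3 := R.le y t hb.le hT.le
  have h4 := hg y
  have h5 : |u y t * (g y - u y t)| ≤ M ^ 2 := by
    rw [abs_mul, abs_of_nonneg h2, sq]
    have : |g y - u y t| ≤ M := by rw [abs_le]; constructor <;> linarith
    have := R.M_pos
    gcongr
  rw [abs_le] at *
  constructor <;> linarith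

set_option maxHeartbeats 2000000 in
theorem exists_front_slope (R : Reg ℓ M K b T g u h) (hg : ∀ x, 0 ≤ g x ∧ g x ≤ M) : ∃ σ : ℝ → ℝ,
    (∀ t, b < t → t < T → ∀ ξ ≥ 0, |u (h t - ξ) t - σ t * ξ| ≤ (K + M ^ 2) * ξ ^ 2) ∧
    (∀ t, b < t → t < T → HasDerivAt h (σ t / ℓ) t) ∧ ContinuousOn σ (Ioo b T) := by
  have hK := R.K_pos
  have hM := R.M_pos
  have hℓ := R.ℓ_pos
  have hex : ∀ t, ∃ σ, b < t → t < T → ∀ ξ ≥ 0, |u (h t - ξ) t - σ * ξ| ≤ (K + M ^ 2) * ξ ^ 2 := by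
    intro t
    by_cases h1 : b < t ∧ t < T
    · obtain ⟨σ, hσ⟩ := R.exists_slope_at hg h1.1 h1.2
      exact ⟨σ, fun _ _ => hσ⟩
    · exact ⟨0, fun a b => absurd ⟨a, b⟩ h1⟩
  choose σ hσ using hex
  obtain ⟨C, hC, hC1, hC2⟩ : ∃ C > 0, ℓ * K ^ 2 + (K + M ^ 2) + (K + M ^ 2) * (1 + K) ^ 2 + K ≤ C ∧
      2 * (K + M ^ 2) + K * (K + 1) ≤ C :=
    ⟨ℓ * K ^ 2 + (K + M ^ 2) + (K + M ^ 2) * (1 + K) ^ 2 + K + (2 * (K + M ^ 2) + K * (K + 1)), by positivity,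
      le_add_of_nonneg_right (by positivity), le_add_of_nonneg_left (by positivity)⟩
  have hσc : ∀ t1 t2 q, b < t1 → t1 < t2 → t2 < T → 0 < q → t2 - t1 = q ^ 2 → |σ t2 - σ t1| ≤ C * q := by
    intro t1 t2 q hb ht hT hq hqe
    have h1 := hσ t1 hb (by linarith) q hq.le
    have h2 := hσ t2 (by linarith) hT q hq.le
    have h3 := R.lip (h t2 - q) (h t1 - q) t2 t1 (by linarith) hT.le hb.le (by linarith)
    have h4 := R.liph t2 t1 (by linarith) hT.le hb.le (by linarith)
    rw [sub_sub_sub_cancel_right, abs_of_pos (show 0 < t2 - t1 by linarith), hqe] at h3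
    rw [abs_of_pos (show 0 < t2 - t1 by linarith), hqe] at h4
    have h5 : K * (|h t2 - h t1| + q ^ 2) ≤ K * (K * q ^ 2 + q ^ 2) := by gcongr
    have : |σ t2 - σ t1| * q ≤ C * q * q := by
      have e : |σ t2 - σ t1| * q = |(σ t2 - σ t1) * q| := by rw [abs_mul, abs_of_pos hq]
      have e2 := mul_le_mul_of_nonneg_right hC2 (sq_nonneg q)
      rw [e]
      rw [abs_le] at h1 h2 h3 ⊢
      constructor <;> linarith
    exact le_of_mul_le_mul_right this hq
  have hh : ∀ t1 t2 q, b < t1 → t1 < t2 → t2 < T → 0 < q → q ≤ 1 → t2 - t1 = q ^ 2 →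
      |ℓ * (h t2 - h t1) - σ t1 * q ^ 2| ≤ C * q * q ^ 2 := by
    intro t1 t2 q hb ht hT hq hq1 hqe
    have h1 := hσ t1 hb (by linarith) q hq.le
    have h2 := R.weak (y := h t1 - q) hb ht hT.le (by linarith)
    have h3 := R.liph t2 t1 (by linarith) hT.le hb.le (by linarith)
    have h4 := R.h_mono t1 t2 hb.le ht.le hT.le
    rw [abs_of_pos (show 0 < t2 - t1 by linarith), abs_of_nonneg (show 0 ≤ h t2 - h t1 by linarith), hqe] at h3
    obtain ⟨δ, hδ⟩ : ∃ δ, δ = h t2 - h t1 := ⟨_, rfl⟩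
    have e1 : h t2 - (h t1 - q) = q + δ := by rw [hδ]; ring
    have e2 : h t1 - (h t1 - q) = q := by ring
    rw [hqe, e1, e2] at h2
    rw [← hδ] at h3 ⊢
    have hδ0 : 0 ≤ δ := by linarith
    have f1 : δ ^ 2 ≤ (K * q ^ 2) ^ 2 := by gcongr
    have f2 : (q + δ) ^ 2 ≤ ((1 + K) * q) ^ 2 := by
      have : K * q ^ 2 ≤ K * q := by
        gcongr; nlinarith
      gcongr; linarith
    have : |ℓ * δ - σ t1 * q ^ 2| * q ≤ C * q * q ^ 2 * q := by
      have e : |ℓ * δ - σ t1 * q ^ 2| * q = |(ℓ * δ - σ t1 * q ^ 2) * q| := by rw [abs_mul, abs_of_pos hq]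
      have e3 : (K + M ^ 2) * (q + δ) ^ 2 * q ^ 2 ≤ (K + M ^ 2) * ((1 + K) * q) ^ 2 * q ^ 2 := by gcongr
      have e4 : ℓ * δ ^ 2 ≤ ℓ * (K * q ^ 2) ^ 2 := by gcongr
      have e5 := mul_le_mul_of_nonneg_right hC1 (show 0 ≤ q ^ 4 by positivity)
      have e6 : |u (h t1 - q) t1 * q ^ 2 - σ t1 * q * q ^ 2| ≤ (K + M ^ 2) * q ^ 2 * q ^ 2 := by
        rw [← sub_mul, abs_mul, abs_of_nonneg (sq_nonneg q)]; gcongr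
      have e7 : 0 ≤ ℓ * δ ^ 2 := by positivity
      rw [e]
      rw [abs_le] at h2 e6 ⊢
      constructor <;> linarith
    exact le_of_mul_le_mul_right this hq
  refine ⟨σ, hσ, fun t hb hT => ?_, fun t ht => ?_⟩
  · refine hasDerivAt_of_bound fun ε hε => ?_
    obtain ⟨δ, hδ, hδ1, hδ2, hδ3, hδ4⟩ : ∃ δ > 0, δ ≤ 1 ∧ 2 * C * δ ≤ ε * ℓ ∧ δ ^ 2 < t - b ∧ δ ^ 2 < T - t := by
      obtain ⟨δ, hδ, hδ'⟩ : ∃ δ > 0, δ < min (min 1 (ε * ℓ / (2 * C))) (min (t - b) (T - t)) :=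
        exists_between (by
          refine lt_min (by positivity) (lt_min (by linarith) (by linarith)))
      simp only [lt_min_iff] at hδ'
      obtain ⟨⟨a1, a2⟩, a3, a4⟩ := hδ'
      have : δ ^ 2 ≤ δ := by nlinarith
      rw [lt_div_iff₀ (by positivity)] at a2
      exact ⟨δ, hδ, a1.le, by linarith, by linarith, by linarith⟩
    refine ⟨δ ^ 2, by positivity, fun s hs => ?_⟩
    obtain ⟨q, hq0, hqe⟩ : ∃ q ≥ 0, q ^ 2 = |s| := ⟨√|s|, by positivity, Real.sq_sqrt (abs_nonneg s)⟩
    have hqδ : q ≤ δ := by nlinarith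
    rcases eq_or_lt_of_le hq0 with hq | hq
    · have : |s| = 0 := by rw [← hqe, ← hq]; norm_num
      rw [abs_eq_zero.1 this]; simp
    have hfin : C * q * q ^ 2 + C * q * q ^ 2 ≤ ε * q ^ 2 * ℓ := by
      have : C * q ≤ C * δ := by gcongr
      nlinarith [sq_nonneg q]
    rw [← hqe]
    refine le_of_mul_le_mul_right (le_trans ?_ hfin) hℓ
    rw [← abs_of_pos hℓ, ← abs_mul, abs_of_pos hℓ]
    have e : (h (t + s) - h t - σ t / ℓ * s) * ℓ = ℓ * (h (t + s) - h t) - σ t * s := by field_simp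
    rw [e]
    have hpos : 0 ≤ C * q * q ^ 2 := by positivity
    rcases le_total 0 s with h0 | h0
    · rw [abs_of_nonneg h0] at hqe
      have := hh t (t + s) q hb (by nlinarith) (by nlinarith) hq (by linarith) (by linarith)
      rw [← hqe] at this ⊢; linarith
    · rw [abs_of_nonpos h0] at hqe
      have hs' : s = -q ^ 2 := by linarith
      have a1 := hh (t + s) t q (by nlinarith) (by nlinarith) hT hq (by linarith) (by linarith)
      have a2 := hσc (t + s) t q (by nlinarith) (by nlinarith) hT hq (by linarith)
      have a3 : |σ t * q ^ 2 - σ (t + s) * q ^ 2| ≤ C * q * q ^ 2 := by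
        rw [← sub_mul, abs_mul, abs_of_nonneg (sq_nonneg q)]; gcongr
      rw [show σ t * s = -(σ t * q ^ 2) by rw [hs']; ring]
      rw [show ℓ * (h (t + s) - h t) - -(σ t * q ^ 2) =
        (σ t * q ^ 2 - σ (t + s) * q ^ 2) - (ℓ * (h t - h (t + s)) - σ (t + s) * q ^ 2) by ring]
      exact (abs_sub _ _).trans (by linarith)
  · rw [Metric.continuousWithinAt_iff]
    intro ε hε
    refine ⟨(ε / (2 * C)) ^ 2, by positivity, fun s hs hd => ?_⟩
    rw [Real.dist_eq] at hd ⊢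
    obtain ⟨q, hq0, hqe⟩ : ∃ q ≥ 0, q ^ 2 = |s - t| := ⟨√|s - t|, by positivity, Real.sq_sqrt (abs_nonneg _)⟩
    have hqδ : q < ε / (2 * C) := by
      refine lt_of_pow_lt_pow_left₀ 2 (by positivity) (by linarith)
    rw [lt_div_iff₀ (by positivity)] at hqδ
    rcases lt_trichotomy s t with h1 | h1 | h1
    · rw [abs_of_neg (by linarith)] at hqe
      have := hσc s t q hs.1 h1 ht.2 (lt_of_le_of_ne hq0 (by rintro rfl; norm_num at hqe; linarith)) (by linarith)
      rw [abs_sub_comm]; linarith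
    · rw [h1]; simpa using hε
    · rw [abs_of_pos (by linarith)] at hqe
      have := hσc t s q ht.1 h1 hs.2 (lt_of_le_of_ne hq0 (by rintro rfl; norm_num at hqe; linarith)) (by linarith)
      linarith

end Reg

/-- The region between two moving edges. -/
def tube (l r : ℝ → ℝ) (t0 t1 : ℝ) : Set (ℝ × ℝ) :=
  {p | (t0 ≤ p.2 ∧ p.2 ≤ t1) ∧ l p.2 ≤ p.1 ∧ p.1 ≤ r p.2}

theorem isClosed_tube {l r : ℝ → ℝ} (hl : Continuous l) (hr : Continuous r) (t0 t1 : ℝ) :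
    IsClosed (tube l r t0 t1) := by
  refine ((isClosed_le ?_ ?_).and (isClosed_le ?_ ?_)).and ((isClosed_le ?_ ?_).and (isClosed_le ?_ ?_))
  all_goals fun_prop

set_option maxHeartbeats 1000000 in
/-- Quantitative spreading of positivity, with linear growth at the moving edges. -/
theorem exists_hopf_const {V ρ0 ρ1 K τ : ℝ} (hV : 0 ≤ V) (hρ0 : 0 < ρ0) (hρ : ρ0 ≤ ρ1) (hK : 0 ≤ K) :
    ∃ q > 0, ∀ (w : ℝ → ℝ → ℝ) (l r l' r' : ℝ → ℝ) (t0 η : ℝ), 0 ≤ τ → 0 ≤ η →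
      Continuous l → Continuous r →
      (∀ t, t0 ≤ t → t ≤ t0 + τ → ρ0 ≤ r t - l t ∧ r t - l t ≤ ρ1) →
      (∀ t, t0 < t → t ≤ t0 + τ → HasDerivAt l (l' t) t ∧ |l' t| ≤ V ∧ HasDerivAt r (r' t) t ∧ |r' t| ≤ V) →
      ContinuousOn (fun p : ℝ × ℝ => w p.1 p.2) (tube l r t0 (t0 + τ)) →
      (∀ p ∈ tube l r t0 (t0 + τ), 0 ≤ w p.1 p.2) →
      (∀ t x, t0 ≤ t → t ≤ t0 + τ → l t < x → x < r t → η ≤ w x t ∨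
        t0 < t ∧ ∃ wt wx wxx, Jet w x t wt wx wxx ∧ wxx - K * w x t ≤ wt) →
      ∀ x, l (t0 + τ) ≤ x → x ≤ r (t0 + τ) →
        η * q * ((x - l (t0 + τ)) * (r (t0 + τ) - x)) ≤ w x (t0 + τ) := by
  obtain ⟨N, hN0, hN⟩ : ∃ N > 0, V * ρ1 + 2 ≤ 2 * N * ρ0 ^ 2 := by
    have : 0 < V * ρ1 + 2 := by have := mul_nonneg hV (hρ0.le.trans hρ); linarith
    exact ⟨(V * ρ1 + 2) / (2 * ρ0 ^ 2), by positivity, by field_simp; exact le_rfl⟩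
  have hρ1 : 0 < ρ1 := by linarith
  obtain ⟨L, hL⟩ : ∃ L, L = K + N * (2 * V * ρ1 + 12) := ⟨_, rfl⟩
  have hL0 : 0 ≤ L := by rw [hL]; positivity
  obtain ⟨Q, hQ0, hQ⟩ : ∃ Q > 0, Q * (ρ1 ^ 2 + N * ρ1 ^ 4) = 1 :=
    ⟨(ρ1 ^ 2 + N * ρ1 ^ 4)⁻¹, by positivity, inv_mul_cancel₀ (by positivity)⟩
  refine ⟨Q * Real.exp (-L * τ), by positivity, ?_⟩
  intro w l r l' r' t0 η hτ hη hlc hrc hlr hd hw hw0 h x hx1 hx2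
  obtain ⟨B, hB⟩ : ∃ B : ℝ → ℝ → ℝ, ∀ x t, B x t = (x - l t) * (r t - x) + N * ((x - l t) * (r t - x)) ^ 2 :=
    ⟨_, fun _ _ => rfl⟩
  have hBb : ∀ x t, t0 ≤ t → t ≤ t0 + τ → l t ≤ x → x ≤ r t → 0 ≤ B x t ∧ Q * B x t ≤ 1 := by
    intro x t h1 h2 h3 h4
    obtain ⟨h5, h6⟩ := hlr t h1 h2
    have hA0 : 0 ≤ (x - l t) * (r t - x) := mul_nonneg (by linarith) (by linarith)
    have hA1 : (x - l t) * (r t - x) ≤ ρ1 ^ 2 := by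
      rw [sq]; exact mul_le_mul (by linarith) (by linarith) (by linarith) hρ1.le
    rw [hB]
    generalize (x - l t) * (r t - x) = A at *
    refine ⟨by positivity, ?_⟩
    rw [← hQ]
    have : A ^ 2 ≤ ρ1 ^ 4 := by
      calc A ^ 2 ≤ (ρ1 ^ 2) ^ 2 := by gcongr
        _ = ρ1 ^ 4 := by ring
    gcongr
  have key := max_principle (isClosed_tube hlc hrc t0 (t0 + τ)) (t0 := t0) (t1 := t0 + τ) (K := -K) (B := η)
    (z := fun x t => w x t - η * Q * Real.exp (-L * (t - t0)) * B x t) (fun p hp => hp.1) ?_ ?_ ?_ x (t0 + τ)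
    ⟨⟨by simpa using hτ, le_rfl⟩, hx1, hx2⟩
  · simp only [add_sub_cancel_left, hB] at key
    have : 0 ≤ η * Q * Real.exp (-L * τ) * (N * ((x - l (t0 + τ)) * (r (t0 + τ) - x)) ^ 2) := by positivity
    linarith
  · refine hw.sub (Continuous.continuousOn ?_)
    simp only [hB]; fun_prop
  · intro p hp
    have h1 := hw0 p hp
    obtain ⟨h2, h3⟩ := hBb p.1 p.2 hp.1.1 hp.1.2 hp.2.1 hp.2.2
    have h4 : Real.exp (-L * (p.2 - t0)) ≤ 1 := Real.exp_le_one_iff.2 (by nlinarith [hp.1.1])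
    have h5 : η * Real.exp (-L * (p.2 - t0)) * (Q * B p.1 p.2) ≤ η * 1 * 1 := by gcongr
    linarith
  · rintro x t ⟨⟨ht0, ht1⟩, hxl, hxr⟩ hz
    simp only at ht0 ht1 hxl hxr hz
    have hwx := hw0 (x, t) ⟨⟨ht0, ht1⟩, hxl, hxr⟩
    obtain ⟨hb0, hb1⟩ := hBb x t ht0 ht1 hxl hxr
    have hE0 := Real.exp_pos (-L * (t - t0))
    have hE1 : Real.exp (-L * (t - t0)) ≤ 1 := Real.exp_le_one_iff.2 (by nlinarith)
    have hBpos : 0 < B x t := by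
      refine lt_of_le_of_ne hb0 fun h0 => ?_
      rw [← h0] at hz; simp only at hwx; linarith
    have hxl' : l t < x := by
      refine lt_of_le_of_ne hxl fun h0 => ?_
      rw [hB, h0] at hBpos; simp at hBpos
    have hxr' : x < r t := by
      refine lt_of_le_of_ne hxr fun h0 => ?_
      rw [hB, h0] at hBpos; simp at hBpos
    rcases h t x ht0 ht1 hxl' hxr' with h1 | ⟨ht, wt, wx, wxx, hJ, hJ'⟩
    · exfalso
      have h5 : η * Real.exp (-L * (t - t0)) * (Q * B x t) ≤ η * 1 * 1 := by gcongr
      linarith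
    refine ⟨?_, ?_, ?_⟩
    · filter_upwards [Ioo_mem_nhds hxl' hxr'] with y hy using ⟨⟨ht0, ht1⟩, hy.1.le, hy.2.le⟩
    · have e1 : ∀ᶠ s in 𝓝[<] t, l s < x := (hlc.tendsto t).mono_left inf_le_left |>.eventually (gt_mem_nhds hxl')
      have e2 : ∀ᶠ s in 𝓝[<] t, x < r s := (hrc.tendsto t).mono_left inf_le_left |>.eventually (lt_mem_nhds hxr')
      filter_upwards [e1, e2, eventually_left_Icc ht ht1] with s h1 h2 h3 using ⟨h3, h1.le, h2.le⟩
    · obtain ⟨dl, dlb, dr, drb⟩ := hd t ht ht1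
      have hA := ((Jet.of_space (t := t) (Jet2.id x)).sub (Jet.of_time (x := x) dl)).mul
        ((Jet.of_time (x := x) dr).sub (Jet.of_space (t := t) (Jet2.id x)))
      have hBJ := hA.add ((hA.mul hA).const_mul N)
      have hE : HasDerivAt (fun s => η * Q * Real.exp (-L * (s - t0))) (-L * (η * Q * Real.exp (-L * (t - t0)))) t := by
        have := ((((hasDerivAt_id t).sub_const t0).const_mul (-L)).exp).const_mul (η * Q)
        exact this.congr_deriv (by simp only [id]; ring)
      have hβ := (Jet.of_time (x := x) hE).mul hBJ
      have hfun : (fun x t => w x t - η * Q * Real.exp (-L * (t - t0)) * B x t) = fun x t => w x t -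
          η * Q * Real.exp (-L * (t - t0)) * ((x - l t) * (r t - x) + N * (((x - l t) * (r t - x)) * ((x - l t) * (r t - x)))) := by
        funext x t; rw [hB]; ring
      refine ⟨_, _, _, hfun ▸ hJ.sub hβ, ?_⟩
      obtain ⟨h5, h6⟩ := hlr t ht0 ht1
      have hA0 : 0 ≤ (x - l t) * (r t - x) := mul_nonneg (by linarith) (by linarith)
      rw [hB] 
      obtain ⟨D, hD0, hD⟩ : ∃ D ≥ 0, D = η * Q * Real.exp (-L * (t - t0)) := ⟨_, by positivity, rfl⟩
      rw [← hD] at *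
      have hAt : -(l' t) * (r t - x) + (x - l t) * r' t ≤ V * ρ1 := by
        rw [abs_le] at dlb drb
        have e1 : -(l' t) * (r t - x) ≤ V * (r t - x) := mul_le_mul_of_nonneg_right (by linarith) (by linarith)
        have e2 : (x - l t) * r' t ≤ (x - l t) * V := mul_le_mul_of_nonneg_left (by linarith) (by linarith)
        linarith [mul_le_mul_of_nonneg_left h6 hV]
      have hAx : (r t + l t - 2 * x) ^ 2 = (r t - l t) ^ 2 - 4 * ((x - l t) * (r t - x)) := by ring
      have hsq : ρ0 ^ 2 ≤ (r t - l t) ^ 2 := by gcongr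
      have main : -L * ((x - l t) * (r t - x) + N * ((x - l t) * (r t - x)) ^ 2)
          + (1 + 2 * N * ((x - l t) * (r t - x))) * (-(l' t) * (r t - x) + (x - l t) * r' t)
          - (-2 - 4 * N * ((x - l t) * (r t - x)) + 2 * N * (r t + l t - 2 * x) ^ 2)
          + K * ((x - l t) * (r t - x) + N * ((x - l t) * (r t - x)) ^ 2) ≤ 0 := by
        rw [hAx]
        generalize (x - l t) * (r t - x) = A at *
        have e1 : (1 + 2 * N * A) * (-(l' t) * (r t - x) + (x - l t) * r' t) ≤ (1 + 2 * N * A) * (V * ρ1) := by gcongr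
        have e2 : 2 * N * ρ0 ^ 2 ≤ 2 * N * (r t - l t) ^ 2 := by gcongr
        have e3 : 0 ≤ (L - K) * (N * A ^ 2) := mul_nonneg (by rw [hL]; linarith [show 0 ≤ N * (2 * V * ρ1 + 12) by positivity]) (by positivity)
        have e4 : (L - K) * A = N * (2 * V * ρ1 + 12) * A := by rw [hL]; ring
        linarith
      have := mul_le_mul_of_nonneg_left main hD0
      linarith

/-- Exponential decay behind a front for linear parabolic inequalities with a strict supersolution. -/
theorem exists_decay_rate {η P V : ℝ} (hη : 0 < η) (hP : 0 ≤ P) (hV : 0 ≤ V) :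
    ∃ lam > 0, ∀ (z v : ℝ → ℝ → ℝ) (h h' : ℝ → ℝ) (A B K t0 t1 : ℝ), Continuous h →
      (∀ t, t0 < t → t ≤ t1 → HasDerivAt h (h' t) t ∧ h' t ≤ V) →
      Continuous (fun p : ℝ × ℝ => z p.1 p.2) → Continuous (fun p : ℝ × ℝ => v p.1 p.2) →
      (∀ t x, t0 ≤ t → t ≤ t1 → x ≤ h t - A → 0 ≤ v x t ∧ z x t ≤ B) →
      (∀ x, x ≤ h t0 - A → z x t0 ≤ v x t0) →
      (∀ t, t0 ≤ t → t ≤ t1 → z (h t - A) t ≤ v (h t - A) t) →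
      (∀ t x, t0 < t → t ≤ t1 → x < h t - A → ∃ zt zx zxx vt vx vxx c, Jet z x t zt zx zxx ∧
        Jet v x t vt vx vxx ∧ zt ≤ zxx + c * z x t ∧ vxx + (c + η) * v x t ≤ vt ∧ |vx| ≤ P * v x t ∧ c ≤ K) →
      ∀ t x, t0 ≤ t → t ≤ t1 → x ≤ h t - A →
        z x t ≤ v x t * (Real.exp (lam * (x - (h t - A))) + Real.exp (-lam * (t - t0))) := by
  obtain ⟨lam, hl0, hl1, hl2, hl3⟩ : ∃ lam > 0, lam ≤ 1 ∧ lam ≤ η ∧ lam * (V + 2 * P + 1) ≤ η := by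
    have hD : 0 < V + 2 * P + 1 + η := by linarith
    refine ⟨η / (V + 2 * P + 1 + η), by positivity, ?_, ?_, ?_⟩
    · rw [div_le_one hD]; linarith
    · rw [div_le_iff₀ hD]; nlinarith
    · rw [div_mul_eq_mul_div, div_le_iff₀ hD]; nlinarith
  refine ⟨lam, hl0, ?_⟩
  intro z v h h' A B K t0 t1 hhc hhd hz hv hb h0 hside hJ t x ht0 ht1 hx
  have hcl : IsClosed {p : ℝ × ℝ | (t0 ≤ p.2 ∧ p.2 ≤ t1) ∧ p.1 ≤ h p.2 - A} := by
    refine ((isClosed_le ?_ ?_).and (isClosed_le ?_ ?_)).and (isClosed_le ?_ ?_)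
    all_goals fun_prop
  have key := max_principle hcl (t0 := t0) (t1 := t1) (K := K) (B := B)
    (z := fun x t => v x t * (Real.exp (lam * (x - (h t - A))) + Real.exp (-lam * (t - t0))) - z x t)
    (fun p hp => hp.1) (Continuous.continuousOn (by fun_prop)) ?_ ?_ x t ⟨⟨ht0, ht1⟩, hx⟩
  · linarith
  · rintro p ⟨⟨h1, h2⟩, h3⟩
    obtain ⟨h4, h5⟩ := hb p.2 p.1 h1 h2 h3
    have := mul_nonneg h4 (show 0 ≤ Real.exp (lam * (p.1 - (h p.2 - A))) + Real.exp (-lam * (p.2 - t0)) by positivity)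
    linarith
  · rintro x t ⟨⟨ht0, ht1⟩, hx⟩ hneg
    simp only at ht0 ht1 hx hneg
    obtain ⟨hv0, -⟩ := hb t x ht0 ht1 hx
    have E1 := Real.exp_pos (lam * (x - (h t - A)))
    have E2 := Real.exp_pos (-lam * (t - t0))
    have ht : t0 < t := by
      refine lt_of_le_of_ne ht0 ?_
      rintro rfl
      have := h0 x hx
      rw [sub_self, mul_zero, Real.exp_zero] at hneg
      nlinarith
    have hx' : x < h t - A := by
      refine lt_of_le_of_ne hx ?_
      rintro rfl
      have := hside t ht0 ht1
      rw [sub_self, mul_zero, Real.exp_zero] at hneg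
      nlinarith
    refine ⟨?_, ?_, ?_⟩
    · filter_upwards [Iio_mem_nhds hx'] with y hy using ⟨⟨ht0, ht1⟩, le_of_lt hy⟩
    · have e1 : ∀ᶠ s in 𝓝[<] t, x < h s - A :=
        ((hhc.sub continuous_const).tendsto t).mono_left inf_le_left |>.eventually (lt_mem_nhds hx')
      filter_upwards [e1, eventually_left_Icc ht ht1] with s h1 h3 using ⟨h3, h1.le⟩
    · obtain ⟨hd, hdV⟩ := hhd t ht ht1
      obtain ⟨zt, zx, zxx, vt, vx, vxx, c, hJz, hJv, hz1, hv1, hv2, hcK⟩ := hJ t x ht ht1 hx'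
      have j1 := (((Jet.of_space (t := t) (Jet2.id x)).sub (Jet.of_time (x := x) (hd.sub_const A))).const_mul lam).exp
      have j2 : HasDerivAt (fun s => Real.exp (-lam * (s - t0))) (-lam * Real.exp (-lam * (t - t0))) t := by
        have := ((((hasDerivAt_id t).sub_const t0).const_mul (-lam)).exp)
        exact this.congr_deriv (by simp only [id]; ring)
      refine ⟨_, _, _, (hJv.mul (j1.add (Jet.of_time (x := x) j2))).sub hJz, ?_⟩
      generalize Real.exp (lam * (x - (h t - A))) = a at *
      generalize Real.exp (-lam * (t - t0)) = e at *
      generalize v x t = V0 at *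
      have k1 : 0 ≤ (a + e) * (vt - vxx - (c + η) * V0) := mul_nonneg (by positivity) (by linarith)
      have k2 : 0 ≤ (K - c) * -(V0 * (a + e) - z x t) := mul_nonneg (by linarith) (by linarith)
      have k3 : 0 ≤ lam * a * V0 * (V - h' t) := mul_nonneg (by positivity) (by linarith)
      have k4 : 0 ≤ lam * a * (P * V0 - vx) := mul_nonneg (by positivity) (by linarith [(abs_le.1 hv2).2])
      have k5 : 0 ≤ a * V0 * (η - lam * (V + 2 * P + 1)) := mul_nonneg (by positivity) (by linarith)
      have k6 : 0 ≤ e * V0 * (η - lam) := mul_nonneg (by positivity) (by linarith)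
      have k7 : 0 ≤ a * V0 * lam * (1 - lam) := mul_nonneg (by positivity) (by linarith)
      nlinarith

/-- Classical monotone solution of the free boundary problem for times after `b`. -/
structure Clas (ℓ M b : ℝ) (g : ℝ → ℝ) (u : ℝ → ℝ → ℝ) (h : ℝ → ℝ) : Prop where
  cont_u : Continuous (fun p : ℝ × ℝ => u p.1 p.2)
  cont_h : Continuous h
  ℓ_pos : 0 < ℓ
  M_pos : 0 < M
  g_nonneg : ∀ x, 0 ≤ g x
  g_le : ∀ x, g x ≤ M
  nonneg : ∀ x t, b ≤ t → 0 ≤ u x t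
  le : ∀ x t, b ≤ t → u x t ≤ M
  zero : ∀ x t, b ≤ t → h t ≤ x → u x t = 0
  mono : ∀ x s t, b ≤ s → s ≤ t → u x s ≤ u x t
  h_mono : ∀ s t, b ≤ s → s ≤ t → h s ≤ h t
  jet : ∀ x t, b < t → x < h t → ∃ zx zxx, Jet u x t (zxx + u x t * (g x - u x t)) zx zxx
  hd : ∀ t, b < t → HasDerivAt h (deriv h t) t
  front : ∀ t, b < t → ∃ C ≥ 0, ∀ ξ ≥ 0, |u (h t - ξ) t - ℓ * deriv h t * ξ| ≤ C * ξ ^ 2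

namespace Clas
variable {ℓ M b : ℝ} {g : ℝ → ℝ} {u : ℝ → ℝ → ℝ} {h : ℝ → ℝ}

theorem of_reg (hR : ∀ T > b, ∃ K, Reg ℓ M K b T g u h) (hu : Continuous (fun p : ℝ × ℝ => u p.1 p.2))
    (hh : Continuous h) (hg0 : ∀ x, 0 ≤ g x) (hgM : ∀ x, g x ≤ M)
    (hm : ∀ x s t, b ≤ s → s ≤ t → u x s ≤ u x t) : Clas ℓ M b g u h := by
  have hR' : ∀ t, b ≤ t → ∃ K, Reg ℓ M K b (t + 1) g u h := fun t ht => hR _ (by linarith)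
  obtain ⟨K0, R0⟩ := hR' b le_rfl
  have hf : ∀ t, b < t → HasDerivAt h (deriv h t) t ∧ ∃ C ≥ 0, ∀ ξ ≥ 0, |u (h t - ξ) t - ℓ * deriv h t * ξ| ≤ C * ξ ^ 2 := by
    intro t ht
    obtain ⟨K, R⟩ := hR' t ht.le
    obtain ⟨σ, h1, h2, -⟩ := R.exists_front_slope fun x => ⟨hg0 x, hgM x⟩
    have h3 := h2 t ht (by linarith)
    have hK := R.K_pos
    refine ⟨h3.differentiableAt.hasDerivAt, K + M ^ 2, by positivity, ?_⟩
    rw [h3.deriv, mul_div_cancel₀ _ R.ℓ_pos.ne']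
    exact h1 t ht (by linarith)
  refine ⟨hu, hh, R0.ℓ_pos, R0.M_pos, hg0, hgM, fun x t ht => ?_, fun x t ht => ?_, fun x t ht hx => ?_, hm,
    fun s t hs hst => ?_, fun x t ht hx => ?_, fun t ht => (hf t ht).1, fun t ht => (hf t ht).2⟩
  · obtain ⟨K, R⟩ := hR' t ht
    exact R.nonneg x t ht (by linarith)
  · obtain ⟨K, R⟩ := hR' t ht
    exact R.le x t ht (by linarith)
  · obtain ⟨K, R⟩ := hR' t ht
    exact R.zero x t ht (by linarith) hx
  · obtain ⟨K, R⟩ := hR' t (by linarith)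
    exact R.h_mono s t hs hst (by linarith)
  · obtain ⟨K, R⟩ := hR' t ht.le
    exact R.jet ht (by linarith) hx

theorem deriv_nonneg (S : Clas ℓ M b g u h) {t : ℝ} (ht : b < t) : 0 ≤ deriv h t := by
  have := HasDerivAt.nonpos_of_eventually_le_left (S.hd t ht).neg (by
    filter_upwards [eventually_left_Icc ht le_rfl] with s hs
    simp only [Pi.neg_apply, neg_le_neg_iff]
    exact S.h_mono s t hs.1 hs.2)
  linarith

theorem slope_ge (S : Clas ℓ M b g u h) {t k δ : ℝ} (ht : b < t) (hδ : 0 < δ)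
    (hk : ∀ ξ, 0 ≤ ξ → ξ ≤ δ → k * ξ ≤ u (h t - ξ) t) : k ≤ ℓ * deriv h t := by
  obtain ⟨C, hC, h1⟩ := S.front t ht
  refine le_of_forall_small (c := C) hδ fun ε hε hεδ => ?_
  have h2 := hk ε hε.le hεδ.le
  have h3 := (abs_le.1 (h1 ε hε.le)).2
  have : k * ε ≤ (ℓ * deriv h t + C * ε) * ε := by nlinarith
  exact le_of_mul_le_mul_right this hε

theorem slope_le (S : Clas ℓ M b g u h) {t k δ : ℝ} (ht : b < t) (hδ : 0 < δ)
    (hk : ∀ ξ, 0 ≤ ξ → ξ ≤ δ → u (h t - ξ) t ≤ k * ξ) : ℓ * deriv h t ≤ k := by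
  obtain ⟨C, hC, h1⟩ := S.front t ht
  refine le_of_forall_small (c := C) hδ fun ε hε hεδ => ?_
  have h2 := hk ε hε.le hεδ.le
  have h3 := (abs_le.1 (h1 ε hε.le)).1
  have : ℓ * deriv h t * ε ≤ (k + C * ε) * ε := by nlinarith
  exact le_of_mul_le_mul_right this hε

theorem time_deriv_nonneg (S : Clas ℓ M b g u h) {x t zt zx zxx : ℝ} (ht : b < t)
    (hJ : Jet u x t zt zx zxx) : 0 ≤ zt := by
  have := HasDerivAt.nonpos_of_eventually_le_left hJ.1.neg (by
    filter_upwards [eventually_left_Icc ht le_rfl] with s hs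
    simp only [Pi.neg_apply, neg_le_neg_iff]
    exact S.mono x s t hs.1 hs.2)
  linarith

theorem slice (S : Clas ℓ M b g u h) {t : ℝ} (ht : b < t) : ∃ ux uxx : ℝ → ℝ, ∀ y < h t,
    Jet u y t (uxx y + u y t * (g y - u y t)) (ux y) (uxx y) ∧ HasDerivAt (fun y => u y t) (ux y) y ∧
    HasDerivAt ux (uxx y) y ∧ -(M * u y t) ≤ uxx y := by
  have h1 : ∀ y, ∃ p : ℝ × ℝ, y < h t → Jet u y t (p.2 + u y t * (g y - u y t)) p.1 p.2 := by
    intro y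
    by_cases hy : y < h t
    · obtain ⟨zx, zxx, hJ⟩ := S.jet y t ht hy
      exact ⟨(zx, zxx), fun _ => hJ⟩
    · exact ⟨0, fun a => absurd a hy⟩
  choose p hp using h1
  refine ⟨fun y => (p y).1, fun y => (p y).2, fun y hy => ⟨hp y hy, ?_⟩⟩
  have := Jet2.family isOpen_Iio (f := fun y => u y t) (f1 := fun y => (p y).1) (f2 := fun y => (p y).2) (fun y hy => (hp y hy).2) y hy
  refine ⟨this.1, this.2, ?_⟩
  have h2 := S.time_deriv_nonneg ht (hp y hy)
  have h3 := S.nonneg y t ht.le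
  have h4 := S.g_le y
  nlinarith

/-- Sturm comparison near the front. -/
theorem sturm (S : Clas ℓ M b g u h) {t : ℝ} (ht : b < t) : ∃ ux : ℝ → ℝ, (∀ y < h t, HasDerivAt (fun y => u y t) (ux y) y) ∧
    ∀ x < h t, M * (h t - x) ^ 2 ≤ 1 →
      ℓ * deriv h t ≤ -((1 - M * (h t - x) ^ 2 / 2) * ux x) + M * (h t - x) * u x t ∧
      ℓ * deriv h t * (h t - x) / 2 ≤ u x t := by
  obtain ⟨ux, uxx, hs⟩ := S.slice ht
  refine ⟨ux, fun y hy => (hs y hy).2.1, ?_⟩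
  have hM := S.M_pos
  obtain ⟨σ, hσ⟩ : ∃ σ, σ = ℓ * deriv h t := ⟨_, rfl⟩
  have hσ0 : 0 ≤ σ := hσ ▸ mul_nonneg S.ℓ_pos.le (S.deriv_nonneg ht)
  obtain ⟨C, hC, hf⟩ := S.front t ht
  have hz := S.zero (h t) t ht.le le_rfl
  have hn := fun y => S.nonneg y t ht.le
  have hcu : Continuous fun y => u y t := S.cont_u.comp (by fun_prop : Continuous fun y : ℝ => (y, t))
  rw [← hσ] at hf ⊢
  generalize h t = H at *
  obtain ⟨φ, hφ⟩ : ∃ φ : ℝ → ℝ, ∀ y, φ y = 1 - M * (H - y) ^ 2 / 2 := ⟨_, fun _ => rfl⟩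
  obtain ⟨Φ, hΦ⟩ : ∃ Φ : ℝ → ℝ, ∀ y, Φ y = -(φ y * ux y) + M * (H - y) * u y t := ⟨_, fun _ => rfl⟩
  have hφd : ∀ y, HasDerivAt φ (M * (H - y)) y := fun y => by
    have := (((((hasDerivAt_id y).const_sub H).pow 2).const_mul M).div_const 2).const_sub 1
    refine (this.congr_of_eventuallyEq (Eventually.of_forall fun z => hφ z)).congr_deriv ?_
    simp; ring
  have hΦd : ∀ y < H, HasDerivAt Φ (-(φ y * uxx y) - M * u y t) y := fun y hy => by
    have := ((hφd y).mul (hs y hy).2.2.1).neg.add ((((hasDerivAt_id y).const_sub H).const_mul M).mul (hs y hy).2.1)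
    refine (this.congr_of_eventuallyEq (Eventually.of_forall fun z => hΦ z)).congr_deriv ?_
    simp; ring
  have key : ∀ x < H, M * (H - x) ^ 2 ≤ 1 → 1 / 2 ≤ φ x ∧ φ x ≤ 1 ∧ (∀ y, x ≤ y → y < H → φ x ≤ φ y ∧ φ y ≤ 1 ∧ Φ y ≤ Φ x) ∧
      ∃ ζ ∈ Ioo x H, u x t / φ x = Φ ζ / φ ζ ^ 2 * (H - x) := by
    intro x hx hMx
    have h1 : ∀ y, x ≤ y → y ≤ H → φ x ≤ φ y ∧ φ y ≤ 1 := fun y hy1 hy2 => by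
      rw [hφ, hφ]
      have : (H - y) ^ 2 ≤ (H - x) ^ 2 := by
        apply pow_le_pow_left₀ <;> linarith
      have := mul_le_mul_of_nonneg_left this hM.le
      exact ⟨by linarith, by linarith [show 0 ≤ M * (H - y) ^ 2 by positivity]⟩
    have h0 : 1 / 2 ≤ φ x := by rw [hφ]; linarith
    have hanti : ∀ y, x ≤ y → y < H → Φ y ≤ Φ x := fun y hy1 hy2 => by
      have : AntitoneOn Φ (Icc x y) := by
        refine antitoneOn_of_deriv_nonpos (convex_Icc x y)
          (fun z hz => (hΦd z (by linarith [hz.2])).continuousAt.continuousWithinAt) (fun z hz => ?_) fun z hz => ?_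
        · rw [interior_Icc] at hz
          exact (hΦd z (by linarith [hz.2])).differentiableAt.differentiableWithinAt
        · rw [interior_Icc] at hz
          have hzH : z < H := by linarith [hz.2]
          rw [(hΦd z hzH).deriv]
          have h2 := h1 z hz.1.le hzH.le
          have h3 := (hs z hzH).2.2.2
          have h4 : φ z * -(M * u z t) ≤ φ z * uxx z := mul_le_mul_of_nonneg_left h3 (by linarith)
          have h5 : 0 ≤ (1 - φ z) * (M * u z t) := mul_nonneg (by linarith) (mul_nonneg hM.le (hn z))
          linarith
      exact this ⟨le_rfl, hy1⟩ ⟨hy1, le_rfl⟩ hy1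
    refine ⟨h0, (h1 x le_rfl hx.le).2, fun y hy1 hy2 => ⟨(h1 y hy1 hy2.le).1, (h1 y hy1 hy2.le).2, hanti y hy1 hy2⟩, ?_⟩
    obtain ⟨ζ, hζ, he⟩ := exists_hasDerivAt_eq_slope (fun y => u y t / φ y) (fun y => -(Φ y / φ y ^ 2)) hx
      (hcu.continuousOn.div (fun y _ => (hφd y).continuousAt.continuousWithinAt) fun y hy => by
        linarith [(h1 y hy.1 hy.2).1]) (fun y hy => by
        have hφy : φ y ≠ 0 := by linarith [(h1 y hy.1.le hy.2.le).1]
        refine ((hs y hy.2).2.1.div (hφd y) hφy).congr_deriv ?_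
        rw [hΦ]; field_simp; ring)
    refine ⟨ζ, hζ, ?_⟩
    rw [hz, zero_div, eq_div_iff (by linarith)] at he
    linarith
  have step : ∀ x < H, M * (H - x) ^ 2 ≤ 1 → σ ≤ Φ x := by
    intro x hx hMx
    refine le_of_forall_small (ε0 := min (H - x) 1) (c := C + σ * M) (lt_min (by linarith) one_pos) fun ε hε hε1 => ?_
    rw [lt_min_iff] at hε1
    obtain ⟨a1, a2, a3, -⟩ := key x hx hMx
    have hMy : M * (H - (H - ε)) ^ 2 ≤ 1 := by
      refine le_trans (mul_le_mul_of_nonneg_left ?_ hM.le) hMx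
      rw [sub_sub_cancel]; apply pow_le_pow_left₀ <;> linarith
    obtain ⟨b1, b2, b3, ζ, hζ, he⟩ := key (H - ε) (by linarith) hMy
    obtain ⟨c1, c2, c3⟩ := b3 ζ hζ.1.le hζ.2
    have c4 := (a3 ζ (by linarith [hζ.1]) hζ.2).2.2
    have h1 := (abs_le.1 (hf ε hε.le)).1
    rw [sub_sub_cancel] at he
    have h2 : u (H - ε) t ≤ u (H - ε) t / φ (H - ε) := by
      rw [le_div_iff₀ (by linarith)]; nlinarith [hn (H - ε)]
    have h3 : σ - C * ε ≤ Φ ζ / φ ζ ^ 2 := by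
      refine le_of_mul_le_mul_right ?_ hε
      linarith
    have hζp : 0 < φ ζ := by linarith
    rw [le_div_iff₀ (by positivity)] at h3
    have h4 : 1 - M * ε ^ 2 ≤ φ ζ ^ 2 := by
      have : φ (H - ε) = 1 - M * ε ^ 2 / 2 := by rw [hφ, sub_sub_cancel]
      nlinarith
    have h5 : φ ζ ^ 2 ≤ 1 := by nlinarith
    have h6 : ε ^ 2 ≤ ε := by nlinarith
    have h7 : σ * (1 - M * ε) ≤ σ * φ ζ ^ 2 := by
      apply mul_le_mul_of_nonneg_left _ hσ0
      nlinarith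
    have h8 : C * ε * φ ζ ^ 2 ≤ C * ε * 1 := by gcongr
    linarith
  intro x hx hMx
  have h1 := step x hx hMx
  refine ⟨by rw [hΦ, hφ] at h1; exact h1, ?_⟩
  obtain ⟨a1, a2, a3, ζ, hζ, he⟩ := key x hx hMx
  obtain ⟨c1, c2, c3⟩ := a3 ζ hζ.1.le hζ.2
  have h2 : σ ≤ Φ ζ := step ζ hζ.2 (le_trans (mul_le_mul_of_nonneg_left (by
    apply pow_le_pow_left₀ <;> linarith [hζ.1, hζ.2]) hM.le) hMx)
  have hζp : 0 < φ ζ := by linarith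
  have h3 : σ ≤ Φ ζ / φ ζ ^ 2 := by
    rw [le_div_iff₀ (by positivity)]
    have : σ * φ ζ ^ 2 ≤ σ * 1 := mul_le_mul_of_nonneg_left (by nlinarith) hσ0
    linarith
  have h4 : σ * (H - x) ≤ u x t / φ x := by
    rw [he]; exact mul_le_mul_of_nonneg_right h3 (by linarith)
  rw [le_div_iff₀ (by linarith)] at h4
  have : 0 ≤ σ * (H - x) := mul_nonneg hσ0 (by linarith)
  nlinarith

end Clas

namespace Clas
variable {ℓ M b : ℝ} {g : ℝ → ℝ} {u : ℝ → ℝ → ℝ} {h : ℝ → ℝ}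

set_option maxHeartbeats 1000000 in
theorem le_linear (S : Clas ℓ M b g u h) {A N : ℝ} (hN : 0 < N) (hNM : M ≤ 2 * N ^ 2) (hA : A ≤ M * N)
    (h0 : ∀ x ≤ h b, u x b ≤ A * (h b - x)) {x t : ℝ} (ht : b ≤ t) (hx : x ≤ h t) :
    u x t ≤ 2 * M * N * (h t - x) := by
  have hM := S.M_pos
  rcases lt_or_ge x (h t - 1 / N) with hfar | hnear
  · have h1 : 1 ≤ N * (h t - x) := by
      have : 1 / N < h t - x := by linarith
      rw [div_lt_iff₀ hN] at this; linarith
    have := S.le x t ht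
    nlinarith
  have hch := S.cont_h
  have hcu := S.cont_u
  have key := max_principle (isClosed_tube (l := fun t => h t - 1 / N) (r := h) (by fun_prop) S.cont_h b t)
    (t0 := b) (t1 := t) (K := 0) (B := M)
    (z := fun x t => M * (2 * N * (h t - x) - N ^ 2 * (h t - x) ^ 2) - u x t) (fun p hp => hp.1)
    (Continuous.continuousOn (by fun_prop)) ?_ ?_ x t ⟨⟨ht, le_rfl⟩, hnear, hx⟩
  · have : 0 ≤ M * N ^ 2 * (h t - x) ^ 2 := by positivity
    linarith
  · rintro ⟨y, s⟩ ⟨⟨h1, h2⟩, h3, h4⟩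
    have h5 := S.le y s h1
    simp only at h3 h4 h5 ⊢
    have h6 : N * (h s - y) ≤ 1 := by
      have : h s - y ≤ 1 / N := by linarith
      rw [le_div_iff₀ hN] at this; linarith
    have h7 : 0 ≤ N * (h s - y) := mul_nonneg hN.le (by linarith)
    have h8 : 0 ≤ M * (2 * (N * (h s - y)) - (N * (h s - y)) ^ 2) := mul_nonneg hM.le (by nlinarith)
    nlinarith
  · rintro y s ⟨⟨h1, h2⟩, h3, h4⟩ hneg
    simp only at h1 h2 h3 h4 hneg
    have h5 := S.le y s h1
    have h6 : N * (h s - y) ≤ 1 := by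
      have : h s - y ≤ 1 / N := by linarith
      rw [le_div_iff₀ hN] at this; linarith
    have h7 : 0 ≤ N * (h s - y) := mul_nonneg hN.le (by linarith)
    have hlt : y < h s := by
      refine lt_of_le_of_ne h4 ?_
      rintro rfl
      have := S.zero (h s) s h1 le_rfl
      rw [this] at hneg; simp at hneg
    have hgt : h s - 1 / N < y := by
      refine lt_of_le_of_ne h3 ?_
      rintro rfl
      have e : M * (2 * N * (h s - (h s - 1 / N)) - N ^ 2 * (h s - (h s - 1 / N)) ^ 2) = M := by
        field_simp; ring
      rw [e] at hneg; linarith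
    have hs : b < s := by
      refine lt_of_le_of_ne h1 ?_
      rintro rfl
      have e1 := h0 y h4
      have e2 : A * (h b - y) ≤ M * N * (h b - y) := mul_le_mul_of_nonneg_right hA (by linarith)
      have e3 : 0 ≤ M * ((N * (h b - y)) * (1 - N * (h b - y))) := mul_nonneg hM.le (mul_nonneg h7 (by linarith))
      nlinarith
    refine ⟨?_, ?_, ?_⟩
    · filter_upwards [Ioo_mem_nhds hgt hlt] with z hz using ⟨⟨h1, h2⟩, hz.1.le, hz.2.le⟩
    · have e1 : ∀ᶠ r in 𝓝[<] s, h r - 1 / N < y :=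
        ((S.cont_h.sub continuous_const).tendsto s).mono_left inf_le_left |>.eventually (gt_mem_nhds hgt)
      have e2 : ∀ᶠ r in 𝓝[<] s, y < h r := (S.cont_h.tendsto s).mono_left inf_le_left |>.eventually (lt_mem_nhds hlt)
      filter_upwards [e1, e2, eventually_left_Icc hs h2] with r h1 h2 h3 using ⟨h3, h1.le, h2.le⟩
    · obtain ⟨zx, zxx, hJ⟩ := S.jet y s hs hlt
      have hd := S.hd s hs
      have hd0 := S.deriv_nonneg hs
      have hξ := (Jet.of_time (x := y) hd).sub (Jet.of_space (t := s) (Jet2.id y))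
      have hW := ((hξ.const_mul (2 * N)).sub ((hξ.mul hξ).const_mul (N ^ 2))).const_mul M
      refine ⟨_, _, _, (hW.congr (w := fun x t => M * (2 * N * (h t - x) - N ^ 2 * (h t - x) ^ 2))
        (Eventually.of_forall fun _ => by ring) (Eventually.of_forall fun _ => by ring)).sub hJ, ?_⟩
      have e1 : 0 ≤ M * N * (deriv h s * (1 - N * (h s - y))) :=
        mul_nonneg (by positivity) (mul_nonneg hd0 (by linarith))
      have e2 : u y s * (g y - u y s) ≤ M * M := by
        have := S.nonneg y s h1
        have := S.g_le y
        have : u y s * (g y - u y s) ≤ u y s * M := mul_le_mul_of_nonneg_left (by linarith) (S.nonneg y s h1)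
        nlinarith
      have e3 : M * M ≤ M * (2 * N ^ 2) := by gcongr
      nlinarith

theorem h_upper (S : Clas ℓ M b g u h) {V : ℝ} (hV : ∀ t > b, deriv h t ≤ V) {s t : ℝ} (hs : b ≤ s) (hst : s ≤ t) :
    h t - h s ≤ V * (t - s) := by
  refine (convex_Icc s t).image_sub_le_mul_sub_of_deriv_le S.cont_h.continuousOn (fun z hz => ?_) (fun z hz => ?_)
    s ⟨le_rfl, hst⟩ t ⟨hst, le_rfl⟩ hst <;> rw [interior_Icc] at hz
  · exact (S.hd z (by linarith [hz.1])).differentiableAt.differentiableWithinAt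
  · exact hV z (by linarith [hz.1])

theorem h_lower (S : Clas ℓ M b g u h) {v : ℝ} {s t : ℝ} (hv : ∀ r, s < r → r < t → v ≤ deriv h r) (hs : b ≤ s) (hst : s ≤ t) :
    v * (t - s) ≤ h t - h s := by
  refine (convex_Icc s t).mul_sub_le_image_sub_of_le_deriv S.cont_h.continuousOn (fun z hz => ?_) (fun z hz => ?_)
    s ⟨le_rfl, hst⟩ t ⟨hst, le_rfl⟩ hst <;> rw [interior_Icc] at hz
  · exact (S.hd z (by linarith [hz.1])).differentiableAt.differentiableWithinAt
  · exact hv z hz.1 hz.2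

/-- Positivity at distance `A` behind the front spreads up to the front in unit time. -/
theorem exists_spread {M V A : ℝ} (hM : 0 < M) (hV : 0 ≤ V) (hA : 0 ≤ A) : ∃ q > 0, ∀ {ℓ b g u h}, Clas ℓ M b g u h →
    (∀ t > b, deriv h t ≤ V) → ∀ t0 η, b ≤ t0 → 0 ≤ η → (∀ x ≤ h t0 - A, η ≤ u x t0) →
    ∀ x ≤ h (t0 + 1), η * q * min (h (t0 + 1) - x) 1 ≤ u x (t0 + 1) := by
  obtain ⟨ρ, hρ0, hρ⟩ : ∃ ρ > 0, ρ = V + A + 1 := ⟨_, by positivity, rfl⟩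
  obtain ⟨q, hq, hH⟩ := exists_hopf_const (V := V + A) (ρ0 := 2 * ρ) (ρ1 := 2 * ρ) (K := M) (τ := 1) (by positivity)
    (by positivity) le_rfl hM.le
  refine ⟨min (q * ρ) 1, lt_min (by positivity) one_pos, ?_⟩
  intro ℓ b g u h S hhV t0 η ht0 hη h0 x hx
  have hch := S.cont_h
  have hm0 : 0 ≤ min (h (t0 + 1) - x) 1 := le_min (by linarith) (by norm_num)
  rcases le_total (h (t0 + 1) - ρ) x with hx' | hx'
  · have := hH u (fun t => h t - A * (t0 + 1 - t) - 2 * ρ) (fun t => h t - A * (t0 + 1 - t)) (fun t => deriv h t + A)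
      (fun t => deriv h t + A) t0 η (by norm_num) hη (by fun_prop) (by fun_prop) (fun t _ _ => by constructor <;> linarith)
      (fun t h1 h2 => ?_) S.cont_u.continuousOn (fun p hp => S.nonneg _ _ (ht0.trans hp.1.1))
      (fun t x h1 h2 h3 h4 => ?_) x (by linarith) (by linarith)
    · have e : (x - (h (t0 + 1) - A * (t0 + 1 - (t0 + 1)) - 2 * ρ)) * (h (t0 + 1) - A * (t0 + 1 - (t0 + 1)) - x)
        = (2 * ρ - (h (t0 + 1) - x)) * (h (t0 + 1) - x) := by ring
      rw [e] at this
      refine le_trans ?_ this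
      have e1 : ρ * min (h (t0 + 1) - x) 1 ≤ (2 * ρ - (h (t0 + 1) - x)) * (h (t0 + 1) - x) := by
        apply mul_le_mul _ (min_le_left _ _) hm0 <;> linarith
      calc η * min (q * ρ) 1 * min (h (t0 + 1) - x) 1 ≤ η * (q * ρ) * min (h (t0 + 1) - x) 1 := by
            gcongr; exact min_le_left _ _
        _ = η * q * (ρ * min (h (t0 + 1) - x) 1) := by ring
        _ ≤ _ := by gcongr
    · have hd := S.hd t (by linarith)
      have hd' : HasDerivAt (fun t => h t - A * (t0 + 1 - t)) (deriv h t + A) t :=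
        (hd.sub (((hasDerivAt_id t).const_sub (t0 + 1)).const_mul A)).congr_deriv (by ring)
      have h3 := S.deriv_nonneg (t := t) (by linarith)
      have h4 : |deriv h t + A| ≤ V + A := by
        rw [abs_of_nonneg (by linarith)]; linarith [hhV t (by linarith)]
      exact ⟨hd'.sub_const _, h4, hd', h4⟩
    · rcases eq_or_lt_of_le h1 with rfl | h1
      · left; refine h0 x ?_
        linarith
      · right
        have : 0 ≤ A * (t0 + 1 - t) := mul_nonneg hA (by linarith)
        obtain ⟨zx, zxx, hJ⟩ := S.jet x t (by linarith) (by linarith)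
        refine ⟨h1, _, _, _, hJ, ?_⟩
        have e1 := S.nonneg x t (by linarith)
        have e2 := S.le x t (by linarith)
        have e3 := S.g_nonneg x
        nlinarith
  · have h1 := S.h_upper hhV ht0 (show t0 ≤ t0 + 1 by linarith)
    have h2 := h0 x (by linarith)
    have h3 := S.mono x t0 (t0 + 1) ht0 (by linarith)
    have : η * min (q * ρ) 1 * min (h (t0 + 1) - x) 1 ≤ η * 1 * 1 := by
      gcongr <;> exact min_le_right _ _
    linarith

end Clas

namespace Clas

/-- One step of front propagation over the distance `d`, keeping a quantitative lower bound. -/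
theorem front_step {ℓ M b m A q k d R K ε κ η τ : ℝ} {g : ℝ → ℝ} {u : ℝ → ℝ → ℝ} {h : ℝ → ℝ} (S : Clas ℓ M b g u h)
    (hspread : ∀ t0 η, b ≤ t0 → 0 ≤ η → (∀ x ≤ h t0 - A, η ≤ u x t0) →
      ∀ x ≤ h (t0 + 1), η * q * min (h (t0 + 1) - x) 1 ≤ u x (t0 + 1))
    (hg : ∀ x, m ≤ g x) (hd : 0 < d) (hdM : M * (3 * d) ^ 2 ≤ 1) (hR : 0 < R) (hA : A = 3 * d + R)
    (hκ : 0 < κ) (hη : 0 < η) (hm : κ + 9 / R ^ 2 + η ≤ m) (hτ0 : 0 ≤ τ) (hε : 0 < ε) (hτ : ε * Real.exp (κ * τ) = η)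
    (hk0 : 0 < k) (hk : k * ℓ = η * q) (hK : τ + 1 + d / k ≤ K) (hεK : ε * (2 * K) = ℓ * d ^ 2)
    {T y : ℝ} (hT : b ≤ T) (hy : h T = y) (hu : ∀ x ≤ y - 2 * d, ε ≤ u x T) :
    ∃ T' ≥ T, h T' = y + d ∧ ∀ x ≤ y + d - 2 * d, ε ≤ u x T' := by
  have hℓ := S.ℓ_pos
  have hdk : 0 < d / k := by positivity
  have hgrow : ∀ x ≤ y - 2 * d - R, η ≤ u x (T + τ) := by
    intro x hx
    have hbox : ∀ z ∈ Ioo (x - R) (x + R), ∀ t, T ≤ t → z < h t := fun z hz t ht => by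
      have := S.h_mono T t hT ht
      linarith [hz.2]
    have := bump_growth (u := u) (g := g) (x := x) (ρ := R) (t0 := T) (t1 := T + τ) (m := m) (η := η) (κ := κ) (ε := ε)
      hR hκ hε hm (by rw [add_sub_cancel_left, hτ]) S.cont_u.continuousOn hg
      (fun z _ t ht => S.nonneg z t (hT.trans ht.1)) (fun z hz => hu z (by linarith [hz.2]))
      (fun z hz t ht => by
        obtain ⟨zx, zxx, hJ⟩ := S.jet z t (by linarith [ht.1]) (hbox z hz t ht.1.le)
        exact ⟨_, _, _, hJ, rfl⟩) (T + τ) ⟨by linarith, le_rfl⟩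
    rwa [add_sub_cancel_left, hτ] at this
  have hspeed : ∀ t, T + τ + 1 < t → h t ≤ y + d → k ≤ deriv h t := by
    intro t ht hty
    have h1 := S.h_mono (t - 1) t (by linarith) (by linarith)
    have h2 := hspread (t - 1) η (by linarith) hη.le fun x hx =>
      (hgrow x (by linarith)).trans (S.mono x _ _ (by linarith) (by linarith))
    rw [sub_add_cancel] at h2
    have h3 := S.slope_ge (k := η * q) (t := t) (by linarith) one_pos fun ξ h0 h1 => by
      have := h2 (h t - ξ) (by linarith)
      rwa [sub_sub_cancel, min_eq_left h1] at this
    rw [← hk, mul_comm] at h3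
    exact le_of_mul_le_mul_left h3 hℓ
  have hreach : y + d ≤ h (T + K) := by
    by_contra hcon
    push Not at hcon
    have h1 := S.h_lower (v := k) (s := T + τ + 1) (t := T + K) (fun r hr1 hr2 => hspeed r hr1 (by
      linarith [S.h_mono r (T + K) (by linarith) hr2.le])) (by linarith) (by linarith)
    have h2 := S.h_mono T (T + τ + 1) hT (by linarith)
    have h3 : k * (d / k) ≤ k * (T + K - (T + τ + 1)) := by gcongr; linarith
    rw [mul_div_cancel₀ _ hk0.ne'] at h3
    linarith
  obtain ⟨T', hT', hhT'⟩ := intermediate_value_Icc (show T ≤ T + K by linarith) S.cont_h.continuousOn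
    (show y + d ∈ Icc (h T) (h (T + K)) from ⟨by linarith, hreach⟩)
  have hTT : T < T' := lt_of_le_of_ne hT'.1 (by rintro rfl; linarith)
  refine ⟨T', hT'.1, hhT', fun x hx => ?_⟩
  rcases le_total x (y - 2 * d) with h1 | h1
  · exact (hu x h1).trans (S.mono x T T' hT hT'.1)
  obtain ⟨t, ht, hte⟩ := exists_hasDerivAt_eq_slope h (deriv h) hTT S.cont_h.continuousOn
    fun z hz => S.hd z (by linarith [hz.1])
  obtain ⟨ux, -, hst⟩ := S.sturm (t := t) (by linarith [ht.1])
  have h2 := S.h_mono T t hT ht.1.le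
  have h3 := S.h_mono t T' (by linarith [ht.1]) ht.2.le
  have hd1 : (h t - x) ^ 2 ≤ (3 * d) ^ 2 := by
    apply pow_le_pow_left₀ <;> linarith
  have h4 := (hst x (by linarith) (le_trans (mul_le_mul_of_nonneg_left hd1 S.M_pos.le) hdM)).2
  refine le_trans (h4.trans' ?_) (S.mono x t T' (by linarith [ht.1]) ht.2.le)
  have h5 : d ≤ deriv h t * K := by
    have : deriv h t * (T' - T) = d := by
      rw [hte, div_mul_cancel₀ _ (by linarith)]; linarith
    nlinarith [S.deriv_nonneg (t := t) (by linarith [ht.1]), hT'.2]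
  have hK0 : 0 < K := by linarith
  have h6 : d * d ≤ deriv h t * K * (h t - x) := mul_le_mul h5 (by linarith) hd.le (by linarith)
  have h7 : ε * (2 * K) ≤ ℓ * deriv h t * (h t - x) / 2 * (2 * K) := by
    rw [hεK]
    nlinarith
  exact le_of_mul_le_mul_right h7 (by positivity)

theorem exists_lower {ℓ M m V : ℝ} (hℓ : 0 < ℓ) (hM : 0 < M) (hm : 0 < m) (hV : 0 ≤ V) (u0 : ℝ → ℝ)
    (hu0 : ∀ d > 0, ∃ δ > 0, ∀ x ≤ -2 * d, δ ≤ u0 x) :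
    ∃ c > 0, ∀ {g u h}, Clas ℓ M 0 g u h → (∀ x, m ≤ g x) → (∀ t > 0, deriv h t ≤ V) → h 0 = 0 →
      (∀ x, u x 0 = u0 x) → ∀ t x, 1 ≤ t → x ≤ h t → c * min (h t - x) 1 ≤ u x t := by
  obtain ⟨d, hd, hdM⟩ : ∃ d > 0, M * (3 * d) ^ 2 ≤ 1 := by
    refine ⟨1 / (3 * √M), by positivity, ?_⟩
    rw [mul_one_div, div_pow, mul_pow, Real.sq_sqrt hM.le]
    field_simp; norm_num
  obtain ⟨R, hR, hRm⟩ : ∃ R > 0, 9 / R ^ 2 = m / 2 := by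
    refine ⟨√(18 / m), by positivity, ?_⟩
    rw [Real.sq_sqrt (by positivity)]; field_simp; norm_num
  obtain ⟨q, hq, hsp⟩ := exists_spread (V := V) (A := 3 * d + R) hM hV (by positivity)
  obtain ⟨q2, hq2, hsp2⟩ := exists_spread (V := V) (A := 4 * d) hM hV (by positivity)
  obtain ⟨δ, hδ, hδu⟩ := hu0 d hd
  obtain ⟨k, hk0, hk⟩ : ∃ k > 0, k * ℓ = m / 4 * q := ⟨m / 4 * q / ℓ, by positivity, by field_simp⟩
  obtain ⟨K, ε, τ, hε, hεδ, hτ0, hτ, hK, hεK⟩ : ∃ K ε τ : ℝ, 0 < ε ∧ ε ≤ δ ∧ 0 ≤ τ ∧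
      ε * Real.exp (m / 4 * τ) = m / 4 ∧ τ + 1 + d / k ≤ K ∧ ε * (2 * K) = ℓ * d ^ 2 := by
    obtain ⟨c, hc0, hc⟩ : ∃ c > 0, c * (ℓ * d ^ 2) = 2 * (m / 4) := ⟨2 * (m / 4) / (ℓ * d ^ 2), by positivity, by field_simp⟩
    obtain ⟨a, ha0, ha⟩ : ∃ a > 0, a * m = 8 * c := ⟨8 * c / m, by positivity, by field_simp⟩
    obtain ⟨K, hK0, hK1, hK2, hK3⟩ : ∃ K > 0, 2 * (4 / m * |Real.log a| + 1 + d / k) ≤ K ∧ ℓ * d ^ 2 ≤ K * δ * 2 ∧ 1 ≤ c * K := by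
      refine ⟨max (2 * (4 / m * |Real.log a| + 1 + d / k)) (max (ℓ * d ^ 2 / (δ * 2)) (1 / c)),
        lt_max_of_lt_left (by positivity), le_max_left _ _, ?_, ?_⟩
      · have := (le_max_left (ℓ * d ^ 2 / (δ * 2)) (1 / c)).trans (le_max_right (2 * (4 / m * |Real.log a| + 1 + d / k)) _)
        rw [div_le_iff₀ (by positivity)] at this
        linarith
      · have := (le_max_right (ℓ * d ^ 2 / (δ * 2)) (1 / c)).trans (le_max_right (2 * (4 / m * |Real.log a| + 1 + d / k)) _)
        rw [div_le_iff₀ (by positivity)] at this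
        linarith
    refine ⟨K, ℓ * d ^ 2 / (2 * K), 4 / m * Real.log (c * K), by positivity, ?_, ?_, ?_, ?_, by field_simp⟩
    · rw [div_le_iff₀ (by positivity)]; linarith
    · have := Real.log_nonneg hK3
      positivity
    · rw [show m / 4 * (4 / m * Real.log (c * K)) = Real.log (c * K) by field_simp, Real.exp_log (by positivity)]
      have : c * (ℓ * d ^ 2) * K = 2 * (m / 4) * K := by rw [hc]
      field_simp
      nlinarith
    · have h1 : Real.log (c * K) ≤ Real.log a + c * K / a := by
        rw [show c * K = a * (c * K / a) by field_simp, Real.log_mul ha0.ne' (by positivity)]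
        have := Real.log_le_sub_one_of_pos (show 0 < c * K / a by positivity)
        rw [show a * (c * K / a) / a = c * K / a by field_simp]
        linarith
      have h2 : c * K / a = m * K / 8 := by
        rw [div_eq_div_iff ha0.ne' (by norm_num)]
        linear_combination (-K) * ha
      have h3 := le_abs_self (Real.log a)
      have h4 : 4 / m * Real.log (c * K) ≤ 4 / m * (|Real.log a| + m * K / 8) := by gcongr; linarith
      have h5 : 4 / m * (m * K / 8) = K / 2 := by field_simp; norm_num
      linarith
  refine ⟨ε * q2, by positivity, ?_⟩
  intro g u h S hg hhV hh0 huu t x ht hx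
  have hj : ∀ j : ℕ, ∃ T ≥ 0, h T = j * d ∧ ∀ x ≤ j * d - 2 * d, ε ≤ u x T := by
    intro j
    induction j with
    | zero =>
      refine ⟨0, le_rfl, by simpa using hh0, fun x hx => ?_⟩
      rw [huu]
      exact hεδ.trans (hδu x (by simpa using hx))
    | succ j ih =>
      obtain ⟨T, hT, hhT, hu⟩ := ih
      obtain ⟨T', h1, h2, h3⟩ := S.front_step (m := m) (κ := m / 4) (η := m / 4) (hsp S hhV) hg hd hdM hR rfl (by positivity)
        (by positivity) (by linarith) hτ0 hε hτ hk0 hk hK hεK hT hhT hu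
      refine ⟨T', by linarith, by rw [h2]; push_cast; ring, fun x hx => h3 x ?_⟩
      push_cast at hx; linarith
  have hlow : ∀ t, 0 ≤ t → ∀ x ≤ h t - 4 * d, ε ≤ u x t := by
    intro t ht x hx
    have h0 : 0 ≤ h t := by rw [← hh0]; exact S.h_mono 0 t le_rfl ht
    obtain ⟨a1, a2⟩ := floor_nat_bounds h0 hd
    rcases Nat.eq_zero_or_pos ⌊h t / d⌋₊ with hz | hz
    · rw [hz] at a2
      have := S.mono x 0 t le_rfl ht
      rw [huu] at this
      refine le_trans (hεδ.trans (hδu x ?_)) this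
      push_cast at a2; linarith
    · obtain ⟨j, hj'⟩ : ∃ j, ⌊h t / d⌋₊ = j + 1 := ⟨_, (Nat.succ_pred_eq_of_pos hz).symm⟩
      rw [hj'] at a1 a2
      push_cast at a1 a2
      obtain ⟨T, hT, hhT, hu⟩ := hj j
      have hTt : T ≤ t := by
        by_contra hcon
        push Not at hcon
        have := S.h_mono t T ht hcon.le
        nlinarith
      exact (hu x (by linarith)).trans (S.mono x T t hT hTt)
  have := hsp2 S hhV (t - 1) ε (by linarith) hε.le (hlow (t - 1) (by linarith)) x (by rwa [sub_add_cancel])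
  rwa [sub_add_cancel] at this

end Clas

namespace Clas

set_option maxHeartbeats 1000000 in
theorem exists_nondegenerate {ℓ M C c : ℝ} (hM : 0 < M) (hC : 0 < C) (hc : 0 < c) :
    ∃ ρ > 0, ∀ {b : ℝ} {g u h}, Clas ℓ M b g u h → ∀ {x t zt zx zxx : ℝ}, b < t → c ≤ ℓ * deriv h t → x < h t →
      u x t ≤ C * (h t - x) → c * min (h t - x) 1 ≤ u x t → Jet u x t zt zx zxx →
      ρ * M ≤ u x t ^ 2 / 2 + zx ^ 2 / M := by
  obtain ⟨r, hr, hr1, hr2, hr3⟩ : ∃ r > 0, r ≤ 1 ∧ M * r ≤ 1 ∧ M * r * C ≤ c / 2 := by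
    refine ⟨min 1 (min (1 / M) (c / 2 / (M * C))), by positivity, min_le_left _ _, ?_, ?_⟩
    · have := (min_le_right 1 (min (1 / M) (c / 2 / (M * C)))).trans (min_le_left _ _)
      rw [le_div_iff₀ hM] at this; linarith
    · have := (min_le_right 1 (min (1 / M) (c / 2 / (M * C)))).trans (min_le_right _ _)
      rw [le_div_iff₀ (by positivity)] at this; linarith
  refine ⟨min ((c / 2) ^ 2 / M) ((c * r) ^ 2 / 2) / M, by positivity, ?_⟩
  intro b g u h S x t zt zx zxx ht hs hx hC' hlow hJ
  rw [div_mul_cancel₀ _ hM.ne']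
  have hξ : 0 < h t - x := by linarith
  rcases le_total (h t - x) r with hn | hf
  · obtain ⟨ux, hux, hst⟩ := S.sturm ht
    have hzx : ux x = zx := (hux x hx).unique hJ.2.hasDerivAt
    have e1 : (h t - x) ^ 2 ≤ r := by nlinarith
    have e2 : M * (h t - x) ^ 2 ≤ 1 := (mul_le_mul_of_nonneg_left e1 hM.le).trans hr2
    have h1 := (hst x hx e2).1
    rw [hzx] at h1
    have h2 : M * (h t - x) * u x t ≤ c / 2 := by
      have a1 : M * (h t - x) * u x t ≤ M * (h t - x) * (C * (h t - x)) := mul_le_mul_of_nonneg_left hC' (by positivity)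
      have a2 : M * C * (h t - x) ^ 2 ≤ M * C * r := mul_le_mul_of_nonneg_left e1 (by positivity)
      nlinarith
    have h3 : c / 2 ≤ (1 - M * (h t - x) ^ 2 / 2) * -zx := by linarith
    have h4 : 0 ≤ M * (h t - x) ^ 2 := by positivity
    have h5 : c / 2 ≤ -zx := by nlinarith
    have h6 : (c / 2) ^ 2 ≤ zx ^ 2 := by nlinarith
    have h7 : (c / 2) ^ 2 / M ≤ zx ^ 2 / M := by gcongr
    have := min_le_left ((c / 2) ^ 2 / M) ((c * r) ^ 2 / 2)
    nlinarith [sq_nonneg (u x t)]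
  · have h1 : c * r ≤ u x t := le_trans (mul_le_mul_of_nonneg_left (le_min hf hr1) hc.le) hlow
    have h2 : (c * r) ^ 2 ≤ u x t ^ 2 := by gcongr
    have h3 : 0 ≤ zx ^ 2 / M := by positivity
    linarith [min_le_right ((c / 2) ^ 2 / M) ((c * r) ^ 2 / 2)]

theorem jet_diff {ℓ M b : ℝ} {g u h} (S : Clas ℓ M b g u h) {x t s : ℝ} (ht : b < t) (hs : 0 ≤ s) (hx : x < h t) :
    ∃ zx zxx, Jet (fun x t => u x (t + s) - u x t) x t
      (zxx + (g x - u x (t + s) - u x t) * (u x (t + s) - u x t)) zx zxx := by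
  obtain ⟨ax, axx, hA⟩ := S.jet x (t + s) (by linarith) (by linarith [S.h_mono t (t + s) ht.le (by linarith)])
  obtain ⟨bx, bxx, hB⟩ := S.jet x t ht hx
  have h1 : Jet (fun x t => u x (t + s)) x t (axx + u x (t + s) * (g x - u x (t + s))) ax axx :=
    ⟨by simpa using hA.1.comp_add_const t s, hA.2⟩
  exact ⟨_, _, (h1.sub hB).cast (by ring) rfl rfl⟩

set_option maxHeartbeats 1000000 in
theorem exists_time_lip {ℓ M C c : ℝ} (hM : 0 < M) (hC : 0 < C) (hc : 0 < c) :
    ∃ K > 0, ∀ {g u h}, Clas ℓ M 0 g u h → (∀ t > 1, c ≤ ℓ * deriv h t) → (∀ t > 0, deriv h t ≤ C) →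
      (∀ x t, 0 ≤ t → x ≤ h t → u x t ≤ C * (h t - x)) → (∀ x t, 1 ≤ t → x ≤ h t → c * min (h t - x) 1 ≤ u x t) →
      (∀ x t s, 0 ≤ t → t ≤ 1 → 0 ≤ s → u x (t + s) - u x t ≤ C * s) →
      ∀ x t s, 0 ≤ t → 0 ≤ s → u x (t + s) - u x t ≤ K * s := by
  obtain ⟨ρ, hρ, hnd⟩ := exists_nondegenerate (ℓ := ℓ) hM hC hc
  obtain ⟨k, hk, hkC⟩ : ∃ k > 0, k * ρ = C + C * C := ⟨(C + C * C) / ρ, by positivity, by field_simp⟩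
  refine ⟨C + C * C + k * (M + ρ), by positivity, ?_⟩
  intro g u h S hsl hV hlin hlow hinit
  have hch := S.cont_h
  have hcu := S.cont_u
  have hfront : ∀ x t s, 0 ≤ t → 0 ≤ s → h t ≤ x → u x (t + s) - u x t ≤ C * C * s := by
    intro x t s ht hs hx
    rw [S.zero x t ht hx]
    rcases le_total (h (t + s)) x with h1 | h1
    · rw [S.zero x (t + s) (by linarith) h1]; simp; positivity
    · have a1 := hlin x (t + s) (by linarith) h1
      have a2 := S.h_upper hV ht (show t ≤ t + s by linarith)
      have : C * (h (t + s) - x) ≤ C * (C * s) := mul_le_mul_of_nonneg_left (by linarith) hC.le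
      linarith
  intro x t s ht hs
  rcases le_total t 1 with h1 | h1
  · have := hinit x t s ht h1 hs
    have : 0 ≤ (C * C + k * (M + ρ)) * s := by positivity
    linarith
  rcases le_total (h t) x with h2 | h2
  · have := hfront x t s ht hs h2
    have : 0 ≤ (C + k * (M + ρ)) * s := by positivity
    linarith
  have key := max_principle (D := {p : ℝ × ℝ | (1 ≤ p.2 ∧ p.2 ≤ t) ∧ p.1 ≤ h p.2})
    ((isClosed_strip 1 t).inter (isClosed_le (f := fun p : ℝ × ℝ => p.1) (g := fun p => h p.2) (by fun_prop) (by fun_prop)))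
    (t0 := 1) (t1 := t) (K := M) (B := M)
    (z := fun x t => k * s * (u x t + ρ - u x t ^ 2 / (2 * M)) - (u x (t + s) - u x t)) (fun p hp => hp.1)
    (Continuous.continuousOn (by
      have : Continuous fun p : ℝ × ℝ => u p.1 (p.2 + s) :=
        hcu.comp (show Continuous fun p : ℝ × ℝ => (p.1, p.2 + s) by fun_prop)
      fun_prop)) ?_ ?_ x t ⟨⟨h1, le_rfl⟩, h2⟩
  · have a1 : u x t - u x t ^ 2 / (2 * M) ≤ M := by
      have := S.le x t ht
      have : 0 ≤ u x t ^ 2 / (2 * M) := by positivity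
      linarith
    have a2 : k * s * (u x t + ρ - u x t ^ 2 / (2 * M)) ≤ k * s * (M + ρ) := by gcongr; linarith
    have : 0 ≤ (C + C * C) * s := by positivity
    linarith
  · rintro ⟨y, r⟩ ⟨⟨hr1, hr2⟩, hy⟩
    simp only at hr1 hr2 hy ⊢
    have b1 := S.nonneg y r (by linarith)
    have b2 := S.le y r (by linarith)
    have b3 : u y r ^ 2 / (2 * M) ≤ u y r := by rw [div_le_iff₀ (by positivity)]; nlinarith
    have b4 : 0 ≤ k * s * (u y r + ρ - u y r ^ 2 / (2 * M)) := by
      have : 0 ≤ u y r + ρ - u y r ^ 2 / (2 * M) := by linarith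
      positivity
    linarith [S.le y (r + s) (by linarith)]
  · rintro y r ⟨⟨hr1, hr2⟩, hy⟩ hneg
    simp only at hr1 hr2 hy hneg
    have b1 := S.nonneg y r (by linarith)
    have b2 := S.le y r (by linarith)
    have b3 : u y r ^ 2 / (2 * M) ≤ u y r := by rw [div_le_iff₀ (by positivity)]; nlinarith
    have b5 : k * s * ρ ≤ k * s * (u y r + ρ - u y r ^ 2 / (2 * M)) := by gcongr; linarith
    have b6 : k * s * ρ = (C + C * C) * s := by linear_combination s * hkC
    have b7 : 0 ≤ C * s := by positivity
    have b8 : 0 ≤ C * C * s := by positivity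
    have hlt : y < h r := by
      refine lt_of_le_of_ne hy ?_
      rintro rfl
      have := hfront (h r) r s (by linarith) hs le_rfl
      linarith
    have hr : 1 < r := by
      refine lt_of_le_of_ne hr1 ?_
      rintro rfl
      have := hinit y 1 s (by norm_num) le_rfl hs
      linarith
    refine ⟨?_, ?_, ?_⟩
    · filter_upwards [gt_mem_nhds hlt] with z hz
      exact ⟨⟨hr1, hr2⟩, hz.le⟩
    · have : ∀ᶠ q in 𝓝[<] r, y < h q :=
        ((hch.tendsto r).mono_left inf_le_left).eventually (lt_mem_nhds hlt)
      filter_upwards [this, eventually_left_Icc hr hr2] with q hq1 hq2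
      exact ⟨hq2, hq1.le⟩
    obtain ⟨ux, uxx, hJ⟩ := S.jet y r (by linarith) hlt
    obtain ⟨dx, dxx, hD⟩ := S.jet_diff (s := s) (by linarith) hs hlt
    have hnd' := hnd S (by linarith) (hsl r hr) hlt (hlin y r (by linarith) hy) (hlow y r hr1 hy) hJ
    have hQ : Jet (fun x t => k * s * (u x t + ρ - u x t ^ 2 / (2 * M))) y r
        (k * s * ((1 - u y r / M) * (uxx + u y r * (g y - u y r)))) (k * s * ((1 - u y r / M) * ux))
        (k * s * ((1 - u y r / M) * uxx - ux ^ 2 / M)) := by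
      have h2 : Jet2 (fun v => k * s * (v + ρ - v ^ 2 / (2 * M))) (u y r) (k * s * (1 - u y r / M)) (k * s * (-(1 / M))) := by
        have := (((Jet2.id (u y r)).add (Jet2.const ρ (u y r))).sub ((Jet2.id (u y r)).sq.const_mul (1 / (2 * M)))).const_mul (k * s)
        refine (this.congr (Eventually.of_forall fun v => ?_)).cast ?_ ?_
        · ring
        · field_simp; ring
        · field_simp; ring
      refine (hJ.comp h2).cast ?_ ?_ ?_ <;> ring
    refine ⟨_, _, _, hQ.sub hD, ?_⟩
    generalize hGd : u y r + ρ - u y r ^ 2 / (2 * M) = G at *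
    generalize hDd : u y (r + s) - u y r = D at *
    have hmono : u y r ≤ u y (r + s) := S.mono y r (r + s) (by linarith) (by linarith)
    have hg1 := S.g_le y
    have hg0 := S.g_nonneg y
    have hks : 0 ≤ k * s := by positivity
    have hGpos : 0 ≤ G := by rw [← hGd]; linarith
    have c1 : (g y - u y (r + s) - u y r) * (k * s * G) ≤ (g y - 2 * u y r) * (k * s * G) := by
      gcongr ?_ * _; linarith
    have c2 : M * (k * s * G - D) ≤ (g y - u y (r + s) - u y r) * (k * s * G - D) := by
      have : g y - u y (r + s) - u y r ≤ M := by linarith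
      nlinarith
    have c3 : (g y - 2 * u y r) * G ≤ (1 - u y r / M) * (u y r * (g y - u y r)) + ux ^ 2 / M := by
      have e : (1 - u y r / M) * (u y r * (g y - u y r)) - (g y - 2 * u y r) * G
          = u y r ^ 2 * (1 - g y / (2 * M)) - ρ * (g y - 2 * u y r) := by
        rw [← hGd]; field_simp; ring
      have e2 : g y / (2 * M) ≤ 1 / 2 := by rw [div_le_div_iff₀ (by positivity) (by norm_num)]; linarith
      have e3 : u y r ^ 2 * (1 / 2) ≤ u y r ^ 2 * (1 - g y / (2 * M)) := by gcongr; linarith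
      have e4 : ρ * (g y - 2 * u y r) ≤ ρ * M := by gcongr; linarith
      linarith
    have c4 := mul_le_mul_of_nonneg_left c3 hks
    linarith

end Clas

/-- A positive steady state of the reaction-diffusion equation, with quantitative bounds. -/
structure Steady (m M P : ℝ) (g p : ℝ → ℝ) : Prop where
  lower : ∀ x, m ≤ p x
  upper : ∀ x, p x ≤ M
  jet : ∀ x, ∃ px, |px| ≤ P ∧ Jet2 p x px (p x * (p x - g x))

theorem Steady.continuous {m M P : ℝ} {g p : ℝ → ℝ} (h : Steady m M P g p) : Continuous p :=
  continuous_iff_continuousAt.2 fun x => let ⟨_, _, hJ⟩ := h.jet x; hJ.hasDerivAt.continuousAt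

theorem IsBddPosSteadyState.steady {m M : ℝ} {g p : ℝ → ℝ} (h : IsBddPosSteadyState g p) (hm : 0 < m)
    (hg : ∀ x, m ≤ g x) (hgM : ∀ x, g x ≤ M) : Steady m M (M + M ^ 2) g p := by
  have hJ := IsBddPosSteadyState.jet2 h
  have hc : Continuous p := h.1.continuous
  obtain ⟨B, hB⟩ := h.2.1
  have hM : 0 < M := hm.trans_le ((hg 0).trans (hgM 0))
  have hlow := steady_lower hg h.2.2.1 hc fun x => ⟨_, hJ x⟩
  have hup := steady_upper hm hg hgM h.2.2.1 (fun x => (le_abs_self _).trans (hB x)) hc fun x => ⟨_, hJ x⟩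
  have hd : ∀ x, HasDerivAt p (deriv p x) x ∧ HasDerivAt (deriv p) (p x * (p x - g x)) x := fun x =>
    Jet2.family isOpen_univ (fun y _ => hJ y) x (mem_univ _)
  refine ⟨hlow, hup, fun x => ⟨_, ?_, hJ x⟩⟩
  obtain ⟨ξ, hξ, he⟩ := exists_hasDerivAt_eq_slope p (deriv p) (show x < x + 1 by linarith) hc.continuousOn
    fun z _ => (hd z).1
  rw [add_sub_cancel_left, div_one] at he
  have h1 : |deriv p x - deriv p ξ| ≤ M ^ 2 * |x - ξ| :=
    Convex.norm_image_sub_le_of_norm_hasDerivWithin_le (s := univ) (f' := fun x => p x * (p x - g x))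
      (fun y _ => (hd y).2.hasDerivWithinAt) (fun y _ => by
        have e1 := hlow y; have e2 := hup y; have e3 := hg y; have e4 := hgM y
        rw [Real.norm_eq_abs, abs_mul, pow_two]
        exact mul_le_mul (abs_le.2 ⟨by linarith, e2⟩) (abs_le.2 ⟨by linarith, by linarith⟩) (abs_nonneg _) hM.le)
      convex_univ (mem_univ _) (mem_univ _)
  have h2 : |x - ξ| ≤ 1 := abs_le.2 ⟨by linarith [hξ.2], by linarith [hξ.1]⟩
  have h3 : M ^ 2 * |x - ξ| ≤ M ^ 2 := mul_le_of_le_one_right (by positivity) h2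
  have h4 : |deriv p ξ| ≤ M := by
    rw [he]
    have e1 := hlow x; have e2 := hup x; have e3 := hlow (x + 1); have e4 := hup (x + 1)
    exact abs_le.2 ⟨by linarith, by linarith⟩
  calc |deriv p x| = |deriv p ξ + (deriv p x - deriv p ξ)| := by ring_nf
    _ ≤ _ := (abs_add_le _ _).trans (by linarith)

namespace Clas

theorem isClosed_below {h : ℝ → ℝ} (hh : Continuous h) (t0 t1 A : ℝ) :
    IsClosed {p : ℝ × ℝ | p.2 ∈ Icc t0 t1 ∧ p.1 ≤ h p.2 - A} :=
  (isClosed_strip t0 t1).inter (isClosed_le (f := fun p : ℝ × ℝ => p.1) (g := fun p => h p.2 - A) (by fun_prop) (by fun_prop))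

theorem jet_steady {ℓ M b m P : ℝ} {g u h p} (S : Clas ℓ M b g u h) (hp : Steady m M P g p) {x t : ℝ} (ht : b < t)
    (hx : x < h t) : ∃ zx zxx px, |px| ≤ P ∧ Jet (fun x _ => p x) x t 0 px (p x * (p x - g x)) ∧
      Jet (fun x t => p x - u x t) x t (zxx + (g x - p x - u x t) * (p x - u x t)) zx zxx := by
  obtain ⟨px, hP, hJp⟩ := hp.jet x
  obtain ⟨ux, uxx, hJ⟩ := S.jet x t ht hx
  have h1 := Jet.of_space (t := t) hJp
  exact ⟨_, _, _, hP, h1, (h1.sub hJ).cast (by ring) rfl rfl⟩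

theorem le_steady {ℓ M m P : ℝ} {g u h p} (S : Clas ℓ M 0 g u h) (hp : Steady m M P g p) (hm : 0 < m)
    (h0 : ∀ x, u x 0 ≤ m) (x t : ℝ) (ht : 0 ≤ t) : u x t ≤ p x := by
  rcases le_total (h t) x with hx | hx
  · rw [S.zero x t ht hx]; linarith [hp.lower x]
  have hcu := S.cont_u
  have hcp := hp.continuous
  have hch := S.cont_h
  have := max_principle (isClosed_below S.cont_h 0 t 0) (t0 := 0) (t1 := t) (K := M) (B := M)
    (z := fun x t => p x - u x t) (fun p hp => hp.1) (Continuous.continuousOn (by fun_prop))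
    (fun q hq => by linarith [hp.lower q.1, S.le q.1 q.2 hq.1.1]) ?_ x t ⟨⟨ht, le_rfl⟩, by simpa using hx⟩
  · linarith
  rintro y r ⟨⟨hr1, hr2⟩, hy⟩ hneg
  simp only [sub_zero] at hr1 hr2 hy hneg
  have b1 := hp.lower y
  have hlt : y < h r := by
    refine lt_of_le_of_ne hy ?_
    rintro rfl
    rw [S.zero _ r hr1 le_rfl] at hneg; linarith
  have hr : 0 < r := by
    refine lt_of_le_of_ne hr1 ?_
    rintro rfl
    linarith [h0 y]
  refine ⟨?_, ?_, ?_⟩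
  · filter_upwards [gt_mem_nhds hlt] with z hz
    exact ⟨⟨hr1, hr2⟩, by simpa using hz.le⟩
  · have : ∀ᶠ q in 𝓝[<] r, y < h q :=
      ((hch.tendsto r).mono_left inf_le_left).eventually (lt_mem_nhds hlt)
    filter_upwards [this, eventually_left_Icc hr hr2] with q hq1 hq2
    exact ⟨hq2, by simpa using hq1.le⟩
  obtain ⟨zx, zxx, px, -, -, hJ⟩ := S.jet_steady hp hr hlt
  refine ⟨_, _, _, hJ, ?_⟩
  have : g y - p y - u y r ≤ M := by linarith [S.g_le y, S.nonneg y r hr1]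
  nlinarith

set_option maxHeartbeats 1000000 in
theorem exists_decay {ℓ M C c m P : ℝ} (hM : 0 < M) (hC : 0 < C) (hc : 0 < c) (hm : 0 < m) (hP : 0 ≤ P) :
    ∃ lam > 0, ∃ C' > 0, ∀ {g u h p}, Clas ℓ M 0 g u h → Steady m M P g p → (∀ x t, 0 ≤ t → u x t ≤ p x) →
      (∀ t > 0, deriv h t ≤ C) → (∀ x t, 1 ≤ t → x ≤ h t → c * min (h t - x) 1 ≤ u x t) →
      (∀ x y t, 0 ≤ t → |u x t - u y t| ≤ C * |x - y|) →
      (∀ x t s, 0 ≤ t → 0 ≤ s → u x (t + s) - u x t ≤ C * s) → ∀ x t, 1 ≤ t →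
      p x - u x t ≤ C' * (Real.exp (lam * (x - h t)) + Real.exp (-lam * (t - 1))) ∧
      ∀ s, 0 ≤ s → u x (t + s) - u x t ≤ C' * s * (Real.exp (lam * (x - h t)) + Real.exp (-lam * (t - 1))) := by
  obtain ⟨lam, hlam, hdec⟩ := exists_decay_rate (η := c) (P := C / c + P / m) (V := C) hc (by positivity) hC.le
  refine ⟨lam, hlam, (M + C + C / c * M) * Real.exp lam, by positivity, ?_⟩
  intro g u h p S hp hup hV hlow hlipx hlipt x t ht
  have hch := S.cont_h
  have hcu := S.cont_u
  have hcp := hp.continuous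
  have hfar : ∀ x t, 1 ≤ t → x ≤ h t - 1 → c ≤ u x t := fun x t h1 h2 => by
    have := hlow x t h1 (by linarith)
    rwa [min_eq_right (by linarith), mul_one] at this
  have hnear : h t - 1 ≤ x → 1 ≤ Real.exp lam * (Real.exp (lam * (x - h t)) + Real.exp (-lam * (t - 1))) := by
    intro hx
    have e1 : 1 ≤ Real.exp (lam + lam * (x - h t)) := Real.one_le_exp (by nlinarith)
    rw [Real.exp_add] at e1
    have := mul_pos (Real.exp_pos lam) (Real.exp_pos (-lam * (t - 1)))
    linarith
  have hexp : ∀ B : ℝ, 0 ≤ B → B * (Real.exp (lam * (x - (h t - 1))) + Real.exp (-lam * (t - 1))) ≤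
      B * (Real.exp lam * (Real.exp (lam * (x - h t)) + Real.exp (-lam * (t - 1)))) := by
    intro B hB
    refine mul_le_mul_of_nonneg_left ?_ hB
    rw [show lam * (x - (h t - 1)) = lam + lam * (x - h t) by ring, Real.exp_add]
    have := mul_le_mul_of_nonneg_right (Real.one_le_exp hlam.le) (Real.exp_pos (-lam * (t - 1))).le
    linarith
  generalize hE : Real.exp lam * (Real.exp (lam * (x - h t)) + Real.exp (-lam * (t - 1))) = E at *
  have hE0 : 0 ≤ E := by rw [← hE]; positivity
  have hCcM : 0 ≤ C / c * M := by positivity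
  have hPm : 0 ≤ P / m := by positivity
  have hCc : 0 ≤ C / c := by positivity
  constructor
  · have goal : p x - u x t ≤ M * E := by
      rcases le_total (h t - 1) x with hx | hx
      · linarith [hp.upper x, S.nonneg x t (by linarith), mul_le_mul_of_nonneg_left (hnear hx) hM.le]
      have := hdec (fun x t => p x - u x t) (fun x _ => p x) h (deriv h) 1 M M 1 t hch
        (fun r h1 h2 => ⟨S.hd r (by linarith), hV r (by linarith)⟩) (by fun_prop) (by fun_prop)
        (fun r y h1 h2 h3 => ⟨hm.le.trans (hp.lower y), by linarith [hp.upper y, S.nonneg y r (by linarith)]⟩)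
        (fun y hy => by linarith [S.nonneg y 1 (by linarith)])
        (fun r h1 h2 => by linarith [S.nonneg (h r - 1) r (by linarith)])
        (fun r y h1 h2 h3 => ?_) t x ht le_rfl hx
      · refine this.trans (le_trans ?_ (hexp M hM.le))
        gcongr
        exact hp.upper x
      · obtain ⟨zx, zxx, px, hpx, h4, h5⟩ := S.jet_steady hp (x := y) (t := r) (by linarith) (by linarith)
        refine ⟨_, _, _, _, _, _, _, h5, h4, le_rfl, ?_, ?_, ?_⟩
        · have := hfar y r h1.le h3.le
          have := hp.lower y
          nlinarith
        · have e1 := hp.lower y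
          have e2 : P ≤ P / m * p y := by
            rw [div_mul_eq_mul_div, le_div_iff₀ hm]; exact mul_le_mul_of_nonneg_left e1 hP
          have e3 : 0 ≤ C / c * p y := mul_nonneg hCc (by linarith)
          linarith
        · linarith [S.g_le y, hp.lower y, S.nonneg y r (by linarith)]
    have : 0 ≤ (C + C / c * M) * E := by positivity
    rw [mul_assoc, hE]
    linarith
  · intro s hs
    have goal : u x (t + s) - u x t ≤ (C + C / c * M) * s * E := by
      rcases le_total (h t - 1) x with hx | hx
      · have e1 := hlipt x t s (by linarith) hs
        have e2 := mul_le_mul_of_nonneg_left (hnear hx) (show 0 ≤ C * s by positivity)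
        have e3 : 0 ≤ C / c * M * s * E := by positivity
        linarith
      have hcs : Continuous fun p : ℝ × ℝ => u p.1 (p.2 + s) :=
        hcu.comp (show Continuous fun p : ℝ × ℝ => (p.1, p.2 + s) by fun_prop)
      have hkey : ∀ y r, 1 ≤ r → y ≤ h r - 1 → u y (r + s) - u y r ≤ C / c * s * u y r := fun y r h1 h2 => by
        refine (hlipt y r s (by linarith) hs).trans ?_
        have e1 := hfar y r h1 h2
        have : C / c * s * c ≤ C / c * s * u y r := by gcongr
        have e2 : C / c * s * c = C * s := by field_simp
        linarith
      have := hdec (fun x t => u x (t + s) - u x t) (fun x t => C / c * s * u x t) h (deriv h) 1 M M 1 t hch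
        (fun r h1 h2 => ⟨S.hd r (by linarith), hV r (by linarith)⟩) (by fun_prop) (by fun_prop)
        (fun r y h1 h2 h3 => ⟨mul_nonneg (by positivity) (S.nonneg y r (by linarith)), by linarith [S.le y (r + s) (by linarith), S.nonneg y r (by linarith)]⟩)
        (fun y hy => hkey y 1 le_rfl hy)
        (fun r h1 h2 => hkey _ r h1 le_rfl)
        (fun r y h1 h2 h3 => ?_) t x ht le_rfl hx
      · refine this.trans (le_trans ?_ (le_trans (hexp (C / c * s * M) (by positivity)) ?_))
        · gcongr
          exact S.le x t (by linarith)
        · have : 0 ≤ C * s * E := by positivity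
          linarith
      · obtain ⟨zx, zxx, h5⟩ := S.jet_diff (x := y) (t := r) (by linarith) hs (by linarith)
        obtain ⟨ux, uxx, hJ⟩ := S.jet y r (by linarith) (by linarith)
        have e1 := hfar y r h1.le h3.le
        have e0 := S.mono y r (r + s) (by linarith) (by linarith)
        refine ⟨_, _, _, _, _, _, _, h5, hJ.const_mul (C / c * s), le_rfl, ?_, ?_, ?_⟩
        · have : (g y - u y (r + s) - u y r + c) * (C / c * s * u y r) ≤ (g y - u y r) * (C / c * s * u y r) := by
            have : 0 ≤ C / c * s * u y r := mul_nonneg (by positivity) (by linarith)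
            gcongr; linarith
          linarith
        · have hux : |ux| ≤ C := HasDerivAt.le_of_lip' hJ.2.hasDerivAt hC.le (Eventually.of_forall fun z => hlipx z y r (by linarith))
          rw [abs_mul, abs_of_nonneg (show 0 ≤ C / c * s by positivity)]
          have e2 : C ≤ C / c * u y r := by
            rw [div_mul_eq_mul_div, le_div_iff₀ hc]; exact mul_le_mul_of_nonneg_left e1 hC.le
          have e3 : 0 ≤ P / m * u y r := mul_nonneg hPm (by linarith)
          have e4 : C / c * s * |ux| ≤ C / c * s * (C / c * u y r + P / m * u y r) := by gcongr; linarith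
          linarith
        · linarith [S.g_le y]
    have : 0 ≤ M * s * E := by positivity
    rw [mul_right_comm _ (Real.exp lam) s, mul_assoc, hE]
    linarith

end Clas

namespace Clas

set_option maxHeartbeats 1000000 in
theorem exists_dt_lower {ℓ M C c : ℝ} (hℓ : 0 < ℓ) (hM : 0 < M) (hC : 0 < C) (hc : 0 < c) :
    ∃ c' > 0, ∀ {g u h}, Clas ℓ M 0 g u h → (∀ t > 1, c ≤ ℓ * deriv h t) → (∀ t > 0, deriv h t ≤ C) →
      (∀ x t, 1 ≤ t → x ≤ h t → c * min (h t - x) 1 ≤ u x t) →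
      ∀ x t s, 2 ≤ t → 0 ≤ s → s ≤ c' → h t - c' ≤ x → x ≤ h t → c' * s ≤ u x (t + s) - u x t := by
  obtain ⟨q, hq, hH⟩ := exists_hopf_const (V := C + 1) (ρ0 := 1) (ρ1 := 2) (K := 2 * M) (τ := 1) (by positivity)
    (by norm_num) (by norm_num) (by positivity)
  refine ⟨min (1 / 2) (min (ℓ / c) (c * (c / ℓ) * q / 2)), by positivity, ?_⟩
  intro g u h S hsl hV hlow x t s ht hs hsc hx1 hx2
  have k1 := min_le_left (1 / 2) (min (ℓ / c) (c * (c / ℓ) * q / 2))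
  have k2 := (min_le_right (1 / 2) (min (ℓ / c) (c * (c / ℓ) * q / 2))).trans (min_le_left _ _)
  have k3 := (min_le_right (1 / 2) (min (ℓ / c) (c * (c / ℓ) * q / 2))).trans (min_le_right _ _)
  have hch := S.cont_h
  have hcu := S.cont_u
  have hcs : Continuous fun p : ℝ × ℝ => u p.1 (p.2 + s) :=
    hcu.comp (show Continuous fun p : ℝ × ℝ => (p.1, p.2 + s) by fun_prop)
  have hcD : Continuous fun p : ℝ × ℝ => u p.1 (p.2 + s) - u p.1 p.2 := by fun_prop
  have hfront : ∀ r, 1 ≤ r → c * (c / ℓ) * s ≤ u (h r) (r + s) - u (h r) r := by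
    intro r hr
    rw [S.zero (h r) r (by linarith) le_rfl, sub_zero]
    have e1 := S.h_lower (v := c / ℓ) (s := r) (t := r + s) (fun z hz _ => by
      rw [div_le_iff₀ hℓ, mul_comm]; exact hsl z (by linarith)) (by linarith) (by linarith)
    rw [add_sub_cancel_left] at e1
    have e2 : c / ℓ * s ≤ 1 := by
      rw [div_mul_eq_mul_div, div_le_one hℓ]
      have := hsc.trans k2
      rw [le_div_iff₀ hc] at this; linarith
    have e3 := hlow (h r) (r + s) (by linarith) (S.h_mono r (r + s) (by linarith) (by linarith))
    refine le_trans ?_ e3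
    rw [mul_assoc]
    exact mul_le_mul_of_nonneg_left (le_min e1 e2) hc.le
  obtain ⟨t0, rfl⟩ : ∃ t0, t = t0 + 1 := ⟨t - 1, by ring⟩
  have := hH (fun x t => u (min x (h t)) (t + s) - u (min x (h t)) t) (fun r => h r - (r - t0)) (fun r => h r + 1)
    (fun r => deriv h r - 1) (deriv h) t0 (c * (c / ℓ) * s) (by norm_num) (by positivity) (by fun_prop) (by fun_prop)
    (fun r h1 h2 => by constructor <;> linarith) (fun r h1 h2 => ?_)
    (Continuous.continuousOn (hcD.comp (show Continuous fun p : ℝ × ℝ => (min p.1 (h p.2), p.2) by fun_prop)))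
    (fun p hp => sub_nonneg.2 (S.mono _ _ _ (by linarith [hp.1.1]) (by linarith))) (fun r y h1 h2 h3 h4 => ?_) x
    (by linarith) (by linarith)
  · simp only [min_eq_left hx2] at this
    refine le_trans ?_ this
    have e1 : (1 / 2 : ℝ) * 1 ≤ (x - (h (t0 + 1) - (t0 + 1 - t0))) * (h (t0 + 1) + 1 - x) := by
      apply mul_le_mul <;> linarith
    have e2 : c * (c / ℓ) * s * q * ((1 / 2 : ℝ) * 1) ≤ c * (c / ℓ) * s * q * ((x - (h (t0 + 1) - (t0 + 1 - t0))) * (h (t0 + 1) + 1 - x)) := by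
      gcongr
    have e3 := mul_le_mul_of_nonneg_right k3 hs
    linarith
  · have d := S.hd r (by linarith)
    have d0 := S.deriv_nonneg (t := r) (by linarith)
    have d1 := hV r (by linarith)
    exact ⟨d.sub ((hasDerivAt_id r).sub_const t0), abs_le.2 ⟨by linarith, by linarith⟩, d.add_const 1,
      abs_le.2 ⟨by linarith, by linarith⟩⟩
  · rcases le_or_gt (h r) y with hy | hy
    · left
      simp only [min_eq_right hy]
      exact hfront r (by linarith)
    · have hr : t0 < r := by
        refine lt_of_le_of_ne h1 ?_
        rintro rfl
        linarith
      refine Or.inr ⟨hr, ?_⟩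
      obtain ⟨zx, zxx, hJ⟩ := S.jet_diff (x := y) (t := r) (s := s) (by linarith) hs hy
      refine ⟨_, _, _, hJ.congr ?_ ?_, ?_⟩
      · filter_upwards [gt_mem_nhds hy] with z hz
        rw [min_eq_left hz.le]
      · filter_upwards [(hch.tendsto r).eventually (lt_mem_nhds hy)] with z hz
        rw [min_eq_left hz.le]
      · simp only [min_eq_left hy.le]
        have e1 := S.mono y r (r + s) (by linarith) (by linarith)
        have e2 : -(2 * M) ≤ g y - u y (r + s) - u y r := by
          linarith [S.le y r (by linarith), S.le y (r + s) (by linarith), S.g_nonneg y]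
        nlinarith

end Clas

/-- Quantitative properties, on the time interval `[b, ∞)`, of a solution invading the state `p`;
all of them are preserved under locally uniform limits. -/
structure WaveOn (ℓ M C c lam b : ℝ) (g p : ℝ → ℝ) (u : ℝ → ℝ → ℝ) (h : ℝ → ℝ) : Prop where
  approx : Approx ℓ M b g u h
  gcont : Continuous g
  g_nonneg : ∀ x, 0 ≤ g x
  g_le : ∀ x, g x ≤ M
  lipx : ∀ x y t, b ≤ t → |u x t - u y t| ≤ C * |x - y|
  lipt : ∀ x t s, b ≤ t → 0 ≤ s → u x (t + s) - u x t ≤ C * s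
  mono : ∀ x s t, b ≤ s → s ≤ t → u x s ≤ u x t
  nonneg : ∀ x t, b ≤ t → 0 ≤ u x t
  le : ∀ x t, b ≤ t → u x t ≤ M
  zero : ∀ x t, b ≤ t → h t ≤ x → u x t = 0
  h_lower : ∀ s t, b ≤ s → s ≤ t → c * (t - s) ≤ h t - h s
  h_upper : ∀ s t, b ≤ s → s ≤ t → h t - h s ≤ C * (t - s)
  lower : ∀ x t, b ≤ t → x ≤ h t → c * min (h t - x) 1 ≤ u x t
  dt_lower : ∀ x t s, b ≤ t → 0 ≤ s → s ≤ c → h t - c ≤ x → x ≤ h t → c * s ≤ u x (t + s) - u x t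
  dt_upper : ∀ x t s, b ≤ t → 0 ≤ s →
    u x (t + s) - u x t ≤ C * s * (Real.exp (lam * (x - h t)) + Real.exp (-lam * (t - b)))
  left : ∀ x t, b ≤ t → |p x - u x t| ≤ C * (Real.exp (lam * (x - h t)) + Real.exp (-lam * (t - b)))

theorem Approx.mono_time {ℓ M b b' : ℝ} {g : ℝ → ℝ} {u : ℝ → ℝ → ℝ} {h : ℝ → ℝ} (H : Approx ℓ M b g u h) (hb : b ≤ b') :
    Approx ℓ M b' g u h := by
  intro R hR ε hε
  obtain ⟨L, h1, h2, h3⟩ := H R hR ε hε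
  exact ⟨L, h1, h2.trans hb, fun k i hk => h3 k i (hb.trans hk)⟩

theorem ini_pos_far {m : ℝ} (hm : 0 < m) (d : ℝ) (hd : 0 < d) : ∃ δ > 0, ∀ x ≤ -2 * d, δ ≤ ini m x := by
  have hs : 0 < Real.sqrt (m / 2) := by positivity
  have hpi := Real.pi_pos
  refine ⟨m / 2 * Real.sin (min (2 * d * Real.sqrt (m / 2)) (Real.pi / 2)), ?_, fun x hx => ?_⟩
  · have := Real.sin_pos_of_pos_of_lt_pi (show 0 < min (2 * d * Real.sqrt (m / 2)) (Real.pi / 2) by positivity)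
      (by linarith [min_le_right (2 * d * Real.sqrt (m / 2)) (Real.pi / 2)])
    positivity
  · unfold ini
    refine mul_le_mul_of_nonneg_left (Real.sin_le_sin_of_le_of_le_pi_div_two ?_ (min_le_right _ _) ?_) (by linarith)
    · have : 0 ≤ min (2 * d * Real.sqrt (m / 2)) (Real.pi / 2) := by positivity
      linarith
    · exact min_le_min_right _ (le_max_of_le_left (mul_le_mul_of_nonneg_right (by linarith) hs.le))

set_option maxHeartbeats 1000000 in
theorem exists_waveOn {ℓ m M P : ℝ} (hℓ : 0 < ℓ) (hm : 0 < m) (hM : 0 < M) (hP : 0 ≤ P) : ∃ C > 0, ∃ c > 0, ∃ lam > 0,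
    ∀ g p : ℝ → ℝ, Continuous g → (∀ x, m ≤ g x) → (∀ x, g x ≤ M) → Steady m M P g p →
      ∃ u h, h 0 = 0 ∧ (∀ t, 0 ≤ t → t ≤ 2 → h t ≤ C * t) ∧ WaveOn ℓ M C c lam 2 g p u h := by
  obtain ⟨C0, hC0, hivp⟩ := ivp_exists hℓ hm hM
  obtain ⟨N, hN, hN1, hN2⟩ : ∃ N > 0, M ≤ 2 * N ^ 2 ∧ C0 ≤ M * N := by
    refine ⟨1 + M + C0 / M, by positivity, ?_, ?_⟩
    · have : 0 ≤ C0 / M := by positivity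
      nlinarith
    · have : M * (1 + M + C0 / M) = M + M ^ 2 + C0 := by field_simp
      rw [this]; nlinarith [sq_nonneg M]
  obtain ⟨c1, hc1, hlow⟩ := Clas.exists_lower hℓ hM hm (V := 2 * M * N / ℓ) (by positivity) (ini m) (ini_pos_far hm)
  obtain ⟨C1, hC1, k1, k2, k3⟩ : ∃ C1 > 0, 2 * M * N ≤ C1 ∧ 2 * M * N / ℓ ≤ C1 ∧ C0 * Real.exp M ≤ C1 := by
    refine ⟨2 * M * N + 2 * M * N / ℓ + C0 * Real.exp M, by positivity, ?_, ?_, ?_⟩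
    · have : 0 ≤ 2 * M * N / ℓ := by positivity
      have : 0 ≤ C0 * Real.exp M := by positivity
      linarith
    · have : 0 ≤ C0 * Real.exp M := by positivity
      have : 0 ≤ 2 * M * N := by positivity
      linarith
    · have : 0 ≤ 2 * M * N / ℓ := by positivity
      have : 0 ≤ 2 * M * N := by positivity
      linarith
  obtain ⟨K, hK, htl⟩ := Clas.exists_time_lip (ℓ := ℓ) hM hC1 hc1
  obtain ⟨C2, hC2, j1, j2, j3⟩ : ∃ C2 > 0, C1 ≤ C2 ∧ K ≤ C2 ∧ C0 ≤ C2 :=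
    ⟨C1 + K + C0, by positivity, by linarith, by linarith, by linarith⟩
  obtain ⟨lam, hlam, C3, hC3, hdec⟩ := Clas.exists_decay (ℓ := ℓ) (P := P) hM hC2 hc1 hm hP
  obtain ⟨c2, hc2, hdl⟩ := Clas.exists_dt_lower hℓ hM hC2 hc1
  obtain ⟨C, hC, i2, i3⟩ : ∃ C > 0, C2 ≤ C ∧ C3 * Real.exp lam ≤ C := by
    refine ⟨C2 + C3 * Real.exp lam, by positivity, ?_, by linarith⟩
    have : 0 ≤ C3 * Real.exp lam := by positivity
    linarith
  obtain ⟨c, hc, a1, a2, a3⟩ : ∃ c > 0, c ≤ c1 ∧ c ≤ c2 ∧ c ≤ c1 / ℓ :=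
    ⟨min c1 (min c2 (c1 / ℓ)), by positivity, min_le_left _ _, (min_le_right _ _).trans (min_le_left _ _),
      (min_le_right _ _).trans (min_le_right _ _)⟩
  refine ⟨C, hC, c, hc, lam, hlam, ?_⟩
  intro g p hgc hg hgM hp
  obtain ⟨u, h, I, hcu, hch⟩ := hivp g hg hgM
  have hlt : ∀ x t s T, 0 ≤ t → 0 ≤ s → t ≤ T → u x (t + s) - u x t ≤ C0 * Real.exp (M * T) * s := by
    intro x t s T h1 h2 h3
    refine (I.lipt x t s h1 h2).trans ?_
    gcongr
  have hmono : ∀ x s t, 0 ≤ s → s ≤ t → u x s ≤ u x t := fun x s t h1 h2 => by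
    have := I.monot x s (t - s) h1 (by linarith)
    rwa [add_sub_cancel] at this
  have hhm : ∀ s t, 0 ≤ s → s ≤ t → h s ≤ h t := fun s t h1 h2 => by
    have := I.h_mono s (t - s) h1 (by linarith)
    rwa [add_sub_cancel] at this
  have S : Clas ℓ M 0 g u h := by
    refine Clas.of_reg (fun T hT => ⟨C0 * Real.exp (M * T), ?_⟩) hcu hch (fun x => hm.le.trans (hg x)) hgM hmono
    have hK1 : C0 ≤ C0 * Real.exp (M * T) := le_mul_of_one_le_right hC0.le (Real.one_le_exp (by positivity))
    refine ⟨I.approx, fun x y t h1 _ => (I.lipx x y t h1).trans (by gcongr), ?_, ?_, fun s t h1 h2 _ => hhm s t h1 h2,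
      hgc, fun x t h1 _ => I.nonneg x t h1, fun x t h1 _ => I.le x t h1, fun x t h1 _ => I.zero x t h1, by positivity, hM, hℓ⟩
    · intro x t s h1 h2 h3 h4
      wlog hts : s ≤ t generalizing t s
      · rw [abs_sub_comm, abs_sub_comm t]
        exact this s t h3 h4 h1 h2 (by linarith)
      have := hlt x s (t - s) T h3 (by linarith) h4
      rw [add_sub_cancel] at this
      rwa [abs_of_nonneg (sub_nonneg.2 (hmono x s t h3 hts)), abs_of_nonneg (sub_nonneg.2 hts)]
    · intro t s h1 h2 h3 h4
      wlog hts : s ≤ t generalizing t s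
      · rw [abs_sub_comm, abs_sub_comm t]
        exact this s t h3 h4 h1 h2 (by linarith)
      have := I.h_lip s (t - s) h3 (by linarith)
      rw [add_sub_cancel] at this
      rw [abs_of_nonneg (sub_nonneg.2 (hhm s t h3 hts)), abs_of_nonneg (sub_nonneg.2 hts)]
      exact this.trans (mul_le_mul_of_nonneg_right hK1 (by linarith))
  have hlin0 : ∀ x t, 0 ≤ t → x ≤ h t → u x t ≤ 2 * M * N * (h t - x) := fun x t h1 h2 =>
    S.le_linear hN hN1 hN2 (fun y hy => by
      have := I.lipx y (h 0) 0 le_rfl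
      rw [I.zero (h 0) 0 le_rfl le_rfl, sub_zero, abs_sub_comm, abs_of_nonneg (sub_nonneg.2 hy)] at this
      exact (le_abs_self _).trans this) h1 h2
  have hV0 : ∀ t > 0, deriv h t ≤ 2 * M * N / ℓ := fun t ht => by
    rw [le_div_iff₀ hℓ, mul_comm]
    exact S.slope_le ht one_pos fun ξ h1 h2 => by
      have := hlin0 (h t - ξ) t ht.le (by linarith)
      rwa [sub_sub_cancel] at this
  have hlow1 : ∀ x t, 1 ≤ t → x ≤ h t → c1 * min (h t - x) 1 ≤ u x t := fun x t h1 h2 =>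
    hlow S hg hV0 I.h0 I.init t x h1 h2
  have hsl : ∀ t > 1, c1 ≤ ℓ * deriv h t := fun t ht => S.slope_ge (by linarith) one_pos fun ξ h1 h2 => by
    have := hlow1 (h t - ξ) t ht.le (by linarith)
    rwa [sub_sub_cancel, min_eq_left h2] at this
  have htl1 := htl S hsl (fun t ht => (hV0 t ht).trans k2)
    (fun x t h1 h2 => (hlin0 x t h1 h2).trans (mul_le_mul_of_nonneg_right k1 (by linarith)))
    hlow1 (fun x t s h1 h2 h3 => (hlt x t s 1 h1 h3 h2).trans (by rw [mul_one]; gcongr))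
  have hV2 : ∀ t > 0, deriv h t ≤ C2 := fun t ht => ((hV0 t ht).trans k2).trans j1
  have hup := S.le_steady hp hm fun x => by rw [I.init]; linarith [ini_le hm x]
  have hdec1 := hdec S hp hup hV2 hlow1 (fun x y t h1 => (I.lipx x y t h1).trans (by gcongr))
    (fun x t s h1 h2 => (htl1 x t s h1 h2).trans (by gcongr))
  have hdl1 := hdl S hsl hV2 hlow1
  have hexp : ∀ x t, C3 * (Real.exp (lam * (x - h t)) + Real.exp (-lam * (t - 1))) ≤
      C * (Real.exp (lam * (x - h t)) + Real.exp (-lam * (t - 2))) := by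
    intro x t
    have e1 : Real.exp (-lam * (t - 1)) ≤ Real.exp (-lam * (t - 2)) := Real.exp_le_exp.2 (by nlinarith)
    have e2 : C3 ≤ C := le_trans (le_mul_of_one_le_right hC3.le (Real.one_le_exp hlam.le)) i3
    gcongr
  refine ⟨u, h, I.h0, fun t h1 h2 => ?_, ?_⟩
  · have := S.h_upper hV2 le_rfl h1
    rw [I.h0, sub_zero, sub_zero] at this
    exact this.trans (by gcongr)
  refine ⟨I.approx.mono_time (by norm_num), hgc, S.g_nonneg, hgM, ?_, ?_, ?_, ?_, ?_, ?_, ?_, ?_, ?_, ?_, ?_, ?_⟩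
  · exact fun x y t ht => (I.lipx x y t (by linarith)).trans (mul_le_mul_of_nonneg_right (j3.trans i2) (abs_nonneg _))
  · exact fun x t s ht hs => (htl1 x t s (by linarith) hs).trans (mul_le_mul_of_nonneg_right (j2.trans i2) hs)
  · exact fun x s t hs => hmono x s t (by linarith)
  · exact fun x t ht => S.nonneg x t (by linarith)
  · exact fun x t ht => S.le x t (by linarith)
  · exact fun x t ht => S.zero x t (by linarith)
  · exact fun s t hs hst => S.h_lower (fun r h1 h2 => a3.trans (by rw [div_le_iff₀ hℓ, mul_comm]; exact hsl r (by linarith)))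
      (by linarith) hst
  · exact fun s t hs hst => (S.h_upper hV2 (by linarith) hst).trans (mul_le_mul_of_nonneg_right i2 (by linarith))
  · exact fun x t ht hx => le_trans (mul_le_mul_of_nonneg_right a1 (le_min (by linarith) (by norm_num))) (hlow1 x t (by linarith) hx)
  · exact fun x t s ht hs h1 h2 h3 => le_trans (mul_le_mul_of_nonneg_right a2 hs) (hdl1 x t s ht hs (h1.trans a2) (by linarith) h3)
  · intro x t s ht hs
    refine ((hdec1 x t (by linarith)).2 s hs).trans ?_
    have := mul_le_mul_of_nonneg_right (hexp x t) hs
    linarith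
  · intro x t ht
    rw [abs_of_nonneg (sub_nonneg.2 (hup x t (by linarith)))]
    exact (hdec1 x t (by linarith)).1.trans (hexp x t)

structure Consts (ℓ M C c lam : ℝ) : Prop where
  hℓ : 0 < ℓ
  hM : 0 < M
  hC : 0 < C
  hc : 0 < c
  hlam : 0 < lam

namespace LatSol

/-- Translate a lattice solution in space and time. -/
def shift {ℓ M : ℝ} (L : LatSol ℓ M) (d σ : ℝ) : LatSol ℓ M :=
  { L with x0 := L.x0 - d, t0 := L.t0 - σ }

theorem shift_x {ℓ M : ℝ} (L : LatSol ℓ M) (d σ : ℝ) (i : ℤ) : (L.shift d σ).x i + d = L.x i := by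
  simp only [shift, x]; ring

theorem shift_t {ℓ M : ℝ} (L : LatSol ℓ M) (d σ : ℝ) (k : ℕ) : (L.shift d σ).t k + σ = L.t k := by
  simp only [shift, t]; ring

end LatSol

theorem Approx.translate {ℓ M b : ℝ} {g : ℝ → ℝ} {u : ℝ → ℝ → ℝ} {h : ℝ → ℝ} (H : Approx ℓ M b g u h) (d σ : ℝ) :
    Approx ℓ M (b - σ) (fun x => g (x + d)) (fun x t => u (x + d) (t + σ)) (fun t => h (t + σ) - d) := by
  intro R hR ε hε
  obtain ⟨L, h1, h2, h3⟩ := H (R + |d| + |σ|) (by positivity) ε hε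
  refine ⟨L.shift d σ, h1, sub_le_sub_right h2 σ, fun k i hk hk2 hi => ?_⟩
  have e1 := L.shift_t d σ k
  have e2 := L.shift_x d σ i
  have b1 : |L.t k| ≤ R + |d| + |σ| := by
    rw [← e1]; exact (abs_add_le _ _).trans (by linarith [abs_nonneg d])
  have b2 : |L.x i| ≤ R + |d| + |σ| := by
    rw [← e2]; exact (abs_add_le _ _).trans (by linarith [abs_nonneg σ])
  obtain ⟨a1, a2, a3, a4⟩ := h3 k i (by linarith) b1 b2
  beta_reduce
  rw [e1, e2]
  exact ⟨a1, a2, fun h => by have := a3 h; linarith, fun h => by have := a4 h; linarith⟩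

theorem Approx.limit {ℓ M b : ℝ} {g : ℝ → ℝ} {u : ℝ → ℝ → ℝ} {h : ℝ → ℝ}
    (H : ∀ R > (0:ℝ), ∀ ε > (0:ℝ), ∃ g' u' h', Approx ℓ M b g' u' h' ∧ ∀ x t, b ≤ t → |x| ≤ R → |t| ≤ R →
      |u' x t - u x t| ≤ ε ∧ |h' t - h t| ≤ ε ∧ |g' x - g x| ≤ ε) : Approx ℓ M b g u h := by
  intro R hR ε hε
  obtain ⟨g', u', h', H', hcl⟩ := H R hR (ε / 2) (by linarith)
  obtain ⟨L, h1, h2, h3⟩ := H' R hR (ε / 2) (by linarith)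
  refine ⟨L, by linarith, h2, fun k i hk hk2 hi => ?_⟩
  obtain ⟨a1, a2, a3, a4⟩ := h3 k i hk hk2 hi
  obtain ⟨c1, c2, c3⟩ := hcl (L.x i) (L.t k) hk hi hk2
  rw [abs_le] at c1 c2 c3 a1 a2
  refine ⟨abs_le.2 ⟨by linarith, by linarith⟩, abs_le.2 ⟨by linarith, by linarith⟩, fun h => ?_, fun h => ?_⟩
  · have := a3 h; linarith
  · have := a4 h; linarith

namespace WaveOn
variable {ℓ M C c lam b : ℝ} {g p : ℝ → ℝ} {u : ℝ → ℝ → ℝ} {h : ℝ → ℝ}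

theorem mono_b (hK : Consts ℓ M C c lam) (W : WaveOn ℓ M C c lam b g p u h) {b' : ℝ} (hb : b ≤ b') :
    WaveOn ℓ M C c lam b' g p u h := by
  have hC := hK.hC
  have hl := hK.hlam
  have key : ∀ x t, Real.exp (lam * (x - h t)) + Real.exp (-lam * (t - b)) ≤ Real.exp (lam * (x - h t)) + Real.exp (-lam * (t - b')) := by
    intro x t
    have : Real.exp (-lam * (t - b)) ≤ Real.exp (-lam * (t - b')) := Real.exp_le_exp.2 (by nlinarith)
    linarith
  exact ⟨W.approx.mono_time hb, W.gcont, W.g_nonneg, W.g_le, fun x y t ht => W.lipx x y t (hb.trans ht),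
    fun x t s ht => W.lipt x t s (hb.trans ht), fun x s t hs => W.mono x s t (hb.trans hs), fun x t ht => W.nonneg x t (hb.trans ht),
    fun x t ht => W.le x t (hb.trans ht), fun x t ht => W.zero x t (hb.trans ht), fun s t hs => W.h_lower s t (hb.trans hs),
    fun s t hs => W.h_upper s t (hb.trans hs), fun x t ht => W.lower x t (hb.trans ht),
    fun x t s ht => W.dt_lower x t s (hb.trans ht),
    fun x t s ht hs => (W.dt_upper x t s (hb.trans ht) hs).trans (mul_le_mul_of_nonneg_left (key x t) (by positivity)),
    fun x t ht => (W.left x t (hb.trans ht)).trans (mul_le_mul_of_nonneg_left (key x t) hC.le)⟩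

theorem translate (W : WaveOn ℓ M C c lam b g p u h) (d σ : ℝ) :
    WaveOn ℓ M C c lam (b - σ) (fun x => g (x + d)) (fun x => p (x + d)) (fun x t => u (x + d) (t + σ)) (fun t => h (t + σ) - d) where
  approx := W.approx.translate d σ
  gcont := W.gcont.comp (by fun_prop)
  g_nonneg x := W.g_nonneg _
  g_le x := W.g_le _
  lipx x y t ht := by have := W.lipx (x + d) (y + d) (t + σ) (by linarith); rwa [add_sub_add_right_eq_sub] at this
  lipt x t s ht hs := by have := W.lipt (x + d) (t + σ) s (by linarith) hs; rwa [add_right_comm] at this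
  mono x s t hs hst := W.mono _ _ _ (by linarith) (by linarith)
  nonneg x t ht := W.nonneg _ _ (by linarith)
  le x t ht := W.le _ _ (by linarith)
  zero x t ht hx := W.zero _ _ (by linarith) (by linarith)
  h_lower s t hs hst := by have := W.h_lower (s + σ) (t + σ) (by linarith) (by linarith); rw [add_sub_add_right_eq_sub] at this; linarith
  h_upper s t hs hst := by have := W.h_upper (s + σ) (t + σ) (by linarith) (by linarith); rw [add_sub_add_right_eq_sub] at this; linarith
  lower x t ht hx := by
    have := W.lower (x + d) (t + σ) (by linarith) (by linarith)
    rwa [show h (t + σ) - d - x = h (t + σ) - (x + d) by ring]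
  dt_lower x t s ht hs hsc h1 h2 := by
    have := W.dt_lower (x + d) (t + σ) s (by linarith) hs hsc (by linarith) (by linarith)
    rwa [add_right_comm] at this
  dt_upper x t s ht hs := by
    have := W.dt_upper (x + d) (t + σ) s (by linarith) hs
    rw [add_right_comm] at this
    rwa [show x - (h (t + σ) - d) = x + d - h (t + σ) by ring, show t - (b - σ) = t + σ - b by ring]
  left x t ht := by
    have := W.left (x + d) (t + σ) (by linarith)
    rwa [show x - (h (t + σ) - d) = x + d - h (t + σ) by ring, show t - (b - σ) = t + σ - b by ring]

theorem abs_lipt (W : WaveOn ℓ M C c lam b g p u h) (x t s : ℝ) (ht : b ≤ t) (hs : b ≤ s) : |u x t - u x s| ≤ C * |t - s| := by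
  wlog hts : s ≤ t generalizing t s
  · rw [abs_sub_comm, abs_sub_comm t]
    exact this s t hs ht (by linarith)
  have := W.lipt x s (t - s) hs (by linarith)
  rw [add_sub_cancel] at this
  rwa [abs_of_nonneg (sub_nonneg.2 (W.mono x s t hs hts)), abs_of_nonneg (sub_nonneg.2 hts)]

theorem h_mono (hK : Consts ℓ M C c lam) (W : WaveOn ℓ M C c lam b g p u h) (s t : ℝ) (hs : b ≤ s) (hst : s ≤ t) : h s ≤ h t := by
  have := W.h_lower s t hs hst
  have := mul_nonneg hK.hc.le (sub_nonneg.2 hst)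
  linarith

theorem abs_liph (hK : Consts ℓ M C c lam) (W : WaveOn ℓ M C c lam b g p u h) (t s : ℝ) (ht : b ≤ t) (hs : b ≤ s) : |h t - h s| ≤ C * |t - s| := by
  wlog hts : s ≤ t generalizing t s
  · rw [abs_sub_comm, abs_sub_comm t]
    exact this s t hs ht (by linarith)
  rw [abs_of_nonneg (sub_nonneg.2 (W.h_mono hK s t hs hts)), abs_of_nonneg (sub_nonneg.2 hts)]
  exact W.h_upper s t hs hts

theorem reg (hK : Consts ℓ M C c lam) (W : WaveOn ℓ M C c lam b g p u h) (T : ℝ) : Reg ℓ M C b T g u h where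
  approx := W.approx
  lipx x y t ht _ := W.lipx x y t ht
  lipt x t s ht _ hs _ := W.abs_lipt x t s ht hs
  liph t s ht _ hs _ := W.abs_liph hK t s ht hs
  h_mono t s ht hst _ := W.h_mono hK t s ht hst
  gcont := W.gcont
  nonneg x t ht _ := W.nonneg x t ht
  le x t ht _ := W.le x t ht
  zero x t ht _ := W.zero x t ht
  K_pos := hK.hC
  M_pos := hK.hM
  ℓ_pos := hK.hℓ

theorem le_front (hK : Consts ℓ M C c lam) (W : WaveOn ℓ M C c lam b g p u h) (x t : ℝ) (ht : b ≤ t) : u x t ≤ C * max (h t - x) 0 := by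
  rcases le_total (h t) x with hx | hx
  · rw [W.zero x t ht hx]; exact mul_nonneg hK.hC.le (le_max_right _ _)
  · have := W.lipx x (h t) t ht
    rw [W.zero (h t) t ht le_rfl, sub_zero, abs_sub_comm, abs_of_nonneg (sub_nonneg.2 hx)] at this
    rw [max_eq_left (sub_nonneg.2 hx)]
    exact (le_abs_self _).trans this

theorem lower' (hK : Consts ℓ M C c lam) (W : WaveOn ℓ M C c lam b g p u h) (x t : ℝ) (ht : b ≤ t) : c * min (h t - x) 1 ≤ u x t := by
  rcases le_total x (h t) with hx | hx
  · exact W.lower x t ht hx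
  · have := mul_nonpos_of_nonneg_of_nonpos hK.hc.le ((min_le_left (h t - x) 1).trans (by linarith))
    exact this.trans (W.nonneg x t ht)

end WaveOn

/-- Locally uniform convergence of solutions, together with their fronts. -/
def Conv (u : ℕ → ℝ → ℝ → ℝ) (h : ℕ → ℝ → ℝ) (u' : ℝ → ℝ → ℝ) (h' : ℝ → ℝ) : Prop :=
  ∀ R, ∀ ε > (0:ℝ), ∃ N, ∀ n ≥ N, ∀ x t, |x| ≤ R → |t| ≤ R → |u n x t - u' x t| < ε ∧ |h n t - h' t| < ε

theorem Conv.tendsto_u {u h u' h'} (H : Conv u h u' h') (x t : ℝ) : Tendsto (fun n => u n x t) atTop (𝓝 (u' x t)) := by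
  rw [Metric.tendsto_atTop]
  intro ε hε
  obtain ⟨N, hN⟩ := H (max |x| |t|) ε hε
  exact ⟨N, fun n hn => (hN n hn x t (le_max_left _ _) (le_max_right _ _)).1⟩

theorem Conv.tendsto_h {u h u' h'} (H : Conv u h u' h') (t : ℝ) : Tendsto (fun n => h n t) atTop (𝓝 (h' t)) := by
  rw [Metric.tendsto_atTop]
  intro ε hε
  obtain ⟨N, hN⟩ := H |t| ε hε
  exact ⟨N, fun n hn => (hN n hn 0 t (by simp) le_rfl).2⟩

theorem Conv.comp {u h u' h'} (H : Conv u h u' h') {φ : ℕ → ℕ} (hφ : StrictMono φ) :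
    Conv (fun n => u (φ n)) (fun n => h (φ n)) u' h' := fun R ε hε =>
  let ⟨N, hN⟩ := H R ε hε
  ⟨N, fun n hn => hN (φ n) (hn.trans (hφ.id_le n))⟩

/-- A limit of waves on expanding time intervals is an entire wave. -/
theorem Conv.waveOn {ℓ M C c lam : ℝ} (hK : Consts ℓ M C c lam) {β : ℕ → ℝ} {g p : ℕ → ℝ → ℝ} {u : ℕ → ℝ → ℝ → ℝ} {h : ℕ → ℝ → ℝ}
    {g' p' : ℝ → ℝ} {u' : ℝ → ℝ → ℝ} {h' : ℝ → ℝ}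
    (H : Conv u h u' h') (W : ∀ n, WaveOn ℓ M C c lam (β n) (g n) (p n) (u n) (h n)) (hβ : Tendsto β atTop atBot)
    (hg : TendstoLocallyUniformly g g' atTop) (hp : ∀ x, Tendsto (fun n => p n x) atTop (𝓝 (p' x))) (b : ℝ) :
    WaveOn ℓ M C c lam b g' p' u' h' := by
  have hC := hK.hC
  have hb : ∀ᶠ n in atTop, WaveOn ℓ M C c lam b (g n) (p n) (u n) (h n) := by
    filter_upwards [hβ.eventually_le_atBot b] with n hn
    exact (W n).mono_b hK hn
  have hU := H.tendsto_u
  have hH := H.tendsto_h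
  have hG := fun x => hg.tendstoLocallyUniformlyOn (s := univ) |>.tendsto_at (mem_univ x)
  refine ⟨?_, ?_, ?_, ?_, ?_, ?_, ?_, ?_, ?_, ?_, ?_, ?_, ?_, ?_, ?_, ?_⟩
  · refine Approx.limit fun R hR ε hε => ?_
    obtain ⟨N1, h1⟩ := TendstoLocallyUniformly.uniform_on_compact hg (isCompact_Icc (a := -R) (b := R)) hε
    obtain ⟨N2, h2⟩ := H R ε hε
    obtain ⟨n, h3, h4⟩ := (hb.and (eventually_ge_atTop (max N1 N2))).exists
    refine ⟨g n, u n, h n, h3.approx, fun x t _ hx ht => ?_⟩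
    obtain ⟨a1, a2⟩ := h2 n ((le_max_right _ _).trans h4) x t hx ht
    exact ⟨a1.le, a2.le, (h1 n ((le_max_left _ _).trans h4) x (abs_le.1 hx)).le⟩
  · exact hg.continuous (Frequently.of_forall fun n => (W n).gcont)
  · exact fun x => ge_of_tendsto' (hG x) fun n => (W n).g_nonneg x
  · exact fun x => le_of_tendsto' (hG x) fun n => (W n).g_le x
  · exact fun x y t ht => le_of_tendsto ((hU x t).sub (hU y t)).abs (hb.mono fun n hn => hn.lipx x y t ht)
  · exact fun x t s ht hs => le_of_tendsto ((hU x (t + s)).sub (hU x t)) (hb.mono fun n hn => hn.lipt x t s ht hs)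
  · exact fun x s t hs hst => le_of_tendsto_of_tendsto (hU x s) (hU x t) (hb.mono fun n hn => hn.mono x s t hs hst)
  · exact fun x t ht => ge_of_tendsto (hU x t) (hb.mono fun n hn => hn.nonneg x t ht)
  · exact fun x t ht => le_of_tendsto (hU x t) (hb.mono fun n hn => hn.le x t ht)
  · intro x t ht hx
    refine le_antisymm ?_ (ge_of_tendsto (hU x t) (hb.mono fun n hn => hn.nonneg x t ht))
    have := le_of_tendsto_of_tendsto (hU x t) ((((hH t).sub_const x).max tendsto_const_nhds).const_mul C)
      (hb.mono fun n hn => hn.le_front hK x t ht)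
    rwa [max_eq_right (by linarith), mul_zero] at this
  · exact fun s t hs hst => ge_of_tendsto ((hH t).sub (hH s)) (hb.mono fun n hn => hn.h_lower s t hs hst)
  · exact fun s t hs hst => le_of_tendsto ((hH t).sub (hH s)) (hb.mono fun n hn => hn.h_upper s t hs hst)
  · intro x t ht hx
    exact le_of_tendsto_of_tendsto ((((hH t).sub_const x).min tendsto_const_nhds).const_mul c) (hU x t)
      (hb.mono fun n hn => hn.lower' hK x t ht)
  · intro x t s ht hs hsc h1 h2
    have e : Tendsto (fun n => c * s - 2 * C * |h n t - h' t|) atTop (𝓝 (c * s)) := by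
      have := ((((hH t).sub_const (h' t)).abs).const_mul (2 * C)).const_sub (c * s)
      simpa using this
    refine le_of_tendsto_of_tendsto e ((hU x (t + s)).sub (hU x t)) (hb.mono fun n hn => ?_)
    have a1 := hn.dt_lower (x + (h n t - h' t)) t s ht hs hsc (by linarith) (by linarith)
    have a2 := (abs_le.1 (hn.lipx (x + (h n t - h' t)) x (t + s) (by linarith))).2
    have a3 := (abs_le.1 (hn.lipx (x + (h n t - h' t)) x t ht)).1
    rw [add_sub_cancel_left] at a2 a3
    linarith
  · intro x t s ht hs
    refine le_of_tendsto_of_tendsto ((hU x (t + s)).sub (hU x t)) ?_ (hb.mono fun n hn => hn.dt_upper x t s ht hs)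
    refine (Tendsto.add ?_ tendsto_const_nhds).const_mul _
    exact (Real.continuous_exp.tendsto _).comp (((hH t).const_sub x).const_mul lam)
  · intro x t ht
    refine le_of_tendsto_of_tendsto (((hp x).sub (hU x t)).abs) ?_ (hb.mono fun n hn => hn.left x t ht)
    refine (Tendsto.add ?_ tendsto_const_nhds).const_mul _
    exact (Real.continuous_exp.tendsto _).comp (((hH t).const_sub x).const_mul lam)

set_option maxHeartbeats 1000000 in
theorem exists_conv {ℓ M C c lam : ℝ} (hK : Consts ℓ M C c lam) {β : ℕ → ℝ} {g p : ℕ → ℝ → ℝ} {u : ℕ → ℝ → ℝ → ℝ} {h : ℕ → ℝ → ℝ}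
    (W : ∀ n, WaveOn ℓ M C c lam (β n) (g n) (p n) (u n) (h n)) (hβ : Tendsto β atTop atBot) (hβ0 : ∀ n, β n ≤ 0)
    (B : ℝ) (hB : ∀ n, |h n 0| ≤ B) : ∃ φ : ℕ → ℕ, StrictMono φ ∧ ∃ u' h', Conv (fun n => u (φ n)) (fun n => h (φ n)) u' h' := by
  have hC := hK.hC
  have hmax : ∀ n t s, |max t (β n) - max s (β n)| ≤ |t - s| := fun n t s => abs_max_sub_max_le_abs t s (β n)
  obtain ⟨φ, hφ, U, -, hU⟩ := exists_subseq_tendstoLocallyUniformly (X := ℝ × ℝ) (fun n q => u n q.1 (max q.2 (β n)))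
    (fun q => ⟨M, fun n => abs_le.2 ⟨by linarith [hK.hM, (W n).nonneg q.1 _ (le_max_right q.2 (β n))], (W n).le _ _ (le_max_right _ _)⟩⟩)
    (fun q ε hε => ⟨ε / (2 * C), by positivity, 0, fun n _ r hr => by
      have e1 := (W n).lipx r.1 q.1 _ (le_max_right r.2 (β n))
      have e2 := (W n).abs_lipt q.1 _ _ (le_max_right r.2 (β n)) (le_max_right q.2 (β n))
      have e3 := hmax n r.2 q.2
      rw [Prod.dist_eq, max_lt_iff, Real.dist_eq, Real.dist_eq, lt_div_iff₀ (by positivity), lt_div_iff₀ (by positivity)] at hr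
      have e4 : C * |max r.2 (β n) - max q.2 (β n)| ≤ C * |r.2 - q.2| := by gcongr
      rw [abs_le] at e1 e2 ⊢
      constructor <;> linarith [hr.1, hr.2]⟩)
  obtain ⟨ψ, hψ, H, -, hH⟩ := exists_subseq_tendstoLocallyUniformly (X := ℝ) (fun n t => h (φ n) (max t (β (φ n))))
    (fun t => ⟨B + C * |t|, fun n => by
      have e1 := (W (φ n)).abs_liph hK _ 0 (le_max_right t (β (φ n))) (hβ0 _)
      have e2 : |max t (β (φ n)) - 0| ≤ |t| := by
        have := hmax (φ n) t 0
        rwa [max_eq_left (hβ0 (φ n)), sub_zero t] at this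
      have e3 : C * |max t (β (φ n)) - 0| ≤ C * |t| := by gcongr
      have e4 := hB (φ n)
      rw [abs_le] at e1 e4 ⊢
      constructor <;> linarith⟩)
    (fun t ε hε => ⟨ε / C, by positivity, 0, fun n _ s hs => by
      have e1 := (W (φ n)).abs_liph hK _ _ (le_max_right s (β (φ n))) (le_max_right t (β (φ n)))
      rw [Real.dist_eq, lt_div_iff₀ hC] at hs
      refine e1.trans ?_
      have : C * |max s (β (φ n)) - max t (β (φ n))| ≤ C * |s - t| := by exact mul_le_mul_of_nonneg_left (hmax (φ n) s t) hC.le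
      linarith⟩)
  refine ⟨φ ∘ ψ, hφ.comp hψ, fun x t => U (x, t), H, fun R ε hε => ?_⟩
  obtain ⟨N1, h1⟩ := TendstoLocallyUniformly.uniform_on_compact hU ((isCompact_Icc (a := -R) (b := R)).prod (isCompact_Icc (a := -R) (b := R))) hε
  obtain ⟨N2, h2⟩ := TendstoLocallyUniformly.uniform_on_compact hH (isCompact_Icc (a := -R) (b := R)) hε
  obtain ⟨N3, h3⟩ := eventually_atTop.1 (((hβ.comp hφ.tendsto_atTop).comp hψ.tendsto_atTop).eventually_le_atBot (-R))
  refine ⟨max N1 (max N2 N3), fun n hn x t hx ht => ?_⟩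
  have n1 : N1 ≤ n := (le_max_left _ _).trans hn
  have n2 : N2 ≤ n := ((le_max_left _ _).trans (le_max_right _ _)).trans hn
  have n3 : N3 ≤ n := ((le_max_right _ _).trans (le_max_right _ _)).trans hn
  have e := h3 n n3
  simp only [Function.comp] at e ⊢
  have a1 := h1 (ψ n) (n1.trans (hψ.id_le n)) (x, t) ⟨abs_le.1 hx, abs_le.1 ht⟩
  have a2 := h2 n n2 t (abs_le.1 ht)
  rw [max_eq_left (e.trans (abs_le.1 ht).1)] at a1 a2
  exact ⟨a1, a2⟩

/-- Comparison of two entire solutions: a relation up to the factor `1 + κ` improves to one without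
factor, at the price of a time shift proportional to `κ`. -/
theorem Clas.relax {ℓ M c0 : ℝ} {g : ℝ → ℝ} {u1 u2 : ℝ → ℝ → ℝ} {h1 h2 : ℝ → ℝ} (S1 : ∀ b, Clas ℓ M b g u1 h1)
    (S2 : ∀ b, Clas ℓ M b g u2 h2) (hpos : ∀ t, 0 < deriv h2 t) (hc0 : 0 < c0)
    (hsup : ∀ x t zt zx zxx, x < h2 t → Jet u2 x t zt zx zxx → c0 * u2 x t ≤ 2 * zt + u2 x t ^ 2)
    {κ s t0 : ℝ} (hκ : 0 < κ) (h0 : h1 t0 < h2 (t0 + s)) (hu : ∀ x, u1 x t0 ≤ (1 + κ) * u2 x (t0 + s)) (t : ℝ) (ht : t0 ≤ t) :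
    h1 t ≤ h2 (t + s + 2 * κ / c0) ∧ ∀ x, u1 x t ≤ (1 + κ * Real.exp (-c0 * (t - t0))) * u2 x (t + s + 2 * κ / c0) := by
  obtain ⟨e, he⟩ : ∃ e : ℝ → ℝ, e = fun t => Real.exp (-c0 * (t - t0)) := ⟨_, rfl⟩
  obtain ⟨T, hT⟩ : ∃ T : ℝ → ℝ, T = fun t => t + s + 2 * κ / c0 * (1 - e t) := ⟨_, rfl⟩
  have he0 : ∀ t, 0 < e t := fun t => by rw [he]; exact Real.exp_pos _
  have hed : ∀ t, HasDerivAt e (-c0 * e t) t := fun t => by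
    rw [he]
    exact ((((hasDerivAt_id t).sub_const t0).const_mul (-c0)).exp).congr_deriv (by simp only [id]; ring)
  have hTd : ∀ t, HasDerivAt T (1 + 2 * κ * e t) t := fun t => by
    rw [hT]
    exact (((hasDerivAt_id t).add_const s).add (((hed t).const_sub 1).const_mul (2 * κ / c0))).congr_deriv (by field_simp)
  have hec : Continuous e := continuous_iff_continuousAt.2 fun t => (hed t).continuousAt
  have hTc : Continuous T := continuous_iff_continuousAt.2 fun t => (hTd t).continuousAt
  have het0 : e t0 = 1 := by rw [he]; simp
  have hTt0 : T t0 = t0 + s := by rw [hT]; simp [het0]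
  have c1 := (S1 0).cont_u
  have c2 := (S2 0).cont_u
  have d1 := (S1 0).cont_h
  have d2 := (S2 0).cont_h
  have cmp : ∀ t1, t0 ≤ t1 → (∀ r, t0 ≤ r → r ≤ t1 → h1 r ≤ h2 (T r)) → ∀ x, u1 x t1 ≤ (1 + κ * e t1) * u2 x (T t1) := by
    intro t1 ht1 hr x
    have hWpos : ∀ x t, 0 ≤ (1 + κ * e t) * u2 x (T t) := fun x t =>
      mul_nonneg (by have := mul_pos hκ (he0 t); linarith) ((S2 (T t)).nonneg x _ le_rfl)
    rcases le_total (h1 t1) x with hx | hx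
    · rw [(S1 t1).zero x t1 le_rfl hx]; exact hWpos x t1
    have key := max_principle (Clas.isClosed_below d1 t0 t1 0) (K := M) (B := M) (t0 := t0) (t1 := t1)
      (z := fun x t => (1 + κ * e t) * u2 (x + 0) (T t) - u1 x t) (fun p hp => hp.1)
      (Continuous.continuousOn (by
        have : Continuous fun p : ℝ × ℝ => u2 (p.1 + 0) (T p.2) :=
          c2.comp (f := fun p : ℝ × ℝ => (p.1 + 0, T p.2)) (by fun_prop)
        fun_prop))
      (fun p _ => by have a1 := hWpos (p.1 + 0) p.2; have a2 := (S1 p.2).le p.1 p.2 le_rfl; linarith) ?_ x t1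
      ⟨⟨ht1, le_rfl⟩, by linarith⟩
    · rw [add_zero] at key; linarith
    · rintro x t ⟨⟨a1, a2⟩, a3⟩ hneg
      simp only [add_zero, sub_zero] at a1 a2 a3 hneg
      have b1 : t0 < t := by
        refine lt_of_le_of_ne a1 ?_
        rintro rfl
        rw [het0, hTt0, mul_one] at hneg
        linarith [hu x]
      have b2 : x < h1 t := by
        refine lt_of_le_of_ne a3 ?_
        rintro rfl
        rw [(S1 t).zero _ t le_rfl le_rfl] at hneg
        linarith [hWpos (h1 t) t]
      refine ⟨?_, ?_, ?_⟩
      · filter_upwards [Iio_mem_nhds b2] with y hy using ⟨⟨a1, a2⟩, by simpa using le_of_lt hy⟩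
      · filter_upwards [(d1.tendsto t).mono_left inf_le_left |>.eventually (lt_mem_nhds b2), eventually_left_Icc b1 a2] with r k1 k2
        exact ⟨k2, by simpa using k1.le⟩
      · have b3 : x < h2 (T t) := b2.trans_le (hr t a1 a2)
        obtain ⟨zx, zxx, hJ1⟩ := (S1 (t - 1)).jet x t (by linarith) b2
        obtain ⟨vx, vxx, hJ2⟩ := (S2 (T t - 1)).jet x (T t) (by linarith) b3
        have hs := hsup _ _ _ _ _ b3 hJ2
        have hJ3 := Jet.comp_time (d := 0) (x := x) (by rwa [add_zero]) (hTd t)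
        have hJ4 := ((Jet.of_time (x := x) (((hed t).const_mul κ).const_add 1)).mul hJ3).sub hJ1
        refine ⟨_, _, _, hJ4, ?_⟩
        have v0 := (S2 (T t)).nonneg x _ le_rfl
        have w0 := (S1 t).nonneg x _ le_rfl
        have v1 := hWpos x t
        have g0 := (S1 0).g_nonneg x
        have g1 := (S1 0).g_le x
        have hE := he0 t
        have vt0 := (S2 (T t - 1)).time_deriv_nonneg (by linarith) hJ2
        rw [add_zero]
        generalize e t = E at *
        generalize u2 x (T t) = v at *
        generalize u1 x t = w at *
        have k1 : 0 ≤ (M - (g x - (1 + κ * E) * v - w)) * -((1 + κ * E) * v - w) := mul_nonneg (by linarith) (by linarith)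
        have k2 : 0 ≤ κ * E * (2 * (vxx + v * (g x - v)) + v ^ 2 - c0 * v) := mul_nonneg (by positivity) (by linarith)
        have k3 : 0 ≤ κ * E * (κ * E) * (2 * (vxx + v * (g x - v)) + v ^ 2) :=
          mul_nonneg (by positivity) (by nlinarith)
        nlinarith
  have front : ∀ t, t0 ≤ t → h1 t < h2 (T t) := by
    by_contra! hcon
    obtain ⟨t2, ht2, hle⟩ := hcon
    obtain ⟨A, hA⟩ : ∃ A : Set ℝ, A = {t | t0 ≤ t ∧ h2 (T t) ≤ h1 t} := ⟨_, rfl⟩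
    have hAc : IsClosed A := by
      rw [hA]; exact (isClosed_le continuous_const continuous_id).inter (isClosed_le (by fun_prop) d1)
    have hAb : BddBelow A := ⟨t0, by rw [hA]; exact fun r hr => hr.1⟩
    have hAn : A.Nonempty := ⟨t2, by rw [hA]; exact ⟨ht2, hle⟩⟩
    have hmem := hAc.csInf_mem hAn hAb
    generalize hr : sInf A = r at *
    have hlt : ∀ q, t0 ≤ q → q < r → h1 q < h2 (T q) := fun q hq hqr => by
      by_contra! hc
      have := csInf_le hAb (show q ∈ A by rw [hA]; exact ⟨hq, hc⟩)
      linarith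
    rw [hA] at hmem
    obtain ⟨m1, m2⟩ := hmem
    have hr0 : t0 < r := by
      refine lt_of_le_of_ne m1 ?_
      rintro rfl
      rw [hTt0] at m2
      linarith
    have heq : h1 r = h2 (T r) := by
      refine le_antisymm ?_ m2
      have q1 : Tendsto h1 (𝓝[<] r) (𝓝 (h1 r)) := (d1.tendsto r).mono_left inf_le_left
      have q2 : Tendsto (fun r => h2 (T r)) (𝓝[<] r) (𝓝 (h2 (T r))) := ((d2.comp hTc).tendsto r).mono_left inf_le_left
      refine le_of_tendsto_of_tendsto q1 q2 ?_
      filter_upwards [Ioo_mem_nhdsLT hr0] with q hq using (hlt q hq.1.le hq.2).le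
    have hcmp := cmp r m1 fun q k1 k2 => by
      rcases k2.lt_or_eq with k2 | rfl
      · exact (hlt q k1 k2).le
      · exact heq.le
    have hD1 := (S1 (r - 1)).hd r (by linarith)
    have hD2 := ((S2 (T r - 1)).hd (T r) (by linarith)).comp r (hTd r)
    have hder := HasDerivAt.nonpos_of_eventually_le_left (hD2.sub hD1) (by
      filter_upwards [Ioo_mem_nhdsLT hr0] with q hq
      simp only [Pi.sub_apply, Function.comp]
      linarith [hlt q hq.1.le hq.2])
    have E := mul_pos hκ (he0 r)
    have hℓ := (S1 0).ℓ_pos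
    have hsl : ℓ * deriv h1 r ≤ (1 + κ * e r) * (ℓ * deriv h2 (T r)) := by
      obtain ⟨C, hC, hf⟩ := (S2 (T r - 1)).front (T r) (by linarith)
      refine le_of_forall_small (c := (1 + κ * e r) * C) one_pos fun ε hε _ => ?_
      refine (S1 (r - 1)).slope_le (by linarith) hε fun ξ k1 k2 => ?_
      refine (hcmp _).trans ?_
      have k3 := (abs_le.1 (hf ξ k1)).2
      rw [heq]
      have k4 : C * ξ ^ 2 ≤ C * ε * ξ := by nlinarith [mul_nonneg (mul_nonneg hC k1) (sub_nonneg.2 k2)]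
      have k5 : (1 + κ * e r) * u2 (h2 (T r) - ξ) (T r) ≤ (1 + κ * e r) * ((ℓ * deriv h2 (T r) + C * ε) * ξ) :=
        mul_le_mul_of_nonneg_left (by linarith) (by linarith)
      linarith
    have hp := mul_pos hℓ (hpos (T r))
    have k6 : ℓ * (deriv h2 (T r) * (1 + 2 * κ * e r) - deriv h1 r) ≤ 0 := mul_nonpos_of_nonneg_of_nonpos hℓ.le hder
    have k7 := mul_pos E hp
    linarith
  have hTle : T t ≤ t + s + 2 * κ / c0 := by
    rw [hT]
    have := mul_pos (show 0 < 2 * κ / c0 by positivity) (he0 t)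
    beta_reduce; linarith
  refine ⟨(front t ht).le.trans ((S2 (T t)).h_mono _ _ le_rfl hTle), fun x => ?_⟩
  have := cmp t ht (fun r k1 _ => (front r k1).le) x
  have k := mul_pos hκ (he0 t)
  have hm := mul_le_mul_of_nonneg_left ((S2 (T t)).mono x _ _ le_rfl hTle) (show 0 ≤ 1 + κ * e t by linarith)
  have h3 := this.trans hm
  rwa [he] at h3

/-- `δ` is a modulus of continuity for `f`. -/
def HasModulus (δ : ℝ → ℝ) (f : ℝ → ℝ) : Prop := ∀ ε > 0, ∀ x y, |x - y| < δ ε → |f x - f y| ≤ ε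

/-- Waves defined for all times. -/
structure Entire (ℓ M C c lam : ℝ) (δ : ℝ → ℝ) (g p : ℝ → ℝ) (u : ℝ → ℝ → ℝ) (h : ℝ → ℝ) : Prop where
  wave : ∀ b, WaveOn ℓ M C c lam b g p u h
  modg : HasModulus δ g
  modp : HasModulus δ p

theorem HasModulus.subseq {δ : ℝ → ℝ} (hδ : ∀ ε > 0, 0 < δ ε) {f : ℕ → ℝ → ℝ} (hf : ∀ n, HasModulus δ (f n))
    (hb : ∀ x, ∃ B, ∀ n, |f n x| ≤ B) : ∃ φ : ℕ → ℕ, StrictMono φ ∧ ∃ f', HasModulus δ f' ∧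
      TendstoLocallyUniformly (fun n => f (φ n)) f' atTop := by
  obtain ⟨φ, hφ, f', -, hf'⟩ := exists_subseq_tendstoLocallyUniformly f hb fun x ε hε =>
    ⟨δ ε, hδ ε hε, 0, fun n _ y hy => hf n ε hε y x (by rwa [Real.dist_eq] at hy)⟩
  have ht := fun x => hf'.tendstoLocallyUniformlyOn (s := univ) |>.tendsto_at (mem_univ x)
  exact ⟨φ, hφ, f', fun ε hε x y hxy => le_of_tendsto' ((ht x).sub (ht y)).abs fun n => hf (φ n) ε hε x y hxy, hf'⟩

namespace Entire
variable {ℓ M C c lam : ℝ} {δ g p : ℝ → ℝ} {u : ℝ → ℝ → ℝ} {h : ℝ → ℝ}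

theorem translate (E : Entire ℓ M C c lam δ g p u h) (d σ : ℝ) : Entire ℓ M C c lam δ (fun x => g (x + d)) (fun x => p (x + d))
    (fun x t => u (x + d) (t + σ)) (fun t => h (t + σ) - d) := by
  refine ⟨fun b => ?_, fun ε hε x y hxy => E.modg ε hε _ _ (by rwa [add_sub_add_right_eq_sub]),
    fun ε hε x y hxy => E.modp ε hε _ _ (by rwa [add_sub_add_right_eq_sub])⟩
  have := (E.wave (b + σ)).translate d σ
  rwa [add_sub_cancel_right] at this

theorem abs_sub_le (E : Entire ℓ M C c lam δ g p u h) (x t y s : ℝ) : |u x t - u y s| ≤ C * |x - y| + C * |t - s| := by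
  have h1 := (E.wave t).lipx x y t le_rfl
  have h2 := (E.wave (min t s)).abs_lipt y t s (min_le_left _ _) (min_le_right _ _)
  calc |u x t - u y s| = |(u x t - u y t) + (u y t - u y s)| := by ring_nf
    _ ≤ _ := (abs_add_le _ _).trans (add_le_add h1 h2)

theorem abs_front_sub_le (hK : Consts ℓ M C c lam) (E : Entire ℓ M C c lam δ g p u h) (t s : ℝ) : |h t - h s| ≤ C * |t - s| :=
  (E.wave (min t s)).abs_liph hK t s (min_le_left _ _) (min_le_right _ _)

theorem cont_h (hK : Consts ℓ M C c lam) (E : Entire ℓ M C c lam δ g p u h) : Continuous h :=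
  (LipschitzWith.of_dist_le_mul (K := C.toNNReal) fun t s => by
    rw [Real.coe_toNNReal _ hK.hC.le]; exact E.abs_front_sub_le hK t s).continuous

theorem cont_u (hK : Consts ℓ M C c lam) (E : Entire ℓ M C c lam δ g p u h) : Continuous fun q : ℝ × ℝ => u q.1 q.2 :=
  (LipschitzWith.of_dist_le_mul (K := (2 * C).toNNReal) fun q r => by
    have hC := hK.hC
    rw [Real.coe_toNNReal _ (by positivity), two_mul, add_mul]
    refine (E.abs_sub_le q.1 q.2 r.1 r.2).trans (add_le_add ?_ ?_)
    · exact mul_le_mul_of_nonneg_left (le_max_left (dist q.1 r.1) _) hC.le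
    · exact mul_le_mul_of_nonneg_left (le_max_right _ (dist q.2 r.2)) hC.le).continuous

theorem clas (hK : Consts ℓ M C c lam) (E : Entire ℓ M C c lam δ g p u h) (b : ℝ) : Clas ℓ M b g u h :=
  Clas.of_reg (fun T _ => ⟨C, (E.wave b).reg hK T⟩) (E.cont_u hK) (E.cont_h hK) (E.wave b).g_nonneg (E.wave b).g_le (E.wave b).mono

theorem deriv_mem (hK : Consts ℓ M C c lam) (E : Entire ℓ M C c lam δ g p u h) (t : ℝ) : c ≤ deriv h t ∧ deriv h t ≤ C := by
  have hd := (E.clas hK (t - 1)).hd t (by linarith)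
  have h1 := HasDerivAt.nonpos_of_eventually_le_left (((hasDerivAt_id t).const_mul c).sub hd) (by
    filter_upwards [self_mem_nhdsWithin] with s hs
    have := (E.wave s).h_lower s t le_rfl (le_of_lt hs)
    simp only [Pi.sub_apply, id]; linarith)
  have h2 := HasDerivAt.nonpos_of_eventually_le_left (hd.sub ((hasDerivAt_id t).const_mul C)) (by
    filter_upwards [self_mem_nhdsWithin] with s hs
    have := (E.wave s).h_upper s t le_rfl (le_of_lt hs)
    simp only [Pi.sub_apply, id]; linarith)
  constructor <;> linarith

theorem h_strictMono (hK : Consts ℓ M C c lam) (E : Entire ℓ M C c lam δ g p u h) : StrictMono h := fun s t hst => by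
  have := (E.wave s).h_lower s t le_rfl hst.le
  have := mul_pos hK.hc (sub_pos.2 hst)
  linarith

theorem sup_ineq (hK : Consts ℓ M C c lam) (E : Entire ℓ M C c lam δ g p u h) {c0 : ℝ} (hc1 : c0 ≤ 1)
    (hcc : c0 ≤ c) (hc2 : c0 ≤ c * c) (x t zt zx zxx : ℝ) (hx : x < h t) (hJ : Jet u x t zt zx zxx) :
    c0 * u x t ≤ 2 * zt + u x t ^ 2 := by
  have hc := hK.hc
  have hzt := (E.clas hK (t - 1)).time_deriv_nonneg (by linarith) hJ
  have u0 := (E.wave t).nonneg x t le_rfl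
  rcases le_total c0 (u x t) with h1 | h1
  · nlinarith
  rcases lt_or_ge c (h t - x) with h2 | h2
  · have h3 := (E.wave t).lower x t le_rfl hx.le
    rcases le_total (h t - x) 1 with h4 | h4
    · rw [min_eq_left h4] at h3
      nlinarith
    · rw [min_eq_right h4] at h3
      nlinarith
  · have h3 := HasDerivAt.nonpos_of_eventually_le_left (((hasDerivAt_id t).const_mul c).sub hJ.1) (by
      filter_upwards [self_mem_nhdsWithin, ((E.cont_h hK).tendsto t).mono_left inf_le_left |>.eventually (lt_mem_nhds hx),
        Ioo_mem_nhdsLT (show t - c < t by linarith)] with s hs hs2 hs3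
      have hs1 := (E.wave s).h_mono hK s t le_rfl (le_of_lt hs)
      have := (E.wave s).dt_lower x s (t - s) le_rfl (sub_nonneg.2 (le_of_lt hs)) (by linarith [hs3.1]) (by linarith) hs2.le
      rw [add_sub_cancel] at this
      simp only [Pi.sub_apply, id]; linarith)
    nlinarith

theorem le_of_forall_early {a B k t t' : ℝ} (hl : 0 < lam) (H : ∀ b ≤ t', a ≤ B + k * Real.exp (-lam * (t - b))) : a ≤ B := by
  have h1 : Tendsto (fun b : ℝ => -lam * (t - b)) atBot atBot :=
    ((tendsto_atBot_add_const_left _ (-lam * t) (tendsto_id.const_mul_atBot hl))).congr fun b => by simp only [id]; ring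
  have h2 : Tendsto (fun b : ℝ => B + k * Real.exp (-lam * (t - b))) atBot (𝓝 (B + k * 0)) :=
    ((Real.tendsto_exp_atBot.comp h1).const_mul k).const_add B
  rw [mul_zero, add_zero] at h2
  exact ge_of_tendsto h2 ((eventually_le_atBot t').mono H)

theorem dt_upper (hK : Consts ℓ M C c lam) (E : Entire ℓ M C c lam δ g p u h) (x t s : ℝ) (hs : 0 ≤ s) :
    u x (t + s) - u x t ≤ C * s * Real.exp (lam * (x - h t)) :=
  le_of_forall_early (k := C * s) (t := t) (t' := t) hK.hlam fun b hb => by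
    rw [← mul_add]; exact (E.wave b).dt_upper x t s hb hs

theorem left (hK : Consts ℓ M C c lam) (E : Entire ℓ M C c lam δ g p u h) (x t : ℝ) :
    |p x - u x t| ≤ C * Real.exp (lam * (x - h t)) :=
  le_of_forall_early (k := C) (t := t) (t' := t) hK.hlam fun b hb => by
    rw [← mul_add]; exact (E.wave b).left x t hb

/-- Compactness of entire waves. -/
theorem compact (hK : Consts ℓ M C c lam) (hδ : ∀ ε > 0, 0 < δ ε) {g p : ℕ → ℝ → ℝ} {u : ℕ → ℝ → ℝ → ℝ} {h : ℕ → ℝ → ℝ}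
    (E : ∀ n, Entire ℓ M C c lam δ (g n) (p n) (u n) (h n)) {B : ℝ} (hB : ∀ n, |h n 0| ≤ B) :
    ∃ φ : ℕ → ℕ, StrictMono φ ∧ ∃ g' p' u' h', (∀ x, Tendsto (fun n => g (φ n) x) atTop (𝓝 (g' x))) ∧
      (∀ x, Tendsto (fun n => p (φ n) x) atTop (𝓝 (p' x))) ∧ Conv (fun n => u (φ n)) (fun n => h (φ n)) u' h' ∧
      Entire ℓ M C c lam δ g' p' u' h' := by
  obtain ⟨φ1, hφ1, g', hg', hg⟩ := HasModulus.subseq hδ (fun n => (E n).modg)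
    fun x => ⟨M, fun n => abs_le.2 ⟨by linarith [((E n).wave 0).g_nonneg x, hK.hM], ((E n).wave 0).g_le x⟩⟩
  obtain ⟨φ2, hφ2, p', hp', hp⟩ := HasModulus.subseq hδ (fun n => (E (φ1 n)).modp)
    fun x => ⟨M + C * Real.exp (lam * (x + B)), fun n => by
      have h1 := (E (φ1 n)).left hK x 0
      have h2 := ((E (φ1 n)).wave 0).le x 0 le_rfl
      have h3 := ((E (φ1 n)).wave 0).nonneg x 0 le_rfl
      have h4 : C * Real.exp (lam * (x - h (φ1 n) 0)) ≤ C * Real.exp (lam * (x + B)) :=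
        mul_le_mul_of_nonneg_left (Real.exp_le_exp.2 (mul_le_mul_of_nonneg_left (by linarith [(abs_le.1 (hB (φ1 n))).1]) hK.hlam.le)) hK.hC.le
      have hM := hK.hM
      rw [abs_le] at h1 ⊢
      constructor <;> linarith⟩
  have hβ : Tendsto (fun n : ℕ => -(n : ℝ)) atTop atBot := tendsto_neg_atTop_atBot.comp tendsto_natCast_atTop_atTop
  obtain ⟨φ3, hφ3, u', h', hc⟩ := exists_conv hK (fun n => (E (φ1 (φ2 n))).wave (-(n : ℝ))) hβ (fun n => by simp) B fun n => hB _
  have hgs : TendstoLocallyUniformly (fun n => g (φ1 (φ2 (φ3 n)))) g' atTop := fun v hv x =>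
    let ⟨s, hs, he⟩ := hg v hv x
    ⟨s, hs, (hφ2.tendsto_atTop.comp hφ3.tendsto_atTop).eventually he⟩
  have hps := fun x => (hp.tendstoLocallyUniformlyOn (s := univ) |>.tendsto_at (mem_univ x)).comp hφ3.tendsto_atTop
  refine ⟨fun n => φ1 (φ2 (φ3 n)), hφ1.comp (hφ2.comp hφ3), g', p', u', h',
    fun x => hgs.tendstoLocallyUniformlyOn (s := univ) |>.tendsto_at (mem_univ x), hps, hc, fun b => ?_, hg', hp'⟩
  exact hc.waveOn hK (fun n => (E (φ1 (φ2 (φ3 n)))).wave (-(n : ℝ))) hβ hgs hps b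

/-- Joint compactness for two sequences of entire waves with asymptotically equal coefficients. -/
theorem compact₂ (hK : Consts ℓ M C c lam) (hδ : ∀ ε > 0, 0 < δ ε) {g1 p1 g2 p2 : ℕ → ℝ → ℝ} {u1 u2 : ℕ → ℝ → ℝ → ℝ}
    {h1 h2 : ℕ → ℝ → ℝ} (E1 : ∀ n, Entire ℓ M C c lam δ (g1 n) (p1 n) (u1 n) (h1 n))
    (E2 : ∀ n, Entire ℓ M C c lam δ (g2 n) (p2 n) (u2 n) (h2 n)) {B : ℝ} (hB1 : ∀ n, |h1 n 0| ≤ B) (hB2 : ∀ n, |h2 n 0| ≤ B)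
    (hg : ∀ x, Tendsto (fun n => g2 n x - g1 n x) atTop (𝓝 0)) (hp : ∀ x, Tendsto (fun n => p2 n x - p1 n x) atTop (𝓝 0)) :
    ∃ φ : ℕ → ℕ, StrictMono φ ∧ ∃ g' p' u1' h1' u2' h2', Conv (fun n => u1 (φ n)) (fun n => h1 (φ n)) u1' h1' ∧
      Conv (fun n => u2 (φ n)) (fun n => h2 (φ n)) u2' h2' ∧ Entire ℓ M C c lam δ g' p' u1' h1' ∧
      Entire ℓ M C c lam δ g' p' u2' h2' := by
  obtain ⟨φ, hφ, g', p', u1', h1', a1, a2, a3, a4⟩ := compact hK hδ E1 hB1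
  obtain ⟨ψ, hψ, g'', p'', u2', h2', b1, b2, b3, b4⟩ := compact hK hδ (fun n => E2 (φ n)) fun n => hB2 (φ n)
  have lim : ∀ {f1 f2 : ℕ → ℝ → ℝ} {f' f'' : ℝ → ℝ}, (∀ x, Tendsto (fun n => f2 n x - f1 n x) atTop (𝓝 0)) →
      (∀ x, Tendsto (fun n => f1 (φ n) x) atTop (𝓝 (f' x))) → (∀ x, Tendsto (fun n => f2 (φ (ψ n)) x) atTop (𝓝 (f'' x))) →
      f'' = f' := fun hd h1 h2 => funext fun x => tendsto_nhds_unique (h2 x) (by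
        have := ((hd x).comp (hφ.tendsto_atTop.comp hψ.tendsto_atTop)).add ((h1 x).comp hψ.tendsto_atTop)
        rw [zero_add] at this
        exact this.congr fun n => by simp)
  rw [lim hg a1 b1, lim hp a2 b2] at b4
  exact ⟨fun n => φ (ψ n), hφ.comp hψ, g', p', u1', h1', u2', h2', a3.comp hψ, b3, a4, b4⟩

end Entire

namespace Entire
variable {ℓ M C c lam : ℝ} {δ g p : ℝ → ℝ} {u u1 u2 : ℝ → ℝ → ℝ} {h h1 h2 : ℝ → ℝ}

theorem front_le (hK : Consts ℓ M C c lam) (E1 : Entire ℓ M C c lam δ g p u1 h1) (E2 : Entire ℓ M C c lam δ g p u2 h2)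
    {k t r : ℝ} (hu : ∀ x, u1 x t ≤ k * u2 x r) : h1 t ≤ h2 r := by
  by_contra! hlt
  have h3 := (E1.wave t).lower (h2 r) t le_rfl hlt.le
  have h4 := hu (h2 r)
  rw [(E2.wave r).zero _ r le_rfl le_rfl, mul_zero] at h4
  have := mul_pos hK.hc (lt_min (sub_pos.2 hlt) one_pos)
  linarith

theorem exists_front_eq (hK : Consts ℓ M C c lam) (E : Entire ℓ M C c lam δ g p u h) (y : ℝ) : ∃ t, h t = y := by
  have hc := hK.hc
  have key : ∀ r, 0 ≤ r → h 0 + c * r ≤ h r ∧ h (-r) ≤ h 0 - c * r := fun r hr => by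
    have e1 := (E.wave 0).h_lower 0 r le_rfl hr
    have e2 := (E.wave (-r)).h_lower (-r) 0 le_rfl (by linarith)
    constructor <;> linarith
  obtain ⟨e1, e2⟩ := key (|y - h 0| / c) (by positivity)
  rw [mul_div_cancel₀ _ hc.ne'] at e1 e2
  have e3 := neg_abs_le (y - h 0)
  have e4 := le_abs_self (y - h 0)
  have e5 : 0 ≤ |y - h 0| / c := by positivity
  obtain ⟨t, -, ht⟩ := intermediate_value_Icc (show -(|y - h 0| / c) ≤ |y - h 0| / c by linarith) (E.cont_h hK).continuousOn
    (show y ∈ Icc _ _ from ⟨by linarith, by linarith⟩)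
  exact ⟨t, ht⟩

/-- Approximate ordering of entire waves improves in time. -/
theorem exists_relax (hK : Consts ℓ M C c lam) : ∃ c0 > 0, ∀ {δ g p : ℝ → ℝ} {u1 u2 : ℝ → ℝ → ℝ} {h1 h2 : ℝ → ℝ},
    Entire ℓ M C c lam δ g p u1 h1 → Entire ℓ M C c lam δ g p u2 h2 → ∀ κ s t0, 0 < κ → (∀ x, u1 x t0 ≤ (1 + κ) * u2 x (t0 + s)) →
    ∀ t, t0 ≤ t → h1 t ≤ h2 (t + s + 2 * κ / c0) ∧
      ∀ x, u1 x t ≤ u2 x (t + s + 2 * κ / c0) + κ * u2 x (t + s + 2 * κ / c0) * Real.exp (-c0 * (t - t0)) := by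
  have hc := hK.hc
  have hC := hK.hC
  obtain ⟨c0, hc0, b1, b2, b3⟩ : ∃ c0 > 0, c0 ≤ 1 ∧ c0 ≤ c ∧ c0 ≤ c * c :=
    ⟨min 1 (min c (c * c)), by positivity, min_le_left _ _, (min_le_right _ _).trans (min_le_left _ _),
      (min_le_right _ _).trans (min_le_right _ _)⟩
  refine ⟨c0, hc0, fun {δ g p u1 u2 h1 h2} E1 E2 κ s t0 hκ hu t ht => ?_⟩
  have hf := front_le hK E1 E2 hu
  have key : ∀ ε, 0 < ε → h1 t ≤ h2 (t + s + 2 * κ / c0) + C * ε ∧ ∀ x, u1 x t ≤ (1 + κ * Real.exp (-c0 * (t - t0))) * u2 x (t + s + 2 * κ / c0)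
      + ((1 + κ * Real.exp (-c0 * (t - t0))) * C) * ε := by
    intro ε hε
    obtain ⟨k1, k2⟩ := Clas.relax (fun b => E1.clas hK b) (fun b => E2.clas hK b) (fun t => hc.trans_le (E2.deriv_mem hK t).1) hc0
      (E2.sup_ineq hK b1 b2 b3) hκ (s := s + ε) (t0 := t0) (hf.trans_lt (E2.h_strictMono hK (by linarith)))
      (fun x => (hu x).trans (mul_le_mul_of_nonneg_left ((E2.wave (t0 + s)).mono x _ _ le_rfl (by linarith)) (by linarith))) t ht
    have e1 := (abs_le.1 (E2.abs_front_sub_le hK (t + (s + ε) + 2 * κ / c0) (t + s + 2 * κ / c0))).2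
    rw [show t + (s + ε) + 2 * κ / c0 - (t + s + 2 * κ / c0) = ε by ring, abs_of_pos hε] at e1
    refine ⟨by linarith, fun x => (k2 x).trans ?_⟩
    have e2 := (E2.wave (t + s + 2 * κ / c0)).lipt x (t + s + 2 * κ / c0) ε le_rfl hε.le
    rw [show t + s + 2 * κ / c0 + ε = t + (s + ε) + 2 * κ / c0 by ring] at e2
    rw [mul_assoc, ← mul_add]
    exact mul_le_mul_of_nonneg_left (by linarith) (by positivity)
  refine ⟨le_of_forall_small one_pos fun ε hε _ => (key ε hε).1, fun x => ?_⟩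
  have := le_of_forall_small one_pos fun ε hε _ => (key ε hε).2 x
  linarith

theorem exists_shift_le (hK : Consts ℓ M C c lam) (E1 : Entire ℓ M C c lam δ g p u1 h1) (E2 : Entire ℓ M C c lam δ g p u2 h2)
    (h10 : h1 0 = 0) (h20 : h2 0 = 0) : ∃ S, ∀ x t, u1 x t ≤ u2 x (t + S) := by
  obtain ⟨c0, hc0, rel⟩ := exists_relax hK
  have hc := hK.hc
  have hM := hK.hM
  have big : ∀ {u1 u2 : ℝ → ℝ → ℝ} {h1 h2 : ℝ → ℝ}, Entire ℓ M C c lam δ g p u1 h1 → Entire ℓ M C c lam δ g p u2 h2 →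
      ∀ t r, h1 t + 1 ≤ h2 r → ∀ x, u1 x t ≤ (1 + M / c) * u2 x r := by
    intro u1 u2 h1 h2 E1 E2 t r hr x
    have a0 := (E2.wave r).nonneg x r le_rfl
    rcases le_total (h1 t) x with hx | hx
    · rw [(E1.wave t).zero x t le_rfl hx]; positivity
    have a1 := (E2.wave r).lower x r le_rfl (by linarith)
    rw [min_eq_right (by linarith), mul_one] at a1
    have a2 := (E1.wave t).le x t le_rfl
    have a3 : M / c * c ≤ M / c * u2 x r := mul_le_mul_of_nonneg_left a1 (by positivity)
    rw [div_mul_cancel₀ _ hc.ne'] at a3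
    linarith
  obtain ⟨D, hD⟩ : ∃ D, D = 2 * (M / c) / c0 := ⟨_, rfl⟩
  have hD0 : 0 < D := by rw [hD]; positivity
  have hic : 0 < 1 / c := by positivity
  have start : ∀ t0 ≤ -(1 / c), ∀ x, u1 x t0 ≤ (1 + M / c) * u2 x (t0 + (2 / c + D)) := by
    intro t0 ht0 x
    obtain ⟨r, hr⟩ := E2.exists_front_eq hK (h1 t0 + 1)
    obtain ⟨r', hr'⟩ := E1.exists_front_eq hK (h2 r + 1)
    have a1 : h1 t0 ≤ -1 := by
      have := (E1.wave t0).h_lower t0 0 le_rfl (by linarith)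
      have h3 : c * (1 / c) ≤ c * (0 - t0) := mul_le_mul_of_nonneg_left (by linarith) hc.le
      rw [mul_one_div_cancel hc.ne'] at h3
      linarith
    have a2 : r ≤ 0 := (E2.h_strictMono hK).le_iff_le.1 (by linarith)
    have a3 : t0 ≤ r' := (E1.h_strictMono hK).le_iff_le.1 (by linarith)
    have a4 : r' - t0 ≤ 2 / c := by
      rw [le_div_iff₀ hc]
      have := (E1.wave t0).h_lower t0 r' le_rfl a3
      linarith
    have a5 := (rel E2 E1 (M / c) (r' - r) r (by positivity) (fun x => by
      rw [add_sub_cancel]; exact big E2 E1 r r' hr'.ge x) 0 a2).1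
    rw [← hD, h20, ← h10] at a5
    have a6 := (E1.h_strictMono hK).le_iff_le.1 a5
    refine (big E1 E2 t0 r hr.ge x).trans (mul_le_mul_of_nonneg_left ((E2.wave r).mono x _ _ le_rfl (by linarith)) (by positivity))
  refine ⟨2 / c + D + D, fun x t => ?_⟩
  rw [← add_assoc, hD, ← hD]
  refine le_of_forall_early (k := M / c * u2 x (t + (2 / c + D) + D)) (t := t) (t' := min t (-(1 / c))) hc0 fun b hb => ?_
  have := (rel E1 E2 (M / c) (2 / c + D) b (by positivity) (start b (hb.trans (min_le_right _ _))) t (hb.trans (min_le_left _ _))).2 x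
  rwa [← hD] at this

/-- Strong maximum principle for two ordered entire waves, up to the free boundary. -/
theorem eq_of_touch (hK : Consts ℓ M C c lam) (E1 : Entire ℓ M C c lam δ g p u1 h1) (E2 : Entire ℓ M C c lam δ g p u2 h2)
    (hu : ∀ x t, u1 x t ≤ u2 x t) (h10 : h1 0 = 0) {y : ℝ} (hy : y ≤ 0) (hty : u2 y 0 ≤ u1 y 0) : h2 0 = 0 ∧ ∀ x, u2 x 0 = u1 x 0 := by
  have hc := hK.hc
  have hC := hK.hC
  have hℓ := hK.hℓ
  have hM := hK.hM
  have hh : ∀ t, h1 t ≤ h2 t := fun t => front_le hK E1 E2 (k := 1) fun x => by rw [one_mul]; exact hu x t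
  have c1 := E1.cont_u hK
  have c2 := E2.cont_u hK
  have d1 := E1.cont_h hK
  by_cases hall : ∀ t < 0, ∀ x < h1 t, u2 x t = u1 x t
  · have e1 : ∀ x < 0, u2 x 0 = u1 x 0 := by
      intro x hx
      have t1 : Tendsto (fun t => u2 x t - u1 x t) (𝓝[<] 0) (𝓝 (u2 x 0 - u1 x 0)) :=
        ((c2.comp (Continuous.prodMk_right x)).sub (c1.comp (Continuous.prodMk_right x))).tendsto 0 |>.mono_left inf_le_left
      have t2 : ∀ᶠ t in 𝓝[<] (0:ℝ), u2 x t - u1 x t = 0 := by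
        filter_upwards [self_mem_nhdsWithin, (d1.tendsto 0).mono_left inf_le_left |>.eventually (lt_mem_nhds (by rwa [h10]))] with t k1 k2
        rw [hall t k1 x k2, sub_self]
      exact sub_eq_zero.1 (tendsto_nhds_unique (t1.congr' t2) tendsto_const_nhds)
    have e2 : u2 0 0 = 0 := by
      have t1 : Tendsto (fun x => u2 x 0 - u1 x 0) (𝓝[<] 0) (𝓝 (u2 0 0 - u1 0 0)) :=
        ((c2.comp (Continuous.prodMk_left 0)).sub (c1.comp (Continuous.prodMk_left 0))).tendsto 0 |>.mono_left inf_le_left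
      have t2 : ∀ᶠ x in 𝓝[<] (0:ℝ), u2 x 0 - u1 x 0 = 0 := by
        filter_upwards [self_mem_nhdsWithin] with x k1
        rw [e1 x k1, sub_self]
      have := tendsto_nhds_unique (t1.congr' t2) tendsto_const_nhds
      rw [(E1.wave 0).zero 0 0 le_rfl h10.le] at this
      linarith
    have e3 : h2 0 ≤ 0 := by
      by_contra! hlt
      have := (E2.wave 0).lower 0 0 le_rfl hlt.le
      have := mul_pos hc (lt_min (sub_pos.2 hlt) one_pos)
      linarith
    refine ⟨le_antisymm e3 (h10.ge.trans (hh 0)), fun x => ?_⟩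
    rcases lt_or_ge x 0 with hx | hx
    · exact e1 x hx
    · rw [(E1.wave 0).zero x 0 le_rfl (by linarith), (E2.wave 0).zero x 0 le_rfl (by linarith)]
  exfalso
  push Not at hall
  obtain ⟨t1, ht1, x1, hx1, hne⟩ := hall
  have hw1 : 0 < u2 x1 t1 - u1 x1 t1 := sub_pos.2 (lt_of_le_of_ne (hu x1 t1) hne.symm)
  obtain ⟨η, hη⟩ : ∃ η, η = (u2 x1 t1 - u1 x1 t1) / 2 := ⟨_, rfl⟩
  have hη0 : 0 < η := by linarith
  obtain ⟨ρ, hρ, hball⟩ := Metric.eventually_nhds_iff.1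
    (((c2.comp (Continuous.prodMk_left t1)).sub (c1.comp (Continuous.prodMk_left t1))).tendsto x1 |>.eventually
      (lt_mem_nhds (show η < u2 x1 t1 - u1 x1 t1 by linarith)))
  obtain ⟨τ, hτ⟩ : ∃ τ, τ = -t1 := ⟨_, rfl⟩
  have hτ0 : 0 < τ := by linarith
  obtain ⟨G, hG⟩ : ∃ G, G = h1 t1 - x1 := ⟨_, rfl⟩
  have hG0 : 0 < G := by linarith
  obtain ⟨R, hR⟩ : ∃ R, R = 2 - y := ⟨_, rfl⟩
  have hR0 : 0 < R := by linarith
  obtain ⟨q, hq, hopf⟩ := exists_hopf_const (V := C + G / τ + R / τ) (ρ0 := ρ / 2) (ρ1 := ρ / 2 + R) (K := 2 * M) (τ := τ)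
    (by positivity) (by positivity) (by linarith) (by positivity)
  have key := hopf (fun x t => u2 x t - u1 x t) (fun t => h1 t + G / τ * t - ρ / 2 - R / τ * (t + τ)) (fun t => h1 t + G / τ * t)
    (fun t => deriv h1 t + G / τ - R / τ) (fun t => deriv h1 t + G / τ) (-τ) η hτ0.le hη0.le (by fun_prop) (by fun_prop) ?_ ?_
    (Continuous.continuousOn (c2.sub c1)) (fun q _ => sub_nonneg.2 (hu q.1 q.2)) ?_
  · rw [neg_add_cancel, mul_zero, h10, zero_add, zero_add, div_mul_cancel₀ _ hτ0.ne'] at key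
    have lin : ∀ x, y - 1 ≤ x → x ≤ 0 → η * q * -x ≤ u2 x 0 - u1 x 0 := fun x k1 k2 => by
      refine le_trans ?_ (key x (by linarith) k2)
      refine mul_le_mul_of_nonneg_left ?_ (by positivity)
      have : 0 ≤ (x - (0 - ρ / 2 - R) - 1) * -x := mul_nonneg (by linarith) (by linarith)
      linarith
    have hηq := mul_pos hη0 hq
    rcases hy.lt_or_eq with hy | rfl
    · have := lin y (by linarith) hy.le
      have := mul_pos hηq (neg_pos.2 hy)
      linarith
    have hz2 : h2 0 = 0 := by
      refine le_antisymm ?_ (h10.ge.trans (hh 0))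
      by_contra! hlt
      have k1 := (E2.wave 0).lower 0 0 le_rfl hlt.le
      have k2 := mul_pos hc (lt_min (sub_pos.2 hlt) one_pos)
      rw [(E1.wave 0).zero 0 0 le_rfl h10.le] at hty
      linarith
    have S1 := E1.clas hK (-1)
    have S2 := E2.clas hK (-1)
    obtain ⟨K, hK0, hf⟩ := S1.front 0 (by norm_num)
    have hsl : ℓ * deriv h1 0 + η * q ≤ ℓ * deriv h2 0 := by
      refine le_of_forall_small (c := K) one_pos fun ε hε hε1 => ?_
      have := S2.slope_ge (t := 0) (k := ℓ * deriv h1 0 + η * q - K * ε) (by norm_num) hε fun ξ k1 k2 => by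
        have k3 := (abs_le.1 (hf ξ k1)).1
        have k4 := lin (-ξ) (by linarith) (by linarith)
        have k5 : K * ξ ^ 2 ≤ K * ε * ξ := by nlinarith [mul_nonneg (mul_nonneg hK0 k1) (sub_nonneg.2 k2)]
        rw [h10, zero_sub] at k3
        rw [hz2, zero_sub]
        linarith
      linarith
    have hd := HasDerivAt.nonpos_of_eventually_le_left ((S2.hd 0 (by norm_num)).sub (S1.hd 0 (by norm_num))) (Eventually.of_forall fun s => by
      simp only [Pi.sub_apply]; rw [h10, hz2]; linarith [hh s])
    have := mul_nonpos_of_nonneg_of_nonpos hℓ.le hd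
    linarith
  · intro t k1 k2
    have k3 : R / τ * (t + τ) ≤ R := by
      rw [div_mul_eq_mul_div, div_le_iff₀ hτ0]
      exact mul_le_mul_of_nonneg_left (by linarith) hR0.le
    have k4 : 0 ≤ R / τ * (t + τ) := mul_nonneg (by positivity) (by linarith)
    constructor <;> linarith
  · intro t k1 k2
    have hd := (E1.clas hK (t - 1)).hd t (by linarith)
    obtain ⟨k3, k4⟩ := E1.deriv_mem hK t
    have k5 : 0 < G / τ := by positivity
    have k6 : 0 < R / τ := by positivity
    have hr := (hd.add ((hasDerivAt_id t).const_mul (G / τ)))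
    refine ⟨((hr.sub_const (ρ / 2)).sub (((hasDerivAt_id t).add_const τ).const_mul (R / τ))).congr_deriv (by ring), ?_, hr.congr_deriv (by ring), ?_⟩
    · exact abs_le.2 ⟨by linarith, by linarith⟩
    · exact abs_le.2 ⟨by linarith, by linarith⟩
  · intro t x k1 k2 k3 k4
    rcases k1.eq_or_lt with rfl | k1
    · left
      rw [show -τ = t1 by linarith] at k3 k4 ⊢
      have e1 : G / τ * t1 = -G := by rw [show t1 = -τ by linarith, mul_neg, div_mul_cancel₀ _ hτ0.ne']
      rw [e1] at k3 k4
      rw [show t1 + τ = 0 by linarith, mul_zero] at k3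
      exact (hball (by rw [Real.dist_eq]; exact abs_lt.2 ⟨by linarith, by linarith⟩)).le
    · right
      have hx : x < h1 t := by
        have : G / τ * t ≤ 0 := mul_nonpos_of_nonneg_of_nonpos (by positivity) (by linarith)
        linarith
      obtain ⟨_, _, hJ1⟩ := (E1.clas hK (t - 1)).jet x t (by linarith) hx
      obtain ⟨_, _, hJ2⟩ := (E2.clas hK (t - 1)).jet x t (by linarith) (hx.trans_le (hh t))
      refine ⟨k1, _, _, _, hJ2.sub hJ1, ?_⟩
      have g0 := (E1.wave t).g_nonneg x
      have a1 := (E1.wave t).le x t le_rfl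
      have a2 := (E2.wave t).le x t le_rfl
      have := mul_nonneg (show 0 ≤ g x + (M - u1 x t) + (M - u2 x t) by linarith) (sub_nonneg.2 (hu x t))
      linarith

end Entire

namespace Entire
variable {ℓ M C c lam : ℝ} {δ g p : ℝ → ℝ} {u1 u2 : ℝ → ℝ → ℝ} {h1 h2 : ℝ → ℝ}

/-- Two waves close to each other near the front are ordered up to a factor and a small time shift. -/
theorem le_of_close (hK : Consts ℓ M C c lam) (E1 : Entire ℓ M C c lam δ g p u1 h1) (E2 : Entire ℓ M C c lam δ g p u2 h2)
    {κ η d R t r : ℝ} (hη : 0 ≤ η) (hηc : η ≤ c) (hd : 0 ≤ d) (hR1 : 1 ≤ R) (hR : 2 * C * Real.exp (-(lam * R)) ≤ κ * c)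
    (hκ : 0 < κ) (hd1 : d ≤ κ * (c * min c 1)) (hd2 : (C + c) * d ≤ c * (c * η)) (hd3 : (C + c) * d ≤ c)
    (hh : h1 t ≤ h2 r) (hh2 : h2 r ≤ h1 t + d) (hcl : ∀ y, |y| ≤ R → u2 (y + h1 t) r - u1 (y + h1 t) t ≤ d) (x : ℝ) :
    u2 x r ≤ (1 + κ) * u1 x (t + η) := by
  have hc := hK.hc
  have hC := hK.hC
  have hl := hK.hlam
  have v0 := (E1.wave (t + η)).nonneg x _ le_rfl
  have mono := (E1.wave t).mono x t (t + η) le_rfl (by linarith)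
  have hκv := mul_nonneg hκ.le v0
  have hcl' : |x - h1 t| ≤ R → u2 x r - u1 x t ≤ d := fun hx => by
    have := hcl (x - h1 t) hx
    rwa [sub_add_cancel] at this
  have hCd := mul_nonneg hC.le hd
  have hcη : d ≤ c * η := le_of_mul_le_mul_left (by linarith) hc
  rcases le_total (x - h1 t) (-R) with h1' | h1'
  · have a1 := (abs_le.1 (E1.left hK x t)).2
    have a2 := (abs_le.1 (E2.left hK x r)).1
    have a3 : ∀ z, h1 t ≤ z → C * Real.exp (lam * (x - z)) ≤ C * Real.exp (-(lam * R)) := fun z hz =>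
      mul_le_mul_of_nonneg_left (Real.exp_le_exp.2 (by rw [← mul_neg]; exact mul_le_mul_of_nonneg_left (by linarith) hl.le)) hC.le
    have a4 := a3 _ le_rfl
    have a5 := a3 _ hh
    have a6 := (E1.wave t).lower x t le_rfl (by linarith)
    rw [min_eq_right (by linarith), mul_one] at a6
    have a7 : κ * c ≤ κ * u1 x (t + η) := mul_le_mul_of_nonneg_left (by linarith) hκ.le
    linarith
  rcases le_total (x - h1 t) (-min c 1) with h2' | h2'
  · have hm := lt_min hc one_pos
    have a1 := hcl' (abs_le.2 ⟨h1', by linarith⟩)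
    have a2 := (E1.wave t).lower x t le_rfl (by linarith)
    have a3 : c * min c 1 ≤ c * min (h1 t - x) 1 := mul_le_mul_of_nonneg_left (le_min (by linarith) (min_le_right _ _)) hc.le
    have a4 : κ * (c * min c 1) ≤ κ * u1 x (t + η) := mul_le_mul_of_nonneg_left (by linarith) hκ.le
    linarith
  rcases le_total (x - h1 t) 0 with h3' | h3'
  · have a1 := hcl' (abs_le.2 ⟨h1', by linarith⟩)
    have a2 := (E1.wave t).dt_lower x t η le_rfl hη hηc (by linarith [min_le_left c 1]) (by linarith)
    linarith
  rcases le_total (h2 r) x with h4' | h4'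
  · rw [(E2.wave r).zero x r le_rfl h4']
    linarith
  · have a1 := (E2.wave r).le_front hK x r le_rfl
    rw [max_eq_left (by linarith)] at a1
    have a2 : C * (h2 r - x) ≤ C * d := mul_le_mul_of_nonneg_left (by linarith) hC.le
    have a3 := (E1.wave t).h_lower t (t + η) le_rfl (by linarith)
    rw [add_sub_cancel_left] at a3
    have a4 := (E1.wave (t + η)).lower x _ le_rfl (by linarith)
    have a5 : C * d ≤ c * min (h1 (t + η) - x) 1 := by
      have := mul_nonneg hc.le hd
      rcases min_cases (h1 (t + η) - x) 1 with ⟨e, -⟩ | ⟨e, -⟩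
      · rw [e]
        have : c * (c * η - d) ≤ c * (h1 (t + η) - x) := mul_le_mul_of_nonneg_left (by linarith) hc.le
        linarith
      · rw [e]; linarith
    linarith

set_option maxHeartbeats 1000000 in
/-- The shift between two normalized entire waves vanishes. -/
theorem le_of_normalized (hK : Consts ℓ M C c lam) (hδ : ∀ ε > 0, 0 < δ ε) (E1 : Entire ℓ M C c lam δ g p u1 h1)
    (E2 : Entire ℓ M C c lam δ g p u2 h2) (h10 : h1 0 = 0) (h20 : h2 0 = 0) (x t : ℝ) : u1 x t ≤ u2 x t := by
  obtain ⟨c0, hc0, rel⟩ := exists_relax hK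
  have hc := hK.hc
  have hC := hK.hC
  have hM := hK.hM
  have hl := hK.hlam
  obtain ⟨S0, hS0⟩ := exists_shift_le hK E1 E2 h10 h20
  obtain ⟨S1, hS1⟩ := exists_shift_le hK E2 E1 h20 h10
  obtain ⟨A, hA⟩ : ∃ A : Set ℝ, A = {s | ∀ x t, u1 x t ≤ u2 x (t + s)} := ⟨_, rfl⟩
  have hA0 : ∀ s ∈ A, 0 ≤ s := fun s hs => by
    rw [hA] at hs
    have := front_le hK E1 E2 (k := 1) (t := 0) (r := 0 + s) fun x => by rw [one_mul]; exact hs x 0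
    rw [h10, ← h20, (E2.h_strictMono hK).le_iff_le] at this
    linarith
  have hAb : BddBelow A := ⟨0, hA0⟩
  have hAc : IsClosed A := by
    have : A = ⋂ x, ⋂ t, {s | u1 x t ≤ u2 x (t + s)} := by rw [hA]; ext s; simp
    rw [this]
    refine isClosed_iInter fun x => isClosed_iInter fun t => isClosed_le continuous_const ?_
    exact (E2.cont_u hK).comp (f := fun s => (x, t + s)) (by fun_prop)
  have hmem := hAc.csInf_mem ⟨S0, by rw [hA]; exact hS0⟩ hAb
  have hmin : ∀ s ∈ A, sInf A ≤ s := fun s hs => csInf_le hAb hs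
  generalize sInf A = σ at *
  have hσ := hA0 σ hmem
  have ord : ∀ x t, u1 x t ≤ u2 x (t + σ) := by rw [hA] at hmem; exact hmem
  rcases hσ.eq_or_lt with rfl | hσ
  · simpa using ord x t
  exfalso
  have fail : ∀ n : ℕ, ∃ t0 ≤ -(n : ℝ), ∃ x, (1 + c0 / 8 * (1 / ((n : ℝ) + 1))) * u2 x (t0 + (σ - 1 / ((n : ℝ) + 1))) < u1 x t0 := by
    intro n
    by_contra! hcon
    have hε : 0 < 1 / ((n : ℝ) + 1) := by positivity
    generalize 1 / ((n : ℝ) + 1) = ε at *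
    have : σ - ε + ε / 4 ∈ A := by
      rw [hA]
      intro x t
      refine le_of_forall_early (k := c0 / 8 * ε * u2 x (t + (σ - ε + ε / 4))) (t := t) (t' := min t (-n)) hc0 fun b hb => ?_
      have := (rel E1 E2 (c0 / 8 * ε) (σ - ε) b (by positivity) (hcon b (hb.trans (min_le_right _ _))) t (hb.trans (min_le_left _ _))).2 x
      rwa [show t + (σ - ε) + 2 * (c0 / 8 * ε) / c0 = t + (σ - ε + ε / 4) by field_simp; ring] at this
    linarith [hmin _ this]
  choose T hT X hX using fail
  obtain ⟨ε, hεd⟩ : ∃ ε : ℕ → ℝ, ε = fun n : ℕ => 1 / ((n : ℝ) + 1) := ⟨_, rfl⟩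
  have hε0 : ∀ n, 0 < ε n := fun n => by rw [hεd]; positivity
  have hε1 : ∀ n, ε n ≤ 1 := fun n => by
    rw [hεd]; exact (div_le_one (by positivity)).2 (by linarith [Nat.cast_nonneg (α := ℝ) n])
  have hεlim : Tendsto ε atTop (𝓝 0) := by rw [hεd]; exact tendsto_one_div_add_atTop_nhds_zero_nat
  have hX' : ∀ n, (1 + c0 / 8 * ε n) * u2 (X n) (T n + (σ - ε n)) < u1 (X n) (T n) := by rw [hεd]; exact hX
  have fr : ∀ t, h1 t ≤ h2 (t + σ) := fun t => front_le hK E1 E2 (k := 1) fun x => by rw [one_mul]; exact ord x t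
  have fr2 : ∀ t, h2 (t + σ) - h1 t ≤ C * |σ + S1| := fun t => by
    have e1 := front_le hK E2 E1 (k := 1) (t := t + σ) (r := t + σ + S1) fun x => by rw [one_mul]; exact hS1 x _
    have e2 := (abs_le.1 (E1.abs_front_sub_le hK (t + σ + S1) t)).2
    rw [show t + σ + S1 - t = σ + S1 by ring] at e2
    linarith
  obtain ⟨Z, hZ⟩ : ∃ Z, Z = C / (c0 / 8 * c * lam) := ⟨_, rfl⟩
  have hZ0 : 0 < Z := by rw [hZ]; positivity
  have loc : ∀ n, X n - h1 (T n) ∈ Icc (-(C + 1 + Z)) 0 := by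
    intro n
    have a0 := hX' n
    have a1 := (E2.wave (T n + (σ - ε n))).nonneg (X n) _ le_rfl
    have a2 : 0 ≤ c0 / 8 * ε n * u2 (X n) (T n + (σ - ε n)) := mul_nonneg (mul_nonneg (by positivity) (hε0 n).le) a1
    constructor
    · by_contra! hlt
      have b1 := E2.dt_upper hK (X n) (T n + (σ - ε n)) (ε n) (hε0 n).le
      rw [show T n + (σ - ε n) + ε n = T n + σ by ring] at b1
      have b2 := ord (X n) (T n)
      have b3 := (abs_le.1 (E2.abs_front_sub_le hK (T n + (σ - ε n)) (T n + σ))).1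
      rw [show T n + (σ - ε n) - (T n + σ) = -ε n by ring, abs_neg, abs_of_pos (hε0 n)] at b3
      have b4 := fr (T n)
      have b5 : C * ε n ≤ C := mul_le_of_le_one_right hC.le (hε1 n)
      have b6 := (E2.wave (T n + (σ - ε n))).lower (X n) _ le_rfl (by linarith)
      rw [min_eq_right (by linarith), mul_one] at b6
      have b7 : c0 / 8 * u2 (X n) (T n + (σ - ε n)) ≤ C * Real.exp (lam * (X n - h2 (T n + (σ - ε n)))) := by
        refine le_of_mul_le_mul_left ?_ (hε0 n)
        linarith
      have b8 : Real.exp (lam * (X n - h2 (T n + (σ - ε n)))) ≤ Real.exp (-(lam * Z)) :=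
        Real.exp_le_exp.2 (by rw [← mul_neg]; exact mul_le_mul_of_nonneg_left (by linarith) hl.le)
      have b9 : c0 / 8 * c ≤ C * Real.exp (-(lam * Z)) :=
        (mul_le_mul_of_nonneg_left b6 (by positivity)).trans (b7.trans (mul_le_mul_of_nonneg_left b8 hC.le))
      have b10 := mul_le_mul_of_nonneg_right b9 (Real.exp_pos (lam * Z)).le
      rw [mul_assoc C, ← Real.exp_add, neg_add_cancel, Real.exp_zero, mul_one] at b10
      have b11 : c0 / 8 * c * (lam * Z + 1) ≤ c0 / 8 * c * Real.exp (lam * Z) :=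
        mul_le_mul_of_nonneg_left (Real.add_one_le_exp _) (by positivity)
      have b12 : c0 / 8 * c * (lam * Z) = C := by rw [hZ]; field_simp
      have b13 : 0 < c0 / 8 * c := by positivity
      linarith
    · by_contra! hlt
      rw [(E1.wave (T n)).zero (X n) (T n) le_rfl (by linarith)] at a0
      linarith
  obtain ⟨φ, hφ, g', p', U1, H1, U2, H2, cv1, cv2, F1, F2⟩ := compact₂ hK hδ (B := C * |σ + S1|)
    (fun n => E1.translate (h1 (T n)) (T n)) (fun n => E2.translate (h1 (T n)) (T n + σ))
    (fun n => by rw [zero_add, sub_self, abs_zero]; positivity)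
    (fun n => by rw [zero_add, abs_of_nonneg (by linarith [fr (T n)])]; exact fr2 (T n))
    (fun x => by simp) (fun x => by simp)
  obtain ⟨y, hy, ψ, hψ, hyl⟩ := isCompact_Icc.tendsto_subseq fun n => loc (φ n)
  have hle : ∀ x t, U1 x t ≤ U2 x t := fun x t => le_of_tendsto_of_tendsto' (cv1.tendsto_u x t) (cv2.tendsto_u x t) fun n => by
    rw [← add_assoc]; exact ord _ _
  have hH1 : H1 0 = 0 := tendsto_nhds_unique (cv1.tendsto_h 0) (by simp)
  have htouch : U2 y 0 ≤ U1 y 0 := by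
    have t1 := ((cv1.tendsto_u y 0).comp hψ.tendsto_atTop)
    have t2 := ((cv2.tendsto_u y 0).comp hψ.tendsto_atTop)
    have t3 := (hεlim.comp (hφ.tendsto_atTop.comp hψ.tendsto_atTop)).const_mul C
    have t4 := ((hyl.sub_const y).abs).const_mul (2 * C)
    rw [sub_self, abs_zero, mul_zero] at t4
    rw [mul_zero] at t3
    have t5 := (t1.add t3).add t4
    rw [add_zero, add_zero] at t5
    refine le_of_tendsto_of_tendsto' t2 t5 fun n => ?_
    simp only [Function.comp, zero_add]
    generalize φ (ψ n) = m
    have a0 := hX' m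
    have a1 := (E2.wave (T m + (σ - ε m))).nonneg (X m) _ le_rfl
    have a2 : 0 ≤ c0 / 8 * ε m * u2 (X m) (T m + (σ - ε m)) := mul_nonneg (mul_nonneg (by positivity) (hε0 m).le) a1
    have a3 := (E2.wave (T m + (σ - ε m))).lipt (X m) _ (ε m) le_rfl (hε0 m).le
    rw [show T m + (σ - ε m) + ε m = T m + σ by ring] at a3
    have a4 := (abs_le.1 ((E1.wave (T m)).lipx (X m) (y + h1 (T m)) (T m) le_rfl)).2
    have a5 := (abs_le.1 ((E2.wave (T m + σ)).lipx (X m) (y + h1 (T m)) (T m + σ) le_rfl)).1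
    rw [← sub_sub, sub_right_comm] at a4 a5
    linarith
  obtain ⟨hH2, heq⟩ := eq_of_touch hK F1 F2 hle hH1 hy.2 htouch
  obtain ⟨η, hη0, hηc, hησ⟩ : ∃ η > 0, η ≤ c ∧ C * η ≤ c * σ / 4 :=
    ⟨min c (c * σ / (4 * C)), by positivity, min_le_left _ _, by
      have := mul_le_mul_of_nonneg_left (min_le_right c (c * σ / (4 * C))) hC.le
      refine this.trans (le_of_eq ?_)
      field_simp⟩
  obtain ⟨κ, hκ⟩ : ∃ κ, κ = c0 * c * σ / (8 * C) := ⟨_, rfl⟩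
  have hκ0 : 0 < κ := by rw [hκ]; positivity
  have hκσ : C * (2 * κ / c0) = c * σ / 4 := by rw [hκ]; field_simp; ring
  obtain ⟨R, hR1, hR⟩ : ∃ R ≥ 1, 2 * C * Real.exp (-(lam * R)) ≤ κ * c := by
    have t1 : Tendsto (fun R => 2 * C * Real.exp (-(lam * R))) atTop (𝓝 (2 * C * 0)) :=
      (Real.tendsto_exp_neg_atTop_nhds_zero.comp (tendsto_id.const_mul_atTop hl)).const_mul _
    rw [mul_zero] at t1
    obtain ⟨R, k1, k2⟩ := ((t1.eventually (ge_mem_nhds (show 0 < κ * c by positivity))).and (eventually_ge_atTop 1)).exists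
    exact ⟨R, k2, k1⟩
  obtain ⟨d, hd0, hd1, hd2, hd3⟩ : ∃ d > 0, d ≤ κ * (c * min c 1) ∧ (C + c) * d ≤ c * (c * η) ∧ (C + c) * d ≤ c := by
    refine ⟨min (κ * (c * min c 1)) (min (c * (c * η)) c / (C + c)), by positivity, min_le_left _ _, ?_⟩
    have := mul_le_mul_of_nonneg_left (min_le_right (κ * (c * min c 1)) (min (c * (c * η)) c / (C + c))) (show 0 ≤ C + c by positivity)
    rw [mul_div_cancel₀ _ (by positivity)] at this
    exact ⟨this.trans (min_le_left _ _), this.trans (min_le_right _ _)⟩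
  obtain ⟨N1, hN1⟩ := cv1 R (d / 2) (by positivity)
  obtain ⟨N2, hN2⟩ := cv2 R (d / 2) (by positivity)
  obtain ⟨n, hn⟩ : ∃ n, n = max N1 N2 := ⟨_, rfl⟩
  have hR0 : |(0:ℝ)| ≤ R := by rw [abs_zero]; linarith
  have e0 := (abs_lt.1 (hN2 n (hn ▸ le_max_right _ _) 0 0 hR0 hR0).2).2
  have close := E1.le_of_close hK E2 (t := T (φ n)) (r := T (φ n) + σ) hη0.le hηc hd0.le hR1 hR hκ0 hd1 hd2 hd3 (fr _)
    (by simp only [zero_add] at e0; linarith) fun z hz => by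
      have e1 := (abs_lt.1 (hN1 n (hn ▸ le_max_left _ _) z 0 hz hR0).1).1
      have e2 := (abs_lt.1 (hN2 n (hn ▸ le_max_right _ _) z 0 hz hR0).1).2
      rw [heq] at e2
      simp only [zero_add] at e1 e2
      linarith
  have hTn : T (φ n) ≤ 0 := (hT _).trans (by simp)
  have hfin := (rel E2 E1 κ (η - σ) (T (φ n) + σ) hκ0 (fun x => by
    rw [show T (φ n) + σ + (η - σ) = T (φ n) + η by ring]; exact close x) σ (by linarith)).1
  have f1 := (E2.wave 0).h_lower 0 σ le_rfl hσ.le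
  have f2 := (E1.wave 0).h_upper 0 (η + 2 * κ / c0) le_rfl (by positivity)
  rw [show σ + (η - σ) + 2 * κ / c0 = η + 2 * κ / c0 by ring] at hfin
  have := mul_pos hc hσ
  linarith

theorem unique (hK : Consts ℓ M C c lam) (hδ : ∀ ε > 0, 0 < δ ε) (E1 : Entire ℓ M C c lam δ g p u1 h1)
    (E2 : Entire ℓ M C c lam δ g p u2 h2) (h10 : h1 0 = 0) (h20 : h2 0 = 0) (x t : ℝ) : u1 x t = u2 x t ∧ h1 t = h2 t := by
  have k1 := le_of_normalized hK hδ E1 E2 h10 h20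
  have k2 := le_of_normalized hK hδ E2 E1 h20 h10
  exact ⟨le_antisymm (k1 x t) (k2 x t), le_antisymm (front_le hK E1 E2 (k := 1) fun x => by rw [one_mul]; exact k1 x t)
    (front_le hK E2 E1 (k := 1) fun x => by rw [one_mul]; exact k2 x t)⟩

end Entire

theorem Steady.translate {m M P : ℝ} {g p : ℝ → ℝ} (S : Steady m M P g p) (d : ℝ) :
    Steady m M P (fun x => g (x + d)) (fun x => p (x + d)) :=
  ⟨fun _ => S.lower _, fun _ => S.upper _, fun x => let ⟨px, h1, h2⟩ := S.jet (x + d); ⟨px, h1, h2.comp_add⟩⟩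

theorem Steady.le_translate {m M P η s : ℝ} {g p : ℝ → ℝ} (hm : 0 < m) (hη : 0 ≤ η) (hgM : ∀ x, g x ≤ M) (S : Steady m M P g p)
    (hs : ∀ x, |g (x + s) - g x| ≤ η) (x : ℝ) : |p (x + s) - p x| ≤ M / m * η := by
  have hM : 0 < M := hm.trans_le ((S.lower 0).trans (S.upper 0))
  have T := S.translate s
  have jet : ∀ {g p : ℝ → ℝ}, Steady m M P g p → ∀ x, ∃ px, Jet2 p x px (p x * (p x - g x)) := fun S x =>
    let ⟨px, _, h2⟩ := S.jet x; ⟨px, h2⟩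
  have h1 := steady_le_of_coeff_le hm hη hgM (fun x => by linarith [(abs_le.1 (hs x)).2]) S.lower T.lower T.upper S.continuous
    T.continuous (jet S) (jet T) x
  have h2 := steady_le_of_coeff_le hm hη (fun x => hgM (x + s)) (fun x => by linarith [(abs_le.1 (hs x)).1]) T.lower S.lower S.upper
    T.continuous S.continuous (jet T) (jet S) x
  have h3 : η / m * p x ≤ η / m * M := mul_le_mul_of_nonneg_left (S.upper x) (by positivity)
  have h4 : η / m * p (x + s) ≤ η / m * M := mul_le_mul_of_nonneg_left (T.upper x) (by positivity)
  rw [show M / m * η = η / m * M by ring]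
  exact abs_le.2 ⟨by linarith, by linarith⟩

theorem exists_tail {lam : ℝ} (hl : 0 < lam) (C : ℝ) {ε : ℝ} (hε : 0 < ε) : ∃ X, ∀ x ≤ X, C * Real.exp (lam * x) < ε := by
  have h1 := (Real.tendsto_exp_atBot.comp (tendsto_id.const_mul_atBot hl)).const_mul C
  rw [mul_zero] at h1
  exact eventually_atBot.1 (h1.eventually (gt_mem_nhds hε))

namespace Entire
variable {ℓ M C c lam : ℝ} {δ g p : ℝ → ℝ} {u : ℝ → ℝ → ℝ} {h : ℝ → ℝ}

/-- An entire wave is a limit of waves issued from ever more distant starting points. -/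
theorem exists_normalized (hK : Consts ℓ M C c lam) (hg : HasModulus δ g) (hp : HasModulus δ p)
    (H : ∀ d : ℝ, ∃ u h, h 0 = 0 ∧ (∀ t, 0 ≤ t → t ≤ 2 → h t ≤ C * t) ∧
      WaveOn ℓ M C c lam 2 (fun x => g (x + d)) (fun x => p (x + d)) u h) :
    ∃ u h, Entire ℓ M C c lam δ g p u h ∧ h 0 = 0 := by
  have hC := hK.hC
  have hc := hK.hc
  have key : ∀ n : ℕ, ∃ u h, ∃ β ≤ -(n : ℝ), h 0 = 0 ∧ WaveOn ℓ M C c lam β g p u h := by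
    intro n
    obtain ⟨y, hy⟩ : ∃ y, y = C * (n + 2) := ⟨_, rfl⟩
    obtain ⟨u, h, -, h2, W⟩ := H (-y)
    have a1 := h2 2 zero_le_two le_rfl
    have a2 : C * 2 ≤ y := by rw [hy]; exact mul_le_mul_of_nonneg_left (by linarith [Nat.cast_nonneg (α := ℝ) n]) hC.le
    have a3 : 0 ≤ (y - h 2) / c := div_nonneg (by linarith) hc.le
    have a4 := W.h_lower 2 (2 + (y - h 2) / c) le_rfl (by linarith)
    rw [add_sub_cancel_left, mul_div_cancel₀ _ hc.ne'] at a4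
    have cont : ContinuousOn h (Icc 2 (2 + (y - h 2) / c)) :=
      (LipschitzOnWith.of_dist_le_mul (K := C.toNNReal) fun t ht s hs => by
        rw [Real.coe_toNNReal _ hC.le]; exact W.abs_liph hK t s ht.1 hs.1).continuousOn
    obtain ⟨T, hT, hTy⟩ := intermediate_value_Icc (by linarith) cont (show y ∈ Icc _ _ from ⟨by linarith, by linarith⟩)
    have a5 := W.h_upper 2 T le_rfl hT.1
    have a6 : (n : ℝ) + 2 ≤ T := le_of_mul_le_mul_left (by linarith) hC
    have W' := W.translate y T
    simp only [add_neg_cancel_right] at W'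
    exact ⟨_, _, _, by linarith, by simp [hTy], W'⟩
  choose u h β hβ h0 W using key
  have hlim : Tendsto (fun n : ℕ => -(n : ℝ)) atTop atBot := tendsto_neg_atTop_atBot.comp tendsto_natCast_atTop_atTop
  have hβ' := tendsto_atBot_mono hβ hlim
  obtain ⟨φ, hφ, u', h', hc'⟩ := exists_conv hK W hβ' (fun n => (hβ n).trans (by simp)) 0 fun n => by simp [h0]
  refine ⟨u', h', ⟨fun b => hc'.waveOn hK (fun n => W (φ n)) (hβ'.comp hφ.tendsto_atTop) ?_ (fun x => tendsto_const_nhds) b, hg, hp⟩, ?_⟩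
  · exact fun v hv x => ⟨univ, univ_mem, Eventually.of_forall fun n y _ => refl_mem_uniformity hv⟩
  · have := hc'.tendsto_h 0
    simp only [h0] at this
    exact tendsto_nhds_unique this tendsto_const_nhds

/-- Almost periods of the coefficient are almost periods of the profile. -/
theorem exists_profile_modulus (hK : Consts ℓ M C c lam) (hδ : ∀ ε > 0, 0 < δ ε) (E : Entire ℓ M C c lam δ g p u h) {m P ε : ℝ}
    (hm : 0 < m) (S : Steady m M P g p) (hε : 0 < ε) : ∃ η > 0, ∀ s, (∀ x, |g (x + s) - g x| ≤ η) → ∀ ξ ≤ 0, ∀ τ t r,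
      h t = τ → h r = τ + s → |u (ξ + (τ + s)) r - u (ξ + τ) t| < ε := by
  by_contra! H
  choose s hs ξ hξ τ t r ht hr hbad using fun n : ℕ => H (1 / ((n : ℝ) + 1)) (by positivity)
  have hp := fun n x => S.le_translate hm (by positivity) (E.wave 0).g_le (hs n) x
  have lim := tendsto_one_div_add_atTop_nhds_zero_nat (𝕜 := ℝ)
  have limp := lim.const_mul (M / m)
  rw [mul_zero] at limp
  have E1 := fun n => E.translate (τ n) (t n)
  have E2 := fun n => E.translate (τ n + s n) (r n)
  have b1 : ∀ n, h (0 + t n) - τ n = 0 := fun n => by rw [zero_add, ht, sub_self]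
  have b2 : ∀ n, h (0 + r n) - (τ n + s n) = 0 := fun n => by rw [zero_add, hr, sub_self]
  obtain ⟨φ, hφ, g', p', u1, h1, u2, h2, c1, c2, F1, F2⟩ := compact₂ hK hδ E1 E2 (B := 0) (fun n => by rw [b1, abs_zero])
    (fun n => by rw [b2, abs_zero])
    (fun x => squeeze_zero_norm (fun n => by rw [← add_assoc, Real.norm_eq_abs]; exact hs n _) lim)
    (fun x => squeeze_zero_norm (fun n => by rw [← add_assoc, Real.norm_eq_abs]; exact hp n _) limp)
  have z1 : h1 0 = 0 := tendsto_nhds_unique (c1.tendsto_h 0) (by simp only [b1]; exact tendsto_const_nhds)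
  have z2 : h2 0 = 0 := tendsto_nhds_unique (c2.tendsto_h 0) (by simp only [b2]; exact tendsto_const_nhds)
  obtain ⟨X, hX⟩ := exists_tail hK.hlam C (show 0 < ε / 4 by positivity)
  obtain ⟨N1, hN1⟩ := c1 |X| (ε / 4) (by positivity)
  obtain ⟨N2, hN2⟩ := c2 |X| (ε / 4) (by positivity)
  obtain ⟨n, hn1, hn2, hn3⟩ := ((eventually_ge_atTop N1).and ((eventually_ge_atTop N2).and
    ((limp.comp hφ.tendsto_atTop).eventually (gt_mem_nhds (show 0 < ε / 4 by positivity))))).exists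
  have bad := hbad (φ n)
  rcases le_total (ξ (φ n)) X with hx | hx
  · have e1 := (E1 (φ n)).left hK (ξ (φ n)) 0
    have e2 := (E2 (φ n)).left hK (ξ (φ n)) 0
    have e3 := hp (φ n) (ξ (φ n) + τ (φ n))
    have e4 := hX _ hx
    simp only [ht, hr, sub_self, sub_zero, zero_add, add_assoc, Function.comp] at e1 e2 e3 hn3
    rw [abs_le] at e1 e2 e3
    rcases le_abs.1 bad with h | h <;> linarith
  · have hX' : |ξ (φ n)| ≤ |X| := by
      rw [abs_of_nonpos (hξ _), abs_of_nonpos (hx.trans (hξ _))]; linarith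
    have e1 := (hN1 n hn1 (ξ (φ n)) 0 hX' (by simp)).1
    have e2 := (hN2 n hn2 (ξ (φ n)) 0 hX' (by simp)).1
    rw [(unique hK hδ F1 F2 z1 z2 _ _).1] at e1
    simp only [zero_add] at e1 e2
    rw [abs_lt] at e1 e2
    rcases le_abs.1 bad with h | h <;> linarith

/-- Continuation of a wave by a smooth odd function beyond its front. -/
noncomputable def extend (ℓ : ℝ) (u : ℝ → ℝ → ℝ) (h : ℝ → ℝ) (x t : ℝ) : ℝ :=
  if x ≤ h t then u x t else -(ℓ * deriv h t) * Real.sin (x - h t)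

theorem extend_of_le {x t : ℝ} (hx : x ≤ h t) : extend ℓ u h x t = u x t := if_pos hx

theorem hasDerivAt_extend (hK : Consts ℓ M C c lam) (E : Entire ℓ M C c lam δ g p u h) (t : ℝ) :
    HasDerivAt (fun y => extend ℓ u h y t) (-(ℓ * deriv h t)) (h t) := by
  obtain ⟨A, hA, hf⟩ := (E.clas hK (t - 1)).front t (by linarith)
  have z := (E.wave t).zero (h t) t le_rfl le_rfl
  have h1 : HasDerivWithinAt (fun y => extend ℓ u h y t) (-(ℓ * deriv h t)) (Iic (h t)) (h t) := by
    rw [hasDerivWithinAt_iff_isLittleO]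
    refine (Asymptotics.IsBigO.of_bound A ?_).trans_isLittleO
      ((Asymptotics.isLittleO_pow_sub_sub (h t) one_lt_two).mono nhdsWithin_le_nhds)
    filter_upwards [self_mem_nhdsWithin] with y hy
    have := hf (h t - y) (sub_nonneg.2 hy)
    rw [sub_sub_cancel] at this
    rw [extend_of_le hy, extend_of_le le_rfl, z, smul_eq_mul, Real.norm_eq_abs, Real.norm_eq_abs, Real.norm_eq_abs, sq_abs, abs_sq]
    rw [show u y t - 0 - (y - h t) * -(ℓ * deriv h t) = u y t - ℓ * deriv h t * (h t - y) by ring, show (y - h t) ^ 2 = (h t - y) ^ 2 by ring]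
    exact this
  have h2 : HasDerivWithinAt (fun y => extend ℓ u h y t) (-(ℓ * deriv h t)) (Ici (h t)) (h t) := by
    have := (((hasDerivAt_id (h t)).sub_const (h t)).sin.const_mul (-(ℓ * deriv h t))).hasDerivWithinAt (s := Ici (h t))
    refine (this.congr_deriv (by simp)).congr (fun y hy => ?_) ?_
    · rcases eq_or_lt_of_le (show h t ≤ y from hy) with rfl | hlt
      · rw [extend_of_le le_rfl, z]; simp
      · exact if_neg (not_le.2 hlt)
    · rw [extend_of_le le_rfl, z]; simp
  have := h1.union h2
  rwa [Iic_union_Ici, hasDerivWithinAt_univ] at this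

theorem isFBPSol (hK : Consts ℓ M C c lam) (E : Entire ℓ M C c lam δ g p u h) : IsFBPSol ℓ⁻¹ g univ (extend ℓ u h) h := by
  have hd : ∀ t, HasDerivAt h (deriv h t) t := fun t => (E.clas hK (t - 1)).hd t (by linarith)
  have space : ∀ t, ∀ x < h t, ∃ zx zxx, HasDerivAt (fun s => u x s) (zxx + u x t * (g x - u x t)) t ∧
      HasDerivAt (fun y => extend ℓ u h y t) zx x ∧ HasDerivAt (deriv fun y => extend ℓ u h y t) zxx x := by
    intro t x hx
    have jet : ∀ y, ∃ zx zxx, y < h t → Jet u y t (zxx + u y t * (g y - u y t)) zx zxx := fun y => by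
      by_cases hy : y < h t
      · obtain ⟨zx, zxx, hJ⟩ := (E.clas hK (t - 1)).jet y t (by linarith) hy
        exact ⟨zx, zxx, fun _ => hJ⟩
      · exact ⟨0, 0, fun h => absurd h hy⟩
    choose zx zxx hJ using jet
    have fam := Jet2.family (U := Iio (h t)) isOpen_Iio fun y hy => (hJ y hy).2
    have ext : ∀ y < h t, HasDerivAt (fun y => extend ℓ u h y t) (zx y) y := fun y hy =>
      (fam y hy).1.congr_of_eventuallyEq (by filter_upwards [gt_mem_nhds hy] with z hz using extend_of_le (le_of_lt hz))
    exact ⟨zx x, zxx x, (hJ x hx).1, ext x hx, (fam x hx).2.congr_of_eventuallyEq (by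
      filter_upwards [gt_mem_nhds hx] with z hz using (ext z hz).deriv)⟩
  have time : ∀ t, ∀ x < h t, (fun s => extend ℓ u h x s) =ᶠ[𝓝 t] fun s => u x s := fun t x hx => by
    filter_upwards [((E.cont_h hK).tendsto t).eventually (lt_mem_nhds hx)] with s hs using extend_of_le (le_of_lt hs)
  refine ⟨fun t _ => (hd t).differentiableAt, ?_, ?_, fun t _ x hx => ?_, fun t _ x hx => ?_, fun t _ x hx => ?_, fun t _ => ?_, fun t _ => ?_⟩
  · rw [continuousOn_univ, continuous_iff_continuousAt]
    intro t
    obtain ⟨σ, -, h2, h3⟩ := ((E.wave (t - 1)).reg hK (t + 1)).exists_front_slope fun x => ⟨(E.wave 0).g_nonneg x, (E.wave 0).g_le x⟩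
    have hmem : Ioo (t - 1) (t + 1) ∈ 𝓝 t := Ioo_mem_nhds (by linarith) (by linarith)
    refine ((h3.continuousAt hmem).div_const ℓ).congr ?_
    filter_upwards [hmem] with s hs using (h2 s hs.1 hs.2).deriv.symm
  · exact (E.cont_u hK).continuousOn.congr fun q hq => extend_of_le hq.2
  · obtain ⟨zx, zxx, -, h2, h3⟩ := space t x hx
    exact ⟨h2.differentiableAt, h3.differentiableAt⟩
  · obtain ⟨zx, zxx, h1, -⟩ := space t x hx
    exact (h1.congr_of_eventuallyEq (time t x hx)).differentiableAt
  · obtain ⟨zx, zxx, h1, -, h3⟩ := space t x hx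
    rw [(h1.congr_of_eventuallyEq (time t x hx)).deriv, h3.deriv, extend_of_le hx.le]
  · rw [extend_of_le le_rfl]; exact (E.wave t).zero _ t le_rfl le_rfl
  · have := hK.hℓ.ne'
    rw [(E.hasDerivAt_extend hK t).deriv]
    field_simp

theorem isAPSemiWave (hK : Consts ℓ M C c lam) (hδ : ∀ ε > 0, 0 < δ ε) (E : Entire ℓ M C c lam δ g p u h) {m P : ℝ}
    (hm : 0 < m) (S : Steady m M P g p) (hg : BohrAlmostPeriodic g) : IsAPSemiWave ℓ⁻¹ g p (extend ℓ u h) h := by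
  have hM := hK.hM
  have hC := hK.hC
  have hℓ := hK.hℓ
  have inv : ∀ τ, h (Function.invFun h τ) = τ := fun τ => Function.invFun_eq (E.exists_front_eq hK τ)
  have prof : ∀ ξ ≤ 0, ∀ τ, profile (extend ℓ u h) h ξ τ = u (ξ + τ) (Function.invFun h τ) := fun ξ hξ τ =>
    extend_of_le (by rw [inv]; linarith)
  have hmono := E.h_strictMono hK
  refine ⟨E.isFBPSol hK, ⟨M + ℓ * C, fun x t => ?_⟩, fun t x hx => ?_, hmono,
    tendsto_atTop_atTop_of_monotone hmono.monotone fun y => (E.exists_front_eq hK y).imp fun t ht => ht.ge,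
    tendsto_atBot_atBot_of_monotone hmono.monotone fun y => (E.exists_front_eq hK y).imp fun t ht => ht.le, fun ε hε => ?_, fun ε hε => ?_⟩
  · have h1 := (E.wave t).nonneg x t le_rfl
    have h2 := (E.wave t).le x t le_rfl
    have hpos : 0 < ℓ * C := by positivity
    unfold extend
    split_ifs
    · rw [abs_of_nonneg h1]; linarith
    · have h3 := E.deriv_mem hK t
      have h4 := hK.hc.le.trans h3.1
      rw [abs_mul, abs_neg, abs_of_nonneg (by positivity)]
      have := mul_le_mul (mul_le_mul_of_nonneg_left h3.2 hℓ.le) (Real.abs_sin_le_one (x - h t)) (abs_nonneg _) hpos.le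
      linarith
  · rw [extend_of_le hx.le]
    exact (mul_pos hK.hc (lt_min (sub_pos.2 hx) one_pos)).trans_le ((E.wave t).lower x t le_rfl hx.le)
  · obtain ⟨η, hη, H⟩ := E.exists_profile_modulus hK hδ hm S hε
    obtain ⟨L, hL, hs⟩ := hg η hη
    refine ⟨L, hL, fun r => (hs r).imp fun s hs => ⟨hs.1, fun ξ hξ τ => ?_⟩⟩
    rw [prof ξ hξ, prof ξ hξ]
    exact H s (fun x => (hs.2 x).le) ξ hξ τ _ _ (inv τ) (inv _)
  · obtain ⟨X, hX⟩ := exists_tail hK.hlam C hε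
    refine ⟨min X 0, fun ξ hξ τ => ?_⟩
    rw [prof ξ (hξ.trans (min_le_right _ _)), abs_sub_comm]
    refine (E.left hK _ _).trans_lt ?_
    rw [inv, add_sub_cancel_right]
    exact hX ξ (hξ.trans (min_le_left _ _))

end Entire

end SemiWave

theorem exists_almost_periodic_semi_wave (μ : ℝ) (hμ : 0 < μ)
    (a ustar : ℝ → ℝ) (ha : BohrAlmostPeriodic a)
    (hainf : ∃ m > (0 : ℝ), ∀ x : ℝ, m ≤ a x)
    (hstar : IsBddPosSteadyState a ustar) :
    ∃ (u : ℝ → ℝ → ℝ) (h : ℝ → ℝ), IsAPSemiWave μ a ustar u h := by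
  obtain ⟨m, hm, ham⟩ := hainf
  have hcont := SemiWave.IsBddPosSteadyState.continuous_coeff hstar
  obtain ⟨M, hM⟩ := SemiWave.BohrAlmostPeriodic.bounded ha hcont
  have haM : ∀ x, a x ≤ M := fun x => (le_abs_self _).trans (hM x)
  have hM0 : 0 < M := hm.trans_le ((ham 0).trans (haM 0))
  have S := SemiWave.IsBddPosSteadyState.steady hstar hm ham haM
  have modp : ∀ ε > 0, ∃ δ > 0, ∀ x y, |x - y| < δ → |ustar x - ustar y| ≤ ε := fun ε hε => by
    have hP : 0 < M + M ^ 2 := by positivity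
    refine ⟨ε / (M + M ^ 2), by positivity, fun x y hxy => ?_⟩
    choose px hpx hJ using S.jet
    have := convex_univ.norm_image_sub_le_of_norm_hasDerivWithin_le (f := ustar) (f' := px)
      (fun x _ => (hJ x).hasDerivAt.hasDerivWithinAt) (fun x _ => hpx x) (Set.mem_univ y) (Set.mem_univ x)
    rw [lt_div_iff₀ hP] at hxy
    rw [Real.norm_eq_abs, Real.norm_eq_abs] at this
    linarith
  have moda := SemiWave.BohrAlmostPeriodic.uniformContinuous ha hcont
  have mod : ∀ ε, ∃ δ, 0 < ε → 0 < δ ∧ (∀ x y, |x - y| < δ → |a x - a y| ≤ ε) ∧ ∀ x y, |x - y| < δ → |ustar x - ustar y| ≤ ε := by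
    intro ε
    by_cases hε : 0 < ε
    · obtain ⟨δ1, h1, h2⟩ := moda ε hε
      obtain ⟨δ2, h3, h4⟩ := modp ε hε
      exact ⟨min δ1 δ2, fun _ => ⟨lt_min h1 h3, fun x y hxy => (h2 x y (hxy.trans_le (min_le_left _ _))).le,
        fun x y hxy => h4 x y (hxy.trans_le (min_le_right _ _))⟩⟩
    · exact ⟨0, fun h => absurd h hε⟩
  choose δ hδ using mod
  obtain ⟨C, hC, c, hc, lam, hlam, H⟩ := SemiWave.exists_waveOn (ℓ := μ⁻¹) (P := M + M ^ 2) (inv_pos.2 hμ) hm hM0 (by positivity)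
  have hK : SemiWave.Consts μ⁻¹ M C c lam := ⟨inv_pos.2 hμ, hM0, hC, hc, hlam⟩
  obtain ⟨u, h, E, -⟩ := SemiWave.Entire.exists_normalized hK (fun ε hε => (hδ ε hε).2.1) (fun ε hε => (hδ ε hε).2.2) fun d =>
    H _ _ (hcont.comp (continuous_add_const d)) (fun x => ham _) (fun x => haM _) (S.translate d)
  have := E.isAPSemiWave hK (fun ε hε => (hδ ε hε).1) hm S ha
  rw [inv_inv] at this
  exact ⟨_, _, this⟩
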